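/- Let α∈(0,1/2] and let ν satisfy: ℓ_ν∈ℛ_α, and p=lim_{x→∞} ν((−∞,−x])/ν((x,∞)) exists and is finite. Suppose there exist L∈ℛ with L(x)≥1 for all x, T≥0 and η∈(0,1] such that: (a) L(x)/ℓ_ν(x)→0 as x→∞, and lim_{ε→0} limsup_{x→∞} (x/ℓ_ν(x))·∑_{n<L(x)} sup_{|t−x|≤εx} F_ν^{*n}((t,t+h]) = 0; (b) if α∈(0,1/2), then I_{η,ν}(x,T) = o( ℓ_ν(x)²·ℓ_ν⁻(L(x)) / L(x)² ) as x→∞; (c) if α=1/2, then, setting u_ν(x)=∫₁^x (ℓ_ν(s)/s)² ds and k_ν(x)=ℓ_ν(x)²/u_ν(x), one has I_{η,ν}(x,T)=O(k_ν(x)) in case u_ν(x)/u_ν(ℓ_ν⁻(L(x)))→1, and I_{η,ν}(x,T)=o(k_ν(x)) otherwise. Then, taking ℓ=ℓ_ν, F satisfies the regular right tail condition and the converging tail ratio condition, and the SRT holds for F. -/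

import Mathlib

open MeasureTheory Filter Set Real Asymptotics

attribute [local instance] Classical.propDecidable

noncomputable section

namespace SRT

/-- Convolution of two measures on `ℝ`. -/
def mconv (μ ν : Measure ℝ) : Measure ℝ := μ.bind fun x => ν.map fun y => x + y

/-- `n`-fold self-convolution of `μ`, with the 0-th power the unit mass at `0`. -/
def convPow (μ : Measure ℝ) : ℕ → Measure ℝ
  | 0 => Measure.dirac 0
  | n + 1 => mconv (convPow μ n) μ

/-- The renewal measure `U = ∑ₙ F^{*n}`. -/
def renewal (μ : Measure ℝ) : Measure ℝ := Measure.sum fun n => convPow μ n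

/-- Right tail `F̄(x) = μ((x,∞))`. -/
def rtail (μ : Measure ℝ) (x : ℝ) : ℝ := (μ (Set.Ioi x)).toReal

/-- `f` is strictly positive on `(0,∞)` and regularly varying at `∞` with exponent `β`. -/
def RegVary (f : ℝ → ℝ) (β : ℝ) : Prop :=
  (∀ x > 0, 0 < f x) ∧
    ∀ c > 0, Tendsto (fun x => f (c * x) / f x) atTop (nhds (c ^ β))

/-- `f` is regularly varying at `∞` with some exponent. -/
def RegVaryAny (f : ℝ → ℝ) : Prop := ∃ β : ℝ, RegVary f β

/-- Regular right tail condition: `F̄(x) ∼ 1/ℓ(x)` as `x → ∞`. -/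
def RightTail (μ : Measure ℝ) (ℓ : ℝ → ℝ) : Prop :=
  Tendsto (fun x => rtail μ x * ℓ x) atTop (nhds 1)

/-- Converging tail ratio condition: `F(-x)/F̄(x)` converges to a finite limit. -/
def TailRatio (μ : Measure ℝ) : Prop :=
  ∃ p : ℝ, Tendsto (fun x => (μ (Set.Iic (-x))).toReal / rtail μ x) atTop (nhds p)

/-- `μ` is concentrated on `dℤ`. -/
def ConcOn (μ : Measure ℝ) (d : ℝ) : Prop := μ {x : ℝ | ∃ k : ℤ, x = k * d} = 1

/-- `μ` is arithmetic. -/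
def Arith (μ : Measure ℝ) : Prop := ∃ d > 0, ConcOn μ d

/-- `h` is admissible: any positive number if `μ` is non-arithmetic, and
the span of `μ` if `μ` is arithmetic. -/
def SpanOK (μ : Measure ℝ) (h : ℝ) : Prop :=
  0 < h ∧ (¬ Arith μ ∨ (ConcOn μ h ∧ ∀ d > 0, ConcOn μ d → d ≤ h))

/-- `μ` is concentrated on `a + dℤ`. -/
def ConcOnLat (μ : Measure ℝ) (a d : ℝ) : Prop :=
  μ {x : ℝ | ∃ k : ℤ, x = a + k * d} = 1

/-- `μ` is lattice. -/
def IsLattice (μ : Measure ℝ) : Prop := ∃ a d : ℝ, 0 ≤ a ∧ a < d ∧ ConcOnLat μ a d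

/-- `h` is admissible: any positive number if `μ` is non-lattice, and
the span of `μ` if `μ` is lattice. -/
def LatSpanOK (μ : Measure ℝ) (h : ℝ) : Prop :=
  0 < h ∧ (¬ IsLattice μ ∨
    ((∃ a, 0 ≤ a ∧ a < h ∧ ConcOnLat μ a h) ∧
      ∀ a d : ℝ, 0 ≤ a → a < d → ConcOnLat μ a d → d ≤ h))

/-- Generalized inverse `ℓ⁻(x) = inf {t ≥ 1 : ℓ(t) > x}`. -/
def linv (ℓ : ℝ → ℝ) (x : ℝ) : ℝ := sInf {t : ℝ | 1 ≤ t ∧ x < ℓ t}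

/-- `ω(x) = x F((x,x+h]) / F̄(x)`. -/
def omegaFn (μ : Measure ℝ) (h x : ℝ) : ℝ :=
  x * (μ (Set.Ioc x (x + h))).toReal / rtail μ x

/-- `I_η(x,T) = ∫_{(1-η)x}^x (ω(y)-T)⁺ dy`. -/
def Iof (μ : Measure ℝ) (h η x T : ℝ) : ℝ :=
  ∫ y in (1 - η) * x..x, max (omegaFn μ h y - T) 0

/-- `Î_{η,n,r}(x,T) = ∫_{(1-η)x}^x e^{-(x-y)/(r aₙ)} (ω(y)-T)⁺ dy`. -/
def IofHat (μ : Measure ℝ) (ℓ : ℝ → ℝ) (h η : ℝ) (n : ℕ) (r x T : ℝ) : ℝ :=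
  ∫ y in (1 - η) * x..x,
    Real.exp (-(x - y) / (r * linv ℓ (n : ℝ))) * max (omegaFn μ h y - T) 0

/-- `Sₙ/aₙ` converges in distribution to a law with density `g`. -/
def StableLimit (F : Measure ℝ) (ℓ : ℝ → ℝ) (g : ℝ → ℝ) : Prop :=
  ∀ f : BoundedContinuousFunction ℝ ℝ,
    Tendsto (fun n : ℕ =>
        ∫ x, f x ∂((convPow F n).map fun y => y / linv ℓ (n : ℝ))) atTop
      (nhds (∫ x, f x * g x))

/-- `Sₙ/aₙ` converges in distribution to the law `μζ`. -/
def WeakLimit (F : Measure ℝ) (ℓ : ℝ → ℝ) (μζ : Measure ℝ) : Prop :=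
  ∀ f : BoundedContinuousFunction ℝ ℝ,
    Tendsto (fun n : ℕ =>
        ∫ x, f x ∂((convPow F n).map fun y => y / linv ℓ (n : ℝ))) atTop
      (nhds (∫ x, f x ∂μζ))

/-- The law `μ` is stable: for each `n`, the `n`-fold convolution is the law of
`cₙ X + dₙ` for some `cₙ > 0`, `dₙ`. -/
def IsStable (μ : Measure ℝ) : Prop :=
  ∀ n : ℕ, 0 < n → ∃ c : ℝ, 0 < c ∧ ∃ d : ℝ, convPow μ n = μ.map fun x => c * x + d

/-- The strong renewal theorem:
`x F̄(x) U((x,x+h]) → α h ∫₀^∞ t^{-α} g(t) dt`. -/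
def SRTholds (F : Measure ℝ) (h α : ℝ) (g : ℝ → ℝ) : Prop :=
  Tendsto (fun x : ℝ => x * rtail F x * ((renewal F) (Set.Ioc x (x + h))).toReal)
    atTop (nhds (α * h * ∫ t in Set.Ioi (0:ℝ), t ^ (-α) * g t))

variable {Ω : Type*} [MeasurableSpace Ω]

/-- Partial sums `Sₙ = X₁ + ⋯ + Xₙ`. -/
def pSum (X : ℕ → Ω → ℝ) (n : ℕ) (ω : Ω) : ℝ := ∑ i ∈ Finset.range n, X i ω

/-- `X` is an i.i.d. sequence with common law `F` under `P`. -/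
def IIDseq (P : Measure Ω) (F : Measure ℝ) (X : ℕ → Ω → ℝ) : Prop :=
  (∀ i, Measurable (X i)) ∧ (∀ i, P.map (X i) = F) ∧
    ProbabilityTheory.iIndepFun (m := fun _ => inferInstance) X P

/-- `Nₙ = #{i ≤ n : Xᵢ > 0}`. -/
def Ncount (X : ℕ → Ω → ℝ) (n : ℕ) (ω : Ω) : ℕ :=
  ((Finset.range n).filter fun i => 0 < X i ω).card

/-- `Sₙ⁻ = ∑_{i ≤ n} Xᵢ⁻`. -/
def sMinus (X : ℕ → Ω → ℝ) (n : ℕ) (ω : Ω) : ℝ :=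
  ∑ i ∈ Finset.range n, max (-(X i ω)) 0

/-- The quantity `R_{T,η,r,c₁,c₂}(x,δ)` of Theorem `t:sum-small-n`, with
`xₙ = x + Sₙ⁻` and `κ = ⌊1/α⌋`. -/
def Rquant (F : Measure ℝ) (ℓ : ℝ → ℝ) (h α : ℝ) (P : Measure Ω) (X : ℕ → Ω → ℝ)
    (L : ℝ → ℝ) (T η r c₁ c₂ x δ : ℝ) : ℝ :=
  (x / ℓ x) * ∑ n ∈ Finset.Ico ⌈L x⌉₊ ⌈ℓ (δ * x)⌉₊,
    ∫ ω, ((Ncount X n ω : ℝ) / linv ℓ ((Ncount X n ω : ℕ) : ℝ)) *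
        (rtail F (x + sMinus X n ω) / (x + sMinus X n ω)) *
        sSup ((fun t => IofHat F ℓ h η (Ncount X n ω) r t T) ''
          Set.Icc (c₁ * (x + sMinus X n ω) / (⌊1/α⌋₊ : ℝ))
            (c₂ * (x + sMinus X n ω) + 2 * h)) ∂P

/-- Strict ascending ladder epochs. -/
def ladderTime (X : ℕ → Ω → ℝ) : ℕ → Ω → ℕ
  | 0 => fun _ => 0
  | k + 1 => fun ω =>
      sInf {n : ℕ | ladderTime X k ω < n ∧ pSum X (ladderTime X k ω) ω < pSum X n ω}

/-- Strict ascending ladder heights `H_k`. -/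
def ladderHeight (X : ℕ → Ω → ℝ) (k : ℕ) (ω : Ω) : ℝ := pSum X (ladderTime X k ω) ω

/-- Weak descending ladder epochs (weak ascending epochs of `-S`). -/
def wLadderTimeDesc (X : ℕ → Ω → ℝ) : ℕ → Ω → ℕ
  | 0 => fun _ => 0
  | k + 1 => fun ω =>
      sInf {n : ℕ | wLadderTimeDesc X k ω < n ∧
        pSum X n ω ≤ pSum X (wLadderTimeDesc X k ω) ω}

/-- Weak descending ladder heights (ladder heights of the walk `-S`). -/
def wLadderHeightDesc (X : ℕ → Ω → ℝ) (k : ℕ) (ω : Ω) : ℝ :=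
  - pSum X (wLadderTimeDesc X k ω) ω

/-- `X_{n:k}`, the `k`-th largest among `X₁,…,Xₙ`; by convention `0` if `k > n`. -/
def ordStat (X : ℕ → Ω → ℝ) (n k : ℕ) (ω : Ω) : ℝ :=
  sSup {t : ℝ | k ≤ ((Finset.range n).filter fun i => t ≤ X i ω).card}

/-- `S_{n:k} = X_{n:1} + ⋯ + X_{n:k}`. -/
def topSum (X : ℕ → Ω → ℝ) (n k : ℕ) (ω : Ω) : ℝ :=
  ∑ j ∈ Finset.Icc 1 k, ordStat X n j ω

/-- `ζ_{n,x} = aₙ^{1-γ} x^γ`. -/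
def zetaCut (ℓ : ℝ → ℝ) (γ : ℝ) (n : ℕ) (x : ℝ) : ℝ :=
  (linv ℓ (n : ℝ)) ^ (1 - γ) * x ^ γ

/-- The event `E_{n,k,x} = {Sₙ ∈ (x,x+h], X_{n:k} > ζ_{n,x} ≥ X_{n:k+1}}`,
with the convention `X_{n:0} = ∞`. -/
def Eevent (X : ℕ → Ω → ℝ) (ℓ : ℝ → ℝ) (h γ : ℝ) (n k : ℕ) (x : ℝ) : Set Ω :=
  {ω | pSum X n ω ∈ Set.Ioc x (x + h) ∧
    (k = 0 ∨ zetaCut ℓ γ n x < ordStat X n k ω) ∧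
    ordStat X n (k + 1) ω ≤ zetaCut ℓ γ n x}

end SRT

open SRT

namespace SRT

/-- Characteristic function of a measure on `ℝ`. -/
def charF (μ : Measure ℝ) (t : ℝ) : ℂ :=
  ∫ x, Complex.exp (Complex.I * (t : ℂ) * (x : ℂ)) ∂μ

/-- `F` is infinitely divisible with Lévy measure `ν` (Lévy–Khintchine
representation of the characteristic function, for some drift `b` and
Gaussian variance `σ2 ≥ 0`). -/
def IsInfDivLevy (F ν : Measure ℝ) : Prop :=
  ν {(0:ℝ)} = 0 ∧ (∫⁻ x, ENNReal.ofReal (min (x ^ 2) 1) ∂ν) < ⊤ ∧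
    ∃ b σ2 : ℝ, 0 ≤ σ2 ∧ ∀ t : ℝ,
      charF F t = Complex.exp (Complex.I * (b : ℂ) * (t : ℂ) - (σ2 : ℂ) * (t : ℂ) ^ 2 / 2 +
        ∫ x : ℝ, (Complex.exp (Complex.I * (t : ℂ) * (x : ℂ)) - 1 -
          Complex.I * (t : ℂ) * (x : ℂ) * (if |x| ≤ 1 then (1 : ℂ) else 0)) ∂ν)

end SRT

namespace SRT

/-- Monotone regularly varying functions of positive index. -/
structure RVMono (ℓ : ℝ → ℝ) (α : ℝ) : Prop where
  index_pos : 0 < α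
  mono : ∀ ⦃x y : ℝ⦄, 0 < x → x ≤ y → ℓ x ≤ ℓ y
  reg : RegVary ℓ α

namespace RVMono

variable {ℓ : ℝ → ℝ} {α : ℝ}

lemma pos (H : RVMono ℓ α) {x : ℝ} (hx : 0 < x) : 0 < ℓ x := H.reg.1 x hx

lemma le_pow_two (H : RVMono ℓ α) {ρ : ℝ} (hρ : α < ρ) :
    ∃ X : ℝ, 1 ≤ X ∧ ∀ (k : ℕ) (z : ℝ), X ≤ z → ℓ (2 ^ k * z) ≤ ((2 : ℝ) ^ ρ) ^ k * ℓ z := by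
  have h1 := H.reg.2 2 (by norm_num)
  have h2 : (2 : ℝ) ^ α < 2 ^ ρ := Real.rpow_lt_rpow_of_exponent_lt (by norm_num) hρ
  obtain ⟨X, hX⟩ := Filter.eventually_atTop.1 (h1.eventually (gt_mem_nhds h2))
  refine ⟨max X 1, le_max_right _ _, fun k => ?_⟩
  induction k with
  | zero => intro z _; simp
  | succ k ih =>
    intro z hz
    have hz1 : 1 ≤ z := (le_max_right _ _).trans hz
    have h3 := hX (2 ^ k * z) (le_trans ((le_max_left _ _).trans hz)
      (le_mul_of_one_le_left (by linarith) (one_le_pow₀ (by norm_num))))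
    have hp : 0 < ℓ (2 ^ k * z) := H.pos (by positivity)
    rw [div_lt_iff₀ hp] at h3
    have e : (2 : ℝ) ^ (k + 1) * z = 2 * (2 ^ k * z) := by ring
    rw [e, pow_succ']
    calc ℓ (2 * (2 ^ k * z)) ≤ 2 ^ ρ * ℓ (2 ^ k * z) := h3.le
      _ ≤ 2 ^ ρ * (((2 : ℝ) ^ ρ) ^ k * ℓ z) := by gcongr; exact ih z hz
      _ = _ := by ring

lemma pow_two_le (H : RVMono ℓ α) {ρ : ℝ} (hρ : ρ < α) :
    ∃ X : ℝ, 1 ≤ X ∧ ∀ (k : ℕ) (z : ℝ), X ≤ z → ((2 : ℝ) ^ ρ) ^ k * ℓ z ≤ ℓ (2 ^ k * z) := by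
  have h1 := H.reg.2 2 (by norm_num)
  have h2 : (2 : ℝ) ^ ρ < 2 ^ α := Real.rpow_lt_rpow_of_exponent_lt (by norm_num) hρ
  obtain ⟨X, hX⟩ := Filter.eventually_atTop.1 (h1.eventually (lt_mem_nhds h2))
  refine ⟨max X 1, le_max_right _ _, fun k => ?_⟩
  induction k with
  | zero => intro z _; simp
  | succ k ih =>
    intro z hz
    have hz1 : 1 ≤ z := (le_max_right _ _).trans hz
    have h3 := hX (2 ^ k * z) (le_trans ((le_max_left _ _).trans hz)
      (le_mul_of_one_le_left (by linarith) (one_le_pow₀ (by norm_num))))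
    have hp : 0 < ℓ (2 ^ k * z) := H.pos (by positivity)
    rw [lt_div_iff₀ hp] at h3
    have e : (2 : ℝ) ^ (k + 1) * z = 2 * (2 ^ k * z) := by ring
    rw [e, pow_succ']
    calc 2 ^ ρ * ((2 : ℝ) ^ ρ) ^ k * ℓ z = 2 ^ ρ * (((2 : ℝ) ^ ρ) ^ k * ℓ z) := by ring
      _ ≤ 2 ^ ρ * ℓ (2 ^ k * z) := by gcongr; exact ih z hz
      _ ≤ _ := h3.le

/-- Potter's upper bound. -/
lemma potter_upper (H : RVMono ℓ α) {ρ : ℝ} (hρ : α < ρ) :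
    ∃ C : ℝ, 1 ≤ C ∧ ∀ z x : ℝ, 1 ≤ z → z ≤ x → ℓ x ≤ C * (x / z) ^ ρ * ℓ z := by
  obtain ⟨X, hX1, hX⟩ := H.le_pow_two hρ
  have hρ0 : 0 < ρ := H.index_pos.trans hρ
  have hA : 1 ≤ (2 : ℝ) ^ ρ := Real.one_le_rpow (by norm_num) hρ0.le
  have hB : 1 ≤ ℓ X / ℓ 1 := by
    rw [one_le_div (H.pos one_pos)]; exact H.mono one_pos hX1
  have key : ∀ z x : ℝ, X ≤ z → z ≤ x → ℓ x ≤ 2 ^ ρ * (x / z) ^ ρ * ℓ z := by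
    intro z x hz hzx
    have hz0 : 0 < z := by linarith
    obtain ⟨k, hk1, hk2⟩ := exists_nat_pow_near ((one_le_div hz0).2 hzx) (one_lt_two (α := ℝ))
    rw [div_lt_iff₀ hz0] at hk2
    calc ℓ x ≤ ℓ (2 ^ (k + 1) * z) := H.mono (by linarith) hk2.le
      _ ≤ ((2 : ℝ) ^ ρ) ^ (k + 1) * ℓ z := hX _ _ hz
      _ = 2 ^ ρ * ((2 : ℝ) ^ k) ^ ρ * ℓ z := by
        rw [pow_succ', ← Real.rpow_natCast, ← Real.rpow_mul (by norm_num),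
          ← Real.rpow_natCast, ← Real.rpow_mul (by norm_num), mul_comm ρ]
      _ ≤ _ := by
        have := (H.pos hz0).le
        gcongr
  refine ⟨2 ^ ρ * (ℓ X / ℓ 1), one_le_mul_of_one_le_of_one_le hA hB, fun z x hz hzx => ?_⟩
  have hz0 : 0 < z := by linarith
  have hpz := H.pos hz0
  have hp1 := H.pos one_pos
  have hpX : 0 < ℓ X := H.pos (by linarith)
  have hr : 1 ≤ (x / z) ^ ρ := Real.one_le_rpow ((one_le_div hz0).2 hzx) hρ0.le
  have hl : ℓ X ≤ (ℓ X / ℓ 1) * ℓ z := by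
    rw [div_mul_eq_mul_div, le_div_iff₀ hp1]
    exact mul_le_mul_of_nonneg_left (H.mono one_pos hz) hpX.le
  rcases le_total X z with h | h
  · calc ℓ x ≤ 2 ^ ρ * (x / z) ^ ρ * ℓ z := key z x h hzx
      _ ≤ (2 ^ ρ * (x / z) ^ ρ * ℓ z) * (ℓ X / ℓ 1) := le_mul_of_one_le_right (by positivity) hB
      _ = _ := by ring
  rcases le_total x X with h' | h'
  · calc ℓ x ≤ ℓ X := H.mono (by linarith) h'
      _ ≤ (ℓ X / ℓ 1) * ℓ z := hl
      _ ≤ ((ℓ X / ℓ 1) * ℓ z) * (2 ^ ρ * (x / z) ^ ρ) :=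
        le_mul_of_one_le_right (by positivity) (one_le_mul_of_one_le_of_one_le hA hr)
      _ = _ := by ring
  · calc ℓ x ≤ 2 ^ ρ * (x / X) ^ ρ * ℓ X := key X x le_rfl h'
      _ ≤ 2 ^ ρ * (x / z) ^ ρ * ((ℓ X / ℓ 1) * ℓ z) := by
        have : 0 ≤ x / X := div_nonneg (by linarith) (by linarith)
        gcongr
        linarith
      _ = _ := by ring

/-- Potter's lower bound. -/
lemma potter_lower (H : RVMono ℓ α) {ρ : ℝ} (hρ0 : 0 ≤ ρ) (hρ : ρ < α) :
    ∃ c : ℝ, 0 < c ∧ c ≤ 1 ∧ ∀ z x : ℝ, 1 ≤ z → z ≤ x → c * (x / z) ^ ρ * ℓ z ≤ ℓ x := by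
  obtain ⟨X, hX1, hX⟩ := H.pow_two_le hρ
  have hX0 : 0 < X := by linarith
  have hA : 1 ≤ (2 : ℝ) ^ ρ := Real.one_le_rpow (by norm_num) hρ0
  have hB : 1 ≤ X ^ ρ := Real.one_le_rpow hX1 hρ0
  have hAB : 1 ≤ (2 : ℝ) ^ ρ * X ^ ρ := one_le_mul_of_one_le_of_one_le hA hB
  have key : ∀ z x : ℝ, X ≤ z → z ≤ x → (x / z) ^ ρ * ℓ z ≤ 2 ^ ρ * ℓ x := by
    intro z x hz hzx
    have hz0 : 0 < z := by linarith
    obtain ⟨k, hk1, hk2⟩ := exists_nat_pow_near ((one_le_div hz0).2 hzx) (one_lt_two (α := ℝ))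
    rw [le_div_iff₀ hz0] at hk1
    have hpz := (H.pos hz0).le
    calc (x / z) ^ ρ * ℓ z ≤ ((2 : ℝ) ^ (k + 1)) ^ ρ * ℓ z := by
          have : 0 ≤ x / z := div_nonneg (by linarith) hz0.le
          gcongr
      _ = 2 ^ ρ * (((2 : ℝ) ^ ρ) ^ k * ℓ z) := by
        rw [← mul_assoc, ← pow_succ', ← Real.rpow_natCast, ← Real.rpow_mul (by norm_num),
          ← Real.rpow_natCast, ← Real.rpow_mul (by norm_num), mul_comm ρ]
      _ ≤ 2 ^ ρ * ℓ x := by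
        gcongr
        exact (hX k z hz).trans (H.mono (by positivity) hk1)
  refine ⟨((2 : ℝ) ^ ρ * X ^ ρ)⁻¹, by positivity, inv_le_one_of_one_le₀ hAB,
    fun z x hz hzx => ?_⟩
  have hz0 : 0 < z := by linarith
  have hx0 : 0 < x := by linarith
  have hpz := H.pos hz0
  have hpx := H.pos hx0
  rw [mul_assoc, inv_mul_le_iff₀ (by positivity)]
  rcases le_total X z with h | h
  · calc (x / z) ^ ρ * ℓ z ≤ 2 ^ ρ * ℓ x := key z x h hzx
      _ ≤ (2 ^ ρ * ℓ x) * X ^ ρ := le_mul_of_one_le_right (by positivity) hB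
      _ = _ := by ring
  rcases le_total x X with h' | h'
  · calc (x / z) ^ ρ * ℓ z ≤ X ^ ρ * ℓ x := by
          have : x / z ≤ X := (div_le_self hx0.le hz).trans h'
          have := H.mono hz0 hzx
          gcongr
      _ ≤ 2 ^ ρ * (X ^ ρ * ℓ x) := le_mul_of_one_le_left (by positivity) hA
      _ = _ := by ring
  · calc (x / z) ^ ρ * ℓ z ≤ (X * (x / X)) ^ ρ * ℓ X := by
          have h1 : x / z ≤ X * (x / X) := by
            rw [mul_div_cancel₀ _ hX0.ne']; exact div_le_self hx0.le hz
          have := H.mono hz0 h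
          gcongr
      _ = X ^ ρ * ((x / X) ^ ρ * ℓ X) := by
        rw [Real.mul_rpow hX0.le (by positivity)]; ring
      _ ≤ X ^ ρ * (2 ^ ρ * ℓ x) := mul_le_mul_of_nonneg_left (key X x le_rfl h') (by positivity)
      _ = _ := by ring

lemma tendsto_atTop (H : RVMono ℓ α) : Tendsto ℓ atTop atTop := by
  obtain ⟨c, hc, -, h⟩ := H.potter_lower (ρ := α / 2) (by linarith [H.index_pos])
    (by linarith [H.index_pos])
  have h1 : Tendsto (fun x : ℝ => c * x ^ (α / 2) * ℓ 1) atTop atTop :=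
    ((tendsto_rpow_atTop (by linarith [H.index_pos])).const_mul_atTop hc).atTop_mul_const
      (H.pos one_pos)
  refine tendsto_atTop_mono' _ ?_ h1
  filter_upwards [eventually_ge_atTop 1] with x hx
  simpa using h 1 x le_rfl hx

lemma isLittleO_rpow (H : RVMono ℓ α) {ρ : ℝ} (hρ : α < ρ) : ℓ =o[atTop] fun x => x ^ ρ := by
  obtain ⟨C, hC, h⟩ := H.potter_upper (ρ := (α + ρ) / 2) (by linarith)
  have h1 : ℓ =O[atTop] fun x : ℝ => x ^ ((α + ρ) / 2) := by
    refine IsBigO.of_bound (C * ℓ 1) ?_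
    filter_upwards [eventually_ge_atTop 1] with x hx
    have := h 1 x le_rfl hx
    rw [Real.norm_of_nonneg (H.pos (by linarith)).le, Real.norm_of_nonneg (by positivity)]
    simpa [mul_right_comm] using this
  refine h1.trans_isLittleO ((isLittleO_iff_tendsto' ?_).2 ?_)
  · filter_upwards [eventually_gt_atTop 0] with x hx h0
    exact absurd h0 (Real.rpow_pos_of_pos hx _).ne'
  · refine (tendsto_rpow_neg_atTop (y := (ρ - α) / 2) (by linarith)).congr' ?_
    filter_upwards [eventually_gt_atTop 0] with x hx
    rw [← Real.rpow_sub hx]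
    congr 1; ring

/-! ### The generalized inverse -/

lemma linv_nonempty (H : RVMono ℓ α) (v : ℝ) : {t : ℝ | 1 ≤ t ∧ v < ℓ t}.Nonempty := by
  obtain ⟨t, h1, h2⟩ := ((eventually_ge_atTop (1 : ℝ)).and
    (H.tendsto_atTop.eventually_gt_atTop v)).exists
  exact ⟨t, h1, h2⟩

lemma one_le_linv (H : RVMono ℓ α) (v : ℝ) : 1 ≤ linv ℓ v :=
  le_csInf (H.linv_nonempty v) fun _ ht => ht.1

lemma linv_pos (H : RVMono ℓ α) (v : ℝ) : 0 < linv ℓ v := one_pos.trans_le (H.one_le_linv v)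

lemma linv_le {v s : ℝ} (hs : 1 ≤ s) (h : v < ℓ s) : linv ℓ v ≤ s :=
  csInf_le ⟨1, fun _ ht => ht.1⟩ ⟨hs, h⟩

lemma linv_mono (H : RVMono ℓ α) : Monotone (linv ℓ) := fun _ w hvw =>
  csInf_le_csInf ⟨1, fun _ ht => ht.1⟩ (H.linv_nonempty w) fun _ ht => ⟨ht.1, hvw.trans_lt ht.2⟩

lemma lt_of_linv_lt (H : RVMono ℓ α) {v s : ℝ} (h : linv ℓ v < s) : v < ℓ s := by
  obtain ⟨t, ht, hts⟩ := exists_lt_of_csInf_lt (H.linv_nonempty v) h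
  exact ht.2.trans_le (H.mono (by linarith [ht.1]) hts.le)

lemma le_of_lt_linv {v s : ℝ} (hs : 1 ≤ s) (h : s < linv ℓ v) : ℓ s ≤ v := by
  by_contra hc
  exact absurd (linv_le hs (not_le.1 hc)) (not_le.2 h)

lemma le_linv (H : RVMono ℓ α) {v s : ℝ} (h : ℓ s ≤ v) : s ≤ linv ℓ v := by
  by_contra hc
  exact absurd (H.lt_of_linv_lt (not_le.1 hc)) (not_lt.2 h)

lemma exists_linv_upper (H : RVMono ℓ α) :
    ∃ C : ℝ, 0 < C ∧ ∀ v : ℝ, 1 ≤ v → ℓ (linv ℓ v) ≤ C * v := by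
  obtain ⟨C, hC, h⟩ := H.potter_upper (ρ := α + 1) (by linarith)
  refine ⟨max (C * 2 ^ (α + 1)) (ℓ 2), lt_max_of_lt_right (H.pos two_pos), fun v hv => ?_⟩
  have ha := H.one_le_linv v
  rcases le_or_gt 2 (linv ℓ v) with h2 | h2
  · have h3 := h (linv ℓ v / 2) (linv ℓ v) (by linarith) (by linarith)
    have h4 : ℓ (linv ℓ v / 2) ≤ v := le_of_lt_linv (by linarith) (by linarith)
    have e : linv ℓ v / (linv ℓ v / 2) = 2 := by field_simp
    rw [e] at h3
    calc _ ≤ _ := h3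
      _ ≤ C * 2 ^ (α + 1) * v := by gcongr
      _ ≤ _ := by gcongr; exact le_max_left _ _
  · calc _ ≤ ℓ 2 := H.mono (by linarith) h2.le
      _ ≤ ℓ 2 * v := le_mul_of_one_le_right (H.pos two_pos).le hv
      _ ≤ _ := by gcongr; exact le_max_right _ _

lemma exists_linv_lower (H : RVMono ℓ α) :
    ∃ c : ℝ, 0 < c ∧ ∀ v : ℝ, c * v ≤ ℓ (linv ℓ v) := by
  obtain ⟨C, hC, h⟩ := H.potter_upper (ρ := α + 1) (by linarith)
  refine ⟨(C * 2 ^ (α + 1))⁻¹, by positivity, fun v => ?_⟩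
  have ha := H.linv_pos v
  have h3 := h (linv ℓ v) (2 * linv ℓ v) (H.one_le_linv v) (by linarith)
  have h4 : v < ℓ (2 * linv ℓ v) := H.lt_of_linv_lt (by linarith)
  have e : 2 * linv ℓ v / linv ℓ v = 2 := by field_simp
  rw [e] at h3
  rw [inv_mul_le_iff₀ (by positivity)]
  exact h4.le.trans h3

/-- If `n(x) / ℓ(x) → v` then `ℓ⁻(n(x)) / x → v ^ (1/α)`. -/
lemma tendsto_linv_div (H : RVMono ℓ α) {n : ℝ → ℝ} {v : ℝ} (hv : 0 < v)
    (hn : Tendsto (fun x => n x / ℓ x) atTop (nhds v)) :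
    Tendsto (fun x => linv ℓ (n x) / x) atTop (nhds (v ^ (1 / α))) := by
  have hα := H.index_pos
  have hpow : (v ^ (1 / α)) ^ α = v := by
    rw [← Real.rpow_mul hv.le, one_div, inv_mul_cancel₀ hα.ne', Real.rpow_one]
  refine tendsto_order.2 ⟨fun c hc => ?_, fun c hc => ?_⟩
  · obtain ⟨c', h1, h2⟩ := exists_between (max_lt hc (Real.rpow_pos_of_pos hv (1 / α)))
    have hc'0 : 0 < c' := (le_max_right _ _).trans_lt h1
    have hlt : c' ^ α < v := by
      rw [← hpow]; exact Real.rpow_lt_rpow hc'0.le h2 hα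
    filter_upwards [eventually_gt_atTop 0, (H.reg.2 c' hc'0).eventually_lt hn hlt] with x hx hlx
    have := (div_lt_div_iff_of_pos_right (H.pos hx)).1 hlx
    rw [lt_div_iff₀ hx]
    calc c * x < c' * x := by
          have := (le_max_left c 0).trans_lt h1
          gcongr
      _ ≤ _ := H.le_linv this.le
  · have hc0 : 0 < c := (Real.rpow_pos_of_pos hv (1 / α)).trans hc
    obtain ⟨c', h1, h2⟩ := exists_between hc
    have hc'0 : 0 < c' := (Real.rpow_pos_of_pos hv (1 / α)).trans h1
    have hlt : v < c' ^ α := by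
      rw [← hpow]; exact Real.rpow_lt_rpow (by positivity) h1 hα
    filter_upwards [eventually_gt_atTop 0, eventually_ge_atTop (1 / c'),
      hn.eventually_lt (H.reg.2 c' hc'0) hlt] with x hx hx1 hlx
    have := (div_lt_div_iff_of_pos_right (H.pos hx)).1 hlx
    rw [div_lt_iff₀ hx]
    have h1 : 1 ≤ c' * x := by rwa [div_le_iff₀' hc'0] at hx1
    calc _ ≤ c' * x := linv_le h1 this
      _ < c * x := by gcongr

/-- Potter-type lower bound for the inverse below `ℓ x`. -/
lemma exists_inv_linv_le (H : RVMono ℓ α) :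
    ∃ C : ℝ, 0 < C ∧ ∀ x v : ℝ, 1 ≤ x → 0 < v → v ≤ ℓ x →
      1 / linv ℓ v ≤ C / x * (ℓ x / v) ^ (2 / α) := by
  have hα := H.index_pos
  obtain ⟨c, hc, hc1, h⟩ := H.potter_lower (ρ := α / 2) (by linarith) (by linarith)
  obtain ⟨c', hc', h'⟩ := H.exists_linv_lower
  refine ⟨max 1 ((1 / (c * c')) ^ (2 / α)), by positivity, fun x v hx hv hvx => ?_⟩
  have hx0 : 0 < x := by linarith
  have ha := H.linv_pos v
  have hr : 1 ≤ ℓ x / v := (one_le_div hv).2 hvx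
  rcases le_total (linv ℓ v) x with h1 | h1
  · have h2 := h (linv ℓ v) x (H.one_le_linv v) h1
    have h3 : (x / linv ℓ v) ^ (α / 2) ≤ 1 / (c * c') * (ℓ x / v) := by
      rw [div_mul_div_comm, one_mul, le_div_iff₀ (by positivity)]
      calc (x / linv ℓ v) ^ (α / 2) * (c * c' * v) = c * (x / linv ℓ v) ^ (α / 2) * (c' * v) := by
            ring
        _ ≤ c * (x / linv ℓ v) ^ (α / 2) * ℓ (linv ℓ v) := by gcongr; exact h' v
        _ ≤ _ := h2
    have h4 : x / linv ℓ v ≤ (1 / (c * c')) ^ (2 / α) * (ℓ x / v) ^ (2 / α) := by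
      rw [← Real.mul_rpow (by positivity) (by positivity)]
      calc x / linv ℓ v = ((x / linv ℓ v) ^ (α / 2)) ^ (2 / α) := by
            rw [← Real.rpow_mul (by positivity)]
            have : α / 2 * (2 / α) = 1 := by field_simp
            rw [this, Real.rpow_one]
        _ ≤ _ := by gcongr
    calc 1 / linv ℓ v = (x / linv ℓ v) / x := by field_simp
      _ ≤ (1 / (c * c')) ^ (2 / α) * (ℓ x / v) ^ (2 / α) / x := by gcongr
      _ ≤ max 1 ((1 / (c * c')) ^ (2 / α)) * (ℓ x / v) ^ (2 / α) / x := by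
        gcongr; exact le_max_right _ _
      _ = _ := by ring
  · calc 1 / linv ℓ v ≤ 1 / x := by gcongr
      _ = 1 / x * 1 := by ring
      _ ≤ max 1 ((1 / (c * c')) ^ (2 / α)) / x * (ℓ x / v) ^ (2 / α) := by
        gcongr
        · exact le_max_left _ _
        · exact Real.one_le_rpow hr (by positivity)

variable {ℓ : ℝ → ℝ} {α : ℝ}

lemma aemeasurable_restrict (H : RVMono ℓ α) {y : ℝ} (hy : 0 ≤ y) :
    AEMeasurable ℓ (volume.restrict (Ioi y)) :=
  aemeasurable_restrict_of_monotoneOn measurableSet_Ioi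
    fun _ ha _ _ hab => H.mono (hy.trans_lt ha) hab

/-- Karamata-type bound for `∫_y^∞ ℓ(s)^j s⁻² ds`. -/
lemma exists_integral_tail_le (H : RVMono ℓ α) (j : ℕ) (hj : j * α < 1) :
    ∃ C : ℝ, 0 < C ∧ ∀ y : ℝ, 1 ≤ y →
      IntegrableOn (fun s => ℓ s ^ j * s ^ (-2 : ℝ)) (Ioi y) ∧
        ∫ s in Ioi y, ℓ s ^ j * s ^ (-2 : ℝ) ≤ C * (ℓ y ^ j / y) := by
  have hα := H.index_pos
  obtain ⟨ρ, hρ, hjρ⟩ : ∃ ρ, α < ρ ∧ j * ρ < 1 := by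
    have h1 : ∀ᶠ ρ in nhdsWithin α (Ioi α), (j : ℝ) * ρ < 1 :=
      nhdsWithin_le_nhds ((continuous_const.mul continuous_id).continuousAt.eventually
        (gt_mem_nhds hj))
    obtain ⟨ρ, h2, h3⟩ := (h1.and self_mem_nhdsWithin).exists
    exact ⟨ρ, h3, h2⟩
  obtain ⟨C, hC, h⟩ := H.potter_upper hρ
  have hd : 0 < 1 - j * ρ := by linarith
  refine ⟨C ^ j / (1 - j * ρ), by positivity, fun y hy => ?_⟩
  have hy0 : 0 < y := by linarith
  have hly := H.pos hy0
  set D : ℝ := C ^ j * ℓ y ^ j * y ^ (-(j * ρ)) with hD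
  have hbound : ∀ s ∈ Ioi y, ℓ s ^ j * s ^ (-2 : ℝ) ≤ D * s ^ (j * ρ - 2) := by
    intro s hs
    have hs0 : 0 < s := hy0.trans hs
    have h1 := h y s hy (le_of_lt hs)
    have hls := H.pos hs0
    calc ℓ s ^ j * s ^ (-2 : ℝ) ≤ (C * (s / y) ^ ρ * ℓ y) ^ j * s ^ (-2 : ℝ) := by gcongr
      _ = D * (s ^ (j * ρ) * s ^ (-2 : ℝ)) := by
        rw [mul_pow, mul_pow, ← Real.rpow_natCast ((s / y) ^ ρ), ← Real.rpow_mul (by positivity),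
          Real.div_rpow hs0.le hy0.le, hD, Real.rpow_neg hy0.le, mul_comm ρ]
        field_simp
      _ = _ := by rw [← Real.rpow_add hs0]; ring_nf
  have hInt : IntegrableOn (fun s : ℝ => D * s ^ (j * ρ - 2)) (Ioi y) :=
    (integrableOn_Ioi_rpow_of_lt (by linarith) hy0).const_mul D
  have hint2 : IntegrableOn (fun s => ℓ s ^ j * s ^ (-2 : ℝ)) (Ioi y) := by
    refine hInt.mono' ?_ ?_
    · exact (((H.aemeasurable_restrict hy0.le).pow_const j).mul
        (by fun_prop)).aestronglyMeasurable
    · filter_upwards [ae_restrict_mem measurableSet_Ioi] with s hs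
      have hs0 : 0 < s := hy0.trans hs
      have hls := H.pos hs0
      rw [Real.norm_of_nonneg (by positivity)]
      exact hbound s hs
  refine ⟨hint2, ?_⟩
  calc ∫ s in Ioi y, ℓ s ^ j * s ^ (-2 : ℝ) ≤ ∫ s in Ioi y, D * s ^ (j * ρ - 2) :=
        setIntegral_mono_on hint2 hInt measurableSet_Ioi hbound
    _ = D * (y ^ (j * ρ - 1) / (1 - j * ρ)) := by
      rw [integral_const_mul, integral_Ioi_rpow_of_lt (by linarith) hy0]
      have e : (j : ℝ) * ρ - 2 + 1 = j * ρ - 1 := by ring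
      rw [e, ← neg_sub (j * ρ) 1, neg_div, div_neg]
    _ = C ^ j / (1 - j * ρ) * (ℓ y ^ j / y) := by
      have e : y ^ (-(j * ρ)) * y ^ (j * ρ - 1) = y⁻¹ := by
        rw [← Real.rpow_add hy0, ← Real.rpow_neg_one]; ring_nf
      rw [hD, mul_div_assoc', mul_assoc _ (y ^ (-(j * ρ))), e]
      field_simp

/-- A sum weighted by `1 / ℓ⁻(n)` as an integral of its distribution function. -/
lemma sum_div_linv_le (H : RVMono ℓ α) {S : Finset ℕ} {w : ℕ → ℝ} {y : ℝ}
    (hy : 1 ≤ y) (hyS : ∀ n ∈ S, y ≤ linv ℓ n) {φ : ℝ → ℝ}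
    (hφ : ∀ s > y, ∑ n ∈ S.filter (fun n : ℕ => linv ℓ (n : ℝ) < s), w n ≤ φ s)
    (hInt : IntegrableOn (fun s => φ s * s ^ (-2 : ℝ)) (Ioi y)) :
    ∑ n ∈ S, w n / linv ℓ n ≤ ∫ s in Ioi y, φ s * s ^ (-2 : ℝ) := by
  have hy0 : 0 < y := by linarith
  have h1 : ∀ n ∈ S, w n / linv ℓ n =
      ∫ s in Ioi y, (Ioi (linv ℓ n)).indicator (fun s => w n * s ^ (-2 : ℝ)) s := by
    intro n hn
    rw [setIntegral_indicator measurableSet_Ioi, inter_eq_right.2 (Ioi_subset_Ioi (hyS n hn)),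
      integral_const_mul, integral_Ioi_rpow_of_lt (by norm_num) (H.linv_pos n)]
    norm_num [Real.rpow_neg_one, div_eq_mul_inv]
  have hi : ∀ n ∈ S, IntegrableOn
      (fun s => (Ioi (linv ℓ n)).indicator (fun s => w n * s ^ (-2 : ℝ)) s) (Ioi y) := by
    intro n _
    exact ((integrableOn_Ioi_rpow_of_lt (by norm_num) hy0).const_mul _).indicator
      measurableSet_Ioi
  rw [Finset.sum_congr rfl h1, ← integral_finsetSum _ hi]
  refine setIntegral_mono_on (integrable_finsetSum _ hi) hInt measurableSet_Ioi fun s hs => ?_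
  have hs0 : 0 < s := hy0.trans hs
  calc ∑ n ∈ S, (Ioi (linv ℓ n)).indicator (fun s => w n * s ^ (-2 : ℝ)) s
      = (∑ n ∈ S.filter (fun n : ℕ => linv ℓ (n : ℝ) < s), w n) * s ^ (-2 : ℝ) := by
        rw [Finset.sum_mul, Finset.sum_filter]
        refine Finset.sum_congr rfl fun n _ => ?_
        simp [indicator_apply]
    _ ≤ _ := by gcongr; exact hφ s hs

lemma card_filter_le {S : Finset ℕ} (hS : ∀ n ∈ S, 1 ≤ n) {V : ℝ} (hV0 : 0 ≤ V)
    (hV : ∀ n ∈ S, (n : ℝ) ≤ V) : (S.card : ℝ) ≤ V := by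
  have : S ⊆ Finset.Icc 1 ⌊V⌋₊ := fun n hn =>
    Finset.mem_Icc.2 ⟨hS n hn, Nat.le_floor (hV n hn)⟩
  calc (S.card : ℝ) ≤ ((Finset.Icc 1 ⌊V⌋₊).card : ℝ) := by exact_mod_cast Finset.card_le_card this
    _ = ⌊V⌋₊ := by simp
    _ ≤ V := Nat.floor_le hV0

lemma sum_natCast_le {S : Finset ℕ} (hS : ∀ n ∈ S, 1 ≤ n) {V : ℝ} (hV0 : 0 ≤ V)
    (hV : ∀ n ∈ S, (n : ℝ) ≤ V) : ∑ n ∈ S, (n : ℝ) ≤ V ^ 2 := by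
  calc ∑ n ∈ S, (n : ℝ) ≤ ∑ n ∈ S, V := Finset.sum_le_sum hV
    _ = S.card * V := by simp
    _ ≤ V * V := by gcongr; exact card_filter_le hS hV0 hV
    _ = _ := by ring

lemma exists_sum_inv_linv_le (H : RVMono ℓ α) (hα1 : α < 1) :
    ∃ C : ℝ, 0 < C ∧ ∀ (v : ℝ) (S : Finset ℕ), 1 ≤ v → (∀ n ∈ S, v ≤ n) →
      ∑ n ∈ S, 1 / linv ℓ ((n : ℕ) : ℝ) ≤ C * (v / linv ℓ v) := by
  obtain ⟨C, hC, h⟩ := H.exists_integral_tail_le 1 (by simpa using hα1)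
  obtain ⟨C', hC', h'⟩ := H.exists_linv_upper
  refine ⟨C * C', by positivity, fun v S hv hS => ?_⟩
  have hy := H.one_le_linv v
  obtain ⟨hi, hb⟩ := h _ hy
  have hS1 : ∀ n ∈ S, 1 ≤ n := fun n hn => by exact_mod_cast hv.trans (hS n hn)
  calc ∑ n ∈ S, 1 / linv ℓ ((n : ℕ) : ℝ) ≤ ∫ s in Ioi (linv ℓ v), ℓ s ^ 1 * s ^ (-2 : ℝ) := by
        refine H.sum_div_linv_le hy (fun n hn => H.linv_mono (hS n hn)) (fun s hs => ?_) hi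
        rw [Finset.sum_const, nsmul_eq_mul, mul_one, pow_one]
        refine card_filter_le (fun n hn => hS1 n (Finset.mem_filter.1 hn).1)
          (H.pos (by linarith)).le fun n hn => (H.lt_of_linv_lt (Finset.mem_filter.1 hn).2).le
    _ ≤ C * (ℓ (linv ℓ v) ^ 1 / linv ℓ v) := hb
    _ ≤ C * (C' * v / linv ℓ v) := by
      rw [pow_one]
      have := H.linv_pos v
      gcongr
      exact h' v hv
    _ = _ := by ring

lemma exists_sum_div_linv_le (H : RVMono ℓ α) (hα1 : α < 1 / 2) :
    ∃ C : ℝ, 0 < C ∧ ∀ (v : ℝ) (S : Finset ℕ), 1 ≤ v → (∀ n ∈ S, v ≤ n) →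
      ∑ n ∈ S, ((n : ℕ) : ℝ) / linv ℓ ((n : ℕ) : ℝ) ≤ C * (v ^ 2 / linv ℓ v) := by
  obtain ⟨C, hC, h⟩ := H.exists_integral_tail_le 2 (by norm_num; linarith)
  obtain ⟨C', hC', h'⟩ := H.exists_linv_upper
  refine ⟨C * C' ^ 2, by positivity, fun v S hv hS => ?_⟩
  have hy := H.one_le_linv v
  obtain ⟨hi, hb⟩ := h _ hy
  have hS1 : ∀ n ∈ S, 1 ≤ n := fun n hn => by exact_mod_cast hv.trans (hS n hn)
  calc ∑ n ∈ S, ((n : ℕ) : ℝ) / linv ℓ ((n : ℕ) : ℝ) ≤ ∫ s in Ioi (linv ℓ v), ℓ s ^ 2 * s ^ (-2 : ℝ) := by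
        refine H.sum_div_linv_le hy (fun n hn => H.linv_mono (hS n hn)) (fun s hs => ?_) hi
        refine sum_natCast_le (fun n hn => hS1 n (Finset.mem_filter.1 hn).1)
          (H.pos (by linarith)).le fun n hn => (H.lt_of_linv_lt (Finset.mem_filter.1 hn).2).le
    _ ≤ C * (ℓ (linv ℓ v) ^ 2 / linv ℓ v) := hb
    _ ≤ C * ((C' * v) ^ 2 / linv ℓ v) := by
      have := H.linv_pos v
      have := H.pos this
      gcongr
      exact h' v hv
    _ = _ := by ring

lemma intervalIntegrable_sq (H : RVMono ℓ α) {a b : ℝ} (ha : 0 < a) (hb : 0 < b) :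
    IntervalIntegrable (fun s => (ℓ s / s) ^ 2) volume a b := by
  have hm : MonotoneOn ℓ (uIcc a b) := fun x hx y _ hxy =>
    H.mono ((lt_min ha hb).trans_le hx.1) hxy
  have h1 : IntervalIntegrable (fun s => ℓ s ^ 2) volume a b := by
    refine MonotoneOn.intervalIntegrable fun x hx y hy hxy => ?_
    have := (H.pos ((lt_min ha hb).trans_le hx.1)).le
    exact pow_le_pow_left₀ this (hm hx hy hxy) 2
  have h2 : ContinuousOn (fun s : ℝ => (s ^ 2)⁻¹) (uIcc a b) := by
    refine ContinuousOn.inv₀ (by fun_prop) fun x hx => ?_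
    have := (lt_min ha hb).trans_le hx.1
    positivity
  refine (h1.mul_continuousOn h2).congr fun s _ => ?_
  show ℓ s ^ 2 * (s ^ 2)⁻¹ = (ℓ s / s) ^ 2
  rw [div_pow, div_eq_mul_inv]

lemma sum_div_linv_le_of_lt (H : RVMono ℓ α) {v V x : ℝ} (hv : 1 ≤ v) (hax : linv ℓ v ≤ x)
    (hV : 0 ≤ V) {S : Finset ℕ} (hS : ∀ n ∈ S, v ≤ n ∧ (n : ℝ) ≤ V) :
    ∑ n ∈ S, ((n : ℕ) : ℝ) / linv ℓ ((n : ℕ) : ℝ) ≤ (∫ s in (linv ℓ v)..x, (ℓ s / s) ^ 2) + V ^ 2 / x := by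
  have hy := H.one_le_linv v
  have hx0 : 0 < x := by linarith
  have hy0 := H.linv_pos v
  have hS1 : ∀ n ∈ S, 1 ≤ n := fun n hn => by exact_mod_cast hv.trans (hS n hn).1
  set φ : ℝ → ℝ := fun s => if s ≤ x then ℓ s ^ 2 else V ^ 2 with hφ
  have e1 : ∀ s ∈ Ioc (linv ℓ v) x, φ s * s ^ (-2 : ℝ) = (ℓ s / s) ^ 2 := by
    intro s hs
    have hs0 : 0 < s := hy0.trans hs.1
    rw [hφ, div_pow]
    simp only [hs.2, if_true]
    rw [Real.rpow_neg hs0.le, div_eq_mul_inv]; norm_cast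
  have e2 : ∀ s ∈ Ioi x, φ s * s ^ (-2 : ℝ) = V ^ 2 * s ^ (-2 : ℝ) := by
    intro s hs
    simp [hφ, not_le.2 (show x < s from hs)]
  have i1 : IntegrableOn (fun s => φ s * s ^ (-2 : ℝ)) (Ioc (linv ℓ v) x) := by
    rw [integrableOn_congr_fun e1 measurableSet_Ioc]
    exact ((intervalIntegrable_iff_integrableOn_Ioc_of_le hax).1
      (H.intervalIntegrable_sq hy0 hx0))
  have i2 : IntegrableOn (fun s => φ s * s ^ (-2 : ℝ)) (Ioi x) := by
    rw [integrableOn_congr_fun e2 measurableSet_Ioi]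
    exact (integrableOn_Ioi_rpow_of_lt (by norm_num) hx0).const_mul _
  have hu : Ioc (linv ℓ v) x ∪ Ioi x = Ioi (linv ℓ v) := Ioc_union_Ioi_eq_Ioi hax
  have hInt : IntegrableOn (fun s => φ s * s ^ (-2 : ℝ)) (Ioi (linv ℓ v)) := by
    rw [← hu]; exact i1.union i2
  calc ∑ n ∈ S, ((n : ℕ) : ℝ) / linv ℓ ((n : ℕ) : ℝ) ≤ ∫ s in Ioi (linv ℓ v), φ s * s ^ (-2 : ℝ) := by
        refine H.sum_div_linv_le hy (fun n hn => H.linv_mono (hS n hn).1) (fun s hs => ?_) hInt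
        simp only [hφ]
        split_ifs with h
        · exact sum_natCast_le (fun n hn => hS1 n (Finset.mem_filter.1 hn).1)
            (H.pos (by linarith)).le fun n hn => (H.lt_of_linv_lt (Finset.mem_filter.1 hn).2).le
        · exact sum_natCast_le (fun n hn => hS1 n (Finset.mem_filter.1 hn).1) hV
            fun n hn => (hS n (Finset.mem_filter.1 hn).1).2
    _ = (∫ s in Ioc (linv ℓ v) x, (ℓ s / s) ^ 2) + ∫ s in Ioi x, V ^ 2 * s ^ (-2 : ℝ) := by
      rw [← hu, setIntegral_union (Ioc_disjoint_Ioi le_rfl) measurableSet_Ioi i1 i2,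
        setIntegral_congr_fun measurableSet_Ioc e1, setIntegral_congr_fun measurableSet_Ioi e2]
    _ = _ := by
      rw [intervalIntegral.integral_of_le hax, integral_const_mul,
        integral_Ioi_rpow_of_lt (by norm_num) hx0]
      norm_num [Real.rpow_neg_one, div_eq_mul_inv]

end RVMono

lemma mconv_eq_conv (μ ν : Measure ℝ) [SFinite ν] : mconv μ ν = μ.conv ν := by
  ext s hs
  have h1 : Measurable fun x : ℝ => ν.map fun y => x + y := by
    have : (fun x : ℝ => ν.map fun y => x + y) =
        fun x => (ν.map (Prod.mk x)).map fun p : ℝ × ℝ => p.1 + p.2 := by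
      ext x : 1
      rw [Measure.map_map (by fun_prop) (by fun_prop)]; rfl
    rw [this]
    exact (Measure.measurable_map _ (by fun_prop)).comp Measurable.map_prodMk_left
  rw [mconv, Measure.bind_apply hs h1.aemeasurable, Measure.conv, Measure.map_apply (by fun_prop) hs,
    Measure.prod_apply ((by fun_prop : Measurable fun p : ℝ × ℝ => p.1 + p.2) hs)]
  refine lintegral_congr fun x => ?_
  rw [Measure.map_apply (by fun_prop) hs]; rfl

lemma conv_apply (μ ν : Measure ℝ) [SFinite ν] {s : Set ℝ} (hs : MeasurableSet s) :
    μ.conv ν s = ∫⁻ x, ν ((fun y => x + y) ⁻¹' s) ∂μ := by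
  rw [Measure.conv, Measure.map_apply (by fun_prop) hs,
    Measure.prod_apply ((by fun_prop : Measurable fun p : ℝ × ℝ => p.1 + p.2) hs)]
  rfl

lemma convPow_zero (μ : Measure ℝ) : convPow μ 0 = Measure.dirac 0 := rfl

instance (μ : Measure ℝ) [IsFiniteMeasure μ] (n : ℕ) : IsFiniteMeasure (convPow μ n) := by
  induction n with
  | zero => rw [convPow_zero]; infer_instance
  | succ n ih => rw [convPow, mconv_eq_conv]; infer_instance

instance (μ : Measure ℝ) [IsProbabilityMeasure μ] (n : ℕ) :
    IsProbabilityMeasure (convPow μ n) := by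
  induction n with
  | zero => rw [convPow_zero]; infer_instance
  | succ n ih => rw [convPow, mconv_eq_conv]; infer_instance

lemma convPow_succ (μ : Measure ℝ) [IsFiniteMeasure μ] (n : ℕ) :
    convPow μ (n + 1) = (convPow μ n).conv μ := by rw [convPow, mconv_eq_conv]

lemma convPow_one (μ : Measure ℝ) [IsFiniteMeasure μ] : convPow μ 1 = μ := by
  rw [convPow_succ, convPow_zero, Measure.dirac_zero_conv]

lemma convPow_add (μ : Measure ℝ) [IsFiniteMeasure μ] (m n : ℕ) :
    convPow μ (m + n) = (convPow μ m).conv (convPow μ n) := by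
  induction n with
  | zero => rw [convPow_zero, Measure.conv_dirac_zero]; rfl
  | succ n ih => rw [← add_assoc, convPow_succ, ih, convPow_succ, Measure.conv_assoc]

lemma charFun_convPow (μ : Measure ℝ) [IsFiniteMeasure μ] (n : ℕ) (t : ℝ) :
    charFun (convPow μ n) t = charFun μ t ^ n := by
  induction n with
  | zero => simp [convPow_zero, charFun_dirac]
  | succ n ih => rw [convPow_succ, charFun_conv, ih, pow_succ]

lemma charF_eq_charFun (μ : Measure ℝ) (t : ℝ) : charF μ t = charFun μ t := by
  rw [charF, charFun_apply_real]
  refine integral_congr_ae (ae_of_all _ fun x => ?_)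
  dsimp only
  congr 1
  ring

/-- Convolving averages the mass of translates, so it does not increase a uniform bound. -/
lemma conv_le_of_forall_le (μ ν : Measure ℝ) [SFinite ν] {s : Set ℝ} (hs : MeasurableSet s)
    {c : ENNReal} (h : ∀ x, ν ((fun y => x + y) ⁻¹' s) ≤ c) : μ.conv ν s ≤ c * μ univ := by
  rw [conv_apply μ ν hs]
  calc _ ≤ ∫⁻ _, c ∂μ := lintegral_mono h
    _ = _ := by simp

lemma conv_mono {μ μ' ν ν' : Measure ℝ} [SFinite ν] [SFinite ν'] (h : μ ≤ μ') (h' : ν ≤ ν') :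
    μ.conv ν ≤ μ'.conv ν' := by
  refine Measure.le_iff.2 fun s hs => ?_
  rw [conv_apply _ _ hs, conv_apply _ _ hs]
  exact lintegral_mono' h fun x => h' _

lemma convPow_mono {μ μ' : Measure ℝ} [IsFiniteMeasure μ] [IsFiniteMeasure μ'] (h : μ ≤ μ')
    (n : ℕ) : convPow μ n ≤ convPow μ' n := by
  induction n with
  | zero => exact le_rfl
  | succ n ih => rw [convPow_succ, convPow_succ]; exact conv_mono ih h

lemma preimage_add_Ioc (x t h : ℝ) :
    (fun y => x + y) ⁻¹' Ioc t (t + h) = Ioc (t - x) (t - x + h) := by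
  rw [preimage_const_add_Ioc]; congr 1; ring

/-- Parseval's relation. -/
lemma integral_integral_exp_eq (μ : Measure ℝ) [IsFiniteMeasure μ] {κ : ℝ → ℂ}
    (hκ : Integrable κ) :
    ∫ y, (∫ θ : ℝ, κ θ * Complex.exp (θ * y * Complex.I)) ∂μ = ∫ θ, κ θ * charFun μ θ := by
  rw [integral_integral_swap]
  · refine integral_congr_ae (ae_of_all _ fun θ => ?_)
    dsimp only
    rw [integral_const_mul, charFun_apply_real]
  · have h1 : Integrable (fun p : ℝ × ℝ => κ p.2) (μ.prod volume) := hκ.comp_snd μ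
    refine h1.mono (h1.aestronglyMeasurable.mul (by fun_prop)) (ae_of_all _ fun p => ?_)
    simp only [Function.uncurry, norm_mul]
    have : ‖Complex.exp (p.2 * p.1 * Complex.I)‖ = 1 := by
      rw [← Complex.ofReal_mul, Complex.norm_exp_ofReal_mul_I]
    rw [this, mul_one]

/-- The triangle function. -/
def tri (θ : ℝ) : ℝ := max (1 - |θ|) 0

/-- The Fejér kernel, the Fourier transform of the triangle function. -/
def fejer (y : ℝ) : ℝ := sinc (y / 2) ^ 2

lemma tri_nonneg (θ : ℝ) : 0 ≤ tri θ := le_max_right _ _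

lemma tri_le_one (θ : ℝ) : tri θ ≤ 1 := max_le (by linarith [abs_nonneg θ]) zero_le_one

lemma tri_zero : tri 0 = 1 := by simp [tri]

lemma tri_eq_zero {θ : ℝ} (h : 1 ≤ |θ|) : tri θ = 0 := max_eq_right (by linarith)

lemma half_le_tri {θ : ℝ} (h : |θ| ≤ 1 / 2) : 1 / 2 ≤ tri θ :=
  le_max_of_le_left (by linarith)

@[fun_prop]
lemma continuous_tri : Continuous tri := by unfold tri; fun_prop

lemma fejer_nonneg (y : ℝ) : 0 ≤ fejer y := sq_nonneg _

@[fun_prop]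
lemma continuous_fejer : Continuous fejer := by
  unfold fejer
  exact (continuous_sinc.comp (by fun_prop)).pow 2

lemma fejer_le_one (y : ℝ) : fejer y ≤ 1 := by
  rw [fejer, sq_le_one_iff_abs_le_one]
  exact abs_sinc_le_one _

lemma fejer_zero : fejer 0 = 1 := by simp [fejer]

lemma fejer_of_ne {y : ℝ} (hy : y ≠ 0) : fejer y = 2 * (1 - cos y) / y ^ 2 := by
  rw [fejer, sinc_of_ne_zero (by positivity), div_pow, sin_sq_eq_half_sub]
  have : 2 * (y / 2) = y := by ring
  rw [this]
  field_simp

lemma half_le_fejer {y : ℝ} (hy : |y| ≤ 1) : 1 / 2 ≤ fejer y := by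
  rcases eq_or_ne y 0 with rfl | h
  · rw [fejer_zero]; norm_num
  · rw [fejer_of_ne h, div_le_div_iff₀ (by norm_num) (by positivity)]
    have h1 := Real.cos_bound hy
    have h2 : |y| ^ 4 = y ^ 4 := by rw [show |y| ^ 4 = (|y| ^ 2) ^ 2 by ring, sq_abs]; ring
    have h3 : y ^ 2 ≤ 1 := by rw [← sq_abs]; exact pow_le_one₀ (abs_nonneg _) hy
    have h4 := (abs_le.1 h1).2
    rw [h2] at h4
    nlinarith [sq_nonneg y]

lemma integrable_tri : Integrable tri := by
  refine Continuous.integrable_of_hasCompactSupport continuous_tri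
    (HasCompactSupport.intro (isCompact_Icc (a := -1) (b := 1)) fun x hx => tri_eq_zero ?_)
  by_contra! h
  exact hx (abs_le.1 h.le)

lemma integral_tri_mul_exp (y : ℝ) :
    ∫ θ : ℝ, (tri θ : ℂ) * Complex.exp (θ * y * Complex.I) = fejer y := by
  have h0 : ∫ θ : ℝ, (tri θ : ℂ) * Complex.exp (θ * y * Complex.I) =
      (∫ θ in (-1 : ℝ)..0, (1 + θ : ℂ) * Complex.exp (y * Complex.I * θ)) +
        ∫ θ in (0 : ℝ)..1, (1 - θ : ℂ) * Complex.exp (y * Complex.I * θ) := by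
    have h1 : ∫ θ : ℝ, (tri θ : ℂ) * Complex.exp (θ * y * Complex.I) =
        ∫ θ in (-1 : ℝ)..1, (tri θ : ℂ) * Complex.exp (θ * y * Complex.I) := by
      rw [intervalIntegral.integral_of_le (by norm_num)]
      refine (setIntegral_eq_integral_of_forall_compl_eq_zero fun x hx => ?_).symm
      rw [tri_eq_zero, Complex.ofReal_zero, zero_mul]
      by_contra! h
      have := abs_lt.1 h
      exact hx ⟨this.1, this.2.le⟩
    have hi : ∀ a b : ℝ, IntervalIntegrable
        (fun θ : ℝ => (tri θ : ℂ) * Complex.exp (θ * y * Complex.I)) volume a b :=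
      fun a b => Continuous.intervalIntegrable (by fun_prop) _ _
    rw [h1, ← intervalIntegral.integral_add_adjacent_intervals (hi (-1) 0) (hi 0 1)]
    congr 1
    · refine intervalIntegral.integral_congr fun θ hθ => ?_
      rw [uIcc_of_le (by norm_num)] at hθ
      have : tri θ = 1 + θ := by
        rw [tri, abs_of_nonpos hθ.2, max_eq_left] <;> linarith [hθ.1]
      simp only [this]; push_cast; congr 2; ring
    · refine intervalIntegral.integral_congr fun θ hθ => ?_
      rw [uIcc_of_le (by norm_num)] at hθ
      have : tri θ = 1 - θ := by
        rw [tri, abs_of_nonneg hθ.1, max_eq_left]; linarith [hθ.2]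
      simp only [this]; push_cast; congr 2; ring
  rw [h0]
  rcases eq_or_ne y 0 with rfl | hy
  · have e1 : ∫ θ in (-1 : ℝ)..0, (1 + θ : ℂ) * Complex.exp ((0 : ℝ) * Complex.I * θ) =
        ((∫ θ in (-1 : ℝ)..0, (1 + θ) : ℝ) : ℂ) := by
      rw [← intervalIntegral.integral_ofReal]; simp
    have e2 : ∫ θ in (0 : ℝ)..1, (1 - θ : ℂ) * Complex.exp ((0 : ℝ) * Complex.I * θ) =
        ((∫ θ in (0 : ℝ)..1, (1 - θ) : ℝ) : ℂ) := by
      rw [← intervalIntegral.integral_ofReal]; simp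
    rw [e1, e2, fejer_zero, intervalIntegral.integral_add (by simp) (by simp),
      intervalIntegral.integral_sub (by simp) (by simp), integral_id, integral_id]
    norm_num
  · set w : ℂ := y * Complex.I with hw
    have hw0 : w ≠ 0 := by simp [hw, hy]
    have hd : ∀ θ : ℝ, HasDerivAt (fun θ : ℝ => Complex.exp (w * θ)) (w * Complex.exp (w * θ)) θ := by
      intro θ
      have := ((Complex.hasDerivAt_exp (w * θ)).comp (θ : ℂ)
        ((hasDerivAt_id (θ : ℂ)).const_mul w)).comp_ofReal
      simpa [mul_comm, Function.comp_def] using this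
    have hid : ∀ θ : ℝ, HasDerivAt (fun θ : ℝ => (θ : ℂ)) 1 θ := fun θ =>
      (hasDerivAt_id (θ : ℂ)).comp_ofReal
    have e1 : ∫ θ in (-1 : ℝ)..0, (1 + θ : ℂ) * Complex.exp (w * θ) =
        (1 / w - 1 / w ^ 2) + Complex.exp (-w) / w ^ 2 := by
      rw [intervalIntegral.integral_eq_sub_of_hasDerivAt
        (f := fun θ : ℝ => (1 + θ : ℂ) * Complex.exp (w * θ) / w - Complex.exp (w * θ) / w ^ 2)
        (fun θ _ => ?_) (Continuous.intervalIntegrable (by fun_prop) _ _)]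
      · simp
      · refine ((((hid θ).const_add 1).mul (hd θ)).div_const w).sub
          ((hd θ).div_const (w ^ 2)) |>.congr_deriv ?_
        field_simp
        ring
    have e2 : ∫ θ in (0 : ℝ)..1, (1 - θ : ℂ) * Complex.exp (w * θ) =
        Complex.exp w / w ^ 2 - (1 / w + 1 / w ^ 2) := by
      rw [intervalIntegral.integral_eq_sub_of_hasDerivAt
        (f := fun θ : ℝ => (1 - θ : ℂ) * Complex.exp (w * θ) / w + Complex.exp (w * θ) / w ^ 2)
        (fun θ _ => ?_) (Continuous.intervalIntegrable (by fun_prop) _ _)]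
      · simp
      · refine ((((hid θ).const_sub 1).mul (hd θ)).div_const w).add
          ((hd θ).div_const (w ^ 2)) |>.congr_deriv ?_
        field_simp
        ring
    rw [e1, e2, fejer_of_ne hy]
    have hc : Complex.exp w + Complex.exp (-w) = 2 * Complex.cos y := by
      rw [Complex.cos, hw]; ring_nf
    have hw2 : w ^ 2 = -(y : ℂ) ^ 2 := by rw [hw, mul_pow, Complex.I_sq]; ring
    have hy' : (y : ℂ) ≠ 0 := by exact_mod_cast hy
    calc _ = (Complex.exp w + Complex.exp (-w) - 2) / w ^ 2 := by ring
      _ = _ := by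
        rw [hc, hw2]; push_cast; field_simp; ring

lemma integral_tri_scaled (s c y : ℝ) (hs : 0 < s) :
    ∫ θ : ℝ, (tri ((θ - c) / s) : ℂ) * Complex.exp (θ * y * Complex.I) =
      s * fejer (s * y) * Complex.exp (c * y * Complex.I) := by
  have h1 := integral_sub_right_eq_self (μ := volume)
    (fun θ : ℝ => (tri (θ / s) : ℂ) * Complex.exp ((θ + c : ℝ) * y * Complex.I)) c
  have h2 := Measure.integral_comp_div
    (fun θ : ℝ => (tri θ : ℂ) * Complex.exp ((s * θ + c : ℝ) * y * Complex.I)) s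
  calc _ = ∫ θ : ℝ, (tri (θ / s) : ℂ) * Complex.exp ((θ + c : ℝ) * y * Complex.I) := by
        rw [← h1]; simp
    _ = ∫ θ : ℝ, (tri (θ / s) : ℂ) * Complex.exp ((s * (θ / s) + c : ℝ) * y * Complex.I) := by
        congr 1; ext θ; rw [mul_div_cancel₀ _ hs.ne']
    _ = s * ∫ θ : ℝ, (tri θ : ℂ) * Complex.exp (θ * (s * y : ℝ) * Complex.I) *
          Complex.exp (c * y * Complex.I) := by
        rw [h2, abs_of_pos hs, Complex.real_smul]
        congr 2; ext θ
        rw [mul_assoc (tri θ : ℂ), ← Complex.exp_add]; push_cast; ring_nf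
    _ = _ := by rw [integral_mul_const, integral_tri_mul_exp, ← mul_assoc]

lemma integrable_tri_scaled {s : ℝ} (hs : 0 < s) (c : ℝ) :
    Integrable fun θ : ℝ => tri ((θ - c) / s) :=
  (integrable_tri.comp_div hs.ne').comp_sub_right c

/-- Fejér-smoothed mass of a measure in terms of its characteristic function. -/
lemma integral_fejer (μ : Measure ℝ) [IsFiniteMeasure μ] {s : ℝ} (hs : 0 < s) (c t : ℝ) :
    ∫ y, (fejer (s * (y - t)) : ℂ) * Complex.exp (c * (y - t : ℝ) * Complex.I) ∂μ =
      1 / s * ∫ θ : ℝ, (tri ((θ - c) / s) : ℂ) * Complex.exp (-(θ * t * Complex.I)) *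
        charFun μ θ := by
  have hκ : Integrable fun θ : ℝ =>
      (tri ((θ - c) / s) : ℂ) * Complex.exp (-(θ * t * Complex.I)) := by
    refine (integrable_tri_scaled hs c).mono (by fun_prop) (ae_of_all _ fun θ => ?_)
    have : ‖Complex.exp (-(θ * t * Complex.I))‖ = 1 := by
      have := Complex.norm_exp_ofReal_mul_I (-(θ * t)); push_cast at this
      rwa [neg_mul] at this
    rw [norm_mul, this, mul_one, Complex.norm_real]
  rw [← integral_integral_exp_eq μ hκ, ← integral_const_mul]
  refine integral_congr_ae (ae_of_all _ fun y => ?_)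
  dsimp only
  have hs' : (s : ℂ) ≠ 0 := by exact_mod_cast hs.ne'
  have := integral_tri_scaled s c (y - t) hs
  calc _ = 1 / s * (s * fejer (s * (y - t)) * Complex.exp (c * (y - t : ℝ) * Complex.I)) := by
        field_simp
    _ = _ := by
      rw [← this]; congr 2; ext θ
      rw [mul_assoc (tri ((θ - c) / s) : ℂ), ← Complex.exp_add]; push_cast; ring_nf

lemma norm_exp_neg_mul_I (a b : ℝ) : ‖Complex.exp (-(a * b * Complex.I))‖ = 1 := by
  have := Complex.norm_exp_ofReal_mul_I (-(a * b)); push_cast at this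
  rwa [neg_mul] at this

lemma norm_integral_tri_mul_le {s : ℝ} (hs : 0 < s) (t : ℝ) {φ : ℝ → ℂ} (hφ : Continuous φ) :
    ‖∫ θ : ℝ, (tri ((θ - 0) / s) : ℂ) * Complex.exp (-(θ * t * Complex.I)) * φ θ‖ ≤
      ∫ θ in -s..s, ‖φ θ‖ := by
  rw [intervalIntegral.integral_of_le (by linarith), ← integral_indicator measurableSet_Ioc]
  refine norm_integral_le_of_norm_le ?_ (ae_of_all _ fun θ => ?_)
  · rw [integrable_indicator_iff measurableSet_Ioc]
    exact (hφ.norm.integrableOn_Icc (a := -s) (b := s)).mono_set Ioc_subset_Icc_self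
  · rw [norm_mul, norm_mul, norm_exp_neg_mul_I, mul_one, sub_zero, Complex.norm_real,
      Real.norm_of_nonneg (tri_nonneg _)]
    by_cases h : θ ∈ Ioc (-s) s
    · rw [indicator_of_mem h]
      exact mul_le_of_le_one_left (norm_nonneg _) (tri_le_one _)
    · rw [indicator_of_notMem h, tri_eq_zero, zero_mul]
      by_contra! h'
      rw [abs_div, abs_of_pos hs, div_lt_one hs, abs_lt] at h'
      exact h ⟨h'.1, h'.2.le⟩

/-- Esseen's concentration inequality. -/
lemma real_Ioc_le_integral_norm_charFun (μ : Measure ℝ) [IsFiniteMeasure μ] {s : ℝ} (hs : 0 < s)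
    (t : ℝ) : μ.real (Ioc t (t + 1 / s)) ≤ 2 / s * ∫ θ in -s..s, ‖charFun μ θ‖ := by
  have h := integral_fejer μ hs 0 t
  simp only [Complex.ofReal_zero, zero_mul, Complex.exp_zero, mul_one] at h
  rw [integral_complex_ofReal] at h
  have hInt : Integrable (fun y => fejer (s * (y - t))) μ := by
    refine Integrable.of_bound (by fun_prop) 1 (ae_of_all _ fun y => ?_)
    rw [Real.norm_of_nonneg (fejer_nonneg _)]; exact fejer_le_one _
  have h1 : (1 / 2) * μ.real (Ioc t (t + 1 / s)) ≤ ∫ y, fejer (s * (y - t)) ∂μ := by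
    have : (1 / 2) * μ.real (Ioc t (t + 1 / s)) =
        ∫ y, (Ioc t (t + 1 / s)).indicator (fun _ => (1 / 2 : ℝ)) y ∂μ := by
      rw [integral_indicator_const _ measurableSet_Ioc, smul_eq_mul, mul_comm]
    rw [this]
    refine integral_mono ((integrable_const _).indicator measurableSet_Ioc) hInt fun y => ?_
    by_cases hy : y ∈ Ioc t (t + 1 / s)
    · rw [indicator_of_mem hy]
      refine half_le_fejer ?_
      have h1 : 0 < y - t := by linarith [hy.1]
      have h2 : y - t ≤ 1 / s := by linarith [hy.2]
      rw [abs_of_pos (by positivity)]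
      calc s * (y - t) ≤ s * (1 / s) := by gcongr
        _ = 1 := by field_simp
    · rw [indicator_of_notMem hy]; exact fejer_nonneg _
  have h2 : ∫ y, fejer (s * (y - t)) ∂μ ≤ 1 / s * ∫ θ in -s..s, ‖charFun μ θ‖ := by
    have h3 : ∫ y, fejer (s * (y - t)) ∂μ ≤ ‖((∫ y, fejer (s * (y - t)) ∂μ : ℝ) : ℂ)‖ := by
      rw [Complex.norm_real]; exact le_norm_self _
    refine h3.trans ?_
    rw [h, norm_mul, norm_div, norm_one, Complex.norm_real, Real.norm_of_nonneg hs.le]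
    gcongr
    exact norm_integral_tri_mul_le hs t (continuous_charFun)
  calc _ ≤ 2 * ∫ y, fejer (s * (y - t)) ∂μ := by linarith
    _ ≤ _ := by rw [div_eq_mul_one_div, mul_assoc]; linarith

lemma charFun_re (μ : Measure ℝ) [IsFiniteMeasure μ] (θ : ℝ) :
    (charFun μ θ).re = ∫ x, cos (θ * x) ∂μ := by
  rw [charFun_apply_real, ← RCLike.re_eq_complex_re, ← integral_re]
  · refine integral_congr_ae (ae_of_all _ fun x => ?_)
    simp only [RCLike.re_eq_complex_re]
    rw [← Complex.ofReal_mul, Complex.exp_ofReal_mul_I_re]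
  · refine Integrable.of_bound (by fun_prop) 1 (ae_of_all _ fun x => ?_)
    rw [← Complex.ofReal_mul, Complex.norm_exp_ofReal_mul_I]

lemma charFun_im (μ : Measure ℝ) [IsFiniteMeasure μ] (θ : ℝ) :
    (charFun μ θ).im = ∫ x, sin (θ * x) ∂μ := by
  rw [charFun_apply_real, ← RCLike.im_eq_complex_im, ← integral_im]
  · refine integral_congr_ae (ae_of_all _ fun x => ?_)
    simp only [RCLike.im_eq_complex_im]
    rw [← Complex.ofReal_mul, Complex.exp_ofReal_mul_I_im]
  · refine Integrable.of_bound (by fun_prop) 1 (ae_of_all _ fun x => ?_)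
    rw [← Complex.ofReal_mul, Complex.norm_exp_ofReal_mul_I]

lemma integrable_cos (μ : Measure ℝ) [IsFiniteMeasure μ] (a b : ℝ) :
    Integrable (fun x => cos (a * x + b)) μ :=
  Integrable.of_bound (by fun_prop) 1 (ae_of_all _ fun x => abs_cos_le_one _)

lemma integrable_sin (μ : Measure ℝ) [IsFiniteMeasure μ] (a b : ℝ) :
    Integrable (fun x => sin (a * x + b)) μ :=
  Integrable.of_bound (by fun_prop) 1 (ae_of_all _ fun x => abs_sin_le_one _)

lemma norm_charFun_sq (μ : Measure ℝ) [IsProbabilityMeasure μ] (θ : ℝ) :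
    1 - ‖charFun μ θ‖ ^ 2 = ∫ y, (∫ x, (1 - cos (θ * x + -(θ * y))) ∂μ) ∂μ := by
  have h1 : ∀ y : ℝ, ∫ x, (1 - cos (θ * x + -(θ * y))) ∂μ =
      1 - (cos (θ * y) * (charFun μ θ).re + sin (θ * y) * (charFun μ θ).im) := by
    intro y
    rw [integral_sub (integrable_const _) (integrable_cos μ _ _), charFun_re, charFun_im,
      ← integral_const_mul, ← integral_const_mul, ← integral_add]
    · simp only [integral_const, probReal_univ, smul_eq_mul, mul_one]
      congr 1
      refine integral_congr_ae (ae_of_all _ fun x => ?_)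
      simp only [cos_add, cos_neg, sin_neg]; ring
    · simpa using (integrable_cos μ θ 0).const_mul _
    · simpa using (integrable_sin μ θ 0).const_mul _
  simp_rw [h1]
  rw [integral_sub (integrable_const _), integral_add, integral_mul_const, integral_mul_const,
    ← charFun_re, ← charFun_im, ← Complex.normSq_eq_norm_sq, Complex.normSq_apply]
  · simp
  · simpa using (integrable_cos μ θ 0).mul_const _
  · simpa using (integrable_sin μ θ 0).mul_const _
  · exact Integrable.add (by simpa using (integrable_cos μ θ 0).mul_const _)
      (by simpa using (integrable_sin μ θ 0).mul_const _)

/-- A quantitative form of `|φ| < 1`. -/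
lemma mul_measure_le_one_sub_norm_charFun_sq (μ : Measure ℝ) [IsProbabilityMeasure μ]
    {X K θ : ℝ} (hX : 0 < X) (hK : K ≤ X / 10) (hθ : |θ| = 1 / X) :
    (1 - cos (9 / 10)) * μ.real (Ioc X (3 * X)) * μ.real (Icc (-K) K) ≤
      1 - ‖charFun μ θ‖ ^ 2 := by
  rw [norm_charFun_sq]
  have hc : cos (9 / 10) ≤ 1 := cos_le_one _
  have hcc : 0 ≤ 1 - cos (9 / 10) := by linarith
  have hInt : ∀ y : ℝ, Integrable (fun x => 1 - cos (θ * x + -(θ * y))) μ := fun y =>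
    (integrable_const _).sub (integrable_cos μ _ _)
  have hin : ∀ y ∈ Icc (-K) K, (1 - cos (9 / 10)) * μ.real (Ioc X (3 * X)) ≤
      ∫ x, (1 - cos (θ * x + -(θ * y))) ∂μ := by
    intro y hy
    have : (1 - cos (9 / 10)) * μ.real (Ioc X (3 * X)) =
        ∫ x, (Ioc X (3 * X)).indicator (fun _ => 1 - cos (9 / 10)) x ∂μ := by
      rw [integral_indicator_const _ measurableSet_Ioc, smul_eq_mul, mul_comm]
    rw [this]
    refine integral_mono ((integrable_const _).indicator measurableSet_Ioc) (hInt y) fun x => ?_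
    by_cases hx : x ∈ Ioc X (3 * X)
    · rw [indicator_of_mem hx]
      have e : cos (θ * x + -(θ * y)) = cos (|θ| * (x - y)) := by
        rw [show θ * x + -(θ * y) = θ * (x - y) by ring, ← cos_abs, abs_mul,
          abs_of_nonneg (a := x - y) (by linarith [hx.1, hy.2])]
      have h1 : 9 / 10 ≤ |θ| * (x - y) := by
        rw [hθ, one_div_mul_eq_div, le_div_iff₀ hX]; linarith [hx.1, hy.2]
      have h2 : |θ| * (x - y) ≤ π := by
        have : |θ| * (x - y) ≤ 3.1 := by
          rw [hθ, one_div_mul_eq_div, div_le_iff₀ hX]; linarith [hx.2, hy.1]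
        linarith [pi_gt_d2]
      show 1 - cos (9 / 10) ≤ 1 - cos (θ * x + -(θ * y))
      rw [e]
      linarith [cos_le_cos_of_nonneg_of_le_pi (by norm_num) h2 h1]
    · rw [indicator_of_notMem hx]
      show 0 ≤ 1 - cos (θ * x + -(θ * y))
      linarith [cos_le_one (θ * x + -(θ * y))]
  have : (1 - cos (9 / 10)) * μ.real (Ioc X (3 * X)) * μ.real (Icc (-K) K) =
      ∫ x, (Icc (-K) K).indicator (fun _ => (1 - cos (9 / 10)) * μ.real (Ioc X (3 * X))) x ∂μ := by
    rw [integral_indicator_const _ measurableSet_Icc, smul_eq_mul, mul_comm]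
  rw [this]
  refine integral_mono ((integrable_const _).indicator measurableSet_Icc) ?_ fun y => ?_
  · refine Integrable.of_bound (C := 2) ?_ (ae_of_all _ fun y => ?_)
    · refine StronglyMeasurable.aestronglyMeasurable (StronglyMeasurable.integral_prod_right'
        (f := fun p : ℝ × ℝ => 1 - cos (θ * p.2 + -(θ * p.1))) ?_)
      exact Continuous.stronglyMeasurable (by fun_prop)
    · refine (norm_integral_le_of_norm_le_const (ae_of_all _ fun x => ?_)).trans
        (b := 2 * μ.real univ) (by simp)
      rw [Real.norm_eq_abs, abs_le]
      constructor <;> linarith [cos_le_one (θ * x + -(θ * y)), neg_one_le_cos (θ * x + -(θ * y))]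
  · by_cases hy : y ∈ Icc (-K) K
    · rw [indicator_of_mem hy]; exact hin y hy
    · rw [indicator_of_notMem hy]
      exact integral_nonneg fun x => by simpa using cos_le_one _

lemma exists_half_le_real_Icc (μ : Measure ℝ) [IsProbabilityMeasure μ] :
    ∃ K : ℝ, 1 / 2 ≤ μ.real (Icc (-K) K) := by
  have h : Tendsto (fun K : ℝ => μ.real (Icc (-K) K)) atTop (nhds (μ.real univ)) := by
    have hm : Monotone fun K : ℝ => Icc (-K) K := fun a b hab =>
      Icc_subset_Icc (by linarith) hab
    have := tendsto_measure_iUnion_atTop (μ := μ) hm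
    have hu : ⋃ K : ℝ, Icc (-K) K = univ :=
      eq_univ_of_forall fun x => mem_iUnion.2 ⟨|x|, abs_le.1 le_rfl⟩
    rw [hu] at this
    exact (ENNReal.tendsto_toReal (measure_ne_top _ _)).comp this
  rw [probReal_univ] at h
  obtain ⟨K, hK⟩ := (h.eventually (lt_mem_nhds (by norm_num : (1 / 2 : ℝ) < 1))).exists
  exact ⟨K, hK.le⟩

namespace RVMono

variable {ℓ : ℝ → ℝ} {α : ℝ}

lemma tendsto_comp_mul_div (H : RVMono ℓ α) {c : ℝ} (hc : 0 < c) :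
    Tendsto (fun x => ℓ (c * x) / ℓ x) atTop (nhds (c ^ α)) := H.reg.2 c hc

lemma tendsto_rtail_mul (H : RVMono ℓ α) {f : ℝ → ℝ} {k : ℝ}
    (hf : Tendsto (fun x => f x * ℓ x) atTop (nhds k)) {c : ℝ} (hc : 0 < c) :
    Tendsto (fun x => f (c * x) * ℓ x) atTop (nhds (k * c ^ (-α))) := by
  have h1 : Tendsto (fun x : ℝ => c * x) atTop atTop := tendsto_id.const_mul_atTop hc
  have h2 := (hf.comp h1).div (H.tendsto_comp_mul_div hc) (Real.rpow_pos_of_pos hc α).ne'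
  rw [Real.rpow_neg hc.le, ← div_eq_mul_inv]
  refine h2.congr' ?_
  filter_upwards [eventually_gt_atTop 0] with x hx
  have := H.pos hx
  have := H.pos (mul_pos hc hx)
  simp only [Pi.div_apply, Function.comp]
  field_simp

lemma exists_norm_charFun_le (H : RVMono ℓ α) {μ : Measure ℝ} [IsProbabilityMeasure μ] {k : ℝ}
    (hk : 0 < k) (hμ : Tendsto (fun x => rtail μ x * ℓ x) atTop (nhds k)) :
    ∃ c θ₀ : ℝ, 0 < c ∧ 0 < θ₀ ∧ θ₀ ≤ 1 ∧ ∀ θ : ℝ, θ ≠ 0 → |θ| ≤ θ₀ →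
      ‖charFun μ θ‖ ≤ exp (-(c / ℓ (1 / |θ|))) := by
  obtain ⟨K, hK⟩ := exists_half_le_real_Icc μ
  have h3 : (3 : ℝ) ^ (-α) < 1 := Real.rpow_lt_one_of_one_lt_of_neg (by norm_num)
    (by linarith [H.index_pos])
  have hlim := hμ.sub (H.tendsto_rtail_mul hμ (by norm_num : (0 : ℝ) < 3))
  have hpos : 0 < k - k * 3 ^ (-α) := by nlinarith
  have hev := hlim.eventually (lt_mem_nhds (half_lt_self hpos))
  obtain ⟨X₀, hX₀⟩ := eventually_atTop.1 hev
  set c₁ := 1 - cos (9 / 10) with hc₁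
  have hc1 : 0 < c₁ := by
    have : cos (9 / 10) < cos 0 := cos_lt_cos_of_nonneg_of_le_pi le_rfl
      (by linarith [pi_gt_three]) (by norm_num)
    rw [cos_zero] at this; linarith
  set d := (k - k * 3 ^ (-α)) / 2 with hd
  have hd0 : 0 < d := by positivity
  set Y := max (max X₀ (10 * K)) 1 with hY
  have hY1 : 1 ≤ Y := le_max_right _ _
  refine ⟨c₁ * d / 4, 1 / Y, by positivity, by positivity, ?_, fun θ hθ hθ' => ?_⟩
  · rw [div_le_one (by linarith)]; exact hY1
  have hθp : 0 < |θ| := abs_pos.2 hθ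
  set X := 1 / |θ| with hX
  have hX0 : 0 < X := by positivity
  have hYX : Y ≤ X := by rw [hX, le_div_iff₀ hθp]; rwa [le_div_iff₀ (by linarith), mul_comm] at hθ'
  have hl := H.pos hX0
  have h1 : d / ℓ X ≤ μ.real (Ioc X (3 * X)) := by
    have h := hX₀ X ((le_max_left _ _).trans ((le_max_left _ _).trans hYX))
    have e : μ.real (Ioc X (3 * X)) = rtail μ X - rtail μ (3 * X) := by
      have : Ioc X (3 * X) = Ioi X \ Ioi (3 * X) := by ext; simp
      rw [this, measureReal_sdiff (Ioi_subset_Ioi (by linarith)) measurableSet_Ioi]; rfl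
    rw [div_le_iff₀ hl, e, sub_mul]; exact h.le
  have h2 := mul_measure_le_one_sub_norm_charFun_sq μ (K := K) hX0
    (by linarith [(le_max_right X₀ (10 * K)).trans ((le_max_left _ _).trans hYX)])
    (show |θ| = 1 / X by rw [hX, one_div_one_div])
  have h3 : c₁ * d / 2 / ℓ X ≤ 1 - ‖charFun μ θ‖ ^ 2 := by
    refine le_trans ?_ h2
    calc c₁ * d / 2 / ℓ X = c₁ * (d / ℓ X) * (1 / 2) := by ring
      _ ≤ _ := by gcongr
  have h4 : ‖charFun μ θ‖ ^ 2 ≤ exp (-(c₁ * d / 4 / ℓ X)) ^ 2 := by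
    rw [← Real.exp_nat_mul]
    have := Real.add_one_le_exp (-(c₁ * d / 2 / ℓ X))
    have e : ((2 : ℕ) : ℝ) * -(c₁ * d / 4 / ℓ X) = -(c₁ * d / 2 / ℓ X) := by push_cast; ring
    rw [e]; linarith
  exact (pow_le_pow_iff_left₀ (norm_nonneg _) (exp_pos _).le two_ne_zero).1 h4

/-- Decay of powers of a characteristic function near the origin, on the scale `ℓ⁻`. -/
lemma exists_norm_charFun_pow_le (H : RVMono ℓ α) {μ : Measure ℝ} [IsProbabilityMeasure μ] {k : ℝ}
    (hk : 0 < k) (hμ : Tendsto (fun x => rtail μ x * ℓ x) atTop (nhds k)) :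
    ∃ C c γ θ₀ : ℝ, 0 < C ∧ 0 < c ∧ 0 < γ ∧ 0 < θ₀ ∧ ∀ (v : ℝ) (m : ℕ) (θ : ℝ), 1 ≤ v → v ≤ 8 * m →
      |θ| ≤ θ₀ → ‖charFun μ θ‖ ^ m ≤ C * exp (-(c * |linv ℓ v * θ| ^ γ)) := by
  obtain ⟨c, θ₀, hc, hθ₀, hθ₁, h⟩ := H.exists_norm_charFun_le hk hμ
  have hα := H.index_pos
  obtain ⟨c', hc', -, hp⟩ := H.potter_lower (ρ := α / 2) (by positivity) (by linarith)
  obtain ⟨C', hC', hu⟩ := H.exists_linv_upper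
  set b := c * c' / (8 * C') with hb
  have hb0 : 0 < b := by positivity
  refine ⟨exp b, b, α / 2, θ₀, exp_pos _, hb0, by positivity, hθ₀, fun v m θ hv hm hθ => ?_⟩
  have ha := H.linv_pos v
  rw [← Real.exp_add, abs_mul, abs_of_pos ha]
  rcases le_or_gt (linv ℓ v * |θ|) 1 with h1 | h1
  · have h2 : (linv ℓ v * |θ|) ^ (α / 2) ≤ 1 :=
      Real.rpow_le_one (by positivity) h1 (by positivity)
    calc ‖charFun μ θ‖ ^ m ≤ 1 := pow_le_one₀ (norm_nonneg _) (norm_charFun_le_one θ)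
      _ ≤ _ := one_le_exp (by nlinarith)
  · have hθ0 : θ ≠ 0 := by rintro rfl; simp at h1; linarith
    have hθp : 0 < |θ| := abs_pos.2 hθ0
    have h2 := h θ hθ0 hθ
    have h3 := hp (1 / |θ|) (linv ℓ v) (by rw [le_div_iff₀ hθp]; linarith)
      (by rw [div_le_iff₀ hθp]; exact h1.le)
    have hl := H.pos (show 0 < 1 / |θ| by positivity)
    have h4 : b * (linv ℓ v * |θ|) ^ (α / 2) ≤ m * (c / ℓ (1 / |θ|)) := by
      have h5 : c' * (linv ℓ v * |θ|) ^ (α / 2) * ℓ (1 / |θ|) ≤ 8 * C' * m := by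
        calc _ = c' * (linv ℓ v / (1 / |θ|)) ^ (α / 2) * ℓ (1 / |θ|) := by
              rw [div_div_eq_mul_div, div_one]
          _ ≤ _ := h3.trans ((hu v hv).trans (by nlinarith))
      rw [mul_div_assoc', le_div_iff₀ hl, hb, div_mul_eq_mul_div, div_mul_eq_mul_div,
        div_le_iff₀ (by positivity)]
      nlinarith
    calc ‖charFun μ θ‖ ^ m ≤ exp (-(c / ℓ (1 / |θ|))) ^ m := by gcongr
      _ = exp (-(m * (c / ℓ (1 / |θ|)))) := by rw [← Real.exp_nat_mul]; ring_nf
      _ ≤ _ := exp_le_exp.2 (by linarith)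

end RVMono

lemma integrable_exp_neg_mul_abs_rpow {c γ : ℝ} (hc : 0 < c) (hγ : 0 < γ) :
    Integrable fun s : ℝ => exp (-(c * |s| ^ γ)) := by
  have h : IntegrableOn (fun s : ℝ => exp (-(c * |s| ^ γ))) (Ioi 0) := by
    have := integrableOn_rpow_mul_exp_neg_mul_rpow (s := 0) (p := γ) (b := c) (by norm_num) hγ hc
    refine this.congr_fun (fun x hx => ?_) measurableSet_Ioi
    simp [abs_of_pos (show 0 < x from hx)]
  have h' : IntegrableOn (fun s : ℝ => exp (-(c * |s| ^ γ))) (Iic 0) := by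
    have := h.comp_neg
    rw [integrableOn_Iic_iff_integrableOn_Iio]
    simpa using this
  rw [← integrableOn_univ, ← Iic_union_Ioi (a := (0 : ℝ))]
  exact h'.union h

lemma real_Ioc_le_of_forall_le (μ : Measure ℝ) [IsFiniteMeasure μ] {r B : ℝ} (hr : 0 < r)
    (hB : ∀ t, μ.real (Ioc t (t + r)) ≤ B) {h : ℝ} (hh : 0 ≤ h) (t : ℝ) :
    μ.real (Ioc t (t + h)) ≤ (h / r + 1) * B := by
  have hB0 : 0 ≤ B := measureReal_nonneg.trans (hB 0)
  have hN : ∀ N : ℕ, μ.real (Ioc t (t + N * r)) ≤ N * B := by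
    intro N
    induction N with
    | zero => simp
    | succ N ih =>
      have hs : Ioc t (t + (N + 1 : ℕ) * r) ⊆
          Ioc t (t + N * r) ∪ Ioc (t + N * r) (t + N * r + r) := by
        rw [Ioc_union_Ioc_eq_Ioc (le_add_of_nonneg_right (by positivity)) (by linarith)]
        push_cast
        exact Ioc_subset_Ioc_right (by linarith)
      calc _ ≤ _ := (measureReal_mono hs).trans (measureReal_union_le _ _)
        _ ≤ N * B + B := add_le_add ih (hB _)
        _ = _ := by push_cast; ring
  have h1 : h ≤ ⌈h / r⌉₊ * r := by rw [← div_le_iff₀ hr]; exact Nat.le_ceil _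
  calc _ ≤ μ.real (Ioc t (t + ⌈h / r⌉₊ * r)) :=
        measureReal_mono (Ioc_subset_Ioc_right (by linarith))
    _ ≤ ⌈h / r⌉₊ * B := hN _
    _ ≤ _ := by gcongr; exact (Nat.ceil_lt_add_one (by positivity)).le

/-- Integrals of a nonnegative characteristic function over intervals are controlled by those
over intervals around the origin. -/
lemma integral_charFun_le_of_nonneg (σ : Measure ℝ) [IsFiniteMeasure σ] {ψ : ℝ → ℝ}
    (hψ : ∀ θ, charFun σ θ = ψ θ) (hψ0 : ∀ θ, 0 ≤ ψ θ) {s : ℝ} (hs : 0 < s) (c : ℝ) :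
    ∫ θ in (c - s / 2)..(c + s / 2), ψ θ ≤ 2 * ∫ θ in -s..s, ψ θ := by
  have hψc : Continuous ψ := by
    have : ψ = fun θ => (charFun σ θ).re := by ext θ; rw [hψ]; simp
    rw [this]
    exact Complex.continuous_re.comp continuous_charFun
  have key : ∀ c : ℝ, ∫ y, (fejer (s * y) : ℂ) * Complex.exp (c * y * Complex.I) ∂σ =
      ((1 / s * ∫ θ : ℝ, tri ((θ - c) / s) * ψ θ : ℝ) : ℂ) := by
    intro c
    have := integral_fejer σ hs c 0
    simp only [sub_zero, Complex.ofReal_zero, mul_zero, zero_mul, neg_zero, Complex.exp_zero,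
      mul_one, hψ] at this
    rw [this]
    push_cast
    rw [← integral_complex_ofReal]
    simp
  have hInt : ∀ c : ℝ, Integrable fun θ => tri ((θ - c) / s) * ψ θ := by
    intro c
    obtain ⟨B, hB⟩ : ∃ B, ∀ θ, ‖ψ θ‖ ≤ B := ⟨σ.real univ, fun θ => by
      have := norm_charFun_le (μ := σ) θ
      rwa [hψ, Complex.norm_real] at this⟩
    exact (integrable_tri_scaled hs c).mul_bdd (c := B) hψc.aestronglyMeasurable (ae_of_all _ hB)
  have h1 : ∫ θ : ℝ, tri ((θ - c) / s) * ψ θ ≤ ∫ θ : ℝ, tri ((θ - 0) / s) * ψ θ := by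
    have e0 := key 0
    simp only [Complex.ofReal_zero, zero_mul, Complex.exp_zero, mul_one] at e0
    rw [integral_complex_ofReal, Complex.ofReal_inj] at e0
    have hn : ‖∫ y, (fejer (s * y) : ℂ) * Complex.exp (c * y * Complex.I) ∂σ‖ ≤
        ∫ y, fejer (s * y) ∂σ := by
      refine norm_integral_le_of_norm_le ?_ (ae_of_all _ fun y => ?_)
      · refine Integrable.of_bound (by fun_prop) 1 (ae_of_all _ fun y => ?_)
        rw [Real.norm_of_nonneg (fejer_nonneg _)]; exact fejer_le_one _
      · rw [norm_mul, ← Complex.ofReal_mul, Complex.norm_exp_ofReal_mul_I, mul_one,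
          Complex.norm_real, Real.norm_of_nonneg (fejer_nonneg _)]
    rw [key c, e0, Complex.norm_real] at hn
    exact le_of_mul_le_mul_left ((le_norm_self _).trans hn) (by positivity)
  have h2 : ∫ θ in (c - s / 2)..(c + s / 2), ψ θ ≤ 2 * ∫ θ : ℝ, tri ((θ - c) / s) * ψ θ := by
    rw [intervalIntegral.integral_of_le (by linarith), ← integral_indicator measurableSet_Ioc,
      ← integral_const_mul]
    refine integral_mono ((integrable_indicator_iff measurableSet_Ioc).2
      ((hψc.integrableOn_Icc (a := c - s / 2) (b := c + s / 2)).mono_set Ioc_subset_Icc_self))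
      ((hInt c).const_mul 2) fun θ => ?_
    by_cases hθ : θ ∈ Ioc (c - s / 2) (c + s / 2)
    · rw [indicator_of_mem hθ]
      have : 1 / 2 ≤ tri ((θ - c) / s) := by
        refine half_le_tri ?_
        rw [abs_div, abs_of_pos hs, div_le_iff₀ hs, abs_le]
        constructor <;> linarith [hθ.1, hθ.2]
      show ψ θ ≤ 2 * (tri ((θ - c) / s) * ψ θ)
      nlinarith [hψ0 θ]
    · rw [indicator_of_notMem hθ]
      have := tri_nonneg ((θ - c) / s)
      have := hψ0 θ
      positivity
  have h3 : ∫ θ : ℝ, tri ((θ - 0) / s) * ψ θ ≤ ∫ θ in -s..s, ψ θ := by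
    have := norm_integral_tri_mul_le hs 0 (φ := fun θ => (ψ θ : ℂ)) (by fun_prop)
    simp only [Complex.ofReal_zero, mul_zero, zero_mul, neg_zero, Complex.exp_zero, mul_one,
      Complex.norm_real] at this
    simp_rw [← Complex.ofReal_mul] at this
    rw [integral_complex_ofReal, Complex.norm_real] at this
    simp_rw [Real.norm_of_nonneg (hψ0 _)] at this
    exact (le_norm_self _).trans this
  linarith

namespace RVMono

variable {ℓ : ℝ → ℝ} {α : ℝ}

lemma exists_integral_norm_charFun_pow_le (H : RVMono ℓ α) {μ : Measure ℝ}
    [IsProbabilityMeasure μ] {k : ℝ} (hk : 0 < k)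
    (hμ : Tendsto (fun x => rtail μ x * ℓ x) atTop (nhds k)) :
    ∃ C θ₀ : ℝ, 0 < C ∧ 0 < θ₀ ∧ ∀ (v : ℝ) (m : ℕ), 1 ≤ v → v ≤ 8 * m →
      ∫ θ in -θ₀..θ₀, ‖charFun μ θ‖ ^ m ≤ C / linv ℓ v := by
  obtain ⟨C, c, γ, θ₀, hC, hc, hγ, hθ₀, h⟩ := H.exists_norm_charFun_pow_le hk hμ
  have hi := integrable_exp_neg_mul_abs_rpow hc hγ
  refine ⟨C * ((∫ s : ℝ, exp (-(c * |s| ^ γ))) + 1), θ₀, ?_, hθ₀, fun v m hv hm => ?_⟩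
  · have : 0 ≤ ∫ s : ℝ, exp (-(c * |s| ^ γ)) := integral_nonneg fun s => (exp_pos _).le
    positivity
  have ha := H.linv_pos v
  have hi' : Integrable fun θ : ℝ => C * exp (-(c * |linv ℓ v * θ| ^ γ)) :=
    (hi.comp_mul_left' ha.ne').const_mul C
  calc ∫ θ in -θ₀..θ₀, ‖charFun μ θ‖ ^ m
      ≤ ∫ θ in -θ₀..θ₀, C * exp (-(c * |linv ℓ v * θ| ^ γ)) := by
        refine intervalIntegral.integral_mono_on (by linarith)
          (Continuous.intervalIntegrable (by fun_prop) _ _) hi'.intervalIntegrable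
          fun θ hθ => h v m θ hv hm (abs_le.2 hθ)
    _ ≤ ∫ θ, C * exp (-(c * |linv ℓ v * θ| ^ γ)) := by
        rw [intervalIntegral.integral_of_le (by linarith)]
        exact setIntegral_le_integral hi' (ae_of_all _ fun θ => by positivity)
    _ = C * (∫ s : ℝ, exp (-(c * |s| ^ γ))) / linv ℓ v := by
        rw [integral_const_mul, Measure.integral_comp_mul_left
          (fun s : ℝ => exp (-(c * |s| ^ γ))) (linv ℓ v), abs_of_pos (inv_pos.2 ha), smul_eq_mul]
        ring
    _ ≤ _ := by gcongr; linarith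

/-- Concentration of convolution powers on the scale `ℓ⁻`. -/
lemma exists_convPow_Ioc_le (H : RVMono ℓ α) {μ : Measure ℝ}
    [IsProbabilityMeasure μ] {k : ℝ} (hk : 0 < k)
    (hμ : Tendsto (fun x => rtail μ x * ℓ x) atTop (nhds k)) {h : ℝ} (hh : 0 < h) :
    ∃ C : ℝ, 0 < C ∧ ∀ (v : ℝ) (m : ℕ) (t : ℝ), 1 ≤ v → v ≤ 8 * m →
      (convPow μ m).real (Ioc t (t + h)) ≤ C / linv ℓ v := by
  obtain ⟨C, θ₀, hC, hθ₀, hb⟩ := H.exists_integral_norm_charFun_pow_le hk hμ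
  refine ⟨(h / (1 / θ₀) + 1) * (2 / θ₀ * C), by positivity, fun v m t hv hm => ?_⟩
  have ha := H.linv_pos v
  refine (real_Ioc_le_of_forall_le (convPow μ m) (show 0 < 1 / θ₀ by positivity)
    (B := 2 / θ₀ * (C / linv ℓ v)) (fun t => ?_) hh.le t).trans_eq (by ring)
  refine (real_Ioc_le_integral_norm_charFun (convPow μ m) hθ₀ t).trans ?_
  gcongr
  simp_rw [charFun_convPow, norm_pow]
  exact hb v m hv hm

lemma exists_integral_norm_charFun_pow_le_of_compact (H : RVMono ℓ α) {μ : Measure ℝ}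
    [IsProbabilityMeasure μ] {k : ℝ} (hk : 0 < k)
    (hμ : Tendsto (fun x => rtail μ x * ℓ x) atTop (nhds k)) (M : ℝ) :
    ∃ C : ℝ, 0 < C ∧ ∀ (v : ℝ) (m : ℕ), 2 ≤ m → 1 ≤ v → v ≤ 4 * m →
      ∫ θ in -M..M, ‖charFun μ θ‖ ^ m ≤ C / linv ℓ v := by
  obtain ⟨C, s, hC, hs, hb⟩ := H.exists_integral_norm_charFun_pow_le hk hμ
  obtain ⟨N, hN⟩ := exists_nat_gt (2 * M / s)
  rw [div_lt_iff₀ hs] at hN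
  refine ⟨(N + 1) * (2 * C), by positivity, fun v m hm hv hvm => ?_⟩
  have ha := H.linv_pos v
  set n := m / 2 with hn
  have hnm : 2 * n ≤ m := by omega
  have hnm' : m ≤ 4 * n := by omega
  have hvn : v ≤ 8 * ((2 * n : ℕ) : ℝ) := by
    have : (m : ℝ) ≤ 4 * n := by exact_mod_cast hnm'
    push_cast; linarith
  set ψ : ℝ → ℝ := fun θ => ‖charFun μ θ‖ ^ (2 * n) with hψ
  have hψc : Continuous ψ := by fun_prop
  have hψ0 : ∀ θ, 0 ≤ ψ θ := fun θ => by positivity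
  have hpos : ∀ c : ℝ, ∫ θ in (c - s / 2)..(c + s / 2), ψ θ ≤ 2 * (C / linv ℓ v) := by
    intro c
    refine (integral_charFun_le_of_nonneg
      ((convPow μ n).conv ((convPow μ n).map fun x => (-1) * x)) (fun θ => ?_) hψ0 hs c).trans ?_
    · have : IsFiniteMeasure ((convPow μ n).map fun x => (-1) * x) := inferInstance
      rw [charFun_conv, charFun_map_mul, neg_one_mul, charFun_neg, Complex.mul_conj,
        Complex.normSq_eq_norm_sq, charFun_convPow, norm_pow, ← pow_mul, mul_comm n 2]
    · gcongr
      exact hb v (2 * n) hv hvn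
  have hi : ∀ a b : ℝ, IntervalIntegrable ψ volume a b := fun a b => hψc.intervalIntegrable a b
  have hsum : ∀ N : ℕ, ∫ θ in -M..(-M + N * s), ψ θ ≤ N * (2 * (C / linv ℓ v)) := by
    intro N
    induction N with
    | zero => simp
    | succ N ih =>
      rw [← intervalIntegral.integral_add_adjacent_intervals (hi _ (-M + N * s)) (hi _ _)]
      have := hpos (-M + N * s + s / 2)
      push_cast
      rw [show -M + N * s + s / 2 - s / 2 = -M + N * s by ring,
        show -M + N * s + s / 2 + s / 2 = -M + (N + 1) * s by ring] at this
      linarith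
  rcases le_or_gt M 0 with hM | hM
  · have h1 : ∫ θ in -M..M, ‖charFun μ θ‖ ^ m ≤ 0 := by
      rw [intervalIntegral.integral_symm]
      exact neg_nonpos.2 (intervalIntegral.integral_nonneg (by linarith) fun θ _ => by positivity)
    exact h1.trans (by positivity)
  calc ∫ θ in -M..M, ‖charFun μ θ‖ ^ m ≤ ∫ θ in -M..M, ψ θ := by
        refine intervalIntegral.integral_mono_on (by linarith)
          (Continuous.intervalIntegrable (by fun_prop) _ _) (hi _ _) fun θ _ => ?_
        exact pow_le_pow_of_le_one (norm_nonneg _) (norm_charFun_le_one _) hnm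
    _ ≤ ∫ θ in -M..(-M + N * s), ψ θ := by
        refine intervalIntegral.integral_mono_interval le_rfl (by linarith) (by linarith)
          (ae_of_all _ hψ0) (hi _ _)
    _ ≤ N * (2 * (C / linv ℓ v)) := hsum N
    _ ≤ (N + 1) * (2 * (C / linv ℓ v)) := by gcongr; linarith
    _ = _ := by ring

end RVMono

lemma convPow_succ_le (μ : Measure ℝ) [IsFiniteMeasure μ] (y : ℝ) (n : ℕ) :
    convPow μ (n + 1) ≤ convPow (μ.restrict (Iic y)) (n + 1) +
      ((n + 1 : ℕ) : ENNReal) • (μ.restrict (Ioi y)).conv (convPow μ n) := by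
  set A := μ.restrict (Iic y) with hA
  set B := μ.restrict (Ioi y) with hB
  have hAB : μ = A + B := by
    rw [hA, hB, ← compl_Iic, Measure.restrict_add_restrict_compl measurableSet_Iic]
  have hAμ : A ≤ μ := Measure.restrict_le_self
  induction n with
  | zero =>
    rw [zero_add, convPow_one, convPow_one, convPow_zero, Measure.conv_dirac_zero]
    simp [← hAB]
  | succ n ih =>
    calc convPow μ (n + 2) = (convPow μ (n + 1)).conv μ := convPow_succ _ _
      _ ≤ (convPow A (n + 1) + ((n + 1 : ℕ) : ENNReal) • B.conv (convPow μ n)).conv μ :=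
        conv_mono ih le_rfl
      _ = (convPow A (n + 1)).conv μ + ((n + 1 : ℕ) : ENNReal) • B.conv (convPow μ (n + 1)) := by
        have : SFinite (((n + 1 : ℕ) : ENNReal) • B.conv (convPow μ n)) := inferInstance
        rw [Measure.add_conv, Measure.conv_smul_left, Measure.conv_assoc, ← convPow_succ]
      _ = convPow A (n + 2) + B.conv (convPow A (n + 1)) +
          ((n + 1 : ℕ) : ENNReal) • B.conv (convPow μ (n + 1)) := by
        conv_lhs => rw [hAB, Measure.conv_add]
        rw [← hAB, ← convPow_succ, Measure.conv_comm _ B]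
      _ ≤ convPow A (n + 2) + B.conv (convPow μ (n + 1)) +
          ((n + 1 : ℕ) : ENNReal) • B.conv (convPow μ (n + 1)) := by
        gcongr
        exact conv_mono le_rfl (convPow_mono hAμ _)
      _ = _ := by
        rw [add_assoc]
        congr 1
        nth_rewrite 1 [← one_smul ENNReal (B.conv (convPow μ (n + 1)))]
        rw [← add_smul]
        push_cast
        rw [add_comm]

lemma lintegral_exp_conv (μ ν : Measure ℝ) [SFinite ν] (l : ℝ) :
    ∫⁻ x, ENNReal.ofReal (exp (l * x)) ∂(μ.conv ν) =
      (∫⁻ x, ENNReal.ofReal (exp (l * x)) ∂μ) * ∫⁻ x, ENNReal.ofReal (exp (l * x)) ∂ν := by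
  rw [Measure.lintegral_conv (by fun_prop), ← lintegral_mul_const _ (by fun_prop)]
  refine lintegral_congr fun x => ?_
  rw [← lintegral_const_mul _ (by fun_prop)]
  refine lintegral_congr fun y => ?_
  rw [mul_add, Real.exp_add, ENNReal.ofReal_mul (exp_pos _).le]

lemma lintegral_exp_convPow (μ : Measure ℝ) [IsFiniteMeasure μ] (l : ℝ) (n : ℕ) :
    ∫⁻ x, ENNReal.ofReal (exp (l * x)) ∂(convPow μ n) =
      (∫⁻ x, ENNReal.ofReal (exp (l * x)) ∂μ) ^ n := by
  induction n with
  | zero => simp [convPow_zero]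
  | succ n ih => rw [convPow_succ, lintegral_exp_conv, ih, pow_succ]

/-- Chernoff's bound. -/
lemma measure_Ioi_le_lintegral_exp (μ : Measure ℝ) {l : ℝ} (hl : 0 ≤ l) (z : ℝ) :
    μ (Ioi z) ≤ ENNReal.ofReal (exp (-(l * z))) * ∫⁻ x, ENNReal.ofReal (exp (l * x)) ∂μ := by
  rw [← lintegral_const_mul _ (by fun_prop), ← lintegral_indicator_one measurableSet_Ioi]
  refine lintegral_mono fun x => ?_
  by_cases hx : x ∈ Ioi z
  · rw [indicator_of_mem hx, ← ENNReal.ofReal_mul (exp_pos _).le, ← Real.exp_add]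
    simp only [Pi.one_apply, ENNReal.one_le_ofReal, one_le_exp_iff]
    have : l * z ≤ l * x := mul_le_mul_of_nonneg_left (le_of_lt hx) hl
    linarith
  · rw [indicator_of_notMem hx]; exact zero_le

/-- Exponential moments of a truncated measure in terms of its truncated first moment. -/
lemma lintegral_exp_restrict_Iic_le (μ : Measure ℝ) [IsProbabilityMeasure μ] {l y B : ℝ}
    (hl : 0 ≤ l) (hy : 0 < y) (hB : 0 ≤ B)
    (hm : ∫⁻ t in Ioo 0 y, μ (Ioi t) ≤ ENNReal.ofReal (B * y)) :
    ∫⁻ x in Iic y, ENNReal.ofReal (exp (l * x)) ∂μ ≤ ENNReal.ofReal (exp (B * exp (l * y))) := by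
  have hf : Measurable fun x : ℝ => max (min x y) 0 := by fun_prop
  have h1 : ∫⁻ x, ENNReal.ofReal (max (min x y) 0) ∂μ ≤ ENNReal.ofReal (B * y) := by
    rw [lintegral_eq_lintegral_meas_lt μ (f := fun x => max (min x y) 0) (ae_of_all _ fun x => le_max_right _ _) hf.aemeasurable]
    refine le_trans ?_ hm
    have : ∫⁻ t in Ioi (0 : ℝ), μ {a | t < max (min a y) 0} =
        ∫⁻ t in Ioi (0 : ℝ), (Iio y).indicator (fun t => μ (Ioi t)) t := by
      refine setLIntegral_congr_fun measurableSet_Ioi fun t ht => ?_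
      have ht' : ¬ t < 0 := not_lt.2 (le_of_lt ht)
      by_cases hty : t < y
      · rw [indicator_of_mem (show t ∈ Iio y from hty)]
        congr 1; ext a; simp [hty, ht']
      · rw [indicator_of_notMem (show t ∉ Iio y from hty)]
        simp [hty, ht']
    rw [this, lintegral_indicator measurableSet_Iio, Measure.restrict_restrict measurableSet_Iio]
    exact le_of_eq (by congr 2; ext t; simp [and_comm])
  have h2 : ∀ x ∈ Iic y, ENNReal.ofReal (exp (l * x)) ≤
      1 + ENNReal.ofReal (exp (l * y) / y) * ENNReal.ofReal (max (min x y) 0) := by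
    intro x hx
    rw [min_eq_left hx, ← ENNReal.ofReal_mul (by positivity), ← ENNReal.ofReal_one,
      ← ENNReal.ofReal_add (by norm_num) (by positivity)]
    refine ENNReal.ofReal_le_ofReal ?_
    rcases le_or_gt x 0 with h0 | h0
    · rw [max_eq_right h0, mul_zero, add_zero]
      exact exp_le_one_iff.2 (mul_nonpos_of_nonneg_of_nonpos hl h0)
    · rw [max_eq_left h0.le]
      have hxy : x / y ≤ 1 := (div_le_one hy).2 hx
      have := convexOn_exp.2 (mem_univ 0) (mem_univ (l * y))
        (show (0 : ℝ) ≤ 1 - x / y by linarith) (show 0 ≤ x / y by positivity) (by ring)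
      simp only [smul_eq_mul, mul_zero, zero_add, Real.exp_zero, mul_one] at this
      have e : x / y * (l * y) = l * x := by field_simp
      rw [e] at this
      have h3 : 0 < x / y := by positivity
      have h4 : exp (l * y) / y * x = x / y * exp (l * y) := by ring
      linarith
  calc ∫⁻ x in Iic y, ENNReal.ofReal (exp (l * x)) ∂μ
      ≤ ∫⁻ x in Iic y, (1 + ENNReal.ofReal (exp (l * y) / y) *
          ENNReal.ofReal (max (min x y) 0)) ∂μ := setLIntegral_mono (by fun_prop) h2
    _ ≤ ∫⁻ x, (1 + ENNReal.ofReal (exp (l * y) / y) *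
          ENNReal.ofReal (max (min x y) 0)) ∂μ := setLIntegral_le_lintegral _ _
    _ = 1 + ENNReal.ofReal (exp (l * y) / y) * ∫⁻ x, ENNReal.ofReal (max (min x y) 0) ∂μ := by
        rw [lintegral_add_left measurable_const, lintegral_const_mul _ (by fun_prop)]; simp
    _ ≤ 1 + ENNReal.ofReal (exp (l * y) / y) * ENNReal.ofReal (B * y) := by gcongr
    _ = ENNReal.ofReal (1 + B * exp (l * y)) := by
        rw [← ENNReal.ofReal_mul (by positivity), ← ENNReal.ofReal_one,
          ← ENNReal.ofReal_add (by norm_num) (by positivity)]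
        congr 1; field_simp
    _ ≤ _ := ENNReal.ofReal_le_ofReal (by linarith [Real.add_one_le_exp (B * exp (l * y))])

namespace RVMono

variable {ℓ : ℝ → ℝ} {α : ℝ}

lemma exists_rtail_le (H : RVMono ℓ α) {μ : Measure ℝ} [IsProbabilityMeasure μ] {k : ℝ}
    (hμ : Tendsto (fun x => rtail μ x * ℓ x) atTop (nhds k)) :
    ∃ C : ℝ, 0 < C ∧ ∀ x : ℝ, 1 ≤ x → rtail μ x ≤ C / ℓ x := by
  obtain ⟨X, hX⟩ := eventually_atTop.1 (hμ.eventually (gt_mem_nhds (lt_add_one k)))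
  have hXp := H.pos (show 0 < max X 1 from lt_max_of_lt_right one_pos)
  refine ⟨max (k + 1) (ℓ (max X 1)), lt_max_of_lt_right hXp, fun x hx => ?_⟩
  have hl := H.pos (show 0 < x by linarith)
  rw [le_div_iff₀ hl]
  rcases le_or_gt X x with h | h
  · exact (hX x h).le.trans (le_max_left _ _)
  · have h1 : rtail μ x ≤ 1 := measureReal_le_one
    calc rtail μ x * ℓ x ≤ 1 * ℓ (max X 1) := by
          gcongr
          exact H.mono (by linarith) (h.le.trans (le_max_left _ _))
      _ ≤ _ := by rw [one_mul]; exact le_max_right _ _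

lemma exists_lintegral_rtail_le (H : RVMono ℓ α) (hα : α < 1) {μ : Measure ℝ}
    [IsProbabilityMeasure μ] {k : ℝ} (hμ : Tendsto (fun x => rtail μ x * ℓ x) atTop (nhds k)) :
    ∃ C : ℝ, 0 < C ∧ ∀ y : ℝ, 1 ≤ y →
      ∫⁻ t in Ioo 0 y, μ (Ioi t) ≤ ENNReal.ofReal (C / ℓ y * y) := by
  obtain ⟨C, hC, hb⟩ := H.exists_rtail_le hμ
  obtain ⟨ρ, hρ, hρ1⟩ := exists_between hα
  obtain ⟨C', hC', hp⟩ := H.potter_upper hρ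
  have hl1 := H.pos one_pos
  have hαp := H.index_pos
  set D := max C (ℓ 1) * C' with hD
  have hCpos : 0 < max C (ℓ 1) := lt_max_of_lt_left hC
  have hD0 : 0 < D := by positivity
  have hpt : ∀ y t : ℝ, 1 ≤ y → 0 < t → t < y → rtail μ t ≤ D / ℓ y * (y ^ ρ * t ^ (-ρ)) := by
    intro y t hy ht hty
    have hly := H.pos (show 0 < y by linarith)
    have e : y ^ ρ * t ^ (-ρ) = (y / t) ^ ρ := by
      rw [Real.div_rpow (by linarith) ht.le, Real.rpow_neg ht.le]; ring
    rw [e, div_mul_eq_mul_div, le_div_iff₀ hly]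
    rcases le_or_gt 1 t with h | h
    · have h1 := hb t h
      have h2 := hp t y h hty.le
      have hlt := H.pos ht
      calc rtail μ t * ℓ y ≤ C / ℓ t * (C' * (y / t) ^ ρ * ℓ t) := by gcongr
        _ = C * C' * (y / t) ^ ρ := by field_simp
        _ ≤ _ := by rw [hD]; gcongr; exact le_max_left _ _
    · have h1 : rtail μ t ≤ 1 := measureReal_le_one
      have h2 := hp 1 y le_rfl hy
      rw [div_one] at h2
      calc rtail μ t * ℓ y ≤ 1 * (C' * y ^ ρ * ℓ 1) := by gcongr
        _ ≤ max C (ℓ 1) * (C' * (y / t) ^ ρ) := by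
          have : y ^ ρ ≤ (y / t) ^ ρ := by
            refine Real.rpow_le_rpow (by linarith) ?_ (by linarith)
            rw [le_div_iff₀ ht]; nlinarith
          calc 1 * (C' * y ^ ρ * ℓ 1) = ℓ 1 * (C' * y ^ ρ) := by ring
            _ ≤ _ := by gcongr; exact le_max_right _ _
        _ = _ := by rw [hD]; ring
  refine ⟨D / (1 - ρ), div_pos hD0 (by linarith), fun y hy => ?_⟩
  have hy0 : 0 < y := by linarith
  have hly := H.pos hy0
  have hInt : IntegrableOn (fun t : ℝ => D / ℓ y * (y ^ ρ * t ^ (-ρ))) (Ioo 0 y) := by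
    have := intervalIntegral.intervalIntegrable_rpow' (a := 0) (b := y) (r := -ρ) (by linarith)
    rw [intervalIntegrable_iff_integrableOn_Ioo_of_le hy0.le] at this
    exact (this.const_mul _).const_mul _
  calc ∫⁻ t in Ioo 0 y, μ (Ioi t)
      ≤ ∫⁻ t in Ioo 0 y, ENNReal.ofReal (D / ℓ y * (y ^ ρ * t ^ (-ρ))) := by
        refine setLIntegral_mono' measurableSet_Ioo fun t ht => ?_
        rw [← ofReal_measureReal]
        exact ENNReal.ofReal_le_ofReal (hpt y t hy ht.1 ht.2)
    _ = ENNReal.ofReal (∫ t in Ioo 0 y, D / ℓ y * (y ^ ρ * t ^ (-ρ))) := by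
        rw [ofReal_integral_eq_lintegral_ofReal hInt]
        filter_upwards [ae_restrict_mem measurableSet_Ioo] with t ht
        have := ht.1
        positivity
    _ = _ := by
        congr 1
        rw [← integral_Ioc_eq_integral_Ioo, ← intervalIntegral.integral_of_le hy0.le,
          intervalIntegral.integral_const_mul, intervalIntegral.integral_const_mul,
          integral_rpow (Or.inl (by linarith)), Real.zero_rpow (by linarith), sub_zero]
        have e : y ^ ρ * y ^ (-ρ + 1) = y := by
          rw [← Real.rpow_add hy0]; simp
        rw [mul_div_assoc', e]
        rw [show -ρ + 1 = 1 - ρ by ring]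
        ring

/-- Fuk–Nagaev type inequality for truncated convolution powers. -/
lemma exists_convPow_restrict_Ioi_le (H : RVMono ℓ α) (hα : α < 1) {μ : Measure ℝ}
    [IsProbabilityMeasure μ] {k : ℝ} (hμ : Tendsto (fun x => rtail μ x * ℓ x) atTop (nhds k)) :
    ∃ C : ℝ, 0 < C ∧ ∀ (y z v : ℝ) (n : ℕ), 1 ≤ y → 0 < v → v ≤ ℓ y → (n : ℝ) ≤ v →
      (convPow (μ.restrict (Iic y)) n).real (Ioi z) ≤ C * (v / ℓ y) ^ (z / y) := by
  obtain ⟨C, hC, hb⟩ := H.exists_lintegral_rtail_le hα hμ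
  refine ⟨exp C, exp_pos _, fun y z v n hy hv hvy hn => ?_⟩
  have hy0 : 0 < y := by linarith
  have hly := H.pos hy0
  set l := log (ℓ y / v) / y with hl
  have hl0 : 0 ≤ l := div_nonneg (log_nonneg ((one_le_div hv).2 hvy)) hy0.le
  have hly' : exp (l * y) = ℓ y / v := by
    rw [hl, div_mul_cancel₀ _ hy0.ne', exp_log (by positivity)]
  have h1 := lintegral_exp_restrict_Iic_le μ hl0 hy0 (by positivity : 0 ≤ C / ℓ y) (hb y hy)
  have h2 := measure_Ioi_le_lintegral_exp (convPow (μ.restrict (Iic y)) n) hl0 z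
  rw [lintegral_exp_convPow] at h2
  have h3 : convPow (μ.restrict (Iic y)) n (Ioi z) ≤
      ENNReal.ofReal (exp (-(l * z)) * exp (C / ℓ y * exp (l * y)) ^ n) := by
    refine h2.trans ?_
    rw [ENNReal.ofReal_mul (exp_pos _).le, ENNReal.ofReal_pow (exp_pos _).le]
    gcongr
  refine (ENNReal.toReal_le_of_le_ofReal (by positivity) h3).trans ?_
  have e1 : exp (-(l * z)) = (v / ℓ y) ^ (z / y) := by
    rw [Real.rpow_def_of_pos (by positivity), hl, ← inv_div (ℓ y) v, Real.log_inv]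
    congr 1
    ring
  rw [e1, mul_comm, ← Real.exp_nat_mul]
  gcongr
  rw [hly']
  calc n * (C / ℓ y * (ℓ y / v)) = C * (n / v) := by field_simp
    _ ≤ C * 1 := by gcongr; exact (div_le_one hv).2 hn
    _ = C := mul_one C

end RVMono

/-- If all interval masses of `ν₁`, `ν₂` are small, an interval far to the right is charged by
their convolution only through the tails. -/
lemma conv_Ioc_le (ν₁ ν₂ : Measure ℝ) [SFinite ν₁] [SFinite ν₂] {t h : ℝ} {c₁ c₂ : ENNReal}
    (h₁ : ∀ s, ν₁ (Ioc s (s + h)) ≤ c₁) (h₂ : ∀ s, ν₂ (Ioc s (s + h)) ≤ c₂) :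
    (ν₁.conv ν₂) (Ioc t (t + h)) ≤ c₂ * ν₁ (Ioi (t / 2)) + c₁ * ν₂ (Ioi (t / 2)) := by
  have hle : ν₁.conv ν₂ (Ioc t (t + h)) ≤
      (ν₁.restrict (Ioi (t / 2))).conv ν₂ (Ioc t (t + h)) +
        (ν₂.restrict (Ioi (t / 2))).conv ν₁ (Ioc t (t + h)) := by
    rw [Measure.conv_comm (ν₂.restrict _) ν₁, conv_apply ν₁ ν₂ measurableSet_Ioc,
      conv_apply (ν₁.restrict _) ν₂ measurableSet_Ioc,
      conv_apply ν₁ (ν₂.restrict _) measurableSet_Ioc, ← lintegral_indicator measurableSet_Ioi,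
      ← lintegral_add_left]
    · refine lintegral_mono fun u => ?_
      by_cases hu : u ∈ Ioi (t / 2)
      · rw [indicator_of_mem hu]; exact le_self_add
      · rw [indicator_of_notMem hu, zero_add, Measure.restrict_apply (by measurability),
          inter_eq_left.2]
        intro v hv
        have h3 := hv.1
        have h4 : u ≤ t / 2 := not_lt.1 hu
        show t / 2 < v
        linarith
    · refine Measurable.indicator ?_ measurableSet_Ioi
      exact measurable_measure_prodMk_left
        ((by fun_prop : Measurable fun p : ℝ × ℝ => p.1 + p.2) measurableSet_Ioc)
  refine hle.trans (add_le_add ?_ ?_)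
  · refine (conv_le_of_forall_le _ _ measurableSet_Ioc fun x => ?_).trans_eq
      (by rw [Measure.restrict_apply_univ])
    rw [preimage_add_Ioc]; exact h₂ _
  · refine (conv_le_of_forall_le _ _ measurableSet_Ioc fun x => ?_).trans_eq
      (by rw [Measure.restrict_apply_univ])
    rw [preimage_add_Ioc]; exact h₁ _

namespace RVMono

variable {ℓ : ℝ → ℝ} {α : ℝ}

/-- Sums of steps truncated at a small multiple of `x` rarely reach an interval near `x`. -/
lemma exists_convPow_restrict_Ioc_le (H : RVMono ℓ α) (hα : α < 1) {μ : Measure ℝ}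
    [IsProbabilityMeasure μ] {k : ℝ} (hk : 0 < k)
    (hμ : Tendsto (fun x => rtail μ x * ℓ x) atTop (nhds k)) {h : ℝ} (hh : 0 < h) :
    ∃ c C : ℝ, 0 < c ∧ c ≤ 1 / 4 ∧ 0 < C ∧ ∀ (x t : ℝ) (n : ℕ), 1 ≤ c * x → x / 2 ≤ t → 1 ≤ n →
      (n : ℝ) ≤ ℓ (c * x) →
      (convPow (μ.restrict (Iic (c * x))) n).real (Ioc t (t + h)) ≤ C / x := by
  obtain ⟨C₁, hC₁, hconc⟩ := H.exists_convPow_Ioc_le hk hμ hh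
  obtain ⟨C₂, hC₂, htail⟩ := H.exists_convPow_restrict_Ioi_le hα hμ
  obtain ⟨C₃, hC₃, hinv⟩ := H.exists_inv_linv_le
  have hα0 := H.index_pos
  set c := min (1 / 4) (α / 8) with hc
  have hc0 : 0 < c := by positivity
  have hc1 : c ≤ 1 / 4 := min_le_left _ _
  refine ⟨c, 2 * C₁ * C₂ * C₃ / c, hc0, hc1, by positivity, fun x t n hx ht hn hnl => ?_⟩
  set y := c * x with hy
  have hx0 : 0 < x := by
    by_contra h0
    have : c * x ≤ 0 := mul_nonpos_of_nonneg_of_nonpos hc0.le (not_lt.1 h0)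
    linarith
  have hy0 : 0 < y := by linarith
  have hyt : y < t := by
    have : c * x ≤ 1 / 4 * x := by gcongr
    linarith
  have hn0 : (0 : ℝ) < n := by exact_mod_cast hn
  have hly := H.pos hy0
  rcases Nat.lt_or_ge n 2 with h2 | h2
  · obtain rfl : n = 1 := by omega
    rw [convPow_one, measureReal_restrict_apply measurableSet_Ioc]
    have : Ioc t (t + h) ∩ Iic y = ∅ := by
      ext u; simp only [mem_inter_iff, mem_Ioc, mem_Iic, mem_empty_iff_false, iff_false]
      rintro ⟨⟨h1, -⟩, h3⟩; linarith
    rw [this, measureReal_empty]; positivity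
  set A := μ.restrict (Iic y) with hA
  have hAμ : A ≤ μ := Measure.restrict_le_self
  have hbd : ∀ m : ℕ, (n : ℝ) ≤ 8 * m → ∀ s, convPow A m (Ioc s (s + h)) ≤
      ENNReal.ofReal (C₁ / linv ℓ n) := by
    intro m hm s
    refine (convPow_mono hAμ m _).trans ?_
    rw [← ENNReal.ofReal_toReal (measure_ne_top (convPow μ m) _)]
    exact ENNReal.ofReal_le_ofReal (hconc n m s (by exact_mod_cast hn) hm)
  have htl : ∀ m : ℕ, m ≤ n → convPow A m (Ioi (t / 2)) ≤
      ENNReal.ofReal (C₂ * (n / ℓ y) ^ (2 / α)) := by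
    intro m hm
    rw [← ENNReal.ofReal_toReal (measure_ne_top (convPow A m) _)]
    refine ENNReal.ofReal_le_ofReal ((htail y (t / 2) n m hx hn0 hnl (by exact_mod_cast hm)).trans ?_)
    refine mul_le_mul_of_nonneg_left ?_ hC₂.le
    refine Real.rpow_le_rpow_of_exponent_ge (by positivity) ((div_le_one hly).2 hnl) ?_
    rw [div_le_div_iff₀ hα0 hy0, hy]
    have h5 : c ≤ α / 8 := min_le_right _ _
    have h6 : c * x ≤ α / 8 * x := by gcongr
    have h7 : α * (x / 2) ≤ α * t := by gcongr
    linarith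
  have hm1 : (n : ℝ) ≤ 8 * ((n / 2 : ℕ) : ℝ) := by
    have : n ≤ 8 * (n / 2) := by omega
    exact_mod_cast this
  have hm2 : (n : ℝ) ≤ 8 * ((n - n / 2 : ℕ) : ℝ) := by
    have : n ≤ 8 * (n - n / 2) := by omega
    exact_mod_cast this
  have key : convPow A n (Ioc t (t + h)) ≤
      ENNReal.ofReal (2 * (C₁ / linv ℓ n * (C₂ * (n / ℓ y) ^ (2 / α)))) := by
    have e : n = n / 2 + (n - n / 2) := by omega
    have ha := H.linv_pos (n : ℝ)
    calc convPow A n (Ioc t (t + h))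
        = ((convPow A (n / 2)).conv (convPow A (n - n / 2))) (Ioc t (t + h)) := by
          rw [← convPow_add, ← e]
      _ ≤ _ := conv_Ioc_le _ _ (hbd _ hm1) (hbd _ hm2)
      _ ≤ ENNReal.ofReal (C₁ / linv ℓ n) * ENNReal.ofReal (C₂ * (n / ℓ y) ^ (2 / α)) +
          ENNReal.ofReal (C₁ / linv ℓ n) * ENNReal.ofReal (C₂ * (n / ℓ y) ^ (2 / α)) := by
          gcongr
          · exact htl _ (by omega)
          · exact htl _ (by omega)
      _ = _ := by
          rw [← ENNReal.ofReal_mul (by positivity), two_mul,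
            ENNReal.ofReal_add (by positivity) (by positivity)]
  refine (ENNReal.toReal_le_of_le_ofReal (mul_nonneg two_pos.le (mul_nonneg
    (div_nonneg hC₁.le (H.linv_pos _).le) (by positivity))) key).trans ?_
  have h8 := hinv y n hx hn0 hnl
  have h9 : (ℓ y / n) ^ (2 / α) * (n / ℓ y) ^ (2 / α) = 1 := by
    rw [← Real.mul_rpow (by positivity) (by positivity)]
    have : ℓ y / n * (n / ℓ y) = 1 := by field_simp
    rw [this, Real.one_rpow]
  calc 2 * (C₁ / linv ℓ n * (C₂ * (n / ℓ y) ^ (2 / α)))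
      = 2 * C₁ * C₂ * (n / ℓ y) ^ (2 / α) * (1 / linv ℓ n) := by ring
    _ ≤ 2 * C₁ * C₂ * (n / ℓ y) ^ (2 / α) * (C₃ / y * (ℓ y / n) ^ (2 / α)) := by gcongr
    _ = 2 * C₁ * C₂ * (C₃ / y) * ((ℓ y / n) ^ (2 / α) * (n / ℓ y) ^ (2 / α)) := by ring
    _ = 2 * C₁ * C₂ * C₃ / c / x := by rw [h9, hy]; field_simp

end RVMono

lemma measurable_rtail (μ : Measure ℝ) [IsFiniteMeasure μ] : Measurable (rtail μ) := by
  refine Antitone.measurable fun a b hab => ?_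
  exact measureReal_mono (μ := μ) (Ioi_subset_Ioi hab)

lemma rtail_nonneg (μ : Measure ℝ) (x : ℝ) : 0 ≤ rtail μ x := ENNReal.toReal_nonneg

lemma measureReal_Ioc_eq_rtail (μ : Measure ℝ) [IsFiniteMeasure μ] {a b : ℝ} (hab : a ≤ b) :
    μ.real (Ioc a b) = rtail μ a - rtail μ b := by
  have h1 := measureReal_sdiff (μ := μ) (Ioi_subset_Ioi hab) (measurableSet_Ioi)
  rw [show Ioi a \ Ioi b = Ioc a b by ext; simp] at h1
  exact h1

lemma measurable_omegaFn (μ : Measure ℝ) [IsFiniteMeasure μ] {h : ℝ} (hh : 0 ≤ h) :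
    Measurable (omegaFn μ h) := by
  have : omegaFn μ h = fun x => x * (rtail μ x - rtail μ (x + h)) / rtail μ x := by
    funext x
    rw [omegaFn, ← measureReal_Ioc_eq_rtail μ (by linarith : x ≤ x + h)]; rfl
  rw [this]
  have := measurable_rtail μ
  fun_prop

/-- The tail integral `∫_y^∞ (F̄(z)/z) (ω(z) - T)⁺ dz`. -/
def jTail (μ : Measure ℝ) (h T y : ℝ) : ENNReal :=
  ∫⁻ z in Ioi y, ENNReal.ofReal (rtail μ z / z * max (omegaFn μ h z - T) 0)

lemma measure_Ioc_le_omegaFn (μ : Measure ℝ) [IsFiniteMeasure μ] {h T z : ℝ} (hh : 0 ≤ h)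
    (hz : 0 < z) (hT : 0 ≤ T) :
    μ (Ioc z (z + h)) ≤ ENNReal.ofReal (rtail μ z / z * T) +
      ENNReal.ofReal (rtail μ z / z * max (omegaFn μ h z - T) 0) := by
  have hr := rtail_nonneg μ z
  rw [← ENNReal.ofReal_add (by positivity) (by positivity), ← mul_add]
  rw [← ENNReal.ofReal_toReal (measure_ne_top μ _)]
  refine ENNReal.ofReal_le_ofReal ?_
  have h1 : omegaFn μ h z ≤ T + max (omegaFn μ h z - T) 0 := by
    linarith [le_max_left (omegaFn μ h z - T) 0]
  refine le_trans ?_ (mul_le_mul_of_nonneg_left h1 (by positivity))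
  rw [omegaFn]
  rcases hr.eq_or_lt with h0 | h0
  · rw [← h0]
    have := measureReal_Ioc_eq_rtail μ (by linarith : z ≤ z + h)
    have h2 := rtail_nonneg μ (z + h)
    have h3 : (μ (Ioc z (z + h))).toReal = μ.real (Ioc z (z + h)) := rfl
    rw [h3]; simp; linarith
  · apply le_of_eq; field_simp

/-- Contribution of a single large step. -/
lemma conv_restrict_Ioi_le (μ G : Measure ℝ) [IsProbabilityMeasure μ] [IsProbabilityMeasure G]
    {h T y t M R : ℝ} (hh : 0 < h) (hT : 0 ≤ T) (hy : h < y)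
    (hM : ∀ s, G.real (Ioc s (s + h)) ≤ M) (hR : ∀ z, y - h < z → rtail μ z / z ≤ R) :
    (μ.restrict (Ioi y)).conv G (Ioc t (t + h)) ≤
      ENNReal.ofReal (2 * T * R) + ENNReal.ofReal (2 * M / h) * jTail μ h T (y - h) := by
  have hR0 : 0 ≤ R := (div_nonneg (rtail_nonneg μ y) (by linarith)).trans (hR y (by linarith))
  have hM0 : 0 ≤ M := measureReal_nonneg.trans (hM 0)
  set Φ : ℝ → ENNReal := fun z => G (Ioc (t - z - h) (t - z + h)) with hΦ
  have hΦm : Measurable Φ := by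
    have : Φ = fun z => G ((fun v => (z, v)) ⁻¹'
        {p : ℝ × ℝ | t - p.1 - h < p.2 ∧ p.2 ≤ t - p.1 + h}) := rfl
    rw [this]
    refine measurable_measure_prodMk_left ?_
    rw [ofPred_and]
    exact (measurableSet_lt (by fun_prop) (by fun_prop)).inter
      (measurableSet_le (by fun_prop) (by fun_prop))
  have hΦM : ∀ z, Φ z ≤ ENNReal.ofReal (2 * M) := by
    intro z
    have hs : Ioc (t - z - h) (t - z + h) ⊆
        Ioc (t - z - h) (t - z - h + h) ∪ Ioc (t - z) (t - z + h) := by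
      rw [sub_add_cancel, Ioc_union_Ioc_eq_Ioc (by linarith) (by linarith)]
    have hb : ∀ s, G (Ioc s (s + h)) ≤ ENNReal.ofReal M := fun s => by
      rw [← ENNReal.ofReal_toReal (measure_ne_top G _)]
      exact ENNReal.ofReal_le_ofReal (hM s)
    calc Φ z ≤ _ := measure_mono hs
      _ ≤ _ := measure_union_le _ _
      _ ≤ ENNReal.ofReal M + ENNReal.ofReal M := add_le_add (hb _) (hb _)
      _ = _ := by rw [← ENNReal.ofReal_add hM0 hM0, two_mul]
  have hΦI : ∫⁻ z, Φ z = ENNReal.ofReal (2 * h) := by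
    have : ∀ z, Φ z = ∫⁻ v, (Ioc (t - v - h) (t - v + h)).indicator 1 z ∂G := by
      intro z
      rw [hΦ]; dsimp only
      rw [← lintegral_indicator_one measurableSet_Ioc]
      refine lintegral_congr fun v => ?_
      simp only [indicator_apply, mem_Ioc]
      congr 1
      refine propext ⟨fun ⟨a, b⟩ => ⟨by linarith, by linarith⟩,
        fun ⟨a, b⟩ => ⟨by linarith, by linarith⟩⟩
    simp_rw [this]
    rw [lintegral_lintegral_swap]
    · simp_rw [lintegral_indicator_one measurableSet_Ioc, Real.volume_Ioc]
      have : ∀ v : ℝ, t - v + h - (t - v - h) = 2 * h := fun v => by ring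
      simp [this]
    · refine Measurable.aemeasurable ?_
      have : (Function.uncurry fun (z v : ℝ) =>
          (Ioc (t - v - h) (t - v + h)).indicator (1 : ℝ → ENNReal) z) =
          {p : ℝ × ℝ | t - p.2 - h < p.1 ∧ p.1 ≤ t - p.2 + h}.indicator 1 := by
        ext ⟨z, v⟩; simp [indicator_apply]
      rw [this, ofPred_and]
      exact measurable_one.indicator ((measurableSet_lt (by fun_prop) (by fun_prop)).inter
        (measurableSet_le (by fun_prop) (by fun_prop)))
  have hstep : ENNReal.ofReal h * (μ.restrict (Ioi y)).conv G (Ioc t (t + h)) ≤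
      ∫⁻ z in Ioi (y - h), μ (Ioc z (z + h)) * Φ z := by
    have h1 : ∀ z, μ (Ioc z (z + h)) * Φ z = ∫⁻ u, (Ico (u - h) u).indicator Φ z ∂μ := by
      intro z
      rw [mul_comm, ← lintegral_indicator_one measurableSet_Ioc, ← lintegral_const_mul _
        (measurable_one.indicator measurableSet_Ioc)]
      refine lintegral_congr fun u => ?_
      simp only [indicator_apply, mem_Ioc, mem_Ico]
      by_cases hz : z < u ∧ u ≤ z + h
      · rw [if_pos hz, if_pos ⟨by linarith, hz.1⟩]; simp
      · rw [if_neg hz, if_neg (fun ⟨a, b⟩ => hz ⟨b, by linarith⟩), mul_zero]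
    simp_rw [h1]
    rw [lintegral_lintegral_swap]
    · rw [conv_apply _ _ measurableSet_Ioc, ← lintegral_indicator measurableSet_Ioi,
        ← lintegral_const_mul']
      · refine lintegral_mono fun u => ?_
        by_cases hu : u ∈ Ioi y
        · have hu' : y < u := hu
          rw [indicator_of_mem hu, preimage_add_Ioc]
          calc ENNReal.ofReal h * G (Ioc (t - u) (t - u + h))
              = ∫⁻ _ in Ioo (u - h) u, G (Ioc (t - u) (t - u + h)) := by
                rw [setLIntegral_const, Real.volume_Ioo, sub_sub_cancel, mul_comm]
            _ ≤ ∫⁻ z in Ioo (u - h) u, (Ico (u - h) u).indicator Φ z := by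
                refine setLIntegral_mono' measurableSet_Ioo fun z hz => ?_
                rw [indicator_of_mem (show z ∈ Ico (u - h) u from ⟨hz.1.le, hz.2⟩)]
                exact measure_mono (Ioc_subset_Ioc (by linarith [hz.1]) (by linarith [hz.2]))
            _ ≤ _ := lintegral_mono_set fun z hz => by
                show y - h < z
                linarith [hz.1]
        · rw [indicator_of_notMem hu, mul_zero]; exact zero_le
      · exact ENNReal.ofReal_ne_top
    · refine Measurable.aemeasurable ?_
      have : (Function.uncurry fun (z u : ℝ) => (Ico (u - h) u).indicator Φ z) =
          {p : ℝ × ℝ | p.2 - h ≤ p.1 ∧ p.1 < p.2}.indicator fun p => Φ p.1 := by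
        ext ⟨z, v⟩; simp [indicator_apply]
      rw [this, ofPred_and]
      exact (hΦm.comp measurable_fst).indicator
        ((measurableSet_le (by fun_prop) (by fun_prop)).inter
          (measurableSet_lt (by fun_prop) (by fun_prop)))
  have hfin : ENNReal.ofReal h * (μ.restrict (Ioi y)).conv G (Ioc t (t + h)) ≤
      ENNReal.ofReal (R * T) * ENNReal.ofReal (2 * h) +
        ENNReal.ofReal (2 * M) * jTail μ h T (y - h) := by
    refine hstep.trans ?_
    calc ∫⁻ z in Ioi (y - h), μ (Ioc z (z + h)) * Φ z
        ≤ ∫⁻ z in Ioi (y - h), (ENNReal.ofReal (R * T) * Φ z + ENNReal.ofReal (2 * M) *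
            ENNReal.ofReal (rtail μ z / z * max (omegaFn μ h z - T) 0)) := by
          refine setLIntegral_mono' measurableSet_Ioi fun z hz => ?_
          have hz0 : 0 < z := by
            have : y - h < z := hz
            linarith
          refine (mul_le_mul_left (measure_Ioc_le_omegaFn μ hh.le hz0 hT) (Φ z)).trans ?_
          rw [add_mul]
          refine add_le_add ?_ ?_
          · gcongr
            exact hR z hz
          · rw [mul_comm]
            gcongr
            exact hΦM z
      _ = ENNReal.ofReal (R * T) * (∫⁻ z in Ioi (y - h), Φ z) +
            ENNReal.ofReal (2 * M) * jTail μ h T (y - h) := by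
          rw [lintegral_add_left (by fun_prop), lintegral_const_mul _ hΦm, lintegral_const_mul',
            jTail]
          exact ENNReal.ofReal_ne_top
      _ ≤ _ := by
          gcongr
          exact (setLIntegral_le_lintegral _ _).trans_eq hΦI
  have hh' : ENNReal.ofReal h ≠ 0 := by simpa using hh
  rw [← ENNReal.mul_le_mul_iff_right hh' ENNReal.ofReal_ne_top]
  refine hfin.trans_eq ?_
  rw [mul_add, ← ENNReal.ofReal_mul (p := R * T) (by positivity),
    ← ENNReal.ofReal_mul (q := 2 * T * R) hh.le, ← mul_assoc (ENNReal.ofReal h),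
    ← ENNReal.ofReal_mul (q := 2 * M / h) hh.le]
  rw [show h * (2 * T * R) = R * T * (2 * h) by ring, mul_div_cancel₀ _ hh.ne']

lemma omegaFn_le (μ : Measure ℝ) [IsFiniteMeasure μ] {h x : ℝ} (hx : 0 ≤ x) :
    omegaFn μ h x ≤ x := by
  refine div_le_of_le_mul₀ (rtail_nonneg μ x) hx ?_
  gcongr
  exact measureReal_mono (μ := μ) fun _ hz => hz.1

lemma integrableOn_omegaFn_sub (μ : Measure ℝ) [IsFiniteMeasure μ] {h T a b : ℝ} (hh : 0 ≤ h)
    (hT : 0 ≤ T) (ha : 0 ≤ a) :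
    IntegrableOn (fun y => max (omegaFn μ h y - T) 0) (Ioc a b) := by
  have hm := measurable_omegaFn μ hh
  refine Measure.integrableOn_of_bounded (M := |b|) (by simp)
    (by fun_prop) ?_
  refine (ae_restrict_iff' measurableSet_Ioc).2 (ae_of_all _ fun y hy => ?_)
  rw [Real.norm_of_nonneg (le_max_right _ _)]
  have hy0 : 0 ≤ y := ha.trans hy.1.le
  refine max_le ?_ (abs_nonneg _)
  linarith [omegaFn_le μ (h := h) hy0, hy.2, le_abs_self b]

lemma ofReal_Iof (μ : Measure ℝ) [IsFiniteMeasure μ] {h η x T : ℝ} (hh : 0 ≤ h) (hT : 0 ≤ T)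
    (hη : 0 ≤ η) (hη1 : η ≤ 1) (hx : 0 ≤ x) :
    ENNReal.ofReal (Iof μ h η x T) =
      ∫⁻ y in Ioc ((1 - η) * x) x, ENNReal.ofReal (max (omegaFn μ h y - T) 0) := by
  have h1 : (1 - η) * x ≤ x := by nlinarith
  rw [Iof, intervalIntegral.integral_of_le h1, ofReal_integral_eq_lintegral_ofReal]
  · exact integrableOn_omegaFn_sub μ hh hT (mul_nonneg (by linarith) hx)
  · exact ae_of_all _ fun y => le_max_right _ _

lemma Iof_nonneg (μ : Measure ℝ) {h η x T : ℝ} (hη : 0 ≤ η) (hx : 0 ≤ x) :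
    0 ≤ Iof μ h η x T :=
  intervalIntegral.integral_nonneg (by nlinarith) fun _ _ => le_max_right _ _

lemma Iof_le_Iof (μ : Measure ℝ) [IsFiniteMeasure μ] {h η η' x T : ℝ} (hh : 0 ≤ h) (hT : 0 ≤ T)
    (hη' : 0 ≤ η') (hle : η' ≤ η) (hη1 : η ≤ 1) (hx : 0 ≤ x) :
    Iof μ h η' x T ≤ Iof μ h η x T := by
  rw [← ENNReal.ofReal_le_ofReal_iff (Iof_nonneg μ (hη'.trans hle) hx),
    ofReal_Iof μ hh hT hη' (hle.trans hη1) hx, ofReal_Iof μ hh hT (hη'.trans hle) hη1 hx]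
  exact lintegral_mono_set (Ioc_subset_Ioc_left (by gcongr))

lemma jTail_antitone (μ : Measure ℝ) (h T : ℝ) : Antitone (jTail μ h T) := fun _ _ hab =>
  lintegral_mono_set (Ioi_subset_Ioi hab)

lemma Ioi_subset_iUnion_Ico {b s : ℝ} (hb : 1 < b) (hs : 0 < s) :
    Ioi s ⊆ ⋃ k : ℕ, Ico (b ^ k * s) (b ^ (k + 1) * s) := by
  intro z hz
  have hz' : s < z := hz
  obtain ⟨m, hm1, hm2⟩ := exists_nat_pow_near ((one_le_div hs).2 hz'.le) hb
  exact mem_iUnion.2 ⟨m, (le_div_iff₀ hs).1 hm1, (div_lt_iff₀ hs).1 hm2⟩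

namespace RVMono

variable {ℓ : ℝ → ℝ} {α : ℝ}

set_option maxHeartbeats 1000000 in
/-- Bounds on the local integrals `I_η` control the tail integral `jTail`. -/
lemma exists_jTail_le (H : RVMono ℓ α) {μ : Measure ℝ} [IsProbabilityMeasure μ] {k : ℝ}
    (hμ : Tendsto (fun x => rtail μ x * ℓ x) atTop (nhds k)) {h T η c : ℝ} (hh : 0 < h)
    (hT : 0 ≤ T) (hη : 0 < η) (hη1 : η ≤ 1 / 2) (hc : 0 < c) (hc1 : c ≤ 1)
    {D : ℝ → ℝ} {ρ K : ℝ} (hρ : ρ < 1 - α)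
    (hD : ∀ᶠ x in atTop, ∀ j : ℕ, D (((1 - η)⁻¹) ^ (j + 1) * (c * x)) ≤
      K * (((1 - η)⁻¹) ^ j) ^ ρ * D x) :
    ∃ C : ℝ, 0 < C ∧ ∀ E : ℝ, 0 ≤ E →
      (∀ᶠ s in atTop, Iof μ h η s T ≤ E * (ℓ s ^ 2 * D s)) →
      ∀ᶠ x in atTop, 0 ≤ D x → jTail μ h T (c * x) ≤ ENNReal.ofReal (C * E * D x * (ℓ x / x)) := by
  obtain ⟨ρ₁, hρ₁, hρ₁'⟩ := exists_between (show α < 1 - ρ by linarith)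
  obtain ⟨C₁, hC₁, hpot⟩ := H.potter_upper hρ₁
  obtain ⟨C₂, hC₂, hrt⟩ := H.exists_rtail_le hμ
  set b := (1 - η)⁻¹ with hb
  have hη' : 0 < 1 - η := by linarith
  have hb0 : 0 < b := by positivity
  have hb1 : 1 < b := (one_lt_inv₀ hη').2 (by linarith)
  have hbη : (1 - η) * b = 1 := mul_inv_cancel₀ hη'.ne'
  set r := b ^ (ρ₁ + ρ - 1) with hr
  have hr0 : 0 < r := by positivity
  have hr1 : r < 1 := Real.rpow_lt_one_of_one_lt_of_neg hb1 (by linarith)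
  set C₃ := C₁ * b ^ ρ₁ with hC₃
  set K' := max K 0 with hK'
  set B := C₂ * C₃ * C₃ * K' / c with hB
  have hB0 : 0 ≤ B := by positivity
  refine ⟨B * (1 - r)⁻¹ + 1, by have := sub_pos.2 hr1; positivity, fun E hE hI => ?_⟩
  obtain ⟨X, hX⟩ := eventually_atTop.1 hI
  filter_upwards [hD, eventually_ge_atTop (max (X / c) (1 / c)), eventually_ge_atTop 1]
    with x hDx hxX hx1 hDx0
  have hx0 : 0 < x := by linarith
  have hcx : 1 ≤ c * x := by
    have := (le_max_right _ _).trans hxX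
    rw [div_le_iff₀ hc] at this; linarith
  have hcX : X ≤ c * x := by
    have := (le_max_left _ _).trans hxX
    rw [div_le_iff₀ hc] at this; linarith
  have hlx := H.pos hx0
  have hterm : ∀ j : ℕ, ∫⁻ z in Ico (b ^ j * (c * x)) (b ^ (j + 1) * (c * x)),
      ENNReal.ofReal (rtail μ z / z * max (omegaFn μ h z - T) 0) ≤
        ENNReal.ofReal (B * E * D x * (ℓ x / x) * r ^ j) := by
    intro j
    set s := b ^ j * (c * x) with hs
    set s' := b ^ (j + 1) * (c * x) with hs'
    have hbj : 1 ≤ b ^ j := one_le_pow₀ hb1.le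
    have hcs : c * x ≤ s := le_mul_of_one_le_left (by linarith) hbj
    have hs1 : 1 ≤ s := hcx.trans hcs
    have hs0 : 0 < s := by linarith
    have hls := H.pos hs0
    have hss' : s' = b * s := by rw [hs, hs']; ring
    have hss1 : (1 - η) * s' = s := by rw [hss', ← mul_assoc, hbη, one_mul]
    have hs'X : X ≤ s' := by
      rw [hss']
      exact (hcX.trans hcs).trans (le_mul_of_one_le_left hs0.le hb1.le)
    have hs'0 : 0 < s' := by rw [hss']; positivity
    have hls' := H.pos hs'0
    have h1 : ℓ s' ≤ C₃ * ℓ s := by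
      have := hpot s s' hs1 (by rw [hss']; exact le_mul_of_one_le_left hs0.le hb1.le)
      rwa [hss', mul_div_assoc, div_self hs0.ne', mul_one, ← hss'] at this
    have h2 : ℓ s' ≤ C₃ * (b ^ j) ^ ρ₁ * ℓ x := by
      have hbx : s' ≤ b ^ (j + 1) * x := by
        rw [hs']; gcongr; exact mul_le_of_le_one_left hx0.le hc1
      have hb2 : 1 ≤ b ^ (j + 1) := one_le_pow₀ hb1.le
      have := hpot x (b ^ (j + 1) * x) hx1 (le_mul_of_one_le_left hx0.le hb2)
      refine (H.mono hs'0 hbx).trans (this.trans_eq ?_)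
      rw [mul_div_assoc, div_self hx0.ne', mul_one, pow_succ, Real.mul_rpow (by positivity) hb0.le]
      ring
    have h3 : Iof μ h η s' T ≤ E * (ℓ s' ^ 2 * (K' * (b ^ j) ^ ρ * D x)) := by
      refine (hX s' hs'X).trans ?_
      gcongr
      refine (hDx j).trans ?_
      gcongr
      exact le_max_left _ _
    have h4 : ∀ z ∈ Ico s s', ENNReal.ofReal (rtail μ z / z * max (omegaFn μ h z - T) 0) ≤
        ENNReal.ofReal (C₂ / ℓ s / s) * ENNReal.ofReal (max (omegaFn μ h z - T) 0) := by
      intro z hz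
      rw [← ENNReal.ofReal_mul (by positivity)]
      refine ENNReal.ofReal_le_ofReal (mul_le_mul_of_nonneg_right ?_ (le_max_right _ _))
      have hz0 : 0 < z := hs0.trans_le hz.1
      have := H.mono hs0 hz.1
      have h5 : rtail μ z ≤ C₂ / ℓ s := (hrt z (hs1.trans hz.1)).trans (by gcongr)
      have := hz.1
      gcongr
    calc _ ≤ ∫⁻ z in Ico s s', ENNReal.ofReal (C₂ / ℓ s / s) *
          ENNReal.ofReal (max (omegaFn μ h z - T) 0) := setLIntegral_mono' measurableSet_Ico h4
      _ = ENNReal.ofReal (C₂ / ℓ s / s) * ENNReal.ofReal (Iof μ h η s' T) := by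
        rw [lintegral_const_mul' _ _ ENNReal.ofReal_ne_top,
          ofReal_Iof μ hh.le hT hη.le (by linarith) hs'0.le, hss1,
          Measure.restrict_congr_set Ico_ae_eq_Ioc]
      _ ≤ _ := by
        rw [← ENNReal.ofReal_mul (by positivity)]
        refine ENNReal.ofReal_le_ofReal ?_
        calc C₂ / ℓ s / s * Iof μ h η s' T
            ≤ C₂ / ℓ s / s * (E * (ℓ s' ^ 2 * (K' * (b ^ j) ^ ρ * D x))) := by gcongr
          _ = C₂ / ℓ s / s * (E * (K' * (b ^ j) ^ ρ * D x)) * (ℓ s' * ℓ s') := by ring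
          _ ≤ C₂ / ℓ s / s * (E * (K' * (b ^ j) ^ ρ * D x)) *
              ((C₃ * ℓ s) * (C₃ * (b ^ j) ^ ρ₁ * ℓ x)) := by gcongr
          _ = C₂ * C₃ * C₃ * K' * E * D x * ℓ x / s * ((b ^ j) ^ ρ * (b ^ j) ^ ρ₁) := by
            field_simp
          _ = B * E * D x * (ℓ x / x) * ((b ^ j) ^ (-1 : ℝ) * ((b ^ j) ^ ρ * (b ^ j) ^ ρ₁)) := by
            rw [hs, hB, Real.rpow_neg_one]; field_simp
          _ = _ := by
            rw [← Real.rpow_add (by positivity), ← Real.rpow_add (by positivity), hr,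
              ← Real.rpow_natCast b, ← Real.rpow_natCast (b ^ _), ← Real.rpow_mul hb0.le,
              ← Real.rpow_mul hb0.le]
            congr 2; ring
  calc jTail μ h T (c * x)
      ≤ ∑' j : ℕ, ∫⁻ z in Ico (b ^ j * (c * x)) (b ^ (j + 1) * (c * x)),
          ENNReal.ofReal (rtail μ z / z * max (omegaFn μ h z - T) 0) :=
        (lintegral_mono_set (Ioi_subset_iUnion_Ico hb1 (by positivity))).trans
          (lintegral_iUnion_le _ _)
    _ ≤ ∑' j : ℕ, ENNReal.ofReal (B * E * D x * (ℓ x / x) * r ^ j) := ENNReal.tsum_le_tsum hterm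
    _ = ENNReal.ofReal (∑' j : ℕ, B * E * D x * (ℓ x / x) * r ^ j) := by
        rw [ENNReal.ofReal_tsum_of_nonneg (fun j => by positivity)]
        exact (summable_geometric_of_lt_one hr0.le hr1).mul_left _
    _ ≤ _ := by
        rw [tsum_mul_left, tsum_geometric_of_lt_one hr0.le hr1]
        refine ENNReal.ofReal_le_ofReal ?_
        have : 0 ≤ E * D x * (ℓ x / x) := by positivity
        calc B * E * D x * (ℓ x / x) * (1 - r)⁻¹
            = B * (1 - r)⁻¹ * (E * D x * (ℓ x / x)) := by ring
          _ ≤ (B * (1 - r)⁻¹ + 1) * (E * D x * (ℓ x / x)) := by gcongr; linarith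
          _ = _ := by ring

end RVMono

/-- The contribution of few summands to the renewal mass near `x` is negligible. -/
def SmallSums (μ : Measure ℝ) (ℓ : ℝ → ℝ) (h : ℝ) : Prop :=
  ∀ ρ > 0, ∃ ε > 0, ∃ δ > 0, ∀ᶠ x in atTop, ∃ M : ℕ → ℝ,
    (∀ (n : ℕ) (t : ℝ), n < ⌈δ * ℓ x⌉₊ → |t - x| ≤ ε * x →
      (convPow μ n).real (Ioc t (t + h)) ≤ M n) ∧
    x / ℓ x * ∑ n ∈ Finset.range ⌈δ * ℓ x⌉₊, M n ≤ ρ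

namespace RVMono

variable {ℓ : ℝ → ℝ} {α : ℝ}

lemma eventually_le_comp_mul (H : RVMono ℓ α) {c : ℝ} (hc : 0 < c) :
    ∃ κ : ℝ, 0 < κ ∧ ∀ᶠ x in atTop, κ * ℓ x ≤ ℓ (c * x) := by
  have hcα : 0 < c ^ α := by positivity
  refine ⟨c ^ α / 2, by positivity, ?_⟩
  filter_upwards [(H.reg.2 c hc).eventually (lt_mem_nhds (half_lt_self hcα)),
    eventually_gt_atTop 0] with x hx hx0
  exact ((lt_div_iff₀ (H.pos hx0)).1 hx).le

/-- Local bound for sums of few steps in terms of the tail integral. -/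
lemma exists_convPow_Ioc_le_of_jTail (H : RVMono ℓ α) (hα : α < 1) {μ : Measure ℝ}
    [IsProbabilityMeasure μ] {k : ℝ} (hk : 0 < k)
    (hμ : Tendsto (fun x => rtail μ x * ℓ x) atTop (nhds k)) {h T : ℝ} (hh : 0 < h)
    (hT : 0 ≤ T) :
    ∃ c δ C : ℝ, 0 < c ∧ c ≤ 1 ∧ 0 < δ ∧ 0 < C ∧ ∀ᶠ x in atTop, ∀ Q : ℝ, 0 ≤ Q →
      jTail μ h T (c * x) ≤ ENNReal.ofReal (Q * (ℓ x / x)) →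
      ∀ (n : ℕ) (t : ℝ), 1 ≤ n → (n : ℝ) ≤ δ * ℓ x → x / 2 ≤ t →
        (convPow μ n).real (Ioc t (t + h)) ≤ C / x + C * Q * (ℓ x / x) * (n / linv ℓ n) := by
  obtain ⟨c, C₁, hc, hc4, hC₁, hA⟩ := H.exists_convPow_restrict_Ioc_le hα hk hμ hh
  obtain ⟨C₂, hC₂, hconc⟩ := H.exists_convPow_Ioc_le hk hμ hh
  obtain ⟨C₃, hC₃, hrt⟩ := H.exists_rtail_le hμ
  obtain ⟨κ, hκ, hκx⟩ := H.eventually_le_comp_mul (half_pos hc)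
  set C₄ := max C₂ (linv ℓ 1) with hC₄
  have hC₄0 : 0 < C₄ := lt_max_of_lt_left hC₂
  refine ⟨c / 2, κ, max (C₁ + 2 * T * (C₃ / (c / 2))) (2 * C₄ / h), by positivity, by linarith, hκ,
    lt_max_of_lt_right (by positivity), ?_⟩
  filter_upwards [hκx, eventually_ge_atTop (2 / c), eventually_ge_atTop (2 * (h + 1) / c)]
    with x hlx hx1 hxh Q hQ hJ n t hn hnl ht
  rw [div_le_iff₀ hc] at hx1 hxh
  have hx0 : 0 < x := by
    by_contra h0
    have := mul_nonpos_of_nonpos_of_nonneg (not_lt.1 h0) hc.le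
    linarith
  have hlx0 := H.pos hx0
  have hcx1 : 1 ≤ c / 2 * x := by linarith
  have hcx0 : 0 < c / 2 * x := by linarith
  have hlc0 := H.pos hcx0
  have han := H.linv_pos (n : ℝ)
  have hnl' : (n : ℝ) ≤ ℓ (c / 2 * x) := hnl.trans hlx
  obtain ⟨m, rfl⟩ : ∃ m, n = m + 1 := ⟨n - 1, by omega⟩
  have hconc' : ∀ s, (convPow μ m).real (Ioc s (s + h)) ≤ C₄ / linv ℓ ((m + 1 : ℕ) : ℝ) := by
    intro s
    rcases Nat.eq_zero_or_pos m with rfl | hm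
    · refine measureReal_le_one.trans ((one_le_div han).2 ?_)
      simp [hC₄]
    · refine (hconc ((m + 1 : ℕ) : ℝ) m s (by exact_mod_cast hn) ?_).trans ?_
      · exact_mod_cast (by omega : m + 1 ≤ 8 * m)
      · gcongr; exact le_max_left _ _
  have hR : ∀ z, c * x - h < z → rtail μ z / z ≤ C₃ / ℓ (c / 2 * x) / (c / 2 * x) := by
    intro z hz
    have hz1 : c / 2 * x ≤ z := by linarith
    have := H.mono hcx0 hz1
    have h5 : rtail μ z ≤ C₃ / ℓ (c / 2 * x) :=
      (hrt z (hcx1.trans hz1)).trans (by gcongr)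
    gcongr
  have hB := conv_restrict_Ioi_le μ (convPow μ m) (t := t) hh hT (by linarith : h < c * x)
    hconc' hR
  have hJ' : jTail μ h T (c * x - h) ≤ ENNReal.ofReal (Q * (ℓ x / x)) :=
    (jTail_antitone μ h T (by linarith)).trans hJ
  have hA' : convPow (μ.restrict (Iic (c * x))) (m + 1) (Ioc t (t + h)) ≤
      ENNReal.ofReal (C₁ / x) := by
    rw [← ENNReal.ofReal_toReal (measure_ne_top _ _)]
    refine ENNReal.ofReal_le_ofReal (hA x t (m + 1) (by linarith) ht hn ?_)
    exact hnl'.trans (H.mono hcx0 (by nlinarith))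
  have hfin : convPow μ (m + 1) (Ioc t (t + h)) ≤ ENNReal.ofReal (C₁ / x +
      ((m + 1 : ℕ) : ℝ) * (2 * T * (C₃ / ℓ (c / 2 * x) / (c / 2 * x)) +
        2 * (C₄ / linv ℓ ((m + 1 : ℕ) : ℝ)) / h * (Q * (ℓ x / x)))) := by
    refine (convPow_succ_le μ (c * x) m _).trans ?_
    rw [Measure.add_apply, Measure.smul_apply, smul_eq_mul, ENNReal.ofReal_add (by positivity)
      (by positivity), ENNReal.ofReal_mul (Nat.cast_nonneg _), ENNReal.ofReal_natCast,
      ENNReal.ofReal_add (by positivity) (by positivity), ENNReal.ofReal_mul (q := Q * (ℓ x / x))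
      (by positivity)]
    gcongr
    refine hB.trans ?_
    gcongr
  refine (ENNReal.toReal_le_of_le_ofReal (by positivity) hfin).trans ?_
  set N : ℝ := ((m + 1 : ℕ) : ℝ) with hN
  calc C₁ / x + N * (2 * T * (C₃ / ℓ (c / 2 * x) / (c / 2 * x)) +
        2 * (C₄ / linv ℓ N) / h * (Q * (ℓ x / x)))
      = (C₁ + 2 * T * (C₃ / (c / 2)) * (N / ℓ (c / 2 * x))) / x +
          2 * C₄ / h * Q * (ℓ x / x) * (N / linv ℓ N) := by
        generalize ℓ (c / 2 * x) = w at hlc0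
        field_simp
        ring
    _ ≤ (C₁ + 2 * T * (C₃ / (c / 2)) * 1) / x +
          2 * C₄ / h * Q * (ℓ x / x) * (N / linv ℓ N) := by
        gcongr
        exact (div_le_one hlc0).2 hnl'
    _ ≤ _ := by
        rw [mul_one]
        gcongr
        · exact le_max_left _ _
        · exact le_max_right _ _

lemma smallSums_of_jTail (H : RVMono ℓ α) (hα : α < 1) {μ : Measure ℝ}
    [IsProbabilityMeasure μ] {k : ℝ} (hk : 0 < k)
    (hμ : Tendsto (fun x => rtail μ x * ℓ x) atTop (nhds k)) {h T : ℝ} (hh : 0 < h)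
    (hT : 0 ≤ T) {L : ℝ → ℝ} (hL : ∀ x, 1 ≤ L x)
    (ha : Tendsto (fun ε : ℝ =>
        Filter.limsup (fun x : ℝ => ENNReal.ofReal ((x / ℓ x) *
          ∑ n ∈ Finset.range ⌈L x⌉₊,
            sSup ((fun t => ((convPow μ n) (Set.Ioc t (t + h))).toReal) ''
              Set.Icc (x - ε * x) (x + ε * x)))) atTop)
      (nhdsWithin 0 (Set.Ioi 0)) (nhds 0))
    (hQ : ∀ c > 0, c ≤ 1 → ∀ ρ > 0, ∃ δ > 0, ∃ Q : ℝ → ℝ, ∀ᶠ x in atTop, 0 ≤ Q x ∧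
      jTail μ h T (c * x) ≤ ENNReal.ofReal (Q x * (ℓ x / x)) ∧
      ∀ S : Finset ℕ, (∀ n ∈ S, L x ≤ n ∧ (n : ℝ) ≤ δ * ℓ x) →
        Q x * ∑ n ∈ S, ((n : ℕ) : ℝ) / linv ℓ n ≤ ρ) :
    SmallSums μ ℓ h := by
  intro ρ hρ
  obtain ⟨c, δ₁, C, hc, hc1, hδ₁, hC, hterm⟩ :=
    H.exists_convPow_Ioc_le_of_jTail hα hk hμ hh hT
  obtain ⟨δ₂, hδ₂, Q, hQx⟩ := hQ c hc hc1 (ρ / 3 / C) (by positivity)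
  have hev : ∀ᶠ ε in nhdsWithin (0 : ℝ) (Ioi 0), Filter.limsup (fun x : ℝ => ENNReal.ofReal
      ((x / ℓ x) * ∑ n ∈ Finset.range ⌈L x⌉₊,
        sSup ((fun t => ((convPow μ n) (Set.Ioc t (t + h))).toReal) ''
          Set.Icc (x - ε * x) (x + ε * x)))) atTop < ENNReal.ofReal (ρ / 3) :=
    ha.eventually (gt_mem_nhds (by simpa using by positivity))
  obtain ⟨ε, hε, hε0, hε1⟩ := (hev.and (Ioo_mem_nhdsGT (show (0 : ℝ) < 1 / 2 by norm_num))).exists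
  set δ := min (min δ₁ δ₂) (ρ / 3 / C) with hδ
  have hδ0 : 0 < δ := by positivity
  have hδ1 : δ ≤ δ₁ := (min_le_left _ _).trans (min_le_left _ _)
  have hδ2 : δ ≤ δ₂ := (min_le_left _ _).trans (min_le_right _ _)
  have hδ3 : δ ≤ ρ / 3 / C := min_le_right _ _
  refine ⟨ε, hε0, δ, hδ0, ?_⟩
  filter_upwards [hterm, hQx, Filter.eventually_lt_of_limsup_lt hε, eventually_gt_atTop 0]
    with x hx ⟨hQ0, hJ, hsum⟩ hsup hx0
  have hlx := H.pos hx0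
  set sup : ℕ → ℝ := fun n => sSup ((fun t => ((convPow μ n) (Set.Ioc t (t + h))).toReal) ''
          Set.Icc (x - ε * x) (x + ε * x)) with hsupdef
  have hsup0 : ∀ n, 0 ≤ sup n := fun n => Real.sSup_nonneg (by
    rintro _ ⟨t, -, rfl⟩; exact ENNReal.toReal_nonneg)
  have hsup' : x / ℓ x * ∑ n ∈ Finset.range ⌈L x⌉₊, sup n ≤ ρ / 3 :=
    ((ENNReal.ofReal_lt_ofReal_iff (by positivity)).1 hsup).le
  set b : ℕ → ℝ := fun n => C / x + C * Q x * (ℓ x / x) * (n / linv ℓ n) with hb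
  refine ⟨fun n => if n < ⌈L x⌉₊ then sup n else b n, fun n t hn ht => ?_, ?_⟩
  · rw [abs_le] at ht
    by_cases hnL : n < ⌈L x⌉₊
    · simp only [if_pos hnL]
      refine le_csSup ⟨1, ?_⟩ ⟨t, ⟨by linarith [ht.1], by linarith [ht.2]⟩, rfl⟩
      rintro _ ⟨s, -, rfl⟩
      exact measureReal_le_one (μ := convPow μ n)
    · simp only [if_neg hnL]
      have hLn : L x ≤ n := Nat.ceil_le.1 (not_lt.1 hnL)
      refine hx (Q x) hQ0 hJ n t (by exact_mod_cast (hL x).trans hLn) ?_ ?_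
      · exact (Nat.lt_ceil.1 hn).le.trans (by gcongr)
      · nlinarith
  · set S := (Finset.range ⌈δ * ℓ x⌉₊).filter fun n => ¬ n < ⌈L x⌉₊ with hS
    have hSn : ∀ n ∈ S, L x ≤ n ∧ (n : ℝ) ≤ δ * ℓ x := by
      intro n hn
      rw [hS, Finset.mem_filter, Finset.mem_range] at hn
      exact ⟨Nat.ceil_le.1 (not_lt.1 hn.2), (Nat.lt_ceil.1 hn.1).le⟩
    have h1 : ∑ n ∈ Finset.range ⌈δ * ℓ x⌉₊, (if n < ⌈L x⌉₊ then sup n else b n) ≤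
        ∑ n ∈ Finset.range ⌈L x⌉₊, sup n + ∑ n ∈ S, b n := by
      rw [Finset.sum_ite]
      refine add_le_add ?_ le_rfl
      refine Finset.sum_le_sum_of_subset_of_nonneg ?_ fun n _ _ => hsup0 n
      intro n hn
      exact Finset.mem_range.2 (Finset.mem_filter.1 hn).2
    have hcard : (S.card : ℝ) ≤ δ * ℓ x := card_filter_le
      (fun n hn => by exact_mod_cast (hL x).trans (hSn n hn).1) (by positivity)
      fun n hn => (hSn n hn).2
    have h2 : x / ℓ x * ∑ n ∈ S, b n ≤ ρ / 3 + ρ / 3 := by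
      rw [hb, Finset.sum_add_distrib, ← Finset.mul_sum, mul_add, Finset.sum_const, nsmul_eq_mul]
      refine add_le_add ?_ ?_
      · calc x / ℓ x * (S.card * (C / x)) = S.card / ℓ x * C := by field_simp
          _ ≤ δ * C := by
            gcongr; exact (div_le_iff₀ hlx).2 hcard
          _ ≤ ρ / 3 / C * C := by gcongr
          _ = ρ / 3 := by field_simp
      · have := hsum S fun n hn => ⟨(hSn n hn).1, (hSn n hn).2.trans (by gcongr)⟩
        calc x / ℓ x * (C * Q x * (ℓ x / x) * ∑ n ∈ S, (n : ℝ) / linv ℓ n)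
            = C * (Q x * ∑ n ∈ S, (n : ℝ) / linv ℓ n) := by field_simp
          _ ≤ C * (ρ / 3 / C) := by gcongr
          _ = ρ / 3 := by field_simp
    calc _ ≤ x / ℓ x * (∑ n ∈ Finset.range ⌈L x⌉₊, sup n + ∑ n ∈ S, b n) := by gcongr
      _ ≤ ρ / 3 + (ρ / 3 + ρ / 3) := by rw [mul_add]; exact add_le_add hsup' h2
      _ = ρ := by ring

end RVMono

lemma RegVary.index_nonneg {L : ℝ → ℝ} {β : ℝ} (h : RegVary L β) (hL : ∀ x, 1 ≤ L x) : 0 ≤ β := by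
  by_contra hβ
  have hr : (2 : ℝ) ^ β < 1 := Real.rpow_lt_one_of_one_lt_of_neg (by norm_num) (not_le.1 hβ)
  obtain ⟨r, hr1, hr2⟩ := exists_between hr
  have hr0 : 0 < r := lt_trans (by positivity) hr1
  obtain ⟨X, hX⟩ := eventually_atTop.1 ((h.2 2 two_pos).eventually (gt_mem_nhds hr1))
  set x := max X 1 with hx
  have hx0 : 0 < x := lt_max_of_lt_right one_pos
  have key : ∀ k : ℕ, L (2 ^ k * x) ≤ r ^ k * L x := by
    intro k
    induction k with
    | zero => simp
    | succ k ih =>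
      have hk : x ≤ 2 ^ k * x := le_mul_of_one_le_left hx0.le (one_le_pow₀ (by norm_num))
      have := hX (2 ^ k * x) ((le_max_left _ _).trans hk)
      rw [div_lt_iff₀ (h.1 _ (by positivity)), ← mul_assoc, ← pow_succ'] at this
      calc _ ≤ _ := this.le
        _ ≤ r * (r ^ k * L x) := by gcongr
        _ = _ := by ring
  have hlim : Tendsto (fun k : ℕ => r ^ k * L x) atTop (nhds (0 * L x)) :=
    (tendsto_pow_atTop_nhds_zero_of_lt_one hr0.le hr2).mul_const _
  rw [zero_mul] at hlim
  obtain ⟨k, hk⟩ := (hlim.eventually (gt_mem_nhds one_pos)).exists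
  linarith [key k, hL (2 ^ k * x)]

lemma RegVary.index_le {L ℓ : ℝ → ℝ} {β α : ℝ} (h : RegVary L β) (h' : RegVary ℓ α)
    (h0 : Tendsto (fun x => L x / ℓ x) atTop (nhds 0)) : β ≤ α := by
  by_contra hβ
  have hr : 1 < (2 : ℝ) ^ β / 2 ^ α := by
    rw [← Real.rpow_sub two_pos]
    exact Real.one_lt_rpow (by norm_num) (by linarith)
  have hlim := (h.2 2 two_pos).div (h'.2 2 two_pos) (by positivity)
  obtain ⟨X, hX⟩ := eventually_atTop.1 (hlim.eventually (lt_mem_nhds hr))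
  set x := max X 1 with hx
  have hx0 : 0 < x := lt_max_of_lt_right one_pos
  have key : ∀ k : ℕ, L x / ℓ x ≤ L (2 ^ k * x) / ℓ (2 ^ k * x) := by
    intro k
    induction k with
    | zero => simp
    | succ k ih =>
      refine ih.trans ?_
      have hk : x ≤ 2 ^ k * x := le_mul_of_one_le_left hx0.le (one_le_pow₀ (by norm_num))
      have h1 := hX (2 ^ k * x) ((le_max_left _ _).trans hk)
      have p1 := h.1 (2 ^ k * x) (by positivity)
      have p2 := h'.1 (2 ^ k * x) (by positivity)
      have p3 := h'.1 (2 ^ (k + 1) * x) (by positivity)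
      simp only [Pi.div_apply] at h1
      rw [← mul_assoc, ← pow_succ', div_div_div_eq, one_lt_div (by positivity)] at h1
      rw [div_le_div_iff₀ p2 p3]
      linarith
  have hx1 : Tendsto (fun k : ℕ => (2 : ℝ) ^ k * x) atTop atTop :=
    (tendsto_pow_atTop_atTop_of_one_lt (by norm_num : (1 : ℝ) < 2)).atTop_mul_const hx0
  have hp : 0 < L x / ℓ x := div_pos (h.1 x hx0) (h'.1 x hx0)
  obtain ⟨k, hk⟩ := ((h0.comp hx1).eventually (gt_mem_nhds hp)).exists
  exact absurd (key k) (not_le.2 hk)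

/-- Iterated form of regular variation along powers of a fixed ratio. -/
lemma RegVary.eventually_pow_bounds {L : ℝ → ℝ} {β : ℝ} (h : RegVary L β) {b ε : ℝ} (hb : 1 < b)
    (hε : 0 < ε) :
    ∀ᶠ x in atTop, ∀ j : ℕ, (b ^ j) ^ (β - ε) * L x ≤ L (b ^ j * x) ∧
      L (b ^ j * x) ≤ (b ^ j) ^ (β + ε) * L x := by
  have hb0 : 0 < b := by linarith
  have h1 : b ^ (β - ε) < b ^ β := Real.rpow_lt_rpow_of_exponent_lt hb (by linarith)
  have h2 : b ^ β < b ^ (β + ε) := Real.rpow_lt_rpow_of_exponent_lt hb (by linarith)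
  obtain ⟨X, hX⟩ := eventually_atTop.1 (((h.2 b hb0).eventually (lt_mem_nhds h1)).and
    ((h.2 b hb0).eventually (gt_mem_nhds h2)))
  filter_upwards [eventually_ge_atTop (max X 1)] with x hx j
  have hx0 : 0 < x := lt_of_lt_of_le one_pos ((le_max_right _ _).trans hx)
  induction j with
  | zero => simp
  | succ j ih =>
    have hk : x ≤ b ^ j * x := le_mul_of_one_le_left hx0.le (one_le_pow₀ hb.le)
    obtain ⟨h3, h4⟩ := hX (b ^ j * x) (((le_max_left _ _).trans hx).trans hk)
    rw [lt_div_iff₀ (h.1 _ (by positivity)), ← mul_assoc, ← pow_succ'] at h3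
    rw [div_lt_iff₀ (h.1 _ (by positivity)), ← mul_assoc, ← pow_succ'] at h4
    constructor
    · refine le_trans ?_ h3.le
      rw [pow_succ', Real.mul_rpow hb0.le (by positivity), mul_assoc]
      exact mul_le_mul_of_nonneg_left ih.1 (by positivity)
    · refine h4.le.trans ?_
      rw [pow_succ', Real.mul_rpow hb0.le (by positivity), mul_assoc]
      exact mul_le_mul_of_nonneg_left ih.2 (by positivity)

namespace RVMono

variable {ℓ : ℝ → ℝ} {α : ℝ}

lemma exists_linv_mul_le (H : RVMono ℓ α) {ρ : ℝ} (hρ0 : 0 < ρ) (hρ : ρ < α) :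
    ∃ C : ℝ, 0 < C ∧ ∀ r v : ℝ, 1 ≤ r → 1 ≤ v → linv ℓ (r * v) ≤ C * r ^ (1 / ρ) * linv ℓ v := by
  obtain ⟨c, hc, hc1, hpot⟩ := H.potter_lower hρ0.le hρ
  obtain ⟨c', hc', hl⟩ := H.exists_linv_lower
  set K := max 1 (2 / (c * c')) with hK
  have hK1 : 1 ≤ K := le_max_left _ _
  refine ⟨K ^ (1 / ρ), by positivity, fun r v hr hv => ?_⟩
  have ha := H.one_le_linv v
  have ha0 := H.linv_pos v
  rw [← Real.mul_rpow (by positivity) (by positivity)]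
  have hKr : 1 ≤ K * r := one_le_mul_of_one_le_of_one_le hK1 hr
  have hM : 1 ≤ (K * r) ^ (1 / ρ) := Real.one_le_rpow hKr (by positivity)
  have h1 := hpot _ _ ha (le_mul_of_one_le_left ha0.le hM)
  refine linv_le (ha.trans (le_mul_of_one_le_left ha0.le hM)) (lt_of_lt_of_le ?_ h1)
  rw [mul_div_assoc, div_self ha0.ne', mul_one, ← Real.rpow_mul (by positivity),
    one_div_mul_cancel hρ0.ne', Real.rpow_one]
  have h2 := hl v
  have h3 : 2 ≤ K * (c * c') := by
    have : 2 / (c * c') ≤ K := le_max_right _ _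
    rwa [div_le_iff₀ (by positivity)] at this
  calc r * v < 2 * (r * v) := by have : 0 < r * v := by positivity
                                 linarith
    _ ≤ K * (c * c') * (r * v) := by gcongr
    _ = c * (K * r) * (c' * v) := by ring
    _ ≤ _ := by gcongr

lemma eventually_linv_div_sq_le (H : RVMono ℓ α) (hα : α < 1 / 2) {L : ℝ → ℝ} {β : ℝ}
    (hL : RegVary L β) (hL1 : ∀ x, 1 ≤ L x)
    (h0 : Tendsto (fun x => L x / ℓ x) atTop (nhds 0)) {b c : ℝ} (hb : 1 < b) (hc : 0 < c)
    (hc1 : c ≤ 1) :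
    ∃ ρ K : ℝ, ρ < 1 - α ∧ ∀ᶠ x in atTop, ∀ j : ℕ,
      linv ℓ (L (b ^ (j + 1) * (c * x))) / L (b ^ (j + 1) * (c * x)) ^ 2 ≤
        K * (b ^ j) ^ ρ * (linv ℓ (L x) / L x ^ 2) := by
  have hα0 := H.index_pos
  have hβ0 := hL.index_nonneg hL1
  have hβα := hL.index_le H.reg h0
  have hb0 : 0 < b := by linarith
  obtain ⟨ε, hερ, hε⟩ : ∃ ε : ℝ, (β + ε) * (1 + ε) / α - 2 * (β - ε) < 1 - α ∧ 0 < ε := by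
    have hcont : Continuous fun ε : ℝ => (β + ε) * (1 + ε) / α - 2 * (β - ε) := by fun_prop
    have hlt : (β + 0) * (1 + 0) / α - 2 * (β - 0) < 1 - α := by
      have h1 : β / α ≤ 1 := (div_le_one hα0).2 hβα
      have h2 : (β + 0) * (1 + 0) / α - 2 * (β - 0) = β / α * (1 - 2 * α) := by
        field_simp; ring
      rw [h2]
      nlinarith
    have h1 : ∀ᶠ ε in nhdsWithin (0 : ℝ) (Ioi 0),
        (β + ε) * (1 + ε) / α - 2 * (β - ε) < 1 - α :=
      nhdsWithin_le_nhds (hcont.continuousAt.eventually (gt_mem_nhds hlt))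
    exact (h1.and self_mem_nhdsWithin).exists
  have hρ'0 : 0 < α / (1 + ε) := by positivity
  obtain ⟨C, hC, hlin⟩ := H.exists_linv_mul_le hρ'0 (div_lt_self hα0 (by linarith))
  rw [one_div_div] at hlin
  set e := (β + ε) * (1 + ε) / α - 2 * (β - ε) with he
  have hcβ : 0 < c ^ β := by positivity
  have hcβ1 : c ^ β ≤ 1 := Real.rpow_le_one hc.le hc1 hβ0
  refine ⟨e, C * 2 ^ ((1 + ε) / α) * (2 / c ^ β) ^ 2 * b ^ e, hερ, ?_⟩
  have hlimc : Tendsto (fun x : ℝ => c * x) atTop atTop := tendsto_id.const_mul_atTop hc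
  filter_upwards [hlimc.eventually (hL.eventually_pow_bounds hb hε),
    (hL.2 c hc).eventually (lt_mem_nhds (half_lt_self hcβ)),
    (hL.2 c hc).eventually (gt_mem_nhds (show c ^ β < 2 by linarith)),
    eventually_gt_atTop 0] with x hx hx1 hx2 hx0 j
  have hLx : 0 < L x := lt_of_lt_of_le one_pos (hL1 x)
  rw [lt_div_iff₀ hLx] at hx1
  rw [div_lt_iff₀ hLx] at hx2
  obtain ⟨h1, h2⟩ := hx (j + 1)
  set y := b ^ (j + 1) * (c * x) with hy
  have hB1 : 1 ≤ b ^ (j + 1) := one_le_pow₀ hb.le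
  set B := b ^ (j + 1) with hB
  have hB0 : 0 < B := by positivity
  have hup : L y ≤ 2 * B ^ (β + ε) * L x := by
    refine h2.trans ?_
    have := mul_le_mul_of_nonneg_left hx2.le (by positivity : 0 ≤ B ^ (β + ε))
    linarith
  have hlow : B ^ (β - ε) * (c ^ β / 2) * L x ≤ L y := by
    refine le_trans ?_ h1
    have := mul_le_mul_of_nonneg_left hx1.le (by positivity : 0 ≤ B ^ (β - ε))
    linarith
  have hr : 1 ≤ 2 * B ^ (β + ε) := by
    have := Real.one_le_rpow hB1 (by positivity : 0 ≤ β + ε)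
    linarith
  have hlin' : linv ℓ (L y) ≤ C * (2 * B ^ (β + ε)) ^ ((1 + ε) / α) * linv ℓ (L x) :=
    (H.linv_mono hup).trans (hlin _ _ hr (hL1 x))
  have ha := H.linv_pos (L x)
  calc linv ℓ (L y) / L y ^ 2
      ≤ C * (2 * B ^ (β + ε)) ^ ((1 + ε) / α) * linv ℓ (L x) /
          (B ^ (β - ε) * (c ^ β / 2) * L x) ^ 2 := by gcongr
    _ = C * 2 ^ ((1 + ε) / α) * (2 / c ^ β) ^ 2 * B ^ e * (linv ℓ (L x) / L x ^ 2) := by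
        have h3 : B ^ e = (B ^ (β + ε)) ^ ((1 + ε) / α) / (B ^ (β - ε)) ^ 2 := by
          rw [← Real.rpow_mul hB0.le, ← Real.rpow_natCast, ← Real.rpow_mul hB0.le,
            ← Real.rpow_sub hB0, he]
          congr 1
          push_cast
          ring
        rw [h3, Real.mul_rpow two_pos.le (by positivity)]
        field_simp
    _ = _ := by
        rw [hB, pow_succ b j, Real.mul_rpow (by positivity) hb0.le]
        ring

lemma smallSums_of_lt_half (H : RVMono ℓ α) (hα : α < 1 / 2) {μ : Measure ℝ}
    [IsProbabilityMeasure μ] {k : ℝ} (hk : 0 < k)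
    (hμ : Tendsto (fun x => rtail μ x * ℓ x) atTop (nhds k)) {h T η : ℝ} (hh : 0 < h)
    (hT : 0 ≤ T) (hη : 0 < η) (hη1 : η ≤ 1) {L : ℝ → ℝ} (hLreg : RegVaryAny L)
    (hL : ∀ x, 1 ≤ L x) (h0 : Tendsto (fun x => L x / ℓ x) atTop (nhds 0))
    (ha : Tendsto (fun ε : ℝ =>
        Filter.limsup (fun x : ℝ => ENNReal.ofReal ((x / ℓ x) *
          ∑ n ∈ Finset.range ⌈L x⌉₊,
            sSup ((fun t => ((convPow μ n) (Set.Ioc t (t + h))).toReal) ''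
              Set.Icc (x - ε * x) (x + ε * x)))) atTop)
      (nhdsWithin 0 (Set.Ioi 0)) (nhds 0))
    (hI : (fun x => Iof μ h η x T) =o[atTop] fun x => ℓ x ^ 2 * linv ℓ (L x) / L x ^ 2) :
    SmallSums μ ℓ h := by
  obtain ⟨β, hβ⟩ := hLreg
  refine H.smallSums_of_jTail (by linarith) hk hμ hh hT hL ha fun c hc hc1 ρ hρ => ?_
  set η' := min η (1 / 2) with hη'
  have hη'0 : 0 < η' := by positivity
  have hη'1 : η' ≤ 1 / 2 := min_le_right _ _
  have hb : 1 < (1 - η')⁻¹ := (one_lt_inv₀ (by linarith)).2 (by linarith)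
  obtain ⟨ρ', K, hρ', hD⟩ := H.eventually_linv_div_sq_le hα hβ hL h0 hb hc hc1
  obtain ⟨C, hC, hJ⟩ := H.exists_jTail_le hμ hh hT hη'0 hη'1 hc hc1
    (D := fun x => linv ℓ (L x) / L x ^ 2) hρ' hD
  obtain ⟨C', hC', hs⟩ := H.exists_sum_div_linv_le hα
  set E := ρ / (C * C') with hE
  have hE0 : 0 < E := by positivity
  have hev := hJ E hE0.le (by
    filter_upwards [hI.def hE0, eventually_gt_atTop 0] with x hx hx0
    refine (Iof_le_Iof μ hh.le hT hη'0.le (min_le_left _ _) hη1 hx0.le).trans ?_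
    have := H.linv_pos (L x)
    rw [Real.norm_of_nonneg (Iof_nonneg μ hη.le hx0.le), Real.norm_of_nonneg (by positivity)] at hx
    rwa [← mul_div_assoc])
  refine ⟨1, one_pos, fun x => C * E * (linv ℓ (L x) / L x ^ 2), ?_⟩
  filter_upwards [hev] with x hx
  have ha := H.linv_pos (L x)
  have hLx : 0 < L x := lt_of_lt_of_le one_pos (hL x)
  refine ⟨by positivity, hx (by positivity), fun S hS => ?_⟩
  calc C * E * (linv ℓ (L x) / L x ^ 2) * ∑ n ∈ S, (n : ℝ) / linv ℓ n
      ≤ C * E * (linv ℓ (L x) / L x ^ 2) * (C' * (L x ^ 2 / linv ℓ (L x))) := by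
        gcongr
        exact hs (L x) S (hL x) fun n hn => (hS n hn).1
    _ = ρ := by rw [hE]; field_simp

variable {ℓ : ℝ → ℝ} {α : ℝ}

lemma integral_sq_sub (H : RVMono ℓ α) {a b c : ℝ} (ha : 0 < a) (hb : 0 < b) (hc : 0 < c) :
    (∫ s in a..c, (ℓ s / s) ^ 2) - ∫ s in a..b, (ℓ s / s) ^ 2 = ∫ s in b..c, (ℓ s / s) ^ 2 :=
  intervalIntegral.integral_interval_sub_left (H.intervalIntegrable_sq ha hc)
    (H.intervalIntegrable_sq ha hb)

lemma integral_sq_mono (H : RVMono ℓ α) {a b c : ℝ} (ha : 0 < a) (hb : 0 < b) (hbc : b ≤ c) :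
    ∫ s in a..b, (ℓ s / s) ^ 2 ≤ ∫ s in a..c, (ℓ s / s) ^ 2 := by
  have h1 := H.integral_sq_sub ha hb (hb.trans_le hbc)
  have h2 : 0 ≤ ∫ s in b..c, (ℓ s / s) ^ 2 :=
    intervalIntegral.integral_nonneg hbc fun s _ => sq_nonneg _
  linarith

lemma exists_sq_div_le_integral_sq (H : RVMono ℓ α) :
    ∃ K : ℝ, 0 < K ∧ ∀ᶠ x in atTop, ℓ x ^ 2 / x ≤ K * ∫ s in (1 : ℝ)..x, (ℓ s / s) ^ 2 := by
  obtain ⟨κ, hκ, hev⟩ := H.eventually_le_comp_mul (c := 1 / 2) (by norm_num)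
  refine ⟨2 / κ ^ 2, by positivity, ?_⟩
  filter_upwards [hev, eventually_ge_atTop 2] with x hx hx2
  have hx0 : 0 < x := by linarith
  have h1 := H.integral_sq_sub (a := 1) (b := 1 / 2 * x) (c := x) one_pos (by linarith) hx0
  have h2 : 0 ≤ ∫ s in (1 : ℝ)..(1 / 2 * x), (ℓ s / s) ^ 2 :=
    intervalIntegral.integral_nonneg (by linarith) fun s _ => sq_nonneg _
  have hℓ := H.pos hx0
  have h3 : (x - 1 / 2 * x) * (κ * ℓ x / x) ^ 2 ≤ ∫ s in (1 / 2 * x)..x, (ℓ s / s) ^ 2 := by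
    rw [← smul_eq_mul, ← intervalIntegral.integral_const]
    refine intervalIntegral.integral_mono_on (by linarith) (by simp)
      (H.intervalIntegrable_sq (by linarith) hx0) fun s hs => ?_
    have hs0 : 0 < s := by linarith [hs.1]
    have := hx.trans (H.mono (by linarith) hs.1)
    have hs2 := hs.2
    gcongr
    exact H.pos hs0 |>.le
  have h4 : (x - 1 / 2 * x) * (κ * ℓ x / x) ^ 2 = κ ^ 2 / 2 * (ℓ x ^ 2 / x) := by
    field_simp; ring
  rw [div_mul_eq_mul_div, le_div_iff₀ (by positivity)]
  linarith

lemma exists_integral_sq_le_comp_mul (H : RVMono ℓ α) {c : ℝ} (hc : 0 < c) (hc1 : c ≤ 1) :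
    ∃ K : ℝ, 0 < K ∧ ∀ᶠ x in atTop,
      ∫ s in (1 : ℝ)..x, (ℓ s / s) ^ 2 ≤ K * ∫ s in (1 : ℝ)..(c * x), (ℓ s / s) ^ 2 := by
  obtain ⟨κ, hκ, hev⟩ := H.eventually_le_comp_mul hc
  obtain ⟨K, hK, hev'⟩ := H.exists_sq_div_le_integral_sq
  have hlimc : Tendsto (fun x : ℝ => c * x) atTop atTop := tendsto_id.const_mul_atTop hc
  refine ⟨1 + K / (c * κ ^ 2), by positivity, ?_⟩
  filter_upwards [hev, hlimc.eventually hev', eventually_gt_atTop 0] with x hx hx' hx0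
  have hcx : 0 < c * x := by positivity
  have hcx' : c * x ≤ x := mul_le_of_le_one_left hx0.le hc1
  have hℓ := H.pos hx0
  have h1 := H.integral_sq_sub (a := 1) one_pos hcx hx0
  have h3 : ∫ s in (c * x)..x, (ℓ s / s) ^ 2 ≤ (x - c * x) * (ℓ x / (c * x)) ^ 2 := by
    rw [← smul_eq_mul (x - c * x), ← intervalIntegral.integral_const]
    refine intervalIntegral.integral_mono_on hcx' (H.intervalIntegrable_sq hcx hx0) (by simp)
      fun s hs => ?_
    have hs0 : 0 < s := hcx.trans_le hs.1
    have := H.mono hs0 hs.2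
    have hs1 := hs.1
    have := (H.pos hs0).le
    gcongr
  have h4 : (x - c * x) * (ℓ x / (c * x)) ^ 2 ≤ x * (ℓ x / (c * x)) ^ 2 := by
    gcongr; linarith
  have h5 : x * (ℓ x / (c * x)) ^ 2 = (κ * ℓ x) ^ 2 / (c * x) / (c * κ ^ 2) := by
    field_simp
  have h6 : (κ * ℓ x) ^ 2 / (c * x) / (c * κ ^ 2) ≤ ℓ (c * x) ^ 2 / (c * x) / (c * κ ^ 2) := by
    gcongr
  have h7 : ℓ (c * x) ^ 2 / (c * x) / (c * κ ^ 2) ≤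
      (K * ∫ s in (1 : ℝ)..(c * x), (ℓ s / s) ^ 2) / (c * κ ^ 2) := by gcongr
  have h8 : (K * ∫ s in (1 : ℝ)..(c * x), (ℓ s / s) ^ 2) / (c * κ ^ 2) =
      K / (c * κ ^ 2) * ∫ s in (1 : ℝ)..(c * x), (ℓ s / s) ^ 2 := by ring
  linarith

lemma integral_sq_pos (H : RVMono ℓ α) {x : ℝ} (hx : 1 < x) :
    0 < ∫ s in (1 : ℝ)..x, (ℓ s / s) ^ 2 :=
  intervalIntegral.intervalIntegral_pos_of_pos_on
    (H.intervalIntegrable_sq one_pos (by linarith))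
    (fun s hs => by
      have hs0 : 0 < s := by linarith [hs.1]
      have := H.pos hs0
      positivity) hx

lemma smallSums_of_eq_half (H : RVMono ℓ α) (hα : α = 1 / 2) {μ : Measure ℝ}
    [IsProbabilityMeasure μ] {k : ℝ} (hk : 0 < k)
    (hμ : Tendsto (fun x => rtail μ x * ℓ x) atTop (nhds k)) {h T η : ℝ} (hh : 0 < h)
    (hT : 0 ≤ T) (hη : 0 < η) (hη1 : η ≤ 1) {L : ℝ → ℝ}
    (hL : ∀ x, 1 ≤ L x) (h0 : Tendsto (fun x => L x / ℓ x) atTop (nhds 0))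
    (ha : Tendsto (fun ε : ℝ =>
        Filter.limsup (fun x : ℝ => ENNReal.ofReal ((x / ℓ x) *
          ∑ n ∈ Finset.range ⌈L x⌉₊,
            sSup ((fun t => ((convPow μ n) (Set.Ioc t (t + h))).toReal) ''
              Set.Icc (x - ε * x) (x + ε * x)))) atTop)
      (nhdsWithin 0 (Set.Ioi 0)) (nhds 0))
    (hI : Tendsto (fun x => (∫ s in (1:ℝ)..x, (ℓ s / s) ^ 2) /
          ∫ s in (1:ℝ)..(linv ℓ (L x)), (ℓ s / s) ^ 2) atTop (nhds 1) →
      (fun x => Iof μ h η x T) =O[atTop] fun x => ℓ x ^ 2 / ∫ s in (1:ℝ)..x, (ℓ s / s) ^ 2)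
    (hI' : ¬ Tendsto (fun x => (∫ s in (1:ℝ)..x, (ℓ s / s) ^ 2) /
          ∫ s in (1:ℝ)..(linv ℓ (L x)), (ℓ s / s) ^ 2) atTop (nhds 1) →
      (fun x => Iof μ h η x T) =o[atTop] fun x => ℓ x ^ 2 / ∫ s in (1:ℝ)..x, (ℓ s / s) ^ 2) :
    SmallSums μ ℓ h := by
  refine H.smallSums_of_jTail (by linarith) hk hμ hh hT hL ha fun c hc hc1 ρ hρ => ?_
  set u : ℝ → ℝ := fun x => ∫ s in (1:ℝ)..x, (ℓ s / s) ^ 2 with hu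
  set η' := min η (1 / 2) with hη'
  have hη'0 : 0 < η' := by positivity
  have hη'1 : η' ≤ 1 / 2 := min_le_right _ _
  have hb : 1 < (1 - η')⁻¹ := (one_lt_inv₀ (by linarith)).2 (by linarith)
  obtain ⟨K₀, hK₀, hcomp⟩ := H.exists_integral_sq_le_comp_mul hc hc1
  have hlimc : Tendsto (fun x : ℝ => c * x) atTop atTop := tendsto_id.const_mul_atTop hc
  have hD : ∀ᶠ x in atTop, ∀ j : ℕ, (fun x => 1 / u x) (((1 - η')⁻¹) ^ (j + 1) * (c * x)) ≤
      K₀ * (((1 - η')⁻¹) ^ j) ^ (0 : ℝ) * (fun x => 1 / u x) x := by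
    filter_upwards [hcomp, hlimc.eventually_gt_atTop 1, eventually_gt_atTop 1] with x hx hx1 hx2 j
    have h1 : c * x ≤ ((1 - η')⁻¹) ^ (j + 1) * (c * x) :=
      le_mul_of_one_le_left (by linarith) (one_le_pow₀ hb.le)
    have h2 : u (c * x) ≤ u (((1 - η')⁻¹) ^ (j + 1) * (c * x)) :=
      H.integral_sq_mono one_pos (by linarith) h1
    have h3 : 0 < u (c * x) := H.integral_sq_pos hx1
    have h4 : 0 < u x := H.integral_sq_pos hx2
    rw [Real.rpow_zero, mul_one]
    rw [mul_one_div, div_le_div_iff₀ (h3.trans_le h2) h4, one_mul]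
    exact le_trans hx (by gcongr)
  obtain ⟨C, hC, hJ⟩ := H.exists_jTail_le hμ hh hT hη'0 hη'1 hc hc1
    (D := fun x => 1 / u x) (by linarith) hD
  obtain ⟨K, hK, hsq⟩ := H.exists_sq_div_le_integral_sq
  have hIof : ∀ E > 0, (∀ᶠ x in atTop, ‖Iof μ h η x T‖ ≤ E * ‖ℓ x ^ 2 / u x‖) →
      ∀ᶠ x in atTop, jTail μ h T (c * x) ≤ ENNReal.ofReal (C * E * (1 / u x) * (ℓ x / x)) := by
    intro E hE hev
    have := hJ E hE.le (by
      filter_upwards [hev, eventually_gt_atTop 1] with x hx hx1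
      have hx0 : 0 < x := by linarith
      refine (Iof_le_Iof μ hh.le hT hη'0.le (min_le_left _ _) hη1 hx0.le).trans ?_
      have : 0 < u x := H.integral_sq_pos hx1
      rw [Real.norm_of_nonneg (Iof_nonneg μ hη.le hx0.le), Real.norm_of_nonneg (by positivity)]
        at hx
      rwa [mul_one_div])
    filter_upwards [this, eventually_gt_atTop 1] with x hx hx1
    have : 0 < u x := H.integral_sq_pos hx1
    exact hx (by positivity)
  have hsum : ∀ δ > 0, ∀ᶠ x in atTop, ∀ S : Finset ℕ, (∀ n ∈ S, L x ≤ n ∧ (n : ℝ) ≤ δ * ℓ x) →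
      ∑ n ∈ S, (n : ℝ) / linv ℓ n ≤ u x - u (linv ℓ (L x)) + δ ^ 2 * (K * u x) := by
    intro δ hδ
    filter_upwards [h0.eventually (gt_mem_nhds one_pos), eventually_ge_atTop 1, hsq]
      with x hx hx1 hx2 S hS
    have hx0 : 0 < x := by linarith
    have hℓ := H.pos hx0
    rw [div_lt_one hℓ] at hx
    have h1 : linv ℓ (L x) ≤ x := linv_le hx1 hx
    have h2 := H.sum_div_linv_le_of_lt (hL x) h1 (V := δ * ℓ x) (by positivity) hS
    rw [← H.integral_sq_sub one_pos (H.linv_pos _) hx0] at h2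
    have h3 : (δ * ℓ x) ^ 2 / x = δ ^ 2 * (ℓ x ^ 2 / x) := by ring
    have h4 := mul_le_mul_of_nonneg_left hx2 (sq_nonneg δ)
    simp only [hu]
    linarith
  by_cases hcase : Tendsto (fun x => (∫ s in (1:ℝ)..x, (ℓ s / s) ^ 2) /
          ∫ s in (1:ℝ)..(linv ℓ (L x)), (ℓ s / s) ^ 2) atTop (nhds 1)
  · obtain ⟨E, hE, hEI⟩ := (hI hcase).exists_pos
    have hQ := hIof E hE hEI.bound
    set δ := Real.sqrt (ρ / (2 * (C * E * K))) with hδ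
    have hδ0 : 0 < δ := Real.sqrt_pos.2 (by positivity)
    have hδ2 : δ ^ 2 = ρ / (2 * (C * E * K)) := Real.sq_sqrt (by positivity)
    refine ⟨δ, hδ0, fun x => C * E * (1 / u x), ?_⟩
    have hinv := hcase.inv₀ one_ne_zero
    rw [inv_one] at hinv
    have hlt : 1 - ρ / (2 * (C * E)) < 1 := by
      have : 0 < ρ / (2 * (C * E)) := by positivity
      linarith
    filter_upwards [hQ, hsum δ hδ0, eventually_gt_atTop 1, hinv.eventually (lt_mem_nhds hlt)]
      with x hx1 hx2 hx3 hx4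
    have hux : 0 < u x := H.integral_sq_pos hx3
    refine ⟨by positivity, hx1, fun S hS => ?_⟩
    have h1 := hx2 S hS
    rw [inv_div, lt_div_iff₀ hux] at hx4
    calc C * E * (1 / u x) * ∑ n ∈ S, (n : ℝ) / linv ℓ n
        ≤ C * E * (1 / u x) * (ρ / (2 * (C * E)) * u x + δ ^ 2 * (K * u x)) := by
          gcongr
          have : u (linv ℓ (L x)) = ∫ s in (1:ℝ)..(linv ℓ (L x)), (ℓ s / s) ^ 2 := rfl
          rw [← this, sub_mul, one_mul] at hx4
          linarith
      _ = ρ := by rw [hδ2]; field_simp; ring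
  · set E := ρ / (C * (1 + K)) with hE
    have hE0 : 0 < E := by positivity
    have hQ := hIof E hE0 ((hI' hcase).def hE0)
    refine ⟨1, one_pos, fun x => C * E * (1 / u x), ?_⟩
    filter_upwards [hQ, hsum 1 one_pos, eventually_gt_atTop 1] with x hx1 hx2 hx3
    have hux : 0 < u x := H.integral_sq_pos hx3
    refine ⟨by positivity, hx1, fun S hS => ?_⟩
    have h1 := hx2 S hS
    have h2 : 0 ≤ u (linv ℓ (L x)) :=
      intervalIntegral.integral_nonneg (H.one_le_linv _) fun s _ => sq_nonneg _
    calc C * E * (1 / u x) * ∑ n ∈ S, (n : ℝ) / linv ℓ n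
        ≤ C * E * (1 / u x) * ((1 + K) * u x) := by
          gcongr
          linarith
      _ = ρ := by rw [hE]; field_simp

end RVMono

/-- Compound Poisson law with finite jump measure `m`. -/
def cPois (m : Measure ℝ) : Measure ℝ :=
  Measure.sum fun k : ℕ => ENNReal.ofReal (exp (-m.real univ) / (k.factorial : ℝ)) • convPow m k

lemma lintegral_exp_cPois (m : Measure ℝ) [IsFiniteMeasure m] {l A : ℝ} (hA : 0 ≤ A)
    (h : ∫⁻ x, ENNReal.ofReal (exp (l * x)) ∂m = ENNReal.ofReal A) :
    ∫⁻ x, ENNReal.ofReal (exp (l * x)) ∂(cPois m) =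
      ENNReal.ofReal (exp (A - m.real univ)) := by
  rw [cPois, lintegral_sum_measure]
  have h1 : ∀ k : ℕ, ∫⁻ x, ENNReal.ofReal (exp (l * x))
      ∂(ENNReal.ofReal (exp (-m.real univ) / (k.factorial : ℝ)) • convPow m k) =
      ENNReal.ofReal (exp (-m.real univ) * (A ^ k / (k.factorial : ℝ))) := fun k => by
    rw [lintegral_smul_measure, lintegral_exp_convPow, h, ← ENNReal.ofReal_pow hA, smul_eq_mul,
      ← ENNReal.ofReal_mul (by positivity)]
    congr 1; ring
  have hs := (NormedSpace.expSeries_div_hasSum_exp A).mul_left (exp (-m.real univ))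
  rw [← Real.exp_eq_exp_ℝ] at hs
  simp_rw [h1]
  rw [← ENNReal.ofReal_tsum_of_nonneg (fun k => by positivity) hs.summable, hs.tsum_eq,
    ← Real.exp_add]
  congr 2; ring

instance (m : Measure ℝ) [IsFiniteMeasure m] : IsProbabilityMeasure (cPois m) := by
  constructor
  have h := lintegral_exp_cPois m (l := 0) (A := m.real univ) measureReal_nonneg (by simp)
  simpa using h

lemma charFun_smul_measure (μ : Measure ℝ) (c : ENNReal) (t : ℝ) :
    charFun (c • μ) t = c.toReal * charFun μ t := by
  rw [charFun, charFun, integral_smul_measure, Complex.real_smul]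

lemma charFun_cPois (m : Measure ℝ) [IsFiniteMeasure m] (t : ℝ) :
    charFun (cPois m) t = Complex.exp (charFun m t - m.real univ) := by
  have hInt : Integrable (fun x : ℝ => Complex.exp (t * x * Complex.I)) (cPois m) := by
    refine Integrable.of_bound (C := 1) (by fun_prop) (ae_of_all _ fun x => ?_)
    rw [← Complex.ofReal_mul, Complex.norm_exp_ofReal_mul_I]
  rw [charFun_apply_real, cPois]
  have h1 := hasSum_integral_measure hInt
  have h2 : ∀ k : ℕ, ∫ x : ℝ, Complex.exp (t * x * Complex.I)
      ∂(ENNReal.ofReal (exp (-m.real univ) / (k.factorial : ℝ)) • convPow m k) =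
      Complex.exp (-m.real univ) * (charFun m t ^ k / k.factorial) := fun k => by
    rw [← charFun_apply_real, charFun_smul_measure, charFun_convPow,
      ENNReal.toReal_ofReal (by positivity)]
    push_cast
    ring
  rw [funext h2] at h1
  have h3 := (NormedSpace.expSeries_div_hasSum_exp (charFun m t)).mul_left
    (Complex.exp (-m.real univ))
  rw [← Complex.exp_eq_exp_ℂ, ← Complex.exp_add] at h3
  rw [h1.unique h3]
  congr 1; ring

lemma convPow_smul (μ : Measure ℝ) [IsFiniteMeasure μ] {c : ENNReal} (hc : c ≠ ⊤) (k : ℕ) :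
    convPow (c • μ) k = c ^ k • convPow μ k := by
  have := Measure.smul_finite μ hc
  induction k with
  | zero => simp [convPow_zero]
  | succ k ih =>
    rw [convPow_succ, convPow_succ, ih]
    ext s hs
    rw [conv_apply _ _ hs, lintegral_smul_measure, Measure.smul_apply, conv_apply _ _ hs]
    simp only [Measure.smul_apply, smul_eq_mul]
    rw [lintegral_const_mul' _ _ hc, pow_succ, mul_assoc]

/-- Lévy's continuity theorem, with existence of the limit law. -/
lemma exists_tendsto_of_tendsto_charFun {μ : ℕ → ProbabilityMeasure ℝ} {f : ℝ → ℂ}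
    (hf : ContinuousAt f 0)
    (h : ∀ t, Tendsto (fun n => charFun (μ n : Measure ℝ) t) atTop (nhds (f t))) :
    ∃ G : ProbabilityMeasure ℝ, Tendsto μ atTop (nhds G) ∧ ∀ t, charFun (G : Measure ℝ) t = f t := by
  have ht := isTightMeasureSet_of_tendsto_charFun hf h
  have hcomp : IsCompact (closure (range μ)) := by
    refine isCompact_closure_of_isTightMeasureSet (ht.subset ?_)
    rintro _ ⟨_, ⟨n, rfl⟩, rfl⟩
    exact ⟨n, rfl⟩
  obtain ⟨G, -, φ, hφ, hG⟩ := hcomp.tendsto_subseq fun n => subset_closure (mem_range_self n)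
  have hc : ∀ t, charFun (G : Measure ℝ) t = f t := fun t =>
    tendsto_nhds_unique (ProbabilityMeasure.tendsto_iff_tendsto_charFun.1 hG t)
      ((h t).comp hφ.tendsto_atTop)
  exact ⟨G, ProbabilityMeasure.tendsto_of_tendsto_charFun fun t => by rw [hc t]; exact h t, hc⟩

lemma lintegral_exp_gaussianReal (b : ℝ) (v : NNReal) (l : ℝ) :
    ∫⁻ x, ENNReal.ofReal (exp (l * x)) ∂(ProbabilityTheory.gaussianReal b v) =
      ENNReal.ofReal (exp (b * l + v * l ^ 2 / 2)) := by
  rw [← ofReal_integral_eq_lintegral_ofReal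
    (ProbabilityTheory.integrable_exp_mul_gaussianReal l) (ae_of_all _ fun x => (exp_pos _).le)]
  have h := congrFun (ProbabilityTheory.mgf_id_gaussianReal (μ := b) (v := v)) l
  rw [ProbabilityTheory.mgf] at h
  rw [← h]; rfl

lemma norm_exp_mul_I_sub_le (y : ℝ) :
    ‖Complex.exp (y * Complex.I) - 1 - y * Complex.I‖ ≤ 3 * y ^ 2 := by
  have hn : ‖(y : ℂ) * Complex.I‖ = |y| := by simp
  rcases le_total |y| 1 with hy | hy
  · have := Complex.norm_exp_sub_one_sub_id_le (x := y * Complex.I) (by rwa [hn])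
    rw [hn, sq_abs] at this
    nlinarith [sq_nonneg y]
  · calc _ ≤ ‖Complex.exp (y * Complex.I)‖ + ‖(1 : ℂ)‖ + ‖(y : ℂ) * Complex.I‖ :=
          (norm_sub_le _ _).trans (by gcongr; exact norm_sub_le _ _)
      _ = 2 + |y| := by rw [Complex.norm_exp_ofReal_mul_I, hn, norm_one]; ring
      _ ≤ 3 * y ^ 2 := by rw [← sq_abs]; nlinarith

section SmallJumps

variable {m : Measure ℝ}

/-- Infinitely divisible law with finite Lévy measure `m`, in centred form. -/
private lemma charFun_cPois_conv_gaussianReal (m : Measure ℝ) [IsFiniteMeasure m]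
    (hm : Integrable (fun x : ℝ => x) m) (b : ℝ) (v : NNReal) (t : ℝ) :
    charFun ((cPois m).conv (ProbabilityTheory.gaussianReal (b - ∫ x, x ∂m) v)) t =
      Complex.exp (t * b * Complex.I - v * t ^ 2 / 2 +
        ∫ x : ℝ, (Complex.exp ((t * x : ℝ) * Complex.I) - 1 - (t * x : ℝ) * Complex.I) ∂m) := by
  rw [charFun_conv, charFun_cPois, ProbabilityTheory.charFun_gaussianReal, ← Complex.exp_add]
  have h1 : Integrable (fun x : ℝ => Complex.exp ((t * x : ℝ) * Complex.I)) m := by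
    refine Integrable.of_bound (C := 1) (by fun_prop) (ae_of_all _ fun x => ?_)
    rw [Complex.norm_exp_ofReal_mul_I]
  have h2 : Integrable (fun x : ℝ => ((t * x : ℝ) : ℂ) * Complex.I) m :=
    (hm.const_mul t).ofReal.mul_const _
  have h3 : Integrable (fun x : ℝ => Complex.exp ((t * x : ℝ) * Complex.I) - 1) m :=
    h1.sub (integrable_const _)
  rw [integral_sub h3 h2, integral_sub h1 (integrable_const _),
    integral_mul_const, integral_complex_ofReal, integral_const_mul, charFun_apply_real]
  simp only [integral_const, Complex.real_smul, mul_one]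
  congr 1
  push_cast
  ring

private lemma lintegral_exp_cPois_conv_gaussianReal_le (m : Measure ℝ) [IsFiniteMeasure m]
    (hm : Integrable (fun x : ℝ => x ^ 2) m) (hm1 : ∀ᵐ x ∂m, |x| ≤ 1) (b : ℝ) (v : NNReal) {l : ℝ}
    (hl : |l| ≤ 1) :
    ∫⁻ x, ENNReal.ofReal (exp (l * x))
        ∂((cPois m).conv (ProbabilityTheory.gaussianReal (b - ∫ x, x ∂m) v)) ≤
      ENNReal.ofReal (exp ((∫ x, x ^ 2 ∂m) + |b| + v)) := by
  have hx : Integrable (fun x : ℝ => x) m :=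
    Integrable.of_bound (C := 1) (by fun_prop) (hm1.mono fun x hx => hx)
  have hlx : ∀ x : ℝ, |x| ≤ 1 → |l * x| ≤ 1 := fun x hx => by
    rw [abs_mul]; exact mul_le_one₀ hl (abs_nonneg _) hx
  have he : Integrable (fun x : ℝ => exp (l * x)) m := by
    refine Integrable.of_bound (C := exp 1) (by fun_prop) (hm1.mono fun x hx => ?_)
    rw [Real.norm_of_nonneg (exp_pos _).le]
    exact exp_le_exp.2 ((le_abs_self _).trans (hlx x hx))
  have he' : Integrable (fun x : ℝ => exp (l * x) - 1) m := he.sub (integrable_const _)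
  rw [lintegral_exp_conv, lintegral_exp_cPois m (A := ∫ x, exp (l * x) ∂m)
    (integral_nonneg fun x => (exp_pos _).le)
    (ofReal_integral_eq_lintegral_ofReal he (ae_of_all _ fun x => (exp_pos _).le)).symm,
    lintegral_exp_gaussianReal, ← ENNReal.ofReal_mul (exp_pos _).le, ← Real.exp_add]
  refine ENNReal.ofReal_le_ofReal (exp_le_exp.2 ?_)
  have h1 : (∫ x, exp (l * x) ∂m) - m.real univ - l * ∫ x, x ∂m =
      ∫ x, (exp (l * x) - 1 - l * x) ∂m := by
    rw [integral_sub he' (hx.const_mul l),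
      integral_sub he (integrable_const _), integral_const_mul]
    simp
  have h2 : ∫ x, (exp (l * x) - 1 - l * x) ∂m ≤ ∫ x, x ^ 2 ∂m := by
    refine integral_mono_ae (he'.sub (hx.const_mul l)) hm ?_
    filter_upwards [hm1] with x hx1
    have := Real.norm_exp_sub_one_sub_id_le (hlx x hx1)
    refine (le_abs_self _).trans (this.trans ?_)
    rw [Real.norm_eq_abs, sq_abs, mul_pow]
    have : l ^ 2 ≤ 1 := by rw [← sq_abs]; exact pow_le_one₀ (abs_nonneg _) hl
    exact mul_le_of_le_one_left (sq_nonneg _) this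
  have h3 : b * l ≤ |b| := by
    refine (le_abs_self _).trans ?_
    rw [abs_mul]; exact mul_le_of_le_one_right (abs_nonneg _) hl
  have h4 : v * l ^ 2 / 2 ≤ (v : ℝ) := by
    have : l ^ 2 ≤ 1 := by rw [← sq_abs]; exact pow_le_one₀ (abs_nonneg _) hl
    have hv : (0 : ℝ) ≤ v := v.2
    have := mul_le_of_le_one_right hv this
    linarith
  linarith

/-- The infinitely divisible law with Lévy measure carried by `[-1, 1]`. -/
lemma exists_infDiv_smallJumps (m : Measure ℝ) (h0 : m {0} = 0)
    (hm : Integrable (fun x : ℝ => x ^ 2) m) (hm1 : ∀ᵐ x ∂m, |x| ≤ 1) (b : ℝ) (v : NNReal)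
    (hf : ContinuousAt (fun t : ℝ => Complex.exp (t * b * Complex.I - v * t ^ 2 / 2 +
        ∫ x : ℝ, (Complex.exp ((t * x : ℝ) * Complex.I) - 1 - (t * x : ℝ) * Complex.I) ∂m)) 0) :
    ∃ G : Measure ℝ, IsProbabilityMeasure G ∧
      (∃ B : ℝ, ∀ l : ℝ, |l| ≤ 1 →
        ∫⁻ x, ENNReal.ofReal (exp (l * x)) ∂G ≤ ENNReal.ofReal (exp B)) ∧
      ∀ t : ℝ, charFun G t = Complex.exp (t * b * Complex.I - v * t ^ 2 / 2 +
        ∫ x : ℝ, (Complex.exp ((t * x : ℝ) * Complex.I) - 1 - (t * x : ℝ) * Complex.I) ∂m) := by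
  set S : ℕ → Set ℝ := fun j => {x | 1 / ((j : ℝ) + 1) < x ^ 2} with hS
  have hSm : ∀ j, MeasurableSet (S j) := fun j => measurableSet_lt (by fun_prop) (by fun_prop)
  have hfin : ∀ j, IsFiniteMeasure (m.restrict (S j)) := fun j =>
    ⟨by rw [Measure.restrict_apply_univ]; exact hm.measure_gt_lt_top (by positivity)⟩
  have hSmono : Monotone S := fun i j hij x hx =>
    lt_of_le_of_lt (one_div_le_one_div_of_le (by positivity : (0 : ℝ) < i + 1)
      (by gcongr : (i : ℝ) + 1 ≤ j + 1)) hx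
  have hSU : m.restrict (⋃ j, S j) = m := by
    refine Measure.restrict_eq_self_of_ae_mem ?_
    rw [ae_iff]
    refine measure_mono_null (fun x hx => ?_) h0
    by_contra hne
    refine hx (mem_iUnion.2 ?_)
    have hx0 : x ≠ 0 := hne
    have : 0 < x ^ 2 := by positivity
    exact exists_nat_one_div_lt this
  have hint1 : ∀ j, Integrable (fun x : ℝ => x) (m.restrict (S j)) := fun j =>
    Integrable.of_bound (C := 1) (by fun_prop) ((ae_restrict_of_ae hm1).mono fun x hx => hx)
  have hIntψ : ∀ t : ℝ, Integrable (fun x : ℝ =>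
      Complex.exp ((t * x : ℝ) * Complex.I) - 1 - (t * x : ℝ) * Complex.I) m := fun t => by
    refine (hm.const_mul (3 * t ^ 2)).mono' (by fun_prop) (ae_of_all _ fun x => ?_)
    exact (norm_exp_mul_I_sub_le _).trans (by rw [mul_pow, mul_assoc])
  set μ : ℕ → ProbabilityMeasure ℝ := fun j =>
    ⟨(cPois (m.restrict (S j))).conv
      (ProbabilityTheory.gaussianReal (b - ∫ x, x ∂(m.restrict (S j))) v), inferInstance⟩ with hμ
  have hlim : ∀ t : ℝ, Tendsto (fun j => charFun (μ j : Measure ℝ) t) atTop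
      (nhds (Complex.exp (t * b * Complex.I - v * t ^ 2 / 2 +
        ∫ x : ℝ, (Complex.exp ((t * x : ℝ) * Complex.I) - 1 - (t * x : ℝ) * Complex.I) ∂m))) := by
    intro t
    have h1 : ∀ j, charFun (μ j : Measure ℝ) t = _ := fun j =>
      charFun_cPois_conv_gaussianReal (m.restrict (S j)) (hint1 j) b v t
    simp_rw [h1]
    have h2 := tendsto_setIntegral_of_monotone hSm hSmono
      (f := fun x : ℝ => Complex.exp ((t * x : ℝ) * Complex.I) - 1 - (t * x : ℝ) * Complex.I)
      (μ := m) (hIntψ t).integrableOn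
    rw [hSU] at h2
    exact (Complex.continuous_exp.tendsto _).comp (h2.const_add _)
  obtain ⟨G, hG, hGc⟩ := exists_tendsto_of_tendsto_charFun hf hlim
  refine ⟨G, inferInstance, ⟨(∫ x, x ^ 2 ∂m) + |b| + v, fun l hl => ?_⟩, hGc⟩
  refine (lintegral_le_liminf_lintegral_of_forall_isOpen_measure_le_liminf_measure
    (μs := fun j => (μ j : Measure ℝ)) (f := fun x => exp (l * x)) (by fun_prop)
    (fun x => (exp_pos _).le)
    fun U hU => ProbabilityMeasure.le_liminf_measure_open_of_tendsto hG hU).trans ?_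
  refine Filter.liminf_le_of_le (by isBoundedDefault) fun c hc => ?_
  obtain ⟨j, hj⟩ := hc.exists
  refine hj.trans ((lintegral_exp_cPois_conv_gaussianReal_le _ hm.restrict
    (ae_restrict_of_ae hm1) b v hl).trans (ENNReal.ofReal_le_ofReal (exp_le_exp.2 ?_)))
  gcongr
  · exact ae_of_all _ fun x => sq_nonneg x
  · exact Measure.restrict_le_self

end SmallJumps

/-- The finite measure of large jumps. -/
lemma isFiniteMeasure_restrict_compl_Ioo {ν : Measure ℝ}
    (h : (∫⁻ x, ENNReal.ofReal (min (x ^ 2) 1) ∂ν) < ⊤) :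
    IsFiniteMeasure (ν.restrict (Ioo (-1 : ℝ) 1)ᶜ) := by
  constructor
  rw [Measure.restrict_apply_univ, ← lintegral_indicator_one measurableSet_Ioo.compl]
  refine lt_of_le_of_lt (lintegral_mono fun x => ?_) h
  by_cases hx : x ∈ (Ioo (-1 : ℝ) 1)ᶜ
  · rw [indicator_of_mem hx, Pi.one_apply, min_eq_right, ENNReal.ofReal_one]
    rw [mem_compl_iff, mem_Ioo, ← abs_lt, not_lt] at hx
    rw [← sq_abs]
    exact one_le_pow₀ hx
  · rw [indicator_of_notMem hx]; exact zero_le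

lemma integrable_sq_restrict_Ioo {ν : Measure ℝ}
    (h : (∫⁻ x, ENNReal.ofReal (min (x ^ 2) 1) ∂ν) < ⊤) :
    Integrable (fun x : ℝ => x ^ 2) (ν.restrict (Ioo (-1 : ℝ) 1)) := by
  refine ⟨by fun_prop, ?_⟩
  rw [hasFiniteIntegral_iff_ofReal (ae_of_all _ fun x => sq_nonneg x)]
  refine lt_of_le_of_lt ?_ h
  refine le_trans ?_ (setLIntegral_le_lintegral (Ioo (-1 : ℝ) 1) _)
  refine setLIntegral_mono' measurableSet_Ioo fun x hx => ?_
  rw [min_eq_left]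
  rw [mem_Ioo, ← abs_lt] at hx
  rw [← sq_abs]
  exact pow_le_one₀ (abs_nonneg _) hx.le

/-- An infinitely divisible law splits off its large jumps as a compound Poisson factor, and the
remaining factor has exponential moments. -/
lemma IsInfDivLevy.exists_eq_conv {F ν : Measure ℝ} [IsProbabilityMeasure F]
    (hID : IsInfDivLevy F ν) :
    ∃ G : Measure ℝ, IsProbabilityMeasure G ∧
      (∃ B : ℝ, ∀ l : ℝ, |l| ≤ 1 →
        ∫⁻ x, ENNReal.ofReal (exp (l * x)) ∂G ≤ ENNReal.ofReal (exp B)) ∧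
      ∀ t, charFun F t = charFun G t * charFun (cPois (ν.restrict (Ioo (-1 : ℝ) 1)ᶜ)) t := by
  obtain ⟨h0, hν, b, σ2, hσ, hF⟩ := hID
  lift σ2 to NNReal using hσ
  have hfin := isFiniteMeasure_restrict_compl_Ioo hν
  have hsq := integrable_sq_restrict_Ioo hν
  set A := Ioo (-1 : ℝ) 1 with hA
  set b' := b - ∫ x in Aᶜ, (if |x| ≤ 1 then x else 0) ∂ν with hb'
  have hmif : Measurable fun x : ℝ => if |x| ≤ 1 then x else 0 :=
    Measurable.ite (measurableSet_le (by fun_prop) (by fun_prop)) measurable_id measurable_const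
  have hi0 : Integrable (fun x : ℝ => if |x| ≤ 1 then x else 0) (ν.restrict Aᶜ) := by
    refine Integrable.of_bound (C := 1) hmif.aestronglyMeasurable (ae_of_all _ fun x => ?_)
    split_ifs with h <;> simp [h]
  have key : ∀ t : ℝ, charFun F t = Complex.exp (t * b' * Complex.I -
      σ2 * t ^ 2 / 2 + ∫ x : ℝ in A,
        (Complex.exp ((t * x : ℝ) * Complex.I) - 1 - (t * x : ℝ) * Complex.I) ∂ν) *
        charFun (cPois (ν.restrict Aᶜ)) t := by
    intro t
    rw [← charF_eq_charFun, hF, charFun_cPois, ← Complex.exp_add]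
    set f : ℝ → ℂ := fun x => Complex.exp (Complex.I * (t : ℂ) * (x : ℂ)) - 1 -
          Complex.I * (t : ℂ) * (x : ℂ) * (if |x| ≤ 1 then (1 : ℂ) else 0) with hf
    have e1 : EqOn f (fun x : ℝ =>
        Complex.exp ((t * x : ℝ) * Complex.I) - 1 - (t * x : ℝ) * Complex.I) A := fun x hx => by
      have : |x| ≤ 1 := (abs_lt.2 hx).le
      simp only [hf, if_pos this, mul_one]
      rw [show Complex.I * (t : ℂ) * (x : ℂ) = (t * x : ℝ) * Complex.I by push_cast; ring]
    have hex : Integrable (fun x : ℝ => Complex.exp (t * x * Complex.I)) (ν.restrict Aᶜ) := by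
      refine Integrable.of_bound (C := 1) (by fun_prop) (ae_of_all _ fun x => ?_)
      rw [← Complex.ofReal_mul, Complex.norm_exp_ofReal_mul_I]
    have e2 : f = fun x : ℝ => Complex.exp (t * x * Complex.I) - 1 -
        ((if |x| ≤ 1 then x else 0 : ℝ) : ℂ) * (t * Complex.I) := by
      funext x
      simp only [hf]
      rw [show Complex.I * (t : ℂ) * (x : ℂ) = t * x * Complex.I by ring]
      split_ifs
      · simp
        ring
      · simp
    have i1 : IntegrableOn f A ν := by
      refine IntegrableOn.congr_fun ?_ e1.symm measurableSet_Ioo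
      refine (hsq.const_mul (3 * t ^ 2)).mono' (by fun_prop) (ae_of_all _ fun x => ?_)
      exact (norm_exp_mul_I_sub_le _).trans (by rw [mul_pow, mul_assoc])
    have hex1 : Integrable (fun x : ℝ => Complex.exp (t * x * Complex.I) - 1) (ν.restrict Aᶜ) :=
      hex.sub (integrable_const _)
    have hi1 : Integrable (fun x : ℝ => ((if |x| ≤ 1 then x else 0 : ℝ) : ℂ) * (t * Complex.I))
        (ν.restrict Aᶜ) := hi0.ofReal.mul_const _
    have i2 : IntegrableOn f Aᶜ ν := by
      rw [e2]; exact hex1.sub hi1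
    have hfi : Integrable f ν := by
      rw [← integrableOn_univ, ← union_compl_self A]; exact i1.union i2
    rw [← integral_add_compl measurableSet_Ioo hfi, setIntegral_congr_fun measurableSet_Ioo e1]
    have e3 : ∫ x in Aᶜ, f x ∂ν = charFun (ν.restrict Aᶜ) t - (ν.restrict Aᶜ).real univ -
        (∫ x in Aᶜ, (if |x| ≤ 1 then x else 0) ∂ν : ℝ) * (t * Complex.I) := by
      rw [e2, integral_sub hex1 hi1, integral_sub hex (integrable_const _), integral_mul_const,
        integral_complex_ofReal, charFun_apply_real]
      simp
    rw [e3, hb']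
    congr 1
    push_cast
    ring
  have hne : ∀ t : ℝ, charFun (cPois (ν.restrict Aᶜ)) t ≠ 0 := fun t => by
    rw [charFun_cPois]; exact Complex.exp_ne_zero _
  obtain ⟨G, hG, hB, hGc⟩ := exists_infDiv_smallJumps (ν.restrict A)
    (le_antisymm ((Measure.restrict_apply_le _ _).trans h0.le) zero_le) hsq
    ((ae_restrict_mem measurableSet_Ioo).mono fun x hx => (abs_lt.2 hx).le) b' σ2 (by
      have : ∀ t : ℝ, Complex.exp (t * b' * Complex.I -
          σ2 * t ^ 2 / 2 + ∫ x : ℝ in A,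
          (Complex.exp ((t * x : ℝ) * Complex.I) - 1 - (t * x : ℝ) * Complex.I) ∂ν) =
          charFun F t / charFun (cPois (ν.restrict Aᶜ)) t := fun t => by
        rw [key t, mul_div_cancel_right₀ _ (hne t)]
      rw [funext this]
      exact (continuous_charFun.div continuous_charFun hne).continuousAt)
  exact ⟨G, hG, hB, fun t => by rw [key t, hGc t]⟩

lemma convPow_eq_conv_cPois {F G m : Measure ℝ} [IsProbabilityMeasure F] [IsProbabilityMeasure G]
    [IsFiniteMeasure m] (h : ∀ t, charFun F t = charFun G t * charFun (cPois m) t) (n : ℕ) :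
    convPow F n = (convPow G n).conv (cPois ((n : ENNReal) • m)) := by
  have := Measure.smul_finite m (ENNReal.natCast_ne_top n)
  refine Measure.ext_of_charFun (funext fun t => ?_)
  rw [charFun_convPow, charFun_conv, charFun_convPow, h, mul_pow]
  congr 1
  rw [charFun_cPois, charFun_cPois, charFun_smul_measure, ← Complex.exp_nat_mul]
  congr 1
  simp
  ring

lemma tendsto_of_forall_eps {f : ℝ → ℝ} {k α : ℝ} (lo up : ℝ → ℝ → ℝ)
    (hlo : ∀ ε ∈ Ioo (0 : ℝ) 1, Tendsto (lo ε) atTop (nhds (k * (1 + ε) ^ (-α))))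
    (hup : ∀ ε ∈ Ioo (0 : ℝ) 1, Tendsto (up ε) atTop (nhds (k * (1 - ε) ^ (-α))))
    (h : ∀ ε ∈ Ioo (0 : ℝ) 1, ∀ᶠ x in atTop, lo ε x ≤ f x ∧ f x ≤ up ε x) :
    Tendsto f atTop (nhds k) := by
  have hI : ∀ᶠ ε in nhdsWithin (0 : ℝ) (Ioi 0), ε ∈ Ioo (0 : ℝ) 1 := Ioo_mem_nhdsGT one_pos
  have h1 : Tendsto (fun ε : ℝ => k * (1 + ε) ^ (-α)) (nhdsWithin 0 (Ioi 0)) (nhds k) := by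
    have : ContinuousAt (fun ε : ℝ => k * (1 + ε) ^ (-α)) 0 :=
      continuousAt_const.mul ((by fun_prop : ContinuousAt (fun ε : ℝ => 1 + ε) 0).rpow_const
        (Or.inl (by norm_num)))
    have := this.tendsto.mono_left (nhdsWithin_le_nhds (s := Ioi (0 : ℝ)))
    simpa using this
  have h2 : Tendsto (fun ε : ℝ => k * (1 - ε) ^ (-α)) (nhdsWithin 0 (Ioi 0)) (nhds k) := by
    have : ContinuousAt (fun ε : ℝ => k * (1 - ε) ^ (-α)) 0 :=
      continuousAt_const.mul ((by fun_prop : ContinuousAt (fun ε : ℝ => 1 - ε) 0).rpow_const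
        (Or.inl (by norm_num)))
    have := this.tendsto.mono_left (nhdsWithin_le_nhds (s := Ioi (0 : ℝ)))
    simpa using this
  refine tendsto_order.2 ⟨fun a ha => ?_, fun a ha => ?_⟩
  · obtain ⟨ε, hε, hεI⟩ := ((h1.eventually (lt_mem_nhds ha)).and hI).exists
    filter_upwards [(hlo ε hεI).eventually (lt_mem_nhds hε), h ε hεI] with x hx hx'
    exact hx.trans_le hx'.1
  · obtain ⟨ε, hε, hεI⟩ := ((h2.eventually (gt_mem_nhds ha)).and hI).exists
    filter_upwards [(hup ε hεI).eventually (gt_mem_nhds hε), h ε hεI] with x hx hx'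
    exact hx'.2.trans_lt hx

lemma conv_real_apply (μ ν : Measure ℝ) [SFinite μ] [SFinite ν] {s : Set ℝ}
    (hs : MeasurableSet s) :
    (μ.conv ν).real s = (μ.prod ν).real {p | p.1 + p.2 ∈ s} := by
  rw [Measure.conv, map_measureReal_apply (by fun_prop) hs]
  rfl

lemma rtail_eq_real (μ : Measure ℝ) (x : ℝ) : rtail μ x = μ.real (Ioi x) := rfl

lemma rtail_conv_le (μ ν : Measure ℝ) [IsProbabilityMeasure μ] [IsProbabilityMeasure ν]
    (a b : ℝ) : rtail (μ.conv ν) (a + b) ≤ rtail μ a + rtail ν b := by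
  rw [rtail_eq_real, conv_real_apply _ _ measurableSet_Ioi]
  calc _ ≤ (μ.prod ν).real (Ioi a ×ˢ univ ∪ univ ×ˢ Ioi b) := measureReal_mono fun p hp => by
          by_contra hn
          simp only [mem_union, mem_prod, mem_Ioi, mem_univ, and_true, true_and, not_or,
            not_lt] at hn
          have : a + b < p.1 + p.2 := hp
          linarith
    _ ≤ _ := (measureReal_union_le _ _).trans (by
        rw [measureReal_prod_prod, measureReal_prod_prod]; simp [rtail_eq_real])

lemma rtail_convPow_le (μ : Measure ℝ) [IsProbabilityMeasure μ] (y : ℝ) (n : ℕ) :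
    rtail (convPow μ n) (n * y) ≤ n * rtail μ y := by
  induction n with
  | zero => simp [convPow_zero, rtail]
  | succ n ih =>
    rw [convPow_succ]
    push_cast
    rw [add_mul, one_mul, add_mul, one_mul]
    exact (rtail_conv_le _ _ _ _).trans (by gcongr)

lemma rtail_conv_le_add (μ ν : Measure ℝ) [IsProbabilityMeasure μ] [IsProbabilityMeasure ν]
    {x ε : ℝ} :
    rtail (μ.conv ν) x ≤ rtail μ ((1 - ε) * x) + rtail ν ((1 - ε) * x) +
      rtail μ (ε * x) * rtail ν (ε * x) := by
  rw [rtail_eq_real, conv_real_apply _ _ measurableSet_Ioi]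
  calc _ ≤ (μ.prod ν).real (Ioi ((1 - ε) * x) ×ˢ univ ∪ univ ×ˢ Ioi ((1 - ε) * x) ∪
            Ioi (ε * x) ×ˢ Ioi (ε * x)) := measureReal_mono fun p hp => by
          by_contra hn
          simp only [mem_union, mem_prod, mem_Ioi, mem_univ, and_true, true_and, not_or,
            not_lt, not_and] at hn
          have h0 : x < p.1 + p.2 := hp
          have h1 : ε * x < p.1 := by linarith [hn.1.2]
          linarith [hn.2 h1, hn.1.1]
    _ ≤ _ := (measureReal_union_le _ _).trans (add_le_add ((measureReal_union_le _ _).trans (by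
        rw [measureReal_prod_prod, measureReal_prod_prod]; simp [rtail_eq_real]))
        (by rw [measureReal_prod_prod]; simp [rtail_eq_real]))

lemma le_rtail_conv (μ ν : Measure ℝ) [IsProbabilityMeasure μ] [IsProbabilityMeasure ν]
    {x ε : ℝ} (hx : 0 < x) :
    rtail μ ((1 + ε) * x) * ν.real (Icc (-(ε * x)) (ε * x)) +
      rtail ν ((1 + ε) * x) * μ.real (Icc (-(ε * x)) (ε * x)) ≤ rtail (μ.conv ν) x := by
  rw [rtail_eq_real (μ.conv ν), conv_real_apply _ _ measurableSet_Ioi]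
  have hd : Disjoint (Ioi ((1 + ε) * x) ×ˢ Icc (-(ε * x)) (ε * x))
      (Icc (-(ε * x)) (ε * x) ×ˢ Ioi ((1 + ε) * x)) := by
    rw [Set.disjoint_left]
    rintro p ⟨h1, -⟩ ⟨h2, -⟩
    have h1' : (1 + ε) * x < p.1 := h1
    linarith [h2.2]
  calc _ = (μ.prod ν).real (Ioi ((1 + ε) * x) ×ˢ Icc (-(ε * x)) (ε * x) ∪
            Icc (-(ε * x)) (ε * x) ×ˢ Ioi ((1 + ε) * x)) := by
          rw [measureReal_union hd (measurableSet_Icc.prod measurableSet_Ioi),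
            measureReal_prod_prod, measureReal_prod_prod, rtail_eq_real, rtail_eq_real]
          ring
    _ ≤ _ := measureReal_mono fun p hp => by
        rcases hp with ⟨h1, h2⟩ | ⟨h1, h2⟩
        · have h1' : (1 + ε) * x < p.1 := h1
          show x < p.1 + p.2
          linarith [h2.1]
        · have h2' : (1 + ε) * x < p.2 := h2
          show x < p.1 + p.2
          linarith [h1.1]

lemma tendsto_real_Icc_atTop (μ : Measure ℝ) [IsProbabilityMeasure μ] {ε : ℝ} (hε : 0 < ε) :
    Tendsto (fun x : ℝ => μ.real (Icc (-(ε * x)) (ε * x))) atTop (nhds 1) := by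
  have hm : Monotone fun x : ℝ => Icc (-(ε * x)) (ε * x) := fun x y hxy =>
    Icc_subset_Icc (by gcongr) (by gcongr)
  have h := tendsto_measure_iUnion_atTop (μ := μ) hm
  have hU : ⋃ x : ℝ, Icc (-(ε * x)) (ε * x) = univ := by
    refine eq_univ_of_forall fun y => mem_iUnion.2 ⟨|y| / ε, ?_⟩
    rw [mul_div_cancel₀ _ hε.ne']
    exact abs_le.1 le_rfl
  rw [hU, measure_univ] at h
  exact (ENNReal.tendsto_toReal ENNReal.one_ne_top).comp h

namespace RVMono

variable {ℓ : ℝ → ℝ} {α : ℝ}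

lemma tendsto_rtail_zero (H : RVMono ℓ α) {f : ℝ → ℝ} {k : ℝ}
    (hf : Tendsto (fun x => f x * ℓ x) atTop (nhds k)) : Tendsto f atTop (nhds 0) := by
  have := hf.mul H.tendsto_atTop.inv_tendsto_atTop
  rw [mul_zero] at this
  refine this.congr' ?_
  filter_upwards [eventually_gt_atTop 0] with x hx
  have := H.pos hx
  simp only [Pi.inv_apply]
  field_simp

lemma tendsto_rtail_conv (H : RVMono ℓ α) {μ ν : Measure ℝ} [IsProbabilityMeasure μ]
    [IsProbabilityMeasure ν] {a b : ℝ}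
    (hμ : Tendsto (fun x => rtail μ x * ℓ x) atTop (nhds a))
    (hν : Tendsto (fun x => rtail ν x * ℓ x) atTop (nhds b)) :
    Tendsto (fun x => rtail (μ.conv ν) x * ℓ x) atTop (nhds (a + b)) := by
  refine tendsto_of_forall_eps (α := α)
    (fun ε x => (rtail μ ((1 + ε) * x) * ℓ x) * ν.real (Icc (-(ε * x)) (ε * x)) +
      (rtail ν ((1 + ε) * x) * ℓ x) * μ.real (Icc (-(ε * x)) (ε * x)))
    (fun ε x => rtail μ ((1 - ε) * x) * ℓ x + rtail ν ((1 - ε) * x) * ℓ x +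
      (rtail μ (ε * x) * ℓ x) * rtail ν (ε * x)) ?_ ?_ ?_
  · intro ε hε
    have hε1 : 0 < 1 + ε := by linarith [hε.1]
    have := ((H.tendsto_rtail_mul hμ hε1).mul (tendsto_real_Icc_atTop ν hε.1)).add
      ((H.tendsto_rtail_mul hν hε1).mul (tendsto_real_Icc_atTop μ hε.1))
    simpa only [mul_one, ← add_mul] using this
  · intro ε hε
    have hε1 : 0 < 1 - ε := by linarith [hε.2]
    have h0 : Tendsto (fun x : ℝ => rtail ν (ε * x)) atTop (nhds 0) :=
      (H.tendsto_rtail_zero hν).comp (tendsto_id.const_mul_atTop hε.1 : Tendsto (fun x : ℝ => ε * x) atTop atTop)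
    have := ((H.tendsto_rtail_mul hμ hε1).add (H.tendsto_rtail_mul hν hε1)).add
      ((H.tendsto_rtail_mul hμ hε.1).mul h0)
    simpa only [mul_zero, add_zero, ← add_mul] using this
  · intro ε hε
    filter_upwards [eventually_gt_atTop 0] with x hx
    have hℓ := (H.pos hx).le
    constructor
    · have := mul_le_mul_of_nonneg_right (le_rtail_conv μ ν (ε := ε) hx) hℓ
      linarith
    · have := mul_le_mul_of_nonneg_right (rtail_conv_le_add μ ν (ε := ε) (x := x)) hℓ
      linarith

lemma tendsto_rtail_convPow (H : RVMono ℓ α) {μ : Measure ℝ} [IsProbabilityMeasure μ] {a : ℝ}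
    (hμ : Tendsto (fun x => rtail μ x * ℓ x) atTop (nhds a)) (n : ℕ) :
    Tendsto (fun x => rtail (convPow μ n) x * ℓ x) atTop (nhds (n * a)) := by
  induction n with
  | zero =>
    rw [Nat.cast_zero, zero_mul]
    refine tendsto_const_nhds.congr' ?_
    filter_upwards [eventually_gt_atTop 0] with x hx
    simp [convPow_zero, rtail, hx.le]
  | succ n ih =>
    rw [convPow_succ]
    push_cast
    rw [add_mul, one_mul]
    exact H.tendsto_rtail_conv ih hμ

lemma exists_rtail_convPow_le (H : RVMono ℓ α) (hα : α < 1) {μ : Measure ℝ}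
    [IsProbabilityMeasure μ] {a : ℝ}
    (hμ : Tendsto (fun x => rtail μ x * ℓ x) atTop (nhds a)) :
    ∃ C : ℝ, 0 < C ∧ ∀ (n : ℕ) (x : ℝ), 1 ≤ x → rtail (convPow μ n) x * ℓ x ≤ C * n ^ 2 := by
  obtain ⟨C, hC, hb⟩ := H.exists_rtail_le hμ
  obtain ⟨C', hC', hp⟩ := H.potter_upper hα
  have hl1 := H.pos one_pos
  refine ⟨C' * (C + ℓ 1), by positivity, fun n x hx => ?_⟩
  have hx0 : 0 < x := by linarith
  rcases Nat.eq_zero_or_pos n with rfl | hn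
  · simp [convPow_zero, rtail, hx0.le]
  have hn0 : (0 : ℝ) < n := by exact_mod_cast hn
  have hn1 : (1 : ℝ) ≤ n := by exact_mod_cast hn
  have h1 := rtail_convPow_le μ (x / n) n
  rw [mul_div_cancel₀ _ hn0.ne'] at h1
  have hℓ := H.pos hx0
  rcases le_total 1 (x / n) with h | h
  · have h2 := hp _ _ h (div_le_self hx0.le hn1)
    rw [div_div_cancel₀ hx0.ne', Real.rpow_one] at h2
    have hℓ' := H.pos (by positivity : 0 < x / n)
    calc _ ≤ n * (C / ℓ (x / n)) * (C' * n * ℓ (x / n)) := by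
          gcongr
          exact h1.trans (by gcongr; exact hb _ h)
      _ = C' * C * n ^ 2 := by field_simp
      _ ≤ _ := by gcongr; linarith
  · have h2 := hp _ _ le_rfl hx
    rw [div_one, Real.rpow_one] at h2
    have h3 : x ≤ n := by rwa [div_le_one hn0] at h
    have h4 : rtail (convPow μ n) x ≤ 1 := measureReal_le_one
    calc _ ≤ 1 * (C' * n * ℓ 1) := by
          gcongr
          exact h2.trans (by gcongr)
      _ ≤ C' * (C + ℓ 1) * n := by
          have : 0 ≤ C' * C * n := by positivity
          linarith
      _ ≤ _ := by gcongr; exact le_self_pow₀ hn1 (by norm_num)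

end RVMono

lemma hasSum_cPois_real (μ : Measure ℝ) [IsProbabilityMeasure μ] {q : ℝ} (hq : 0 ≤ q) (s : Set ℝ) :
    HasSum (fun k : ℕ => exp (-q) * q ^ k / (k.factorial : ℝ) * (convPow μ k).real s)
      ((cPois (ENNReal.ofReal q • μ)).real s) := by
  have hm : (ENNReal.ofReal q • μ).real univ = q := by simp [hq]
  have h1 : ∀ k : ℕ, (ENNReal.ofReal (exp (-(ENNReal.ofReal q • μ).real univ) /
      (k.factorial : ℝ)) • convPow (ENNReal.ofReal q • μ) k) s =
      ENNReal.ofReal (exp (-q) * q ^ k / (k.factorial : ℝ) * (convPow μ k).real s) := fun k => by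
    rw [hm, convPow_smul μ ENNReal.ofReal_ne_top, Measure.smul_apply, Measure.smul_apply,
      smul_eq_mul, smul_eq_mul, ← ENNReal.ofReal_pow hq, ← ofReal_measureReal (μ := convPow μ k),
      ← mul_assoc, ← ENNReal.ofReal_mul (by positivity), ← ENNReal.ofReal_mul (by positivity)]
    congr 1; ring
  have hs : Summable fun k : ℕ =>
      exp (-q) * q ^ k / (k.factorial : ℝ) * (convPow μ k).real s := by
    refine Summable.of_nonneg_of_le (fun k => by positivity) (fun k => ?_)
      ((Real.summable_pow_div_factorial q).mul_left (exp (-q)))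
    rw [mul_div_assoc]
    exact mul_le_of_le_one_right (by positivity) measureReal_le_one
  have h2 : (cPois (ENNReal.ofReal q • μ)) s = ENNReal.ofReal (∑' k : ℕ,
      exp (-q) * q ^ k / (k.factorial : ℝ) * (convPow μ k).real s) := by
    rw [cPois, Measure.sum_apply_of_countable, ENNReal.ofReal_tsum_of_nonneg (fun k => by positivity) hs]
    exact tsum_congr h1
  rw [measureReal_def, h2, ENNReal.toReal_ofReal (tsum_nonneg fun k => by positivity)]
  exact hs.hasSum

lemma hasSum_poisson_mean (q : ℝ) :
    HasSum (fun k : ℕ => exp (-q) * q ^ k / (k.factorial : ℝ) * k) q := by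
  have h := NormedSpace.expSeries_div_hasSum_exp q
  rw [← Real.exp_eq_exp_ℝ] at h
  have h1 := h.mul_left (exp (-q) * q)
  have h2 : exp (-q) * q * exp q = q := by
    rw [mul_right_comm, ← Real.exp_add]; simp
  rw [h2] at h1
  rw [← hasSum_nat_add_iff' 1]
  simp only [Finset.range_one, Finset.sum_singleton, Nat.cast_zero, mul_zero, sub_zero]
  refine h1.congr_fun fun k => ?_
  rw [Nat.factorial_succ]
  push_cast
  have : (k : ℝ) + 1 ≠ 0 := by positivity
  field_simp
  ring

namespace RVMono

variable {ℓ : ℝ → ℝ} {α : ℝ}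

lemma tendsto_rtail_cPois (H : RVMono ℓ α) (hα : α < 1) {μ : Measure ℝ} [IsProbabilityMeasure μ]
    {c q : ℝ} (hq : 0 ≤ q) (hμ : Tendsto (fun x => rtail μ x * ℓ x) atTop (nhds c)) :
    Tendsto (fun x => rtail (cPois (ENNReal.ofReal q • μ)) x * ℓ x) atTop (nhds (q * c)) := by
  obtain ⟨C, hC, hb⟩ := H.exists_rtail_convPow_le hα hμ
  have hlim : Tendsto (fun x => ∑' k : ℕ, exp (-q) * q ^ k / (k.factorial : ℝ) *
      (rtail (convPow μ k) x * ℓ x)) atTop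
      (nhds (∑' k : ℕ, exp (-q) * q ^ k / (k.factorial : ℝ) * (k * c))) := by
    refine tendsto_tsum_of_dominated_convergence
      (bound := fun k : ℕ => exp (-q) * C * ((4 * q) ^ k / (k.factorial : ℝ)))
      ((Real.summable_pow_div_factorial (4 * q)).mul_left _)
      (fun k => (H.tendsto_rtail_convPow hμ k).const_mul _) ?_
    filter_upwards [eventually_ge_atTop 1] with x hx k
    have h0 : 0 ≤ rtail (convPow μ k) x * ℓ x :=
      mul_nonneg (rtail_nonneg _ _) (H.pos (by linarith)).le
    have hk : (k : ℝ) ^ 2 ≤ 4 ^ k := by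
      have : k < 2 ^ k := Nat.lt_two_pow_self
      have h2 : k ^ 2 ≤ (2 ^ k) ^ 2 := Nat.pow_le_pow_left this.le 2
      rw [← pow_mul, mul_comm, pow_mul] at h2
      exact_mod_cast h2
    rw [Real.norm_of_nonneg (by positivity)]
    calc _ ≤ exp (-q) * q ^ k / (k.factorial : ℝ) * (C * 4 ^ k) := by
          refine mul_le_mul_of_nonneg_left ((hb k x hx).trans ?_) (by positivity)
          gcongr
      _ = _ := by rw [mul_pow]; ring
  have h1 : ∑' k : ℕ, exp (-q) * q ^ k / (k.factorial : ℝ) * (k * c) = q * c := by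
    have := ((hasSum_poisson_mean q).mul_right c).tsum_eq
    rw [← this]
    exact tsum_congr fun k => by ring
  rw [h1] at hlim
  refine hlim.congr fun x => ?_
  have := ((hasSum_cPois_real μ hq (Ioi x)).mul_right (ℓ x)).tsum_eq
  rw [rtail_eq_real, ← this]
  exact tsum_congr fun k => by rw [rtail_eq_real]; ring

lemma tendsto_rtail_of_lintegral_exp (H : RVMono ℓ α) (hα : α < 1) {G : Measure ℝ}
    [IsProbabilityMeasure G] {B : ℝ}
    (hG : ∫⁻ x, ENNReal.ofReal (exp (1 * x)) ∂G ≤ ENNReal.ofReal (exp B)) :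
    Tendsto (fun x => rtail G x * ℓ x) atTop (nhds 0) := by
  have hle : ∀ x, rtail G x ≤ exp B * exp (-x) := fun x => by
    have h := (measure_Ioi_le_lintegral_exp G zero_le_one x).trans (mul_le_mul_right hG _)
    rw [← ENNReal.ofReal_mul (exp_pos _).le] at h
    have := ENNReal.toReal_le_of_le_ofReal (by positivity) h
    rw [one_mul] at this
    rw [mul_comm]
    exact this
  have h1 := (H.isLittleO_rpow hα).tendsto_div_nhds_zero
  have h2 := (Real.tendsto_pow_mul_exp_neg_atTop_nhds_zero 1).const_mul (exp B)
  have h3 := h1.mul h2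
  rw [mul_zero, mul_zero] at h3
  refine squeeze_zero' ?_ ?_ h3
  · filter_upwards [eventually_gt_atTop 0] with x hx
    exact mul_nonneg (rtail_nonneg _ _) (H.pos hx).le
  · filter_upwards [eventually_gt_atTop 0] with x hx
    have := (H.pos hx).le
    calc _ ≤ exp B * exp (-x) * ℓ x := by gcongr; exact hle x
      _ = _ := by rw [Real.rpow_one]; field_simp

lemma tendsto_rtail_infDiv (H : RVMono ℓ α) (hα : α < 1) {F G μ : Measure ℝ}
    [IsProbabilityMeasure F] [IsProbabilityMeasure G] [IsProbabilityMeasure μ] {B c q : ℝ}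
    (hq : 0 ≤ q) (hG : ∫⁻ x, ENNReal.ofReal (exp (1 * x)) ∂G ≤ ENNReal.ofReal (exp B))
    (hF : ∀ t, charFun F t = charFun G t * charFun (cPois (ENNReal.ofReal q • μ)) t)
    (hμ : Tendsto (fun x => rtail μ x * ℓ x) atTop (nhds c)) :
    Tendsto (fun x => rtail F x * ℓ x) atTop (nhds (q * c)) := by
  have := Measure.smul_finite μ (ENNReal.ofReal_ne_top (r := q))
  have h : F = G.conv (cPois (ENNReal.ofReal q • μ)) :=
    Measure.ext_of_charFun (funext fun t => by rw [hF, charFun_conv])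
  rw [h, ← zero_add (q * c)]
  exact H.tendsto_rtail_conv (H.tendsto_rtail_of_lintegral_exp hα hG)
    (H.tendsto_rtail_cPois hα hq hμ)

lemma tendsto_of_interlace (H : RVMono ℓ α) {f g : ℝ → ℝ} {k : ℝ}
    (hfg : ∀ x y, x < y → f y ≤ g x) (hgf : ∀ x y, x < y → g y ≤ f x)
    (hf : Tendsto (fun x => f x * ℓ x) atTop (nhds k)) :
    Tendsto (fun x => g x * ℓ x) atTop (nhds k) := by
  refine tendsto_of_forall_eps (α := α) (fun ε x => f ((1 + ε) * x) * ℓ x)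
    (fun ε x => f ((1 - ε) * x) * ℓ x)
    (fun ε hε => H.tendsto_rtail_mul hf (by linarith [hε.1]))
    (fun ε hε => H.tendsto_rtail_mul hf (by linarith [hε.2])) fun ε hε => ?_
  filter_upwards [eventually_gt_atTop 0] with x hx
  have := H.pos hx
  have := mul_pos hε.1 hx
  constructor
  · gcongr
    exact hfg _ _ (by linarith)
  · gcongr
    exact hgf _ _ (by linarith)

lemma tendsto_ltail_infDiv (H : RVMono ℓ α) (hα : α < 1) {F G μ : Measure ℝ}
    [IsProbabilityMeasure F] [IsProbabilityMeasure G] [IsProbabilityMeasure μ] {B c q : ℝ}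
    (hq : 0 ≤ q) (hG : ∫⁻ x, ENNReal.ofReal (exp ((-1) * x)) ∂G ≤ ENNReal.ofReal (exp B))
    (hF : ∀ t, charFun F t = charFun G t * charFun (cPois (ENNReal.ofReal q • μ)) t)
    (hμ : Tendsto (fun x => μ.real (Iic (-x)) * ℓ x) atTop (nhds c)) :
    Tendsto (fun x => F.real (Iic (-x)) * ℓ x) atTop (nhds (q * c)) := by
  have hfin := Measure.smul_finite μ (ENNReal.ofReal_ne_top (r := q))
  have hP : ∀ m : Measure ℝ, [IsProbabilityMeasure m] →
      IsProbabilityMeasure (m.map fun x : ℝ => -x) := fun m _ =>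
    Measure.isProbabilityMeasure_map (by fun_prop)
  have := hP F; have := hP G; have := hP μ
  have hc : ∀ (m : Measure ℝ) (t : ℝ), charFun (m.map fun x : ℝ => -x) t = charFun m (-t) := by
    intro m t
    rw [charFun_apply_real, integral_map (by fun_prop) (by fun_prop), charFun_apply_real]
    congr 1 with x; push_cast; ring_nf
  have hr : ∀ (m : Measure ℝ) [IsProbabilityMeasure m] (x : ℝ),
      rtail (m.map fun x : ℝ => -x) x = m.real (Iio (-x)) := fun m _ x => by
    rw [rtail_eq_real, map_measureReal_apply (by fun_prop) measurableSet_Ioi]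
    congr 1; ext y; simp
  have hi : ∀ (m : Measure ℝ) [IsProbabilityMeasure m] (x y : ℝ), x < y →
      m.real (Iic (-y)) ≤ m.real (Iio (-x)) ∧ m.real (Iio (-y)) ≤ m.real (Iic (-x)) :=
    fun m _ x y hxy => ⟨measureReal_mono fun z hz => lt_of_le_of_lt hz (neg_lt_neg hxy),
      measureReal_mono fun z hz => (lt_trans hz (neg_lt_neg hxy) : z < -x).le⟩
  have h1 := H.tendsto_of_interlace (g := fun x => rtail (μ.map fun x : ℝ => -x) x)
    (fun x y h => by rw [hr]; exact (hi μ x y h).1) (fun x y h => by rw [hr]; exact (hi μ x y h).2) hμ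
  have h2 := H.tendsto_rtail_infDiv hα (F := F.map fun x : ℝ => -x) (G := G.map fun x : ℝ => -x)
    (B := B) hq ?_ (fun t => ?_) h1
  · exact H.tendsto_of_interlace (fun x y h => by rw [hr]; exact (hi F x y h).2)
      (fun x y h => by rw [hr]; exact (hi F x y h).1) h2
  · rw [lintegral_map (by fun_prop) (by fun_prop)]
    simpa using hG
  · have := Measure.smul_finite (μ.map fun x : ℝ => -x) (ENNReal.ofReal_ne_top (r := q))
    rw [hc, hc, hF, charFun_cPois, charFun_cPois, charFun_smul_measure, charFun_smul_measure, hc]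
    simp

end RVMono

lemma sum_poisson_le {q : ℝ} (hq : 0 < q) (k N : ℕ) :
    ∑ n ∈ Finset.range N, exp (-(n * q)) * (n * q) ^ k / (k.factorial : ℝ) ≤ exp q / q := by
  set f : ℝ → ℝ := fun s => exp q * (exp (-(s * q)) * (s * q) ^ k / (k.factorial : ℝ)) with hf
  have hfc : Continuous f := by fun_prop
  have hI : ∫ s in Ioi (0 : ℝ), s ^ k * exp (-(q * s)) = k.factorial / q ^ (k + 1) := by
    have := integral_rpow_mul_exp_neg_mul_Ioi (a := k + 1) (by positivity) hq
    rw [Real.Gamma_nat_eq_factorial] at this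
    simp only [add_sub_cancel_right, Real.rpow_natCast] at this
    rw [this, ← Nat.cast_succ, Real.rpow_natCast, one_div, inv_pow]
    exact (div_eq_inv_mul _ _).symm
  have hInt : IntegrableOn (fun s : ℝ => s ^ k * exp (-(q * s))) (Ioi 0) := by
    refine not_imp_comm.1 integral_undef ?_
    rw [hI]; positivity
  have hfe : ∀ s, f s = exp q * q ^ k / k.factorial * (s ^ k * exp (-(q * s))) := fun s => by
    simp only [hf]; rw [mul_pow, mul_comm q s]; ring
  have hfint : IntegrableOn f (Ioi 0) := by
    rw [funext hfe]; exact hInt.const_mul _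
  have hterm : ∀ n : ℕ, exp (-(n * q)) * (n * q) ^ k / (k.factorial : ℝ) ≤
      ∫ s in (n : ℝ)..((n + 1 : ℕ) : ℝ), f s := fun n => by
    have h1 : ∫ s in (n : ℝ)..((n + 1 : ℕ) : ℝ), exp (-(n * q)) * (n * q) ^ k / (k.factorial : ℝ) =
        exp (-(n * q)) * (n * q) ^ k / (k.factorial : ℝ) := by simp
    rw [← h1]
    refine intervalIntegral.integral_mono_on (by simp) (by simp) (hfc.intervalIntegrable _ _)
      fun s hs => ?_
    push_cast at hs
    simp only [hf]
    have : exp (-(n * q)) ≤ exp q * exp (-(s * q)) := by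
      rw [← Real.exp_add, Real.exp_le_exp]; nlinarith [hs.2]
    calc _ ≤ (exp q * exp (-(s * q))) * (s * q) ^ k / (k.factorial : ℝ) := by
          gcongr; exact hs.1
      _ = _ := by ring
  calc _ ≤ ∑ n ∈ Finset.range N, ∫ s in (n : ℝ)..((n + 1 : ℕ) : ℝ), f s :=
        Finset.sum_le_sum fun n _ => hterm n
    _ = ∫ s in (0 : ℝ)..N, f s := by
        rw [intervalIntegral.sum_integral_adjacent_intervals
          (a := fun n : ℕ => (n : ℝ)) fun n _ => hfc.intervalIntegrable _ _]
        simp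
    _ ≤ ∫ s in Ioi (0 : ℝ), f s := by
        rw [intervalIntegral.integral_of_le (by positivity)]
        refine setIntegral_mono_set hfint ?_ Ioc_subset_Ioi_self.eventuallyLE
        filter_upwards [ae_restrict_mem measurableSet_Ioi] with s hs
        have : (0 : ℝ) < s := hs
        simp only [hf, Pi.zero_apply]; positivity
    _ = _ := by
        simp_rw [hfe]
        rw [integral_const_mul, hI, pow_succ]
        field_simp

lemma cPois_real_le (μ : Measure ℝ) [IsProbabilityMeasure μ] {q : ℝ} (hq : 0 ≤ q) (s : Set ℝ)
    {M : ℕ → ℝ} {K : ℕ} (hM : ∀ k < K, (convPow μ k).real s ≤ M k) :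
    (cPois (ENNReal.ofReal q • μ)).real s ≤
      ∑ k ∈ Finset.range K, exp (-q) * q ^ k / (k.factorial : ℝ) * M k + exp q * (1 / 2) ^ K := by
  have hs := NormedSpace.expSeries_div_hasSum_exp (2 * q)
  rw [← Real.exp_eq_exp_ℝ] at hs
  have h1 : HasSum (fun k : ℕ => if k ∈ Finset.range K then
      exp (-q) * q ^ k / (k.factorial : ℝ) * M k else 0)
      (∑ k ∈ Finset.range K, exp (-q) * q ^ k / (k.factorial : ℝ) * M k) := by
    have := hasSum_sum_of_ne_finset_zero (f := fun k : ℕ => if k ∈ Finset.range K then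
      exp (-q) * q ^ k / (k.factorial : ℝ) * M k else 0) (s := Finset.range K)
      (L := .unconditional ℕ) fun k hk => if_neg hk
    rwa [Finset.sum_congr rfl fun k hk => if_pos hk] at this
  have h2 := hs.mul_left (exp (-q) * (1 / 2) ^ K)
  have h3 : exp (-q) * (1 / 2) ^ K * exp (2 * q) = exp q * (1 / 2) ^ K := by
    rw [mul_right_comm, ← Real.exp_add]; ring_nf
  rw [h3] at h2
  refine hasSum_le (fun k => ?_) (hasSum_cPois_real μ hq s) (h1.add h2)
  by_cases hk : k < K
  · rw [if_pos (Finset.mem_range.2 hk)]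
    have : 0 ≤ exp (-q) * (1 / 2) ^ K * ((2 * q) ^ k / (k.factorial : ℝ)) := by positivity
    have h4 : exp (-q) * q ^ k / (k.factorial : ℝ) * (convPow μ k).real s ≤
        exp (-q) * q ^ k / (k.factorial : ℝ) * M k := by gcongr; exact hM k hk
    linarith
  · rw [if_neg (by simpa using hk), zero_add]
    have h5 : (1 : ℝ) ≤ (1 / 2) ^ K * 2 ^ k := by
      rw [one_div, inv_pow, ← div_eq_inv_mul, one_le_div (by positivity)]
      exact pow_le_pow_right₀ (by norm_num) (by omega)
    have h6 : (convPow μ k).real s ≤ 1 := measureReal_le_one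
    calc _ ≤ exp (-q) * q ^ k / (k.factorial : ℝ) * ((1 / 2) ^ K * 2 ^ k) := by
          gcongr; exact h6.trans h5
      _ = _ := by rw [mul_pow]; ring

lemma real_conv_Ioc_le (μ ν : Measure ℝ) [IsProbabilityMeasure μ] [IsProbabilityMeasure ν]
    {x h r c : ℝ} (hc : 0 ≤ c) (hν : ∀ t, |t - x| ≤ r → ν.real (Ioc t (t + h)) ≤ c) :
    (μ.conv ν).real (Ioc x (x + h)) ≤ μ.real (Icc (-r) r)ᶜ + c := by
  have h1 : (μ.conv ν) (Ioc x (x + h)) ≤ μ (Icc (-r) r)ᶜ + ENNReal.ofReal c := by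
    rw [conv_apply _ _ measurableSet_Ioc]
    calc _ ≤ ∫⁻ y, ((Icc (-r) r)ᶜ.indicator 1 y + ENNReal.ofReal c) ∂μ := by
          refine lintegral_mono fun y => ?_
          by_cases hy : y ∈ Icc (-r) r
          · rw [indicator_of_notMem (by simpa using hy), zero_add, preimage_add_Ioc,
              ← ofReal_measureReal]
            refine ENNReal.ofReal_le_ofReal (hν _ ?_)
            rw [sub_sub_cancel_left, abs_neg]
            exact abs_le.2 hy
          · rw [indicator_of_mem hy]
            exact prob_le_one.trans (by simp)
      _ = _ := by
          rw [lintegral_add_right _ measurable_const,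
            lintegral_indicator_one measurableSet_Icc.compl]
          simp
  have h2 := ENNReal.toReal_mono (by finiteness) h1
  rwa [ENNReal.toReal_add (by finiteness) (by finiteness), ENNReal.toReal_ofReal hc] at h2

lemma convPow_real_compl_Icc_le {G : Measure ℝ} [IsProbabilityMeasure G] {B : ℝ}
    (hG : ∀ l : ℝ, |l| ≤ 1 → ∫⁻ x, ENNReal.ofReal (exp (l * x)) ∂G ≤ ENNReal.ofReal (exp B))
    (n : ℕ) (r : ℝ) :
    (convPow G n).real (Icc (-r) r)ᶜ ≤ 2 * exp (B * n - r) := by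
  have hpt : ∀ y : ℝ, (Icc (-r) r)ᶜ.indicator (1 : ℝ → ENNReal) y ≤ ENNReal.ofReal (exp (-r)) *
      (ENNReal.ofReal (exp (1 * y)) + ENNReal.ofReal (exp (-1 * y))) := fun y => by
    by_cases hy : y ∈ Icc (-r) r
    · rw [indicator_of_notMem (by simpa using hy)]; exact zero_le
    · rw [indicator_of_mem hy, Pi.one_apply, ← ENNReal.ofReal_add (by positivity) (by positivity),
        ← ENNReal.ofReal_mul (by positivity), ENNReal.one_le_ofReal, mul_add, ← Real.exp_add,
        ← Real.exp_add]
      rw [mem_Icc, not_and_or, not_le, not_le] at hy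
      rcases hy with hy | hy
      · have := Real.one_le_exp (show 0 ≤ -r + -1 * y by linarith)
        linarith [exp_pos (-r + 1 * y)]
      · have := Real.one_le_exp (show 0 ≤ -r + 1 * y by linarith)
        linarith [exp_pos (-r + -1 * y)]
  have hl : ∀ l : ℝ, |l| ≤ 1 → ∫⁻ x, ENNReal.ofReal (exp (l * x)) ∂(convPow G n) ≤
      ENNReal.ofReal (exp (B * n)) := fun l h => by
    rw [lintegral_exp_convPow, mul_comm, Real.exp_nat_mul, ENNReal.ofReal_pow (exp_pos _).le]
    gcongr
    exact hG l h
  have h1 : (convPow G n) (Icc (-r) r)ᶜ ≤ ENNReal.ofReal (2 * exp (B * n - r)) := by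
    rw [← lintegral_indicator_one measurableSet_Icc.compl]
    calc _ ≤ _ := lintegral_mono hpt
      _ ≤ ENNReal.ofReal (exp (-r)) *
            (ENNReal.ofReal (exp (B * n)) + ENNReal.ofReal (exp (B * n))) := by
          rw [lintegral_const_mul _ (by fun_prop), lintegral_add_left (by fun_prop)]
          gcongr
          · exact hl 1 (by simp)
          · exact hl (-1) (by simp)
      _ = _ := by
          rw [← ENNReal.ofReal_add (by positivity) (by positivity),
            ← ENNReal.ofReal_mul (by positivity), mul_add, ← Real.exp_add]
          congr 1; ring_nf
  exact ENNReal.toReal_le_of_le_ofReal (by positivity) h1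

namespace RVMono

variable {ℓ : ℝ → ℝ} {α : ℝ}

lemma tendsto_mul_exp_neg_mul (H : RVMono ℓ α) {b : ℝ} (hb : 0 < b) :
    Tendsto (fun x : ℝ => x * exp (-b * ℓ x)) atTop (nhds 0) := by
  have hα2 : 0 < α / 2 := half_pos H.index_pos
  obtain ⟨c, hc, -, hp⟩ := H.potter_lower hα2.le (by linarith)
  have hl1 := H.pos one_pos
  have h1 := (tendsto_rpow_mul_exp_neg_mul_atTop_nhds_zero (1 / (α / 2)) (b * (c * ℓ 1))
    (by positivity)).comp (tendsto_rpow_atTop hα2)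
  refine squeeze_zero' ?_ ?_ h1
  · filter_upwards [eventually_gt_atTop 0] with x hx
    positivity
  · filter_upwards [eventually_ge_atTop 1] with x hx
    have hx0 : 0 ≤ x := by linarith
    have h2 := hp 1 x le_rfl hx
    rw [div_one] at h2
    simp only [Function.comp]
    rw [← Real.rpow_mul hx0, mul_one_div_cancel hα2.ne', Real.rpow_one]
    refine mul_le_mul_of_nonneg_left (Real.exp_le_exp.2 ?_) hx0
    have := mul_le_mul_of_nonneg_left h2 hb.le
    linarith

/-- Few summands contribute negligibly to the renewal mass of an infinitely divisible law whose
normalized Lévy measure has this property. -/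
lemma sum_convPow_infDiv_le (H : RVMono ℓ α) (hα : α < 1) {F G μ : Measure ℝ}
    [IsProbabilityMeasure F] [IsProbabilityMeasure G] [IsProbabilityMeasure μ] {B q h : ℝ}
    (hq : 0 < q)
    (hG : ∀ l : ℝ, |l| ≤ 1 → ∫⁻ x, ENNReal.ofReal (exp (l * x)) ∂G ≤ ENNReal.ofReal (exp B))
    (hF : ∀ t, charFun F t = charFun G t * charFun (cPois (ENNReal.ofReal q • μ)) t)
    (hμ : SmallSums μ ℓ h) {ρ : ℝ} (hρ : 0 < ρ) :
    ∃ δ > 0, ∀ᶠ x in atTop,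
      x / ℓ x * ∑ n ∈ Finset.range ⌈δ * ℓ x⌉₊, (convPow F n).real (Ioc x (x + h)) ≤ ρ := by
  have hfin := Measure.smul_finite μ (ENNReal.ofReal_ne_top (r := q))
  obtain ⟨ε, hε, δ, hδ, hS⟩ := hμ (ρ / 3 * (q / exp q)) (by positivity)
  set δ' := δ / (4 * q) with hδ'
  have hδ'0 : 0 < δ' := by positivity
  have hT1 : Tendsto (fun x : ℝ => 2 * (δ' + 1) * (x * exp (-(ε / 2) * x))) atTop (nhds 0) := by
    have := (tendsto_rpow_mul_exp_neg_mul_atTop_nhds_zero 1 (ε / 2) (by positivity)).const_mul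
      (2 * (δ' + 1))
    simpa only [Real.rpow_one, mul_zero] using this
  have hT2 : Tendsto (fun x : ℝ => (δ' + 1) * (x * exp (-(δ / 4) * ℓ x))) atTop (nhds 0) := by
    simpa only [mul_zero] using
      (H.tendsto_mul_exp_neg_mul (show 0 < δ / 4 by positivity)).const_mul (δ' + 1)
  have hℓo := ((H.isLittleO_rpow hα).bound
    (show 0 < ε / 2 / ((|B| + 1) * (δ')) by positivity))
  refine ⟨δ', hδ'0, ?_⟩
  filter_upwards [hS, hT1.eventually (gt_mem_nhds (show (0 : ℝ) < ρ / 3 by positivity)),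
    hT2.eventually (gt_mem_nhds (show (0 : ℝ) < ρ / 3 by positivity)), hℓo,
    H.tendsto_atTop.eventually_ge_atTop 1, eventually_gt_atTop 0] with x ⟨M, hM, hMs⟩ h1 h2 h3 h4 hx
  set K := ⌈δ * ℓ x⌉₊ with hK
  set N := ⌈δ' * ℓ x⌉₊ with hN
  have hM0 : ∀ k < K, 0 ≤ M k := fun k hk =>
    measureReal_nonneg.trans (hM k x hk (by simp; positivity))
  have hn : ∀ n ∈ Finset.range N, (n : ℝ) ≤ δ' * ℓ x := fun n hn =>
    (Nat.lt_ceil.1 (Finset.mem_range.1 hn)).le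
  have hterm : ∀ n ∈ Finset.range N, (convPow F n).real (Ioc x (x + h)) ≤
      2 * exp (-(ε / 2) * x) + (∑ k ∈ Finset.range K,
        exp (-(n * q)) * (n * q) ^ k / (k.factorial : ℝ) * M k + exp (-(δ / 4) * ℓ x)) := by
    intro n hnN
    have hnle := hn n hnN
    have hsm : (n : ENNReal) • (ENNReal.ofReal q • μ) = ENNReal.ofReal (n * q) • μ := by
      rw [smul_smul, ENNReal.ofReal_mul (by positivity), ENNReal.ofReal_natCast]
    have hfin2 := Measure.smul_finite μ (ENNReal.ofReal_ne_top (r := n * q))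
    rw [convPow_eq_conv_cPois hF n, hsm]
    have hnq : (0 : ℝ) ≤ n * q := by positivity
    have hsum0 : 0 ≤ ∑ k ∈ Finset.range K,
        exp (-(n * q)) * (n * q) ^ k / (k.factorial : ℝ) * M k :=
      Finset.sum_nonneg fun k hk => mul_nonneg (by positivity) (hM0 k (Finset.mem_range.1 hk))
    refine (real_conv_Ioc_le _ _ (r := ε * x) (c := ∑ k ∈ Finset.range K,
        exp (-(n * q)) * (n * q) ^ k / (k.factorial : ℝ) * M k + exp (n * q) * (1 / 2) ^ K)
        (by positivity) fun t ht => cPois_real_le μ hnq _ fun k hk => hM k t hk ht).trans ?_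
    refine add_le_add ((convPow_real_compl_Icc_le hG n _).trans ?_) (add_le_add le_rfl ?_)
    · gcongr
      rw [Real.rpow_one, Real.norm_of_nonneg (by positivity), Real.norm_of_nonneg hx.le] at h3
      have h5 : B * n ≤ (|B| + 1) * (δ' * ℓ x) := by
        have hB : B ≤ |B| + 1 := by linarith [le_abs_self B]
        calc B * n ≤ (|B| + 1) * n := by gcongr
          _ ≤ _ := by gcongr
      have h6 : (|B| + 1) * (δ' * ℓ x) ≤ ε / 2 * x := by
        calc _ ≤ (|B| + 1) * (δ' * (ε / 2 / ((|B| + 1) * δ') * x)) := by gcongr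
          _ = _ := by field_simp
      linarith
    · have h7 : n * q ≤ δ * ℓ x / 4 := by
        calc n * q ≤ δ' * ℓ x * q := by gcongr
          _ = _ := by rw [hδ']; field_simp
      have h8 : ((1 : ℝ) / 2) ^ K ≤ exp (-(δ * ℓ x / 2)) := by
        have h9 : (1 : ℝ) / 2 ≤ exp (-(1 / 2)) := by
          rw [Real.exp_neg, ← one_div]
          refine one_div_le_one_div_of_le (exp_pos _) ?_
          have := Real.exp_bound' (x := 1 / 2) (by norm_num) (by norm_num) (n := 3) (by norm_num)
          refine this.trans ?_
          norm_num [Finset.sum_range_succ, Nat.factorial]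
        calc ((1 : ℝ) / 2) ^ K ≤ exp (-(1 / 2)) ^ K := by gcongr
          _ = exp (K * -(1 / 2)) := (Real.exp_nat_mul _ _).symm
          _ ≤ _ := by
            gcongr
            have : δ * ℓ x ≤ K := Nat.le_ceil _
            linarith
      calc _ ≤ exp (δ * ℓ x / 4) * exp (-(δ * ℓ x / 2)) := by gcongr
        _ = _ := by rw [← Real.exp_add]; congr 1; ring
  have hNle : (N : ℝ) ≤ (δ' + 1) * ℓ x := by
    have := (Nat.ceil_lt_add_one (show 0 ≤ δ' * ℓ x by positivity)).le
    rw [← hN] at this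
    linarith
  have hxl : 0 ≤ x / ℓ x := by positivity
  have hsum : ∑ n ∈ Finset.range N, (convPow F n).real (Ioc x (x + h)) ≤
      N * (2 * exp (-(ε / 2) * x)) + (exp q / q * ∑ k ∈ Finset.range K, M k +
        N * exp (-(δ / 4) * ℓ x)) := by
    refine (Finset.sum_le_sum hterm).trans ?_
    rw [Finset.sum_add_distrib, Finset.sum_add_distrib, Finset.sum_const, Finset.sum_const,
      Finset.card_range, nsmul_eq_mul, nsmul_eq_mul, Finset.sum_comm, Finset.mul_sum]
    gcongr with k hk
    rw [← Finset.sum_mul]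
    exact mul_le_mul_of_nonneg_right (sum_poisson_le hq k N) (hM0 k (Finset.mem_range.1 hk))
  have hℓ0 : 0 < ℓ x := by linarith
  calc _ ≤ x / ℓ x * (N * (2 * exp (-(ε / 2) * x)) + (exp q / q * ∑ k ∈ Finset.range K, M k +
        N * exp (-(δ / 4) * ℓ x))) := by gcongr
    _ = x / ℓ x * N * (2 * exp (-(ε / 2) * x)) + exp q / q * (x / ℓ x * ∑ k ∈ Finset.range K, M k)
        + x / ℓ x * N * exp (-(δ / 4) * ℓ x) := by ring
    _ ≤ x / ℓ x * ((δ' + 1) * ℓ x) * (2 * exp (-(ε / 2) * x)) +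
        exp q / q * (ρ / 3 * (q / exp q)) +
        x / ℓ x * ((δ' + 1) * ℓ x) * exp (-(δ / 4) * ℓ x) := by gcongr
    _ = 2 * (δ' + 1) * (x * exp (-(ε / 2) * x)) + ρ / 3 +
        (δ' + 1) * (x * exp (-(δ / 4) * ℓ x)) := by field_simp
    _ ≤ ρ := by linarith

end RVMono

section SmoothKernels

open scoped FourierTransform SchwartzMap ContDiff

/-- Fourier inversion almost everywhere, for an integrable function with integrable transform. -/
lemma ae_eq_fourierInv_fourier {f : ℝ → ℂ} (hf : Integrable f) (hf' : Integrable (𝓕 f)) :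
    ∀ᵐ x, f x = 𝓕⁻ (𝓕 f) x := by
  have hflip : ∀ (u v : ℝ → ℂ), Integrable u → Integrable v →
      ∫ ξ, 𝓕 u ξ • v ξ = ∫ x, u x • 𝓕 v x := fun u v hu hv => by
    simpa using! VectorFourier.integral_fourierIntegral_smul_eq_flip (L := innerₗ ℝ)
      Real.continuous_fourierChar continuous_inner hu hv
  have hneg : Integrable fun ξ => 𝓕 f (-ξ) := hf'.comp_neg
  have hinv : 𝓕⁻ (𝓕 f) = 𝓕 fun ξ => 𝓕 f (-ξ) := Real.fourierInv_eq_fourier_comp_neg _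
  have hcont : Continuous (𝓕⁻ (𝓕 f)) := by
    rw [hinv]
    exact VectorFourier.fourierIntegral_continuous Real.continuous_fourierChar
      (L := innerₗ ℝ) continuous_inner hneg
  refine ae_eq_of_integral_contDiff_smul_eq hf.locallyIntegrable hcont.locallyIntegrable
    fun g hg hgs => ?_
  have hgs' : HasCompactSupport fun x => (g x : ℂ) := hgs.comp_left (g := ((↑) : ℝ → ℂ)) rfl
  have hg' : ContDiff ℝ ∞ fun x => (g x : ℂ) := Complex.ofRealCLM.contDiff.comp hg
  set u : 𝓢(ℝ, ℂ) := hgs'.toSchwartzMap hg' with hu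
  have hux : ∀ x, u x = (g x : ℂ) := fun x => rfl
  have h1 : ∀ x, 𝓕 (𝓕⁻ u : 𝓢(ℝ, ℂ)) x = u x := fun x => by
    rw [FourierTransform.fourier_fourierInv_eq]
  calc ∫ x, g x • f x = ∫ x, 𝓕 (⇑(𝓕⁻ u : 𝓢(ℝ, ℂ))) x • f x := by
        refine integral_congr_ae (ae_of_all _ fun x => ?_)
        simp only
        rw [← SchwartzMap.fourier_coe, h1, hux, Complex.real_smul, smul_eq_mul]
    _ = ∫ x, (𝓕⁻ u : 𝓢(ℝ, ℂ)) x • 𝓕 f x :=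
        hflip _ _ (𝓕⁻ u : 𝓢(ℝ, ℂ)).integrable hf
    _ = ∫ x, 𝓕 (⇑u) x • 𝓕 f (-x) := by
        rw [← integral_neg_eq_self]
        refine integral_congr_ae (ae_of_all _ fun x => ?_)
        simp only
        rw [SchwartzMap.fourierInv_coe, Real.fourierInv_eq_fourier_neg, neg_neg]
    _ = ∫ x, u x • 𝓕 (fun ξ => 𝓕 f (-ξ)) x := hflip _ _ u.integrable hneg
    _ = _ := by
        refine integral_congr_ae (ae_of_all _ fun x => ?_)
        simp only
        rw [hinv, hux, Complex.real_smul, smul_eq_mul]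

/-- Characteristic function of a density. -/
def densCF (g : ℝ → ℝ) (s : ℝ) : ℂ := ∫ x, (g x : ℂ) * Complex.exp (s * x * Complex.I)

/-- Fourier inversion integral of the characteristic function of a density, up to `2 * π`. -/
def invDens (g : ℝ → ℝ) (t : ℝ) : ℂ := ∫ s : ℝ, Complex.exp (-(s * t * Complex.I)) * densCF g s

lemma densCF_eq_fourier (g : ℝ → ℝ) (s : ℝ) :
    densCF g s = 𝓕 (fun x => (g x : ℂ)) (-s / (2 * π)) := by
  rw [Real.fourier_real_eq_integral_exp_smul, densCF]
  congr 1 with x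
  rw [smul_eq_mul, mul_comm]
  congr 2
  push_cast
  have : (π : ℂ) ≠ 0 := by exact_mod_cast Real.pi_ne_zero
  field_simp

lemma ae_eq_invDens {g : ℝ → ℝ} (hg : Integrable g) (hg' : Integrable (densCF g)) :
    ∀ᵐ t, (g t : ℂ) = 1 / (2 * π) * invDens g t := by
  have hpi : (2 * π : ℝ) ≠ 0 := by positivity
  have he : ∀ ξ : ℝ, 𝓕 (fun x => (g x : ℂ)) ξ = densCF g (ξ * -(2 * π)) := fun ξ => by
    rw [densCF_eq_fourier]; field_simp
  have hF : Integrable (𝓕 fun x => (g x : ℂ)) := by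
    rw [funext he]; exact hg'.comp_mul_right' (neg_ne_zero.2 hpi)
  have hgc : Integrable fun x => (g x : ℂ) := hg.ofReal
  filter_upwards [ae_eq_fourierInv_fourier hgc hF] with t ht
  rw [ht, Real.fourierInv_eq_fourier_neg, Real.fourier_real_eq_integral_exp_smul, invDens]
  have h1 := Measure.integral_comp_mul_right
    (fun s : ℝ => Complex.exp (-(s * t * Complex.I)) * densCF g s) (-(2 * π))
  have h2 : |(-(2 * π))⁻¹| = 1 / (2 * π) := by
    rw [abs_inv, abs_neg, abs_of_pos (by positivity), one_div]
  rw [h2, Complex.real_smul] at h1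
  push_cast at h1
  rw [← h1]
  congr 1 with ξ
  rw [smul_eq_mul, he]
  push_cast
  ring_nf

lemma integrable_fejer : Integrable fejer := by
  refine (integrable_inv_one_add_sq.const_mul 5).mono'
    continuous_fejer.aestronglyMeasurable (ae_of_all _ fun y => ?_)
  rw [Real.norm_of_nonneg (fejer_nonneg y), ← div_eq_mul_inv, le_div_iff₀ (by positivity)]
  have h1 : fejer y * y ^ 2 ≤ 4 := by
    rcases eq_or_ne y 0 with rfl | hy
    · norm_num
    · rw [fejer_of_ne hy, div_mul_cancel₀ _ (by positivity)]
      linarith [Real.neg_one_le_cos y]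
  linarith [fejer_le_one y]

lemma continuous_invDens {g : ℝ → ℝ} (hg' : Integrable (densCF g)) : Continuous (invDens g) := by
  refine continuous_of_dominated (bound := fun s => ‖densCF g s‖) (fun t => ?_)
    (fun t => ae_of_all _ fun s => ?_) hg'.norm (ae_of_all _ fun s => by fun_prop)
  · exact (Continuous.aestronglyMeasurable (by fun_prop)).mul hg'.1
  · rw [norm_mul, norm_exp_neg_mul_I, one_mul]

/-- The Fourier transform of the Fejér kernel. -/
lemma integral_fejer_mul_exp (c : ℝ) :
    ∫ y : ℝ, (fejer y : ℂ) * Complex.exp (c * y * Complex.I) = 2 * π * tri c := by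
  have hd : densCF tri = fun s => (fejer s : ℂ) := funext fun s => by
    rw [← integral_tri_mul_exp, densCF]
    congr 1 with x
    ring_nf
  have hi : Integrable (densCF tri) := by rw [hd]; exact integrable_fejer.ofReal
  have h2 := (ae_eq_invDens integrable_tri hi)
  have h3 : (fun t => (tri t : ℂ)) = fun t => 1 / (2 * π) * invDens tri t := by
    refine MeasureTheory.Measure.eq_of_ae_eq h2 ?_ ?_
    · exact Complex.continuous_ofReal.comp continuous_tri
    · exact continuous_const.mul (continuous_invDens hi)
  have h4 := congrFun h3 (-c)
  have h5 : tri (-c) = tri c := by simp [tri]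
  simp only [h5] at h4
  have hpi : (π : ℂ) ≠ 0 := by exact_mod_cast Real.pi_ne_zero
  rw [h4, ← mul_assoc, mul_one_div_cancel (by simp), one_mul, invDens, hd]
  congr 1 with s
  rw [mul_comm]
  push_cast
  ring_nf

end SmoothKernels

namespace RVMono

variable {ℓ : ℝ → ℝ} {α : ℝ}

lemma tendsto_linv_atTop (H : RVMono ℓ α) : Tendsto (linv ℓ) atTop atTop :=
  tendsto_atTop_atTop.2 fun b => ⟨ℓ b, fun _ hv => H.le_linv hv⟩

end RVMono

lemma integral_map_convPow (F : Measure ℝ) [IsProbabilityMeasure F] (n : ℕ) (a : ℝ) {f : ℝ → ℝ}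
    (hf : Continuous f) :
    ∫ x, f x ∂((convPow F n).map fun y => y / a) = ∫ y, f (y / a) ∂convPow F n :=
  integral_map (by fun_prop) hf.aestronglyMeasurable

lemma StableLimit.integrable {F : Measure ℝ} [IsProbabilityMeasure F] {ℓ g : ℝ → ℝ}
    (hg : StableLimit F ℓ g) : Integrable g := by
  have h1 := hg (BoundedContinuousFunction.const ℝ 1)
  simp only [BoundedContinuousFunction.const_apply, one_mul] at h1
  have h2 : ∀ n : ℕ, ∫ _, (1 : ℝ) ∂((convPow F n).map fun y => y / linv ℓ (n : ℝ)) = 1 := fun n => by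
    rw [integral_map_convPow F n _ continuous_const]; simp
  simp only [h2] at h1
  by_contra hni
  rw [integral_undef hni] at h1
  exact one_ne_zero (tendsto_nhds_unique tendsto_const_nhds h1)

lemma densCF_re {g : ℝ → ℝ} (hg : Integrable g) (s : ℝ) :
    (densCF g s).re = ∫ x, cos (s * x) * g x := by
  have hi : Integrable fun x => (g x : ℂ) * Complex.exp (s * x * Complex.I) := by
    refine hg.ofReal.mul_bdd (c := 1) (Continuous.aestronglyMeasurable (by fun_prop))
      (ae_of_all _ fun x => ?_)
    rw [← Complex.ofReal_mul, Complex.norm_exp_ofReal_mul_I]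
  rw [densCF, ← RCLike.re_eq_complex_re, ← integral_re hi]
  congr 1 with x
  rw [RCLike.re_eq_complex_re, Complex.re_ofReal_mul, ← Complex.ofReal_mul,
    Complex.exp_ofReal_mul_I_re, mul_comm]

lemma densCF_im {g : ℝ → ℝ} (hg : Integrable g) (s : ℝ) :
    (densCF g s).im = ∫ x, sin (s * x) * g x := by
  have hi : Integrable fun x => (g x : ℂ) * Complex.exp (s * x * Complex.I) := by
    refine hg.ofReal.mul_bdd (c := 1) (Continuous.aestronglyMeasurable (by fun_prop))
      (ae_of_all _ fun x => ?_)
    rw [← Complex.ofReal_mul, Complex.norm_exp_ofReal_mul_I]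
  rw [densCF, ← RCLike.im_eq_complex_im, ← integral_im hi]
  congr 1 with x
  rw [RCLike.im_eq_complex_im, Complex.im_ofReal_mul, ← Complex.ofReal_mul,
    Complex.exp_ofReal_mul_I_im, mul_comm]

lemma StableLimit.tendsto_charFun_pow {F : Measure ℝ} [IsProbabilityMeasure F] {ℓ g : ℝ → ℝ}
    (hg : StableLimit F ℓ g) (s : ℝ) :
    Tendsto (fun n : ℕ => charFun F (s / linv ℓ n) ^ n) atTop (nhds (densCF g s)) := by
  have hre := hg (BoundedContinuousFunction.ofNormedAddCommGroup (fun x => cos (s * x))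
    (by fun_prop) 1 fun x => by simpa using abs_cos_le_one _)
  have him := hg (BoundedContinuousFunction.ofNormedAddCommGroup (fun x => sin (s * x))
    (by fun_prop) 1 fun x => by simpa using abs_sin_le_one _)
  simp only [BoundedContinuousFunction.coe_ofNormedAddCommGroup] at hre him
  rw [← densCF_re hg.integrable] at hre
  rw [← densCF_im hg.integrable] at him
  have hre' : Tendsto (fun n : ℕ => (charFun F (s / linv ℓ n) ^ n).re) atTop
      (nhds (densCF g s).re) := by
    refine hre.congr fun n => ?_
    rw [integral_map_convPow F n _ (by fun_prop), ← charFun_convPow, charFun_re]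
    congr 1 with y
    congr 1; ring
  have him' : Tendsto (fun n : ℕ => (charFun F (s / linv ℓ n) ^ n).im) atTop
      (nhds (densCF g s).im) := by
    refine him.congr fun n => ?_
    rw [integral_map_convPow F n _ (by fun_prop), ← charFun_convPow, charFun_im]
    congr 1 with y
    congr 1; ring
  have h := ((Complex.continuous_ofReal.tendsto _).comp hre').add
    (((Complex.continuous_ofReal.tendsto _).comp him').mul_const Complex.I)
  rw [Complex.re_add_im] at h
  exact h.congr fun n => Complex.re_add_im _

lemma norm_densCF_le {F : Measure ℝ} [IsProbabilityMeasure F] {ℓ g : ℝ → ℝ} {α : ℝ}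
    (H : RVMono ℓ α) (hg : StableLimit F ℓ g) {C c γ θ₀ : ℝ} (hθ₀ : 0 < θ₀)
    (hb : ∀ (v : ℝ) (m : ℕ) (θ : ℝ), 1 ≤ v → v ≤ 8 * m →
      |θ| ≤ θ₀ → ‖charFun F θ‖ ^ m ≤ C * exp (-(c * |linv ℓ v * θ| ^ γ))) (s : ℝ) :
    ‖densCF g s‖ ≤ C * exp (-(c * |s| ^ γ)) := by
  have ha : Tendsto (fun n : ℕ => linv ℓ n) atTop atTop :=
    H.tendsto_linv_atTop.comp tendsto_natCast_atTop_atTop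
  refine le_of_tendsto (hg.tendsto_charFun_pow s).norm ?_
  filter_upwards [ha.eventually_ge_atTop (|s| / θ₀), eventually_ge_atTop 1] with n hn h1
  have hn1 : (1 : ℝ) ≤ n := by exact_mod_cast h1
  have hp := H.linv_pos (n : ℝ)
  have := hb n n (s / linv ℓ n) hn1 (by linarith) (by
    rw [abs_div, abs_of_pos hp, div_le_iff₀ hp]
    rwa [div_le_iff₀ hθ₀, mul_comm] at hn)
  rwa [mul_div_cancel₀ _ hp.ne', ← norm_pow] at this

lemma continuous_densCF {g : ℝ → ℝ} (hg : Integrable g) : Continuous (densCF g) := by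
  refine continuous_of_dominated (bound := fun x => ‖g x‖) (fun t => ?_)
    (fun t => ae_of_all _ fun x => ?_) hg.norm (ae_of_all _ fun x => by fun_prop)
  · exact (hg.ofReal (𝕜 := ℂ)).1.mul (Continuous.aestronglyMeasurable (by fun_prop))
  · rw [norm_mul, ← Complex.ofReal_mul, Complex.norm_exp_ofReal_mul_I, mul_one, Complex.norm_real]

lemma integrable_densCF {g : ℝ → ℝ} (hg : Integrable g) {C c γ : ℝ} (hc : 0 < c) (hγ : 0 < γ)
    (hb : ∀ s, ‖densCF g s‖ ≤ C * exp (-(c * |s| ^ γ))) : Integrable (densCF g) :=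
  ((integrable_exp_neg_mul_abs_rpow hc hγ).const_mul C).mono'
    (continuous_densCF hg).aestronglyMeasurable (ae_of_all _ hb)

lemma norm_invDens_le (g : ℝ → ℝ) (t : ℝ) : ‖invDens g t‖ ≤ ∫ s, ‖densCF g s‖ := by
  refine (norm_integral_le_integral_norm _).trans_eq ?_
  congr 1 with s
  rw [norm_mul, norm_exp_neg_mul_I, one_mul]

lemma sum_Ico_eq_integral_floor (f : ℕ → ℂ) {A B : ℕ} (hAB : A ≤ B) :
    ∑ n ∈ Finset.Ico A B, f n = ∫ u in (A : ℝ)..B, f ⌊u⌋₊ := by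
  have h1 : ∀ n : ℕ, EqOn (fun _ => f n) (fun u : ℝ => f ⌊u⌋₊) (Ioo (n : ℝ) (n + 1 : ℕ)) :=
    fun n u hu => by
      simp only
      rw [(Nat.floor_eq_iff (n.cast_nonneg.trans hu.1.le)).2 ⟨hu.1.le, by exact_mod_cast hu.2⟩]
  have hle : ∀ n : ℕ, (n : ℝ) ≤ (n + 1 : ℕ) := fun n => by push_cast; linarith
  have h2 : ∀ n : ℕ, ∫ u in (n : ℝ)..(n + 1 : ℕ), f ⌊u⌋₊ = f n := fun n => by
    rw [intervalIntegral.integral_of_le (hle n), integral_Ioc_eq_integral_Ioo,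
      ← setIntegral_congr_fun measurableSet_Ioo (h1 n), ← integral_Ioc_eq_integral_Ioo,
      ← intervalIntegral.integral_of_le (hle n), intervalIntegral.integral_const]
    simp
  have h3 : ∀ n : ℕ, IntervalIntegrable (fun u : ℝ => f ⌊u⌋₊) volume n (n + 1 : ℕ) := fun n => by
    rw [intervalIntegrable_iff_integrableOn_Ioo_of_le (hle n)]
    exact (integrableOn_const (by simp)).congr_fun (h1 n) measurableSet_Ioo
  rw [← intervalIntegral.sum_integral_adjacent_intervals_Ico (a := fun n : ℕ => (n : ℝ)) hAB
    fun k _ => h3 k]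
  exact Finset.sum_congr rfl fun n _ => (h2 n).symm

/-- A Riemann sum with mesh `1 / ℓ x` converges by dominated convergence. -/
lemma tendsto_riemann_sum {ℓ : ℝ → ℝ} (hℓ : Tendsto ℓ atTop atTop) {δ K : ℝ} (hδ : 0 < δ)
    (hδK : δ ≤ K) {f : ℝ → ℕ → ℂ} {Φ : ℝ → ℂ} {D : ℝ}
    (hD : ∀ᶠ x in atTop, ∀ n : ℕ, ⌈δ * ℓ x⌉₊ ≤ n → ‖f x n‖ ≤ D)
    (hf : ∀ v, δ < v → Tendsto (fun x => f x ⌊ℓ x * v⌋₊) atTop (nhds (Φ v))) :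
    Tendsto (fun x => 1 / (ℓ x : ℂ) * ∑ n ∈ Finset.Ico ⌈δ * ℓ x⌉₊ ⌈K * ℓ x⌉₊, f x n) atTop
      (nhds (∫ v in δ..K, Φ v)) := by
  have hcl : ∀ c : ℝ, 0 ≤ c → Tendsto (fun x => (⌈c * ℓ x⌉₊ : ℝ) / ℓ x) atTop (nhds c) :=
    fun c hc => (tendsto_nat_ceil_mul_div_atTop hc).comp hℓ
  have hA := hcl δ hδ.le
  have hB := hcl K (hδ.le.trans hδK)
  set S : ℝ → Set ℝ := fun x => Ioc ((⌈δ * ℓ x⌉₊ : ℝ) / ℓ x) ((⌈K * ℓ x⌉₊ : ℝ) / ℓ x) with hS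
  have hrep : ∀ᶠ x in atTop, ∫ v, (S x).indicator (fun v => f x ⌊ℓ x * v⌋₊) v =
      1 / (ℓ x : ℂ) * ∑ n ∈ Finset.Ico ⌈δ * ℓ x⌉₊ ⌈K * ℓ x⌉₊, f x n := by
    filter_upwards [hℓ.eventually_gt_atTop 0] with x hx
    have hle : ⌈δ * ℓ x⌉₊ ≤ ⌈K * ℓ x⌉₊ := Nat.ceil_mono (by gcongr)
    rw [integral_indicator measurableSet_Ioc, ← intervalIntegral.integral_of_le (by gcongr),
      intervalIntegral.integral_comp_mul_left (fun u => f x ⌊u⌋₊) hx.ne',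
      mul_div_cancel₀ _ hx.ne', mul_div_cancel₀ _ hx.ne', sum_Ico_eq_integral_floor _ hle,
      Complex.real_smul]
    simp
  refine Tendsto.congr' hrep ?_
  rw [intervalIntegral.integral_of_le hδK, ← integral_indicator measurableSet_Ioc]
  refine tendsto_integral_filter_of_dominated_convergence
    (bound := (Icc δ (K + 1)).indicator fun _ => |D|) ?_ ?_ ?_ ?_
  · refine Eventually.of_forall fun x => AEStronglyMeasurable.indicator ?_ measurableSet_Ioc
    exact ((measurable_from_nat (f := f x)).comp (Nat.measurable_floor.comp
      (measurable_const_mul (ℓ x)))).aestronglyMeasurable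
  · filter_upwards [hD, hℓ.eventually_ge_atTop 1] with x hx h1
    refine ae_of_all _ fun v => ?_
    have h0 : 0 < ℓ x := by linarith
    by_cases hv : v ∈ S x
    · have hv1 := hv.1
      have hv2 := hv.2
      rw [div_lt_iff₀ h0] at hv1
      rw [le_div_iff₀ h0] at hv2
      have h3 := Nat.le_ceil (δ * ℓ x)
      have h4 := (Nat.ceil_lt_add_one (a := K * ℓ x) (by
        have := hδ.le.trans hδK; positivity)).le
      have hvI : v ∈ Icc δ (K + 1) :=
        ⟨le_of_mul_le_mul_right (h3.trans hv1.le) h0,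
          le_of_mul_le_mul_right (show v * ℓ x ≤ (K + 1) * ℓ x by nlinarith) h0⟩
      rw [indicator_of_mem hv, indicator_of_mem hvI]
      exact (hx _ (Nat.le_floor (by rw [mul_comm (ℓ x) v]; exact hv1.le))).trans (le_abs_self D)
    · rw [indicator_of_notMem hv, norm_zero]
      exact indicator_nonneg (fun _ _ => abs_nonneg D) _
  · exact (integrable_indicator_iff measurableSet_Icc).2 (integrableOn_const (by simp))
  · have hne : ∀ᵐ v : ℝ, v ≠ δ ∧ v ≠ K := by
      filter_upwards [Measure.ae_ne volume δ, Measure.ae_ne volume K] with v h1 h2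
      exact ⟨h1, h2⟩
    filter_upwards [hne] with v hv
    rcases lt_or_gt_of_ne hv.1 with h1 | h1
    · rw [indicator_of_notMem fun hm => absurd hm.1 (not_lt.2 h1.le)]
      refine tendsto_const_nhds.congr' ?_
      filter_upwards [hA.eventually (lt_mem_nhds h1)] with x hx
      rw [indicator_of_notMem fun hm => absurd hm.1 (not_lt.2 hx.le)]
    rcases lt_or_gt_of_ne hv.2 with h2 | h2
    · have hm : v ∈ Ioc δ K := ⟨h1, h2.le⟩
      rw [indicator_of_mem hm]
      refine (hf v h1).congr' ?_
      filter_upwards [hA.eventually (gt_mem_nhds h1), hB.eventually (lt_mem_nhds h2)] with x hx hx'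
      have hm : v ∈ S x := ⟨hx, hx'.le⟩
      rw [indicator_of_mem hm]
    · rw [indicator_of_notMem fun hm => absurd hm.2 (not_le.2 h2)]
      refine tendsto_const_nhds.congr' ?_
      filter_upwards [hB.eventually (gt_mem_nhds h2)] with x hx
      rw [indicator_of_notMem fun hm => absurd hm.2 (not_le.2 hx)]

/-- Local limit estimate for the part of the inversion integral near the origin. -/
lemma exists_norm_inversion_sub_le {F : Measure ℝ} [IsProbabilityMeasure F] {ℓ g : ℝ → ℝ} {α : ℝ}
    (H : RVMono ℓ α) (hg : StableLimit F ℓ g) {C c γ θ₀ : ℝ} (hC : 0 < C) (hc : 0 < c) (hγ : 0 < γ)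
    (hθ₀ : 0 < θ₀)
    (hb : ∀ (v : ℝ) (m : ℕ) (θ : ℝ), 1 ≤ v → v ≤ 8 * m →
      |θ| ≤ θ₀ → ‖charFun F θ‖ ^ m ≤ C * exp (-(c * |linv ℓ v * θ| ^ γ)))
    {κ : ℝ → ℂ} (hκm : Measurable κ) {Q : ℝ} (hκQ : ∀ θ, ‖κ θ‖ ≤ Q)
    (hκ0 : ∀ θ, θ₀ < |θ| → κ θ = 0) (hκc : ContinuousAt κ 0) :
    ∃ e : ℕ → ℝ, Tendsto e atTop (nhds 0) ∧ ∀ (n : ℕ) (y : ℝ), 1 ≤ n →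
      ‖linv ℓ n * (∫ θ : ℝ, κ θ * Complex.exp (-(θ * y * Complex.I)) * charFun F θ ^ n)
        - κ 0 * invDens g (y / linv ℓ n)‖ ≤ e n := by
  have hQ : 0 ≤ Q := (norm_nonneg _).trans (hκQ 0)
  have hψ := norm_densCF_le H hg hθ₀ hb
  have hψi := integrable_densCF hg.integrable hc hγ hψ
  have hφm : Measurable (charFun F) := continuous_charFun.measurable
  set u : ℕ → ℝ → ℂ := fun n s => κ (s / linv ℓ n) * charFun F (s / linv ℓ n) ^ n with hu
  have hum : ∀ n, Measurable (u n) := fun n =>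
    (hκm.comp (measurable_id.div_const _)).mul ((hφm.comp (measurable_id.div_const _)).pow_const n)
  have hub : ∀ n : ℕ, 1 ≤ n → ∀ s, ‖u n s‖ ≤ Q * (C * exp (-(c * |s| ^ γ))) := by
    intro n hn s
    have hn1 : (1 : ℝ) ≤ n := by exact_mod_cast hn
    have hp := H.linv_pos (n : ℝ)
    rcases le_or_gt |s / linv ℓ n| θ₀ with h | h
    · have h1 := hb n n (s / linv ℓ n) hn1 (by linarith) h
      rw [mul_div_cancel₀ _ hp.ne'] at h1
      rw [hu, norm_mul, norm_pow]
      exact mul_le_mul (hκQ _) h1 (by positivity) hQ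
    · rw [hu]
      simp only [hκ0 _ h, zero_mul, norm_zero]
      positivity
  have hei := (integrable_exp_neg_mul_abs_rpow hc hγ).const_mul C
  have hui : ∀ n : ℕ, 1 ≤ n → Integrable (u n) := fun n hn =>
    (hei.const_mul Q).mono' (hum n).aestronglyMeasurable (ae_of_all _ (hub n hn))
  have ha : Tendsto (fun n : ℕ => linv ℓ n) atTop atTop :=
    H.tendsto_linv_atTop.comp tendsto_natCast_atTop_atTop
  refine ⟨fun n => ∫ s, ‖u n s - κ 0 * densCF g s‖, ?_, fun n y hn => ?_⟩
  · have h0 : ∫ _ : ℝ, (0 : ℝ) = 0 := integral_zero ℝ ℝ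
    rw [← h0]
    clear h0
    refine tendsto_integral_filter_of_dominated_convergence
      (bound := fun s => Q * (C * exp (-(c * |s| ^ γ))) + Q * (C * exp (-(c * |s| ^ γ)))) ?_ ?_
      ((hei.const_mul Q).add (hei.const_mul Q)) ?_
    · exact Eventually.of_forall fun n =>
        ((hum n).aestronglyMeasurable.sub (hψi.1.const_mul _)).norm
    · filter_upwards [eventually_ge_atTop 1] with n hn
      refine ae_of_all _ fun s => ?_
      rw [norm_norm]
      refine (norm_sub_le _ _).trans (add_le_add (hub n hn s) ?_)
      rw [norm_mul]
      exact mul_le_mul (hκQ _) (hψ s) (norm_nonneg _) hQ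
    · refine ae_of_all _ fun s => ?_
      have h1 : Tendsto (fun n : ℕ => s / linv ℓ n) atTop (nhds 0) := ha.const_div_atTop s
      have h2 : Tendsto (fun n => u n s) atTop (nhds (κ 0 * densCF g s)) :=
        (hκc.tendsto.comp h1).mul (hg.tendsto_charFun_pow s)
      simpa using (h2.sub_const (κ 0 * densCF g s)).norm
  · have hp := H.linv_pos (n : ℝ)
    have h1 := Measure.integral_comp_div
      (fun θ : ℝ => κ θ * Complex.exp (-(θ * y * Complex.I)) * charFun F θ ^ n) (linv ℓ n)
    rw [abs_of_pos hp, Complex.real_smul] at h1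
    have hexp : Measurable fun s : ℝ =>
        Complex.exp (-(s * (y / linv ℓ n : ℝ) * Complex.I)) := by fun_prop
    have hexpi : ∀ {w : ℝ → ℂ}, Integrable w → Integrable fun s : ℝ =>
        Complex.exp (-(s * (y / linv ℓ n : ℝ) * Complex.I)) * w s := fun hw =>
      hw.bdd_mul (c := 1) hexp.aestronglyMeasurable
        (ae_of_all _ fun s => (norm_exp_neg_mul_I _ _).le)
    have h2 : ∫ s : ℝ, κ (s / linv ℓ n) *
          Complex.exp (-((s / linv ℓ n : ℝ) * y * Complex.I)) * charFun F (s / linv ℓ n) ^ n =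
        ∫ s : ℝ, Complex.exp (-(s * (y / linv ℓ n : ℝ) * Complex.I)) * u n s := by
      congr 1 with s
      have : (-((s / linv ℓ n : ℝ) * y * Complex.I) : ℂ) =
          -(s * (y / linv ℓ n : ℝ) * Complex.I) := by push_cast; ring
      rw [this]; simp only [hu]; ring
    rw [← h1, h2, invDens, ← integral_const_mul, ← integral_sub (hexpi (hui n hn))
      ((hexpi hψi).const_mul _)]
    refine (norm_integral_le_integral_norm _).trans_eq ?_
    congr 1 with s
    rw [mul_left_comm (κ 0), ← mul_sub, norm_mul, norm_exp_neg_mul_I, one_mul]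

/-- The inversion integral of the `n`-th power of a characteristic function against `κ`. -/
def invInt (F : Measure ℝ) (κ : ℝ → ℂ) (n : ℕ) (y : ℝ) : ℂ :=
  ∫ θ : ℝ, κ θ * Complex.exp (-(θ * y * Complex.I)) * charFun F θ ^ n

lemma tendsto_sum_invInt_near {F : Measure ℝ} [IsProbabilityMeasure F] {ℓ g : ℝ → ℝ} {α : ℝ}
    (H : RVMono ℓ α) (hg : StableLimit F ℓ g) {C c γ θ₀ : ℝ} (hC : 0 < C) (hc : 0 < c) (hγ : 0 < γ)
    (hθ₀ : 0 < θ₀)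
    (hb : ∀ (v : ℝ) (m : ℕ) (θ : ℝ), 1 ≤ v → v ≤ 8 * m →
      |θ| ≤ θ₀ → ‖charFun F θ‖ ^ m ≤ C * exp (-(c * |linv ℓ v * θ| ^ γ)))
    {κ : ℝ → ℂ} (hκm : Measurable κ) {Q : ℝ} (hκQ : ∀ θ, ‖κ θ‖ ≤ Q)
    (hκ0 : ∀ θ, θ₀ < |θ| → κ θ = 0) (hκc : ContinuousAt κ 0) {y : ℝ → ℝ}
    (hy : Tendsto (fun x => y x / x) atTop (nhds 1)) {δ K : ℝ} (hδ : 0 < δ) (hδK : δ ≤ K) :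
    Tendsto (fun x => ((x / ℓ x : ℝ) : ℂ) *
        ∑ n ∈ Finset.Ico ⌈δ * ℓ x⌉₊ ⌈K * ℓ x⌉₊, invInt F κ n (y x)) atTop
      (nhds (κ 0 * ∫ v in δ..K,
        (((v ^ (1 / α))⁻¹ : ℝ) : ℂ) * invDens g ((v ^ (1 / α))⁻¹))) := by
  obtain ⟨e, he, hJ⟩ := exists_norm_inversion_sub_le H hg hC hc hγ hθ₀ hb hκm hκQ hκ0 hκc
  have hψi := integrable_densCF hg.integrable hc hγ (norm_densCF_le H hg hθ₀ hb)
  have hlin : ∀ v, 0 < v → ∀ n : ℝ → ℝ, Tendsto (fun x => n x / ℓ x) atTop (nhds v) →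
      Tendsto (fun x => x / linv ℓ (n x)) atTop (nhds (v ^ (1 / α))⁻¹) := fun v hv n hn => by
    have := (H.tendsto_linv_div hv hn).inv₀ (rpow_pos_of_pos hv _).ne'
    exact this.congr fun x => inv_div _ _
  have hfac : ∀ n : ℕ, ((linv ℓ n : ℝ) : ℂ) ≠ 0 := fun n =>
    Complex.ofReal_ne_zero.2 (H.linv_pos _).ne'
  have hsplit : ∀ (n : ℕ) (x y : ℝ), (x : ℂ) * invInt F κ n y =
      ((x / linv ℓ n : ℝ) : ℂ) * (linv ℓ n * invInt F κ n y) := fun n x y => by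
    have := hfac n
    push_cast
    field_simp
  have hR := tendsto_riemann_sum H.tendsto_atTop hδ hδK
    (f := fun x n => (x : ℂ) * invInt F κ n (y x))
    (Φ := fun v => κ 0 * ((((v ^ (1 / α))⁻¹ : ℝ) : ℂ) * invDens g ((v ^ (1 / α))⁻¹)))
    (D := ((δ ^ (1 / α))⁻¹ + 1) * (Q * (∫ s, ‖densCF g s‖) + 1)) ?_ ?_
  · rw [intervalIntegral.integral_const_mul] at hR
    refine hR.congr fun x => ?_
    rw [← Finset.mul_sum, ← mul_assoc]
    push_cast
    ring
  · have h1 := hlin δ hδ (fun x => δ * ℓ x) (tendsto_const_nhds.congr' (by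
      filter_upwards [eventually_gt_atTop 0] with x hx
      rw [mul_div_cancel_right₀ _ (H.pos hx).ne']))
    obtain ⟨N, hN⟩ := eventually_atTop.1 (he.eventually (gt_mem_nhds one_pos))
    filter_upwards [h1.eventually (gt_mem_nhds (lt_add_one _)), eventually_gt_atTop 0,
      (H.tendsto_atTop.const_mul_atTop hδ).eventually_ge_atTop (N + 1 : ℝ)] with x hx hx0 hxN n hn
    have hn' : δ * ℓ x ≤ n := (Nat.le_ceil _).trans (by exact_mod_cast hn)
    have hnN : N + 1 ≤ n := by exact_mod_cast hxN.trans hn'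
    have h2 := hJ n (y x) (by omega)
    have h3 : ‖(linv ℓ n : ℂ) * invInt F κ n (y x)‖ ≤ Q * (∫ s, ‖densCF g s‖) + 1 := by
      have h4 := norm_le_norm_add_norm_sub' ((linv ℓ n : ℂ) * invInt F κ n (y x))
        (κ 0 * invDens g (y x / linv ℓ n))
      have h5 : ‖κ 0 * invDens g (y x / linv ℓ n)‖ ≤ Q * (∫ s, ‖densCF g s‖) := by
        rw [norm_mul]
        exact mul_le_mul (hκQ 0) (norm_invDens_le _ _) (norm_nonneg _)
          ((norm_nonneg _).trans (hκQ 0))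
      have h6 := hN n (by omega)
      rw [invInt] at h4 ⊢
      linarith
    rw [hsplit, norm_mul, Complex.norm_real]
    have h7 : ‖x / linv ℓ n‖ ≤ (δ ^ (1 / α))⁻¹ + 1 := by
      rw [Real.norm_of_nonneg (div_nonneg hx0.le (H.linv_pos _).le)]
      exact (div_le_div_of_nonneg_left hx0.le (H.linv_pos _) (H.linv_mono hn')).trans hx.le
    exact mul_le_mul h7 h3 (norm_nonneg _) (by positivity)
  · intro v hv
    have hv0 : 0 < v := hδ.trans hv
    have hnv : Tendsto (fun x => ((⌊ℓ x * v⌋₊ : ℕ) : ℝ) / ℓ x) atTop (nhds v) := by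
      have := (tendsto_nat_floor_mul_div_atTop hv0.le).comp H.tendsto_atTop
      refine this.congr fun x => ?_
      simp only [Function.comp_apply, mul_comm v]
    have h1 := hlin v hv0 _ hnv
    have hninf : Tendsto (fun x => ⌊ℓ x * v⌋₊) atTop atTop :=
      tendsto_nat_floor_atTop.comp (H.tendsto_atTop.atTop_mul_const hv0)
    have h2 : Tendsto (fun x => (linv ℓ (⌊ℓ x * v⌋₊ : ℕ) : ℂ) * invInt F κ ⌊ℓ x * v⌋₊ (y x) -
        κ 0 * invDens g (y x / linv ℓ (⌊ℓ x * v⌋₊ : ℕ))) atTop (nhds 0) := by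
      refine squeeze_zero_norm' ?_ (he.comp hninf)
      filter_upwards [hninf.eventually_ge_atTop 1] with x hx
      exact hJ _ _ hx
    have h3 : Tendsto (fun x => y x / linv ℓ (⌊ℓ x * v⌋₊ : ℕ)) atTop
        (nhds (v ^ (1 / α))⁻¹) := by
      have := hy.mul h1
      rw [one_mul] at this
      refine this.congr' ?_
      filter_upwards [eventually_gt_atTop 0] with x hx
      rw [div_mul_div_cancel₀ hx.ne']
    have h4 : Tendsto (fun x => κ 0 * invDens g (y x / linv ℓ (⌊ℓ x * v⌋₊ : ℕ))) atTop
        (nhds (κ 0 * invDens g (v ^ (1 / α))⁻¹)) :=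
      (((continuous_invDens hψi).tendsto _).comp h3).const_mul _
    have h5 := (h2.add h4)
    simp only [sub_add_cancel, zero_add] at h5
    have h6 := ((Complex.continuous_ofReal.tendsto _).comp h1).mul h5
    rw [mul_left_comm] at h6
    exact h6.congr fun x => (hsplit _ _ _).symm

lemma integrable_invInt {F : Measure ℝ} [IsProbabilityMeasure F] {κ : ℝ → ℂ} (hκm : Measurable κ)
    {Q : ℝ} (hκQ : ∀ θ, ‖κ θ‖ ≤ Q) {M : ℝ} (hκ0 : ∀ θ, M < |θ| → κ θ = 0) (y : ℝ) (n : ℕ) :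
    Integrable fun θ : ℝ => κ θ * Complex.exp (-(θ * y * Complex.I)) * charFun F θ ^ n := by
  have hQ : 0 ≤ Q := (norm_nonneg _).trans (hκQ 0)
  have hφc : Continuous (charFun F) := continuous_charFun
  have h1 : Integrable ((Icc (-M) M).indicator fun _ : ℝ => Q) :=
    (integrable_indicator_iff measurableSet_Icc).2 (integrableOn_const (by simp))
  refine h1.mono' ?_ (ae_of_all _ fun θ => ?_)
  · exact ((hκm.mul (by fun_prop)).mul (hφc.measurable.pow_const n)).aestronglyMeasurable
  · by_cases hθ : θ ∈ Icc (-M) M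
    · rw [indicator_of_mem hθ, norm_mul, norm_mul, norm_exp_neg_mul_I, mul_one, norm_pow]
      exact (mul_le_mul_of_nonneg_right (hκQ θ) (by positivity)).trans
        (mul_le_of_le_one_right hQ (pow_le_one₀ (norm_nonneg _) (norm_charFun_le_one _)))
    · rw [indicator_of_notMem hθ, hκ0 θ (by
        by_contra hcon; exact hθ (abs_le.1 (not_lt.1 hcon)))]
      simp

lemma tendsto_sum_invInt_far {F : Measure ℝ} [IsProbabilityMeasure F] {ℓ : ℝ → ℝ} {α k : ℝ}
    (H : RVMono ℓ α) (hk : 0 < k) (hF : Tendsto (fun x => rtail F x * ℓ x) atTop (nhds k))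
    {κ : ℝ → ℂ} (hκm : Measurable κ) {Q : ℝ} (hκQ : ∀ θ, ‖κ θ‖ ≤ Q) {θ₁ M : ℝ}
    (hM : 0 < M) (hκ0 : ∀ θ, |θ| < θ₁ ∨ M < |θ| → κ θ = 0)
    (hφ : ∀ θ, θ₁ ≤ |θ| → |θ| ≤ M → charFun F θ ≠ 1) (y : ℝ → ℝ)
    {δ K : ℝ} (hδ : 0 < δ) (hδK : δ ≤ K) :
    Tendsto (fun x => ((x / ℓ x : ℝ) : ℂ) *
        ∑ n ∈ Finset.Ico ⌈δ * ℓ x⌉₊ ⌈K * ℓ x⌉₊, invInt F κ n (y x)) atTop (nhds 0) := by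
  have hQ : 0 ≤ Q := (norm_nonneg _).trans (hκQ 0)
  have hφc : Continuous (charFun F) := continuous_charFun
  obtain ⟨c, hc, hcb⟩ : ∃ c : ℝ, 0 < c ∧ ∀ θ, θ₁ ≤ |θ| → |θ| ≤ M → c ≤ ‖1 - charFun F θ‖ := by
    have hcomp : IsCompact {θ : ℝ | θ₁ ≤ |θ| ∧ |θ| ≤ M} := by
      refine (isCompact_Icc (a := -M) (b := M)).of_isClosed_subset ?_ fun θ h => abs_le.1 h.2
      exact (isClosed_le continuous_const continuous_abs).inter
        (isClosed_le continuous_abs continuous_const)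
    rcases Set.eq_empty_or_nonempty {θ : ℝ | θ₁ ≤ |θ| ∧ |θ| ≤ M} with h | h
    · refine ⟨1, one_pos, fun θ h1 h2 => ?_⟩
      have : θ ∈ {θ : ℝ | θ₁ ≤ |θ| ∧ |θ| ≤ M} := ⟨h1, h2⟩
      rw [h] at this
      exact this.elim
    · obtain ⟨θ, hθ, hmin⟩ := hcomp.exists_isMinOn h
        (f := fun θ => ‖1 - charFun F θ‖) (by fun_prop)
      exact ⟨_, norm_pos_iff.2 (sub_ne_zero.2 (hφ θ hθ.1 hθ.2).symm), fun θ' h1 h2 =>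
        hmin ⟨h1, h2⟩⟩
  obtain ⟨C, hC, hCb⟩ := H.exists_integral_norm_charFun_pow_le_of_compact hk hF M
  have hInt := integrable_invInt (F := F) hκm hκQ fun θ h => hκ0 θ (Or.inr h)
  have key : ∀ (A B : ℕ) (y : ℝ), 2 ≤ A → A ≤ B →
      ‖∑ n ∈ Finset.Ico A B, invInt F κ n y‖ ≤ Q / c * (2 * (C / linv ℓ A)) := by
    intro A B y hA hAB
    have hA2 : (2 : ℝ) ≤ A := by exact_mod_cast hA
    simp only [invInt]
    rw [← integral_finsetSum _ fun n _ => hInt y n]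
    have h1 : ∀ θ : ℝ, ‖∑ n ∈ Finset.Ico A B,
        κ θ * Complex.exp (-(θ * y * Complex.I)) * charFun F θ ^ n‖ ≤
        (Icc (-M) M).indicator (fun θ => Q / c * (2 * ‖charFun F θ‖ ^ A)) θ := by
      intro θ
      by_cases hθ : θ₁ ≤ |θ| ∧ |θ| ≤ M
      · have hm : θ ∈ Icc (-M) M := abs_le.1 hθ.2
        rw [indicator_of_mem hm, ← Finset.mul_sum, geom_sum_Ico (hφ θ hθ.1 hθ.2) hAB, norm_mul,
          norm_mul, norm_exp_neg_mul_I, mul_one, norm_div, div_mul_eq_mul_div, mul_div_assoc]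
        have h2 := norm_charFun_le_one (μ := F) θ
        have h3 : ‖charFun F θ ^ B - charFun F θ ^ A‖ ≤ 2 * ‖charFun F θ‖ ^ A := by
          refine (norm_sub_le _ _).trans ?_
          rw [norm_pow, norm_pow]
          linarith [pow_le_pow_of_le_one (norm_nonneg _) h2 hAB]
        have h4 : c ≤ ‖charFun F θ - 1‖ := by
          rw [norm_sub_rev]; exact hcb θ hθ.1 hθ.2
        exact mul_le_mul (hκQ θ) (div_le_div₀ (by positivity) h3 hc h4) (by positivity) hQ
      · have h0 : κ θ = 0 := hκ0 θ (by
          rcases not_and_or.1 hθ with h | h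
          · exact Or.inl (not_le.1 h)
          · exact Or.inr (not_le.1 h))
        simp only [h0, zero_mul, Finset.sum_const_zero, norm_zero]
        exact indicator_nonneg (fun _ _ => by positivity) _
    have hci : IntegrableOn (fun θ => Q / c * (2 * ‖charFun F θ‖ ^ A)) (Icc (-M) M) :=
      Continuous.integrableOn_Icc (by fun_prop)
    refine (norm_integral_le_of_norm_le
      ((integrable_indicator_iff measurableSet_Icc).2 hci) (ae_of_all _ h1)).trans ?_
    rw [integral_indicator measurableSet_Icc, integral_Icc_eq_integral_Ioc,
      ← intervalIntegral.integral_of_le (by linarith), intervalIntegral.integral_const_mul,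
      intervalIntegral.integral_const_mul]
    have := hCb A A hA (by linarith) (by linarith)
    gcongr
  have h1 : Tendsto (fun x => linv ℓ (δ * ℓ x) / x) atTop (nhds (δ ^ (1 / α))) :=
    H.tendsto_linv_div hδ (tendsto_const_nhds.congr' (by
      filter_upwards [eventually_gt_atTop 0] with x hx
      rw [mul_div_cancel_right₀ _ (H.pos hx).ne']))
  have h2 : Tendsto (fun x => Q / c * (2 * C) * ((linv ℓ (δ * ℓ x) / x)⁻¹ * (ℓ x)⁻¹)) atTop
      (nhds 0) := by
    have := (((h1.inv₀ (rpow_pos_of_pos hδ _).ne').mul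
      (tendsto_inv_atTop_zero.comp H.tendsto_atTop)).const_mul (Q / c * (2 * C)))
    simpa using this
  refine squeeze_zero_norm' ?_ h2
  filter_upwards [eventually_gt_atTop 0,
    (H.tendsto_atTop.const_mul_atTop hδ).eventually_ge_atTop 2] with x hx0 hx2
  have hl := H.pos hx0
  have hA : 2 ≤ ⌈δ * ℓ x⌉₊ := by exact_mod_cast hx2.trans (Nat.le_ceil _)
  have h3 := key ⌈δ * ℓ x⌉₊ ⌈K * ℓ x⌉₊ (y x) hA (Nat.ceil_mono (by gcongr))
  have h4 := H.linv_mono (Nat.le_ceil (δ * ℓ x))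
  have h5 := H.linv_pos (δ * ℓ x)
  rw [norm_mul, Complex.norm_real, Real.norm_of_nonneg (by positivity)]
  calc x / ℓ x * _ ≤ x / ℓ x * (Q / c * (2 * (C / linv ℓ (δ * ℓ x)))) := by
        refine mul_le_mul_of_nonneg_left (h3.trans ?_) (by positivity)
        gcongr
    _ = _ := by field_simp

/-- Contribution of the middle range to a smoothed renewal mass. -/
def midMass (g : ℝ → ℝ) (α δ K : ℝ) : ℂ :=
  ∫ v in δ..K, (((v ^ (1 / α))⁻¹ : ℝ) : ℂ) * invDens g ((v ^ (1 / α))⁻¹)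

lemma tendsto_sum_invInt {F : Measure ℝ} [IsProbabilityMeasure F] {ℓ g : ℝ → ℝ} {α k : ℝ}
    (H : RVMono ℓ α) (hk : 0 < k) (hF : Tendsto (fun x => rtail F x * ℓ x) atTop (nhds k))
    (hg : StableLimit F ℓ g)
    {κ : ℝ → ℂ} (hκm : Measurable κ) {Q : ℝ} (hκQ : ∀ θ, ‖κ θ‖ ≤ Q) {M : ℝ}
    (hM : 0 < M) (hκ0 : ∀ θ, M < |θ| → κ θ = 0) (hκc : ContinuousAt κ 0)
    (hφ : ∀ θ, 0 < |θ| → |θ| ≤ M → charFun F θ ≠ 1) {y : ℝ → ℝ}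
    (hy : Tendsto (fun x => y x / x) atTop (nhds 1)) {δ K : ℝ} (hδ : 0 < δ) (hδK : δ ≤ K) :
    Tendsto (fun x => ((x / ℓ x : ℝ) : ℂ) *
        ∑ n ∈ Finset.Ico ⌈δ * ℓ x⌉₊ ⌈K * ℓ x⌉₊, invInt F κ n (y x)) atTop
      (nhds (κ 0 * midMass g α δ K)) := by
  obtain ⟨C, c, γ, θ₀, hC, hc, hγ, hθ₀, hb⟩ := H.exists_norm_charFun_pow_le hk hF
  have hQ : 0 ≤ Q := (norm_nonneg _).trans (hκQ 0)
  have hm0 : (0 : ℝ) ∈ Ioo (-θ₀) θ₀ := ⟨by linarith, hθ₀⟩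
  set κ₁ : ℝ → ℂ := (Ioo (-θ₀) θ₀).indicator κ with hκ₁
  set κ₂ : ℝ → ℂ := (Ioo (-θ₀) θ₀)ᶜ.indicator κ with hκ₂
  have hmem : ∀ θ, θ ∈ Ioo (-θ₀) θ₀ ↔ |θ| < θ₀ := fun θ => abs_lt.symm
  have h1m : Measurable κ₁ := hκm.indicator measurableSet_Ioo
  have h2m : Measurable κ₂ := hκm.indicator measurableSet_Ioo.compl
  have h1Q : ∀ θ, ‖κ₁ θ‖ ≤ Q := fun θ => (norm_indicator_le_norm_self _ _).trans (hκQ θ)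
  have h2Q : ∀ θ, ‖κ₂ θ‖ ≤ Q := fun θ => (norm_indicator_le_norm_self _ _).trans (hκQ θ)
  have h10 : κ₁ 0 = κ 0 := indicator_of_mem hm0 _
  have h1c : ContinuousAt κ₁ 0 := by
    refine hκc.congr ?_
    filter_upwards [Ioo_mem_nhds hm0.1 hm0.2] with θ hθ
    exact (indicator_of_mem hθ _).symm
  have hnear := tendsto_sum_invInt_near H hg hC hc hγ hθ₀ hb h1m h1Q
    (fun θ hθ => indicator_of_notMem (fun h => absurd ((hmem θ).1 h) (not_lt.2 hθ.le)) _)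
    h1c hy hδ hδK
  have hfar := tendsto_sum_invInt_far H hk hF h2m h2Q (θ₁ := θ₀) hM (fun θ hθ => by
      rcases hθ with h | h
      · exact indicator_of_notMem (notMem_compl_iff.2 ((hmem θ).2 h)) _
      · rw [hκ₂]
        simp only [indicator_apply, hκ0 θ h, ite_self])
    (fun θ h1 h2 => hφ θ (hθ₀.trans_le h1) h2) y hδ hδK
  rw [h10] at hnear
  have h := hnear.add hfar
  rw [add_zero] at h
  refine h.congr fun x => ?_
  rw [← mul_add, ← Finset.sum_add_distrib]
  congr 1
  refine Finset.sum_congr rfl fun n _ => ?_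
  have h20 : ∀ (s : Set ℝ) θ, M < |θ| → s.indicator κ θ = 0 := fun s θ hθ => by
    simp only [indicator_apply, hκ0 θ hθ, ite_self]
  rw [invInt, invInt, invInt, ← integral_add (integrable_invInt h1m h1Q (h20 _) _ _)
    (integrable_invInt h2m h2Q (h20 _) _ _)]
  congr 1 with θ
  rw [← add_mul, ← add_mul]
  congr 2
  exact congrFun (indicator_self_add_compl (Ioo (-θ₀) θ₀) κ) θ

lemma measurableSet_lattice (d : ℝ) : MeasurableSet {x : ℝ | ∃ k : ℤ, x = k * d} := by
  have : {x : ℝ | ∃ k : ℤ, x = k * d} = range fun k : ℤ => (k : ℝ) * d := by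
    ext x; simp [eq_comm]
  rw [this]
  exact (countable_range _).measurableSet

lemma concOn_iff_ae (μ : Measure ℝ) [IsProbabilityMeasure μ] (d : ℝ) :
    ConcOn μ d ↔ ∀ᵐ x ∂μ, ∃ k : ℤ, x = k * d :=
  (mem_ae_iff_prob_eq_one (measurableSet_lattice d)).symm

lemma concOn_of_charFun_eq_one {μ : Measure ℝ} [IsProbabilityMeasure μ] {θ : ℝ}
    (hθ : 0 < |θ|) (h : charFun μ θ = 1) : ConcOn μ (2 * π / |θ|) := by
  have h1 : ∫ x, (1 - cos (θ * x)) ∂μ = 0 := by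
    have hi := integrable_cos μ θ 0
    simp only [add_zero] at hi
    rw [integral_sub (integrable_const _) hi, ← charFun_re, h]
    simp
  rw [concOn_iff_ae]
  have hi : Integrable (fun x => 1 - cos (θ * x)) μ := by
    have hi := integrable_cos μ θ 0
    simp only [add_zero] at hi
    exact (integrable_const _).sub hi
  have h2 := (integral_eq_zero_iff_of_nonneg (fun x => sub_nonneg.2 (cos_le_one _)) hi).1 h1
  filter_upwards [h2] with x hx
  have hx' : cos (|θ| * x) = 1 := by
    have h3 : cos (θ * x) = 1 := by
      have : (1 : ℝ) - cos (θ * x) = 0 := hx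
      linarith
    rcases abs_choice θ with h | h
    · rw [h]; exact h3
    · rw [h, neg_mul, cos_neg]; exact h3
  obtain ⟨k, hk⟩ := (cos_eq_one_iff _).1 hx'
  refine ⟨k, ?_⟩
  rw [← mul_div_assoc, hk, mul_div_cancel_left₀ _ hθ.ne']

lemma ConcOn.convPow {μ : Measure ℝ} [IsProbabilityMeasure μ] {d : ℝ} (h : ConcOn μ d) (n : ℕ) :
    ∀ᵐ x ∂convPow μ n, ∃ k : ℤ, x = k * d := by
  induction n with
  | zero =>
    rw [convPow_zero, ae_dirac_iff (measurableSet_lattice d)]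
    exact ⟨0, by simp⟩
  | succ n ih =>
    rw [convPow_succ, ae_iff]
    have hm : MeasurableSet {x : ℝ | ¬∃ k : ℤ, x = k * d} := (measurableSet_lattice d).compl
    rw [conv_apply _ _ hm, lintegral_congr_ae (g := fun _ => 0), lintegral_zero]
    filter_upwards [ih] with x hx
    obtain ⟨k, rfl⟩ := hx
    refine measure_mono_null (fun y hy => ?_) (ae_iff.1 ((concOn_iff_ae μ d).1 h))
    rintro ⟨j, rfl⟩
    exact hy ⟨k + j, by push_cast; ring⟩

lemma integral_Icc_exp {d : ℝ} (hd : 0 < d) (k : ℤ) :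
    ∫ θ : ℝ, (Icc (-(π / d)) (π / d)).indicator (fun _ => (1 : ℂ)) θ *
      Complex.exp (θ * (k * d : ℝ) * Complex.I) = if k = 0 then (2 * π / d : ℂ) else 0 := by
  have hpi := Real.pi_pos
  have hM : 0 < π / d := by positivity
  have hd' : (d : ℂ) ≠ 0 := by exact_mod_cast hd.ne'
  have h1 : ∫ θ : ℝ, (Icc (-(π / d)) (π / d)).indicator (fun _ => (1 : ℂ)) θ *
      Complex.exp (θ * (k * d : ℝ) * Complex.I) =
      ∫ θ in (-(π / d))..(π / d), Complex.exp ((k * d * Complex.I) * θ) := by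
    rw [intervalIntegral.integral_of_le (by linarith), ← integral_Icc_eq_integral_Ioc,
      ← integral_indicator measurableSet_Icc]
    congr 1 with θ
    by_cases hθ : θ ∈ Icc (-(π / d)) (π / d)
    · rw [indicator_of_mem hθ, indicator_of_mem hθ, one_mul]
      push_cast
      ring_nf
    · rw [indicator_of_notMem hθ, indicator_of_notMem hθ, zero_mul]
  rw [h1]
  split_ifs with hk
  · subst hk
    simp
    ring
  · have hk' : (k : ℂ) ≠ 0 := by exact_mod_cast hk
    have hc : (k * d * Complex.I : ℂ) ≠ 0 := by simp [hk', hd']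
    rw [integral_exp_mul_complex hc, div_eq_zero_iff]
    left
    rw [sub_eq_zero, Complex.exp_eq_exp_iff_exists_int]
    refine ⟨k, ?_⟩
    push_cast
    field_simp
    ring

/-- The renewal mass of the middle range, for an arithmetic distribution. -/
lemma tendsto_sum_convPow_of_concOn {F : Measure ℝ} [IsProbabilityMeasure F] {ℓ g : ℝ → ℝ}
    {α k h : ℝ} (H : RVMono ℓ α) (hk : 0 < k)
    (hF : Tendsto (fun x => rtail F x * ℓ x) atTop (nhds k)) (hg : StableLimit F ℓ g) (hh : 0 < h)
    (hconc : ConcOn F h) (hmax : ∀ d > 0, ConcOn F d → d ≤ h) {δ K : ℝ} (hδ : 0 < δ)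
    (hδK : δ ≤ K) :
    Tendsto (fun x => ((x / ℓ x * ∑ n ∈ Finset.Ico ⌈δ * ℓ x⌉₊ ⌈K * ℓ x⌉₊,
      (convPow F n).real (Ioc x (x + h)) : ℝ) : ℂ)) atTop
      (nhds (h / (2 * π) * midMass g α δ K)) := by
  have hpi := Real.pi_pos
  have hM : 0 < π / h := by positivity
  have hh' : (h : ℂ) ≠ 0 := by exact_mod_cast hh.ne'
  have hpi' : (π : ℂ) ≠ 0 := by exact_mod_cast hpi.ne'
  set κ : ℝ → ℂ := (Icc (-(π / h)) (π / h)).indicator fun _ => (1 : ℂ) with hκ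
  have hκm : Measurable κ := measurable_const.indicator measurableSet_Icc
  have hκQ : ∀ θ, ‖κ θ‖ ≤ 1 := fun θ =>
    (norm_indicator_le_norm_self _ _).trans (by simp)
  have hκ0 : ∀ θ, π / h < |θ| → κ θ = 0 := fun θ hθ =>
    indicator_of_notMem (s := Icc (-(π / h)) (π / h))
      (fun hm => absurd (abs_le.2 hm) (not_le.2 hθ)) _
  have hκ1 : κ 0 = 1 := indicator_of_mem (s := Icc (-(π / h)) (π / h)) ⟨by linarith, hM.le⟩ _
  have hκc : ContinuousAt κ 0 := by
    refine continuousAt_const.congr (f := fun _ => (1 : ℂ)) ?_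
    filter_upwards [Icc_mem_nhds (neg_lt_zero.2 hM) hM] with θ hθ
    rw [hκ, indicator_of_mem hθ]
  set y : ℝ → ℝ := fun x => ((⌊x / h⌋ + 1 : ℤ) : ℝ) * h with hy
  have hyx : ∀ x, x < y x ∧ y x ≤ x + h := fun x => by
    have h1 := Int.lt_floor_add_one (x / h)
    have h2 := Int.floor_le (x / h)
    rw [div_lt_iff₀ hh] at h1
    rw [le_div_iff₀ hh] at h2
    simp only [hy]
    push_cast
    exact ⟨h1, by linarith⟩
  have hyl : Tendsto (fun x => y x / x) atTop (nhds 1) := by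
    have h1 : Tendsto (fun x : ℝ => 1 + h / x) atTop (nhds 1) := by
      simpa using (tendsto_id.const_div_atTop h).const_add 1
    refine tendsto_of_tendsto_of_tendsto_of_le_of_le' tendsto_const_nhds h1 ?_ ?_
    · filter_upwards [eventually_gt_atTop 0] with x hx
      rw [le_div_iff₀ hx, one_mul]; exact (hyx x).1.le
    · filter_upwards [eventually_gt_atTop 0] with x hx
      rw [div_le_iff₀ hx, add_mul, one_mul, div_mul_cancel₀ _ hx.ne']; exact (hyx x).2
  have hmass : ∀ (n : ℕ) (x : ℝ),
      (((convPow F n).real (Ioc x (x + h)) : ℝ) : ℂ) = h / (2 * π) * invInt F κ n (y x) := by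
    intro n x
    have hκi : Integrable fun θ : ℝ => κ θ * Complex.exp (-(θ * y x * Complex.I)) := by
      simpa using integrable_invInt (F := F) hκm hκQ hκ0 (y x) 0
    have h1 := integral_integral_exp_eq (convPow F n) hκi
    simp only [charFun_convPow] at h1
    rw [invInt, ← h1, ← integral_const_mul, ← integral_indicator_one measurableSet_Ioc,
      ← integral_complex_ofReal]
    refine integral_congr_ae ?_
    filter_upwards [hconc.convPow n] with z hz
    obtain ⟨j, rfl⟩ := hz
    have h2 : ∫ θ : ℝ, κ θ * Complex.exp (-(θ * y x * Complex.I)) *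
        Complex.exp (θ * (j * h : ℝ) * Complex.I) =
        ∫ θ : ℝ, κ θ * Complex.exp (θ * ((j - (⌊x / h⌋ + 1) : ℤ) * h : ℝ) * Complex.I) := by
      congr 1 with θ
      rw [mul_assoc, ← Complex.exp_add]
      simp only [hy]
      push_cast
      ring_nf
    rw [h2, integral_Icc_exp hh]
    split_ifs with hj
    · have hj' : j = ⌊x / h⌋ + 1 := by omega
      rw [indicator_of_mem (by rw [hj']; exact hyx x)]
      simp
      field_simp
    · rw [indicator_of_notMem, mul_zero, Complex.ofReal_zero]
      rintro ⟨h3, h4⟩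
      apply hj
      have h5 : ⌊x / h⌋ < j := Int.floor_lt.2 ((div_lt_iff₀ hh).2 h3)
      have h6 : j - 1 ≤ ⌊x / h⌋ := Int.le_floor.2 (by
        rw [le_div_iff₀ hh]; push_cast; linarith)
      omega
  have hmain := (tendsto_sum_invInt H hk hF hg hκm hκQ hM hκ0 hκc (fun θ h0 h1 h2 => ?_) hyl hδ
    hδK).const_mul (h / (2 * π) : ℂ)
  · rw [hκ1, one_mul] at hmain
    refine hmain.congr fun x => ?_
    push_cast
    simp only [hmass, ← Finset.mul_sum]
    ring
  · have h3 := hmax _ (by positivity) (concOn_of_charFun_eq_one h0 h2)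
    rw [div_le_iff₀ h0] at h3
    rw [le_div_iff₀ hh] at h1
    linarith

lemma integral_fejer_scaled_mul_exp {s : ℝ} (hs : 0 < s) (c : ℝ) :
    ∫ z : ℝ, (fejer (s * z) : ℂ) * Complex.exp (c * z * Complex.I) = 2 * π / s * tri (c / s) := by
  have h1 := Measure.integral_comp_mul_left
    (fun y : ℝ => (fejer y : ℂ) * Complex.exp ((c / s : ℝ) * y * Complex.I)) s
  rw [integral_fejer_mul_exp, abs_of_pos (inv_pos.2 hs)] at h1
  have hs' : (s : ℂ) ≠ 0 := by exact_mod_cast hs.ne'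
  calc _ = ∫ z : ℝ, (fejer (s * z) : ℂ) * Complex.exp ((c / s : ℝ) * (s * z : ℝ) * Complex.I) := by
        congr 1 with z
        push_cast
        field_simp
    _ = _ := by
        rw [h1, Complex.real_smul]
        push_cast
        field_simp

/-- The measure `μ` weighted by the scaled Fejér kernel. -/
def fejerWeight (s : ℝ) (μ : Measure ℝ) : Measure ℝ :=
  μ.withDensity fun z => ENNReal.ofReal (fejer (s * z))

lemma measurable_fejer_scaled (s : ℝ) : Measurable fun z => ENNReal.ofReal (fejer (s * z)) :=
  (continuous_fejer.comp (continuous_const.mul continuous_id)).measurable.ennreal_ofReal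

instance isFiniteMeasure_fejerWeight (s : ℝ) (μ : Measure ℝ) [IsFiniteMeasure μ] :
    IsFiniteMeasure (fejerWeight s μ) := by
  refine isFiniteMeasure_withDensity ((lintegral_mono (g := fun _ => 1) fun z => ?_).trans_lt ?_).ne
  · exact ENNReal.ofReal_le_one.2 (fejer_le_one _)
  · simp [measure_lt_top]

lemma charFun_fejerWeight (s : ℝ) (μ : Measure ℝ) (c : ℝ) :
    charFun (fejerWeight s μ) c =
      ∫ z, (fejer (s * z) : ℂ) * Complex.exp (c * z * Complex.I) ∂μ := by
  rw [charFun_apply_real, fejerWeight,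
    integral_withDensity_eq_integral_toReal_smul (measurable_fejer_scaled s) (by simp)]
  congr 1 with z
  rw [ENNReal.toReal_ofReal (fejer_nonneg _), Complex.real_smul]

lemma fejerWeight_real (s : ℝ) (μ : Measure ℝ) {E : Set ℝ} (hE : MeasurableSet E) :
    (fejerWeight s μ).real E = ∫ z in E, fejer (s * z) ∂μ := by
  have h1 : Continuous fun z => fejer (s * z) :=
    continuous_fejer.comp (continuous_const.mul continuous_id)
  rw [Measure.real, fejerWeight, withDensity_apply _ hE, integral_eq_lintegral_of_nonneg_ae
    (ae_of_all _ fun z => fejer_nonneg _) h1.aestronglyMeasurable]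

lemma tendsto_integral_fejer_Ioc {N : ℕ → Measure ℝ} [∀ k, IsFiniteMeasure (N k)] {s r h : ℝ}
    (hs : 0 < s) (hr : 0 ≤ r) (hh : 0 < h)
    (hN : ∀ c : ℝ, Tendsto (fun k => ∫ z, (fejer (s * z) : ℂ) * Complex.exp (c * z * Complex.I) ∂N k)
      atTop (nhds (1 / s * tri (c / s) * r))) :
    Tendsto (fun k => ∫ z in Ioc 0 h, fejer (s * z) ∂N k) atTop
      (nhds (r / (2 * π) * ∫ z in Ioc 0 h, fejer (s * z))) := by
  have hpi := Real.pi_pos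
  have hs' : (s : ℂ) ≠ 0 := by exact_mod_cast hs.ne'
  have hpi' : (π : ℂ) ≠ 0 := by exact_mod_cast hpi.ne'
  simp only [← fejerWeight_real s _ (measurableSet_Ioc (a := (0 : ℝ)) (b := h)),
    ← charFun_fejerWeight] at hN ⊢
  have hm : Tendsto (fun k => (fejerWeight s (N k)).real univ) atTop (nhds (r / s)) := by
    have h1 := hN 0
    simp only [charFun_zero, zero_div, tri_zero] at h1
    rw [show (1 / s * (1 : ℝ) * r : ℂ) = ((r / s : ℝ) : ℂ) by push_cast; ring] at h1
    exact_mod_cast (Complex.continuous_re.tendsto _).comp h1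
  rcases hr.eq_or_lt with rfl | hr
  · simp only [zero_div, zero_mul] at hm ⊢
    exact squeeze_zero (fun k => measureReal_nonneg) (fun k => measureReal_mono (subset_univ _)) hm
  have hvol : ∀ c, charFun (fejerWeight s volume) c = 2 * π / s * tri (c / s) := fun c => by
    rw [charFun_fejerWeight, integral_fejer_scaled_mul_exp hs]
  have hfin : IsFiniteMeasure (fejerWeight s volume) := by
    refine isFiniteMeasure_withDensity ?_
    have h1 : Integrable fun z => fejer (s * z) := integrable_fejer.comp_mul_left' hs.ne'
    exact h1.lintegral_lt_top.ne
  set V : FiniteMeasure ℝ := ⟨fejerWeight s volume, hfin⟩ with hV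
  set R : ℕ → FiniteMeasure ℝ := fun k => ⟨fejerWeight s (N k), inferInstance⟩ with hR
  have hVm : (V.mass : ℝ) = 2 * π / s := by
    have h1 := hvol 0
    simp only [charFun_zero, zero_div, tri_zero] at h1
    have h2 : (fejerWeight s volume).real univ = 2 * π / s := by
      rw [← Complex.ofReal_inj, h1]; push_cast; ring
    rw [← h2]; rfl
  have hRm : ∀ k, ((R k).mass : ℝ) = (fejerWeight s (N k)).real univ := fun k => rfl
  have hV0 : V ≠ 0 := by
    rw [← FiniteMeasure.mass_nonzero_iff]
    intro h0
    rw [h0, NNReal.coe_zero] at hVm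
    have : 0 < 2 * π / s := by positivity
    linarith
  have hrs : 0 < r / s := by positivity
  have hR0 : ∀ᶠ k in atTop, R k ≠ 0 := by
    filter_upwards [hm.eventually (lt_mem_nhds hrs)] with k hk
    rw [← FiniteMeasure.mass_nonzero_iff]
    intro h0
    rw [← hRm, h0, NNReal.coe_zero] at hk
    exact lt_irrefl _ hk
  have hchar : ∀ (W : FiniteMeasure ℝ), W ≠ 0 → ∀ c,
      charFun (W.normalize : Measure ℝ) c = (W.mass : ℝ)⁻¹ * charFun (W : Measure ℝ) c := by
    intro W hW c
    rw [FiniteMeasure.toMeasure_normalize_eq_of_nonzero _ hW]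
    simp only [charFun_apply_real]
    rw [integral_smul_nnreal_measure, NNReal.smul_def, Complex.real_smul]
    push_cast
    rfl
  have hweak : Tendsto (fun k => (R k).normalize) atTop (nhds V.normalize) := by
    refine ProbabilityMeasure.tendsto_of_tendsto_charFun fun c => ?_
    rw [hchar V hV0, hVm, show charFun (V : Measure ℝ) c = _ from hvol c]
    have h1 : Tendsto (fun k => (((fejerWeight s (N k)).real univ)⁻¹ : ℝ) *
        charFun (fejerWeight s (N k)) c) atTop
        (nhds (((r / s)⁻¹ : ℝ) * (1 / s * tri (c / s) * r : ℂ))) :=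
      ((Complex.continuous_ofReal.tendsto _).comp (hm.inv₀ hrs.ne')).mul (hN c)
    have hr' : (r : ℂ) ≠ 0 := by exact_mod_cast hr.ne'
    rw [show (((r / s)⁻¹ : ℝ) * (1 / s * tri (c / s) * r : ℂ)) =
      ((2 * π / s : ℝ)⁻¹ : ℝ) * (2 * π / s * tri (c / s) : ℂ) by push_cast; field_simp] at h1
    refine h1.congr' ?_
    filter_upwards [hR0] with k hk
    rw [hchar (R k) hk, hRm]
    push_cast
    rfl
  have hE : (V.normalize : Measure ℝ) (frontier (Ioc 0 h)) = 0 := by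
    have h1 : (V.normalize : Measure ℝ) ≪ volume := by
      rw [FiniteMeasure.toMeasure_normalize_eq_of_nonzero _ hV0]
      exact (Measure.smul_absolutelyContinuous).trans (withDensity_absolutelyContinuous _ _)
    rw [frontier_Ioc hh]
    exact h1 (((countable_singleton h).insert 0).measure_zero _)
  have hconv := ProbabilityMeasure.tendsto_measure_of_null_frontier_of_tendsto' hweak hE
  have hconv' := (ENNReal.tendsto_toReal (measure_ne_top _ _)).comp hconv
  have hreal : ∀ (W : FiniteMeasure ℝ), W ≠ 0 →
      ((W.normalize : Measure ℝ) (Ioc 0 h)).toReal =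
        (W.mass : ℝ)⁻¹ * (W : Measure ℝ).real (Ioc 0 h) := by
    intro W hW
    rw [FiniteMeasure.toMeasure_normalize_eq_of_nonzero _ hW]
    exact measureReal_nnreal_smul_apply _
  rw [hreal V hV0, hVm] at hconv'
  have h2 := hm.mul hconv'
  rw [show r / s * ((2 * π / s)⁻¹ * (V : Measure ℝ).real (Ioc 0 h)) =
    r / (2 * π) * (fejerWeight s volume).real (Ioc 0 h) by
      rw [show (V : Measure ℝ) = fejerWeight s volume from rfl]; field_simp] at h2
  refine h2.congr' ?_
  filter_upwards [hR0] with k hk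
  simp only [Function.comp]
  rw [hreal (R k) hk, hRm, ← mul_assoc, mul_inv_cancel₀, one_mul]
  · rfl
  · rw [← hRm]
    exact_mod_cast (FiniteMeasure.mass_nonzero_iff _).2 hk

lemma exists_le_fejer_scaled {h ε : ℝ} (hh : 0 < h) (hε : 0 < ε) :
    ∃ s > 0, ∀ z ∈ Ioc 0 h, 1 - ε ≤ fejer (s * z) := by
  have h1 : Tendsto fejer (nhds 0) (nhds 1) := by
    simpa [fejer_zero] using continuous_fejer.tendsto 0
  obtain ⟨δ, hδ, hb⟩ := Metric.eventually_nhds_iff.1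
    (h1.eventually (lt_mem_nhds (show 1 - ε < 1 by linarith)))
  refine ⟨δ / (2 * h), by positivity, fun z hz => (hb ?_).le⟩
  have hz0 : 0 < z := hz.1
  rw [Real.dist_eq, sub_zero, abs_of_pos (by positivity), div_mul_eq_mul_div,
    div_lt_iff₀ (by positivity)]
  have := mul_le_mul_of_nonneg_left hz.2 hδ.le
  linarith [mul_pos hδ hh]

/-- Convergence of all Fejér-weighted transforms to those of `Λ / (2 * π)` times Lebesgue measure
gives convergence of the masses of an interval. -/
lemma tendsto_real_Ioc_of_fejer {N : ℕ → Measure ℝ} [∀ k, IsFiniteMeasure (N k)] {Λ : ℂ} {h : ℝ}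
    (hh : 0 < h)
    (hN : ∀ s > 0, ∀ c : ℝ, Tendsto
      (fun k => ∫ z, (fejer (s * z) : ℂ) * Complex.exp (c * z * Complex.I) ∂N k)
      atTop (nhds (1 / s * tri (c / s) * Λ))) :
    Tendsto (fun k => (((N k).real (Ioc 0 h) : ℝ) : ℂ)) atTop (nhds (h / (2 * π) * Λ)) := by
  have hpi := Real.pi_pos
  obtain ⟨r, hr, rfl⟩ : ∃ r : ℝ, 0 ≤ r ∧ Λ = r := by
    have h1 := hN 1 one_pos 0
    simp only [Complex.ofReal_zero, zero_mul, Complex.exp_zero, mul_one, tri_zero,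
      Complex.ofReal_one, one_mul, div_one, integral_complex_ofReal] at h1
    have h2 := (Complex.continuous_re.tendsto _).comp h1
    have h3 := (Complex.continuous_im.tendsto _).comp h1
    refine ⟨Λ.re, ge_of_tendsto' h2 fun k => ?_, Complex.ext rfl ?_⟩
    · simpa using integral_nonneg fun z => fejer_nonneg z
    · refine tendsto_nhds_unique h3 ?_
      simp [Function.comp_def]
  have hlim : Tendsto (fun k => (N k).real (Ioc 0 h)) atTop (nhds (h / (2 * π) * r)) := by
    set A := h / (2 * π) * r with hA
    have hA0 : 0 ≤ A := by positivity
    have hbd : ∀ ε ∈ Ioo (0 : ℝ) 1, ∀ᶠ k in atTop, (1 - ε) * A - ε < (N k).real (Ioc 0 h) ∧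
        (N k).real (Ioc 0 h) < (A + ε) / (1 - ε) := by
      intro ε hε
      obtain ⟨s, hs, hfs⟩ := exists_le_fejer_scaled hh hε.1
      have hcont : Continuous fun z => fejer (s * z) :=
        continuous_fejer.comp (continuous_const.mul continuous_id)
      have hInt : ∀ (μ : Measure ℝ) [IsLocallyFiniteMeasure μ],
          IntegrableOn (fun z => fejer (s * z)) (Ioc 0 h) μ := fun μ _ =>
        (hcont.integrableOn_Icc (μ := μ) (a := 0) (b := h)).mono_set Ioc_subset_Icc_self
      have hlo : ∀ (μ : Measure ℝ) [IsLocallyFiniteMeasure μ],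
          (1 - ε) * μ.real (Ioc 0 h) ≤ ∫ z in Ioc 0 h, fejer (s * z) ∂μ := fun μ _ => by
        have hfin : μ (Ioc 0 h) ≠ ⊤ := measure_Ioc_lt_top.ne
        have := setIntegral_mono_on (μ := μ) (integrableOn_const (C := 1 - ε) hfin) (hInt μ)
          measurableSet_Ioc hfs
        rwa [setIntegral_const, smul_eq_mul, mul_comm] at this
      have hup : ∀ (μ : Measure ℝ) [IsLocallyFiniteMeasure μ],
          ∫ z in Ioc 0 h, fejer (s * z) ∂μ ≤ μ.real (Ioc 0 h) := fun μ _ => by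
        have hfin : μ (Ioc 0 h) ≠ ⊤ := measure_Ioc_lt_top.ne
        have := setIntegral_mono_on (μ := μ) (hInt μ) (integrableOn_const (C := (1 : ℝ)) hfin)
          measurableSet_Ioc fun z _ => fejer_le_one _
        rwa [setIntegral_const, smul_eq_mul, mul_one] at this
      have hvol : (volume : Measure ℝ).real (Ioc 0 h) = h := by
        rw [Real.volume_real_Ioc_of_le hh.le, sub_zero]
      have hc := tendsto_integral_fejer_Ioc hs hr hh (hN s hs)
      have hJ1 := hlo volume
      have hJ2 := hup volume
      rw [hvol] at hJ1 hJ2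
      set J := ∫ z in Ioc 0 h, fejer (s * z)
      have hrp : 0 ≤ r / (2 * π) := by positivity
      have hA1 : (1 - ε) * A ≤ r / (2 * π) * J := by
        have := mul_le_mul_of_nonneg_left hJ1 hrp
        calc _ = r / (2 * π) * ((1 - ε) * h) := by rw [hA]; ring
          _ ≤ _ := this
      have hA2 : r / (2 * π) * J ≤ A := by
        calc _ ≤ r / (2 * π) * h := mul_le_mul_of_nonneg_left hJ2 hrp
          _ = A := by rw [hA]; ring
      filter_upwards [hc.eventually (lt_mem_nhds (show (1 - ε) * A - ε < _ by linarith [hε.1])),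
        hc.eventually (gt_mem_nhds (show _ < A + ε by linarith [hε.1]))] with k hk1 hk2
      refine ⟨hk1.trans_le (hup (N k)), ?_⟩
      rw [lt_div_iff₀ (by linarith [hε.2]), mul_comm]
      exact (hlo (N k)).trans_lt hk2
    have hI : ∀ᶠ ε in nhdsWithin (0 : ℝ) (Ioi 0), ε ∈ Ioo (0 : ℝ) 1 := Ioo_mem_nhdsGT one_pos
    have hl : Tendsto (fun ε : ℝ => (1 - ε) * A - ε) (nhdsWithin 0 (Ioi 0)) (nhds A) := by
      have : ContinuousAt (fun ε : ℝ => (1 - ε) * A - ε) 0 := by fun_prop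
      simpa using this.tendsto.mono_left nhdsWithin_le_nhds
    have hu : Tendsto (fun ε : ℝ => (A + ε) / (1 - ε)) (nhdsWithin 0 (Ioi 0)) (nhds A) := by
      have : ContinuousAt (fun ε : ℝ => (A + ε) / (1 - ε)) 0 := by
        refine ContinuousAt.div (by fun_prop) (by fun_prop) (by simp)
      simpa using this.tendsto.mono_left nhdsWithin_le_nhds
    refine tendsto_order.2 ⟨fun a ha => ?_, fun a ha => ?_⟩
    · obtain ⟨ε, hε, ha'⟩ := (hI.and (hl.eventually (lt_mem_nhds ha))).exists
      filter_upwards [hbd ε hε] with k hk using ha'.trans hk.1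
    · obtain ⟨ε, hε, ha'⟩ := (hI.and (hu.eventually (gt_mem_nhds ha))).exists
      filter_upwards [hbd ε hε] with k hk using hk.2.trans ha'
  have := (Complex.continuous_ofReal.tendsto _).comp hlim
  simpa [Function.comp_def] using this

/-- The renewal mass of the middle range, for a non-arithmetic distribution. -/
lemma tendsto_sum_convPow_of_not_arith {F : Measure ℝ} [IsProbabilityMeasure F] {ℓ g : ℝ → ℝ}
    {α k h : ℝ} (H : RVMono ℓ α) (hk : 0 < k)
    (hF : Tendsto (fun x => rtail F x * ℓ x) atTop (nhds k)) (hg : StableLimit F ℓ g) (hh : 0 < h)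
    (hna : ¬ Arith F) {δ K : ℝ} (hδ : 0 < δ) (hδK : δ ≤ K) :
    Tendsto (fun x => ((x / ℓ x * ∑ n ∈ Finset.Ico ⌈δ * ℓ x⌉₊ ⌈K * ℓ x⌉₊,
      (convPow F n).real (Ioc x (x + h)) : ℝ) : ℂ)) atTop
      (nhds (h / (2 * π) * midMass g α δ K)) := by
  have hpi := Real.pi_pos
  set S : ℝ → Finset ℕ := fun x => Finset.Ico ⌈δ * ℓ x⌉₊ ⌈K * ℓ x⌉₊ with hS
  set N : ℝ → Measure ℝ := fun x =>
    ENNReal.ofReal (x / ℓ x) • ∑ n ∈ S x, (convPow F n).map (fun z => z - x) with hNdef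
  have hfin : ∀ x, IsFiniteMeasure (N x) := fun x => Measure.smul_finite _ ENNReal.ofReal_ne_top
  have hpos : ∀ x, 0 < x → 0 ≤ x / ℓ x := fun x hx => (div_pos hx (H.pos hx)).le
  have hNm : ∀ x, 0 < x → (N x).real (Ioc 0 h) =
      x / ℓ x * ∑ n ∈ S x, (convPow F n).real (Ioc x (x + h)) := by
    intro x hx
    rw [hNdef, measureReal_ennreal_smul_apply, ENNReal.toReal_ofReal (hpos x hx),
      measureReal_def, Measure.finsetSum_apply, ENNReal.toReal_sum (fun n _ => measure_ne_top _ _)]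
    refine congrArg _ (Finset.sum_congr rfl fun n _ => ?_)
    rw [Measure.map_apply (by fun_prop) measurableSet_Ioc, Measure.real]
    congr 2
    ext z
    simp only [mem_preimage, mem_Ioc]
    constructor <;> rintro ⟨h1, h2⟩ <;> constructor <;> linarith
  have hNi : ∀ x, 0 < x → ∀ s > 0, ∀ c : ℝ,
      ∫ z, (fejer (s * z) : ℂ) * Complex.exp (c * z * Complex.I) ∂N x =
        ((x / ℓ x : ℝ) : ℂ) * ∑ n ∈ S x,
          invInt F (fun θ => 1 / s * (tri ((θ - c) / s) : ℂ)) n x := by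
    intro x hx s hs c
    have hcont : Continuous fun z : ℝ => (fejer (s * z) : ℂ) * Complex.exp (c * z * Complex.I) := by
      have := continuous_fejer
      fun_prop
    rw [hNdef, integral_smul_measure, ENNReal.toReal_ofReal (hpos x hx), Complex.real_smul,
      integral_finsetSum_measure]
    · refine congrArg _ (Finset.sum_congr rfl fun n _ => ?_)
      rw [integral_map (by fun_prop) hcont.aestronglyMeasurable, integral_fejer _ hs, invInt,
        ← integral_const_mul]
      congr 1 with θ
      rw [charFun_convPow]
      ring
    · intro n _
      refine (integrable_const (1 : ℝ)).mono' hcont.aestronglyMeasurable (ae_of_all _ fun z => ?_)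
      rw [norm_mul, show (c * z * Complex.I : ℂ) = ((c * z : ℝ) : ℂ) * Complex.I by push_cast; ring,
        Complex.norm_exp_ofReal_mul_I, mul_one, Complex.norm_real, Real.norm_eq_abs,
        abs_of_nonneg (fejer_nonneg _)]
      exact fejer_le_one _
  have hlim : ∀ s > 0, ∀ c : ℝ, Tendsto (fun x => ∫ z, (fejer (s * z) : ℂ) *
      Complex.exp (c * z * Complex.I) ∂N x) atTop
      (nhds (1 / s * tri (c / s) * midMass g α δ K)) := by
    intro s hs c
    have hcont : Continuous fun θ : ℝ => (1 / s * (tri ((θ - c) / s) : ℂ)) := by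
      have := continuous_tri
      fun_prop
    have h0 : (1 / s * (tri (((0 : ℝ) - c) / s) : ℂ)) = 1 / s * tri (c / s) := by
      rw [zero_sub, neg_div, tri, tri, abs_neg]
    rw [← h0]
    refine (tendsto_sum_invInt H hk hF hg (κ := fun θ => (1 / s * (tri ((θ - c) / s) : ℂ)))
      hcont.measurable (Q := 1 / s) (M := s + |c|) (fun θ => ?_) (by positivity) (fun θ hθ => ?_)
      hcont.continuousAt (fun θ h1 _ h2 => hna ⟨_, by positivity, concOn_of_charFun_eq_one h1 h2⟩)
      (y := fun x => x) ?_ hδ hδK).congr' ?_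
    · rw [norm_mul, norm_div, norm_one, Complex.norm_real, Complex.norm_real, Real.norm_eq_abs,
        Real.norm_eq_abs, abs_of_pos hs, abs_of_nonneg (tri_nonneg _)]
      exact mul_le_of_le_one_right (by positivity) (tri_le_one _)
    · rw [tri_eq_zero, Complex.ofReal_zero, mul_zero]
      rw [abs_div, abs_of_pos hs, one_le_div hs]
      linarith [abs_sub_abs_le_abs_sub θ c]
    · refine tendsto_const_nhds.congr' ?_
      filter_upwards [eventually_gt_atTop 0] with x hx
      rw [div_self hx.ne']
    · filter_upwards [eventually_gt_atTop 0] with x hx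
      rw [hNi x hx s hs c]
  refine tendsto_of_seq_tendsto fun u hu => ?_
  have hseq := tendsto_real_Ioc_of_fejer (N := fun k => N (u k)) hh
    (fun s hs c => (hlim s hs c).comp hu)
  refine hseq.congr' ?_
  filter_upwards [hu.eventually_gt_atTop 0] with n hn
  rw [hNm _ hn]
  rfl

lemma rpow_neg_one_div_rpow_neg {α t : ℝ} (hα : 0 < α) (ht : 0 < t) :
    ((t ^ (-α)) ^ (1 / α))⁻¹ = t := by
  rw [← rpow_mul ht.le, neg_mul, mul_one_div_cancel hα.ne', rpow_neg_one, inv_inv]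

/-- The middle-range mass in the variable `t = v ^ (-1/α)`. -/
lemma midMass_eq_integral {g : ℝ → ℝ} (hg : Integrable g) (hg' : Integrable (densCF g)) {α δ K : ℝ}
    (hα : 0 < α) (hδ : 0 < δ) (hδK : δ ≤ K) :
    midMass g α δ K =
      ((2 * π * α * ∫ t in Ioc (K ^ (-1 / α)) (δ ^ (-1 / α)), t ^ (-α) * g t : ℝ) : ℂ) := by
  have hpi := Real.pi_pos
  have hK : 0 < K := hδ.trans_le hδK
  have hpi' : (π : ℂ) ≠ 0 := by exact_mod_cast hpi.ne'
  set a := K ^ (-1 / α) with ha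
  set b := δ ^ (-1 / α) with hb
  have ha0 : 0 < a := rpow_pos_of_pos hK _
  have hab : a ≤ b := rpow_le_rpow_of_nonpos hδ hδK (by
    rw [neg_div]; exact neg_nonpos.2 (by positivity))
  have hend : ∀ v : ℝ, 0 < v → (v ^ (-1 / α)) ^ (-α) = v := fun v hv => by
    rw [← rpow_mul hv.le, show -1 / α * -α = 1 by field_simp, rpow_one]
  have hpos : ∀ t ∈ uIcc a b, 0 < t := fun t ht => by
    rw [uIcc_of_le hab] at ht; exact ha0.trans_le ht.1
  set G : ℝ → ℂ := fun v => (((v ^ (1 / α))⁻¹ : ℝ) : ℂ) * invDens g ((v ^ (1 / α))⁻¹) with hG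
  have hGc : ContinuousOn G (Ioi 0) := by
    have h1 : ContinuousOn (fun v : ℝ => (v ^ (1 / α))⁻¹) (Ioi 0) :=
      ContinuousOn.inv₀ (continuousOn_id.rpow_const fun v hv => Or.inl (ne_of_gt hv))
        fun v hv => (rpow_pos_of_pos hv _).ne'
    exact (Complex.continuous_ofReal.comp_continuousOn h1).mul
      ((continuous_invDens hg').comp_continuousOn h1)
  have hsub := intervalIntegral.integral_deriv_smul_comp'' (a := a) (b := b) (g := G)
    (f := fun t => t ^ (-α)) (f' := fun t => -α * t ^ (-α - 1))
    (continuousOn_id.rpow_const fun t ht => Or.inl (hpos t ht).ne')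
    (fun t ht => (hasDerivAt_rpow_const (Or.inl (hpos t (by
      rw [uIcc_of_le hab]; rw [min_eq_left hab, max_eq_right hab] at ht
      exact Ioo_subset_Icc_self ht)).ne')).hasDerivWithinAt)
    (continuousOn_const.mul (continuousOn_id.rpow_const fun t ht => Or.inl (hpos t ht).ne'))
    (hGc.mono (by rintro _ ⟨t, ht, rfl⟩; exact rpow_pos_of_pos (hpos t ht) _))
  rw [ha, hb, hend K hK, hend δ hδ, intervalIntegral.integral_symm δ K, ← ha, ← hb] at hsub
  have hmid : midMass g α δ K = ∫ v in δ..K, G v := rfl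
  rw [hmid, ← neg_neg (∫ v in δ..K, G v), ← hsub, ← intervalIntegral.integral_neg,
    intervalIntegral.integral_of_le hab]
  push_cast
  rw [← integral_complex_ofReal, ← integral_const_mul]
  refine setIntegral_congr_ae measurableSet_Ioc ?_
  filter_upwards [ae_eq_invDens hg hg'] with t ht hm
  have ht0 : 0 < t := ha0.trans hm.1
  have hψ : invDens g t = 2 * π * g t := by rw [ht]; field_simp
  simp only [Function.comp, hG]
  rw [rpow_neg_one_div_rpow_neg hα ht0, hψ, Complex.real_smul, rpow_sub_one ht0.ne']
  have ht' : (t : ℂ) ≠ 0 := by exact_mod_cast ht0.ne'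
  push_cast
  field_simp

lemma integrableOn_rpow_neg_mul {g : ℝ → ℝ} (hg : Integrable g) (hg' : Integrable (densCF g))
    {α : ℝ} (hα : 0 < α) (hα1 : α < 1) : IntegrableOn (fun t => t ^ (-α) * g t) (Ioi 0) := by
  have hm : AEStronglyMeasurable (fun t : ℝ => t ^ (-α) * g t) volume :=
    (measurable_id.pow_const (-α)).aestronglyMeasurable.mul hg.1
  rw [← Ioc_union_Ioi_eq_Ioi zero_le_one]
  refine IntegrableOn.union ?_ ?_
  · have h1 : IntegrableOn (fun t : ℝ => t ^ (-α)) (Ioc 0 1) :=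
      (intervalIntegral.intervalIntegrable_rpow' (a := 0) (b := 1)
        (by linarith : -1 < -α)).1
    refine (h1.const_mul (1 / (2 * π) * ∫ s, ‖densCF g s‖)).mono' hm.restrict ?_
    rw [ae_restrict_iff' measurableSet_Ioc]
    filter_upwards [ae_eq_invDens hg hg'] with t ht hmem
    rw [norm_mul, Real.norm_of_nonneg (rpow_nonneg hmem.1.le _), mul_comm]
    refine mul_le_mul_of_nonneg_right ?_ (rpow_nonneg hmem.1.le _)
    rw [← Complex.norm_real, ht, norm_mul]
    have h2 : ‖(1 / (2 * π) : ℂ)‖ = 1 / (2 * π) := by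
      rw [show (1 / (2 * π) : ℂ) = ((1 / (2 * π) : ℝ) : ℂ) by push_cast; rfl, Complex.norm_real,
        Real.norm_of_nonneg (by positivity)]
    rw [h2]
    exact mul_le_mul_of_nonneg_left (norm_invDens_le g t) (by positivity)
  · refine hg.norm.restrict.mono' hm.restrict ?_
    refine (ae_restrict_mem measurableSet_Ioi).mono fun t ht => ?_
    have ht1 : (1 : ℝ) < t := ht
    rw [norm_mul, Real.norm_of_nonneg (rpow_nonneg (by linarith) _)]
    exact mul_le_of_le_one_left (norm_nonneg _) (rpow_le_one_of_one_le_of_nonpos ht1.le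
      (by linarith))

lemma tendsto_midMass {g : ℝ → ℝ} (hg : Integrable g) (hg' : Integrable (densCF g)) {α : ℝ}
    (hα : 0 < α) (hα1 : α < 1) :
    Tendsto (fun δ => midMass g α δ δ⁻¹) (nhdsWithin 0 (Ioi 0))
      (nhds ((2 * π * α * ∫ t in Ioi 0, t ^ (-α) * g t : ℝ) : ℂ)) := by
  have hinv : Tendsto (fun δ : ℝ => δ⁻¹) (nhdsWithin 0 (Ioi 0)) atTop := tendsto_inv_nhdsGT_zero
  have hb : Tendsto (fun δ : ℝ => δ ^ (-1 / α)) (nhdsWithin 0 (Ioi 0)) atTop := by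
    refine ((tendsto_rpow_atTop (show 0 < 1 / α by positivity)).comp hinv).congr' ?_
    filter_upwards [self_mem_nhdsWithin] with δ hδ
    have hδ : 0 < δ := hδ
    rw [Function.comp, inv_rpow hδ.le, ← rpow_neg hδ.le, neg_div]
  have ha : Tendsto (fun δ : ℝ => (δ⁻¹) ^ (-1 / α)) (nhdsWithin 0 (Ioi 0)) (nhds 0) := by
    have := (tendsto_rpow_neg_atTop (show 0 < 1 / α by positivity)).comp hinv
    simpa [Function.comp_def, neg_div] using this
  have hcov : AECover (volume.restrict (Ioi (0 : ℝ))) (nhdsWithin (0 : ℝ) (Ioi 0))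
      fun δ : ℝ => Ioi ((δ⁻¹) ^ (-1 / α)) ∩ Iic (δ ^ (-1 / α)) :=
    (aecover_Ioi_of_Ioi ha).inter (aecover_Iic hb)
  have h1 := hcov.integral_tendsto_of_countably_generated
    (integrableOn_rpow_neg_mul hg hg' hα hα1)
  have h2 := (Complex.continuous_ofReal.tendsto _).comp (h1.const_mul (2 * π * α))
  refine h2.congr' ?_
  filter_upwards [Ioo_mem_nhdsGT one_pos] with δ hδ
  rw [midMass_eq_integral hg hg' hα hδ.1 (hδ.2.le.trans ((one_le_inv₀ hδ.1).2 hδ.2.le)),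
    Function.comp, Measure.restrict_restrict (measurableSet_Ioi.inter measurableSet_Iic)]
  congr 4
  rw [Ioi_inter_Iic, inter_eq_left]
  intro t ht
  exact (rpow_pos_of_pos (inv_pos.2 hδ.1) _).trans ht.1

/-- The contribution of large `n` to the renewal mass is negligible. -/
lemma eventually_sum_tail_le {F : Measure ℝ} [IsProbabilityMeasure F] {ℓ : ℝ → ℝ} {α k h ρ : ℝ}
    (H : RVMono ℓ α) (hα : α < 1) (hk : 0 < k)
    (hF : Tendsto (fun x => rtail F x * ℓ x) atTop (nhds k)) (hh : 0 < h) (hρ : 0 < ρ) :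
    ∀ᶠ K in atTop, ∀ᶠ x in atTop, ∀ S : Finset ℕ, (∀ n ∈ S, ⌈K * ℓ x⌉₊ ≤ n) →
      x / ℓ x * ∑ n ∈ S, (convPow F n).real (Ioc x (x + h)) ≤ ρ := by
  have hα0 := H.index_pos
  obtain ⟨C, hC, hb⟩ := H.exists_convPow_Ioc_le hk hF hh
  obtain ⟨C', hC', hs⟩ := H.exists_sum_inv_linv_le hα
  have hlim : Tendsto (fun K : ℝ => C * C' * K ^ (-(1 / α - 1))) atTop (nhds 0) := by
    have h1 : 0 < 1 / α - 1 := by rw [sub_pos, lt_div_iff₀ hα0]; linarith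
    simpa using (tendsto_rpow_neg_atTop h1).const_mul (C * C')
  filter_upwards [hlim.eventually (gt_mem_nhds hρ), eventually_gt_atTop 0] with K hK hK0
  have hn : Tendsto (fun x => K * ℓ x / ℓ x) atTop (nhds K) := by
    refine tendsto_const_nhds.congr' ?_
    filter_upwards [eventually_gt_atTop 0] with x hx
    rw [mul_div_cancel_right₀ _ (H.pos hx).ne']
  have h2 : Tendsto (fun x => C * C' * (K * (linv ℓ (K * ℓ x) / x)⁻¹)) atTop
      (nhds (C * C' * (K * (K ^ (1 / α))⁻¹))) :=
    (((H.tendsto_linv_div hK0 hn).inv₀ (rpow_pos_of_pos hK0 _).ne').const_mul K).const_mul _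
  have h3 : K * (K ^ (1 / α))⁻¹ = K ^ (-(1 / α - 1)) := by
    rw [neg_sub, rpow_sub hK0, rpow_one, ← div_eq_mul_inv]
  rw [h3] at h2
  filter_upwards [h2.eventually (gt_mem_nhds hK), eventually_gt_atTop 0,
    (H.tendsto_atTop.const_mul_atTop hK0).eventually_ge_atTop 1] with x hx hx0 hx1 S hS
  have hℓ := H.pos hx0
  have hlp := H.linv_pos (K * ℓ x)
  have hSn : ∀ n ∈ S, K * ℓ x ≤ n := fun n hn => (Nat.le_ceil _).trans (by exact_mod_cast hS n hn)
  have h4 : ∑ n ∈ S, (convPow F n).real (Ioc x (x + h)) ≤ C * ∑ n ∈ S, 1 / linv ℓ n := by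
    rw [Finset.mul_sum]
    refine Finset.sum_le_sum fun n hn => ?_
    have h5 := hSn n hn
    rw [mul_one_div]
    exact hb n n x (hx1.trans h5) (by linarith)
  calc x / ℓ x * ∑ n ∈ S, (convPow F n).real (Ioc x (x + h))
      ≤ x / ℓ x * (C * (C' * (K * ℓ x / linv ℓ (K * ℓ x)))) := by
        refine mul_le_mul_of_nonneg_left (h4.trans ?_) (by positivity)
        exact mul_le_mul_of_nonneg_left (hs _ S hx1 hSn) hC.le
    _ = C * C' * (K * (linv ℓ (K * ℓ x) / x)⁻¹) := by
        rw [inv_div]; field_simp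
    _ ≤ ρ := hx.le

lemma tendsto_sum_convPow {F : Measure ℝ} [IsProbabilityMeasure F] {ℓ g : ℝ → ℝ}
    {α k h : ℝ} (H : RVMono ℓ α) (hk : 0 < k)
    (hF : Tendsto (fun x => rtail F x * ℓ x) atTop (nhds k)) (hg : StableLimit F ℓ g)
    (hspan : SpanOK F h) {δ K : ℝ} (hδ : 0 < δ) (hδK : δ ≤ K) :
    Tendsto (fun x => x / ℓ x * ∑ n ∈ Finset.Ico ⌈δ * ℓ x⌉₊ ⌈K * ℓ x⌉₊,
      (convPow F n).real (Ioc x (x + h))) atTop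
      (nhds (h / (2 * π) * midMass g α δ K).re) := by
  have h1 : Tendsto (fun x => ((x / ℓ x * ∑ n ∈ Finset.Ico ⌈δ * ℓ x⌉₊ ⌈K * ℓ x⌉₊,
      (convPow F n).real (Ioc x (x + h)) : ℝ) : ℂ)) atTop
      (nhds (h / (2 * π) * midMass g α δ K)) := by
    obtain ⟨hh, hna | ⟨hc, hm⟩⟩ := hspan
    · exact tendsto_sum_convPow_of_not_arith H hk hF hg hh hna hδ hδK
    · exact tendsto_sum_convPow_of_concOn H hk hF hg hh hc hm hδ hδK
  exact (Complex.continuous_re.tendsto _).comp h1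

lemma renewal_toReal (F : Measure ℝ) [IsProbabilityMeasure F] {E : Set ℝ} (hE : MeasurableSet E) :
    (renewal F E).toReal = ∑' n, (convPow F n).real E := by
  rw [renewal, Measure.sum_apply _ hE, ENNReal.tsum_toReal_eq fun n => measure_ne_top _ _]
  rfl

/-- Strong renewal theorem, given negligibility of the contribution of small `n`. -/
theorem srtHolds_of_small {F : Measure ℝ} [IsProbabilityMeasure F] {ℓ g : ℝ → ℝ} {α h : ℝ}
    (H : RVMono ℓ α) (hα : α < 1)
    (hF : Tendsto (fun x => rtail F x * ℓ x) atTop (nhds 1)) (hg : StableLimit F ℓ g)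
    (hspan : SpanOK F h)
    (hsmall : ∀ ρ > 0, ∃ δ > 0, ∀ᶠ x in atTop, x / ℓ x * ∑ n ∈ Finset.range ⌈δ * ℓ x⌉₊,
      (convPow F n).real (Ioc x (x + h)) ≤ ρ) :
    SRTholds F h α g := by
  have hpi := Real.pi_pos
  obtain ⟨C, c, γ, θ₀, hC, hc, hγ, hθ₀, hb⟩ := H.exists_norm_charFun_pow_le one_pos hF
  have hg' := integrable_densCF hg.integrable hc hγ (norm_densCF_le H hg hθ₀ hb)
  have hmid := tendsto_midMass hg.integrable hg' H.index_pos hα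
  set A := α * h * ∫ t in Ioi 0, t ^ (-α) * g t with hA
  have hmidA : Tendsto (fun δ => (h / (2 * π) * midMass g α δ δ⁻¹).re) (nhdsWithin 0 (Ioi 0))
      (nhds A) := by
    have h1 := (Complex.continuous_re.tendsto _).comp (hmid.const_mul (h / (2 * π) : ℂ))
    have hpi' : (π : ℂ) ≠ 0 := by exact_mod_cast hpi.ne'
    have h2 : (h / (2 * π) * ((2 * π * α * ∫ t in Ioi 0, t ^ (-α) * g t : ℝ) : ℂ) : ℂ) = (A : ℂ) := by
      rw [hA]
      push_cast
      field_simp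
    rw [h2, Complex.ofReal_re] at h1
    exact h1
  have hR : Tendsto (fun x => x / ℓ x * (renewal F (Ioc x (x + h))).toReal) atTop (nhds A) := by
    rw [Metric.tendsto_nhds]
    intro ε hε
    set ρ := ε / 4 with hρ
    have hρ0 : 0 < ρ := by positivity
    obtain ⟨δ₀, hδ₀, hs⟩ := hsmall ρ hρ0
    have htail := tendsto_inv_nhdsGT_zero.eventually
      (eventually_sum_tail_le H hα one_pos hF hspan.1 hρ0)
    have hI : ∀ᶠ δ in nhdsWithin (0 : ℝ) (Ioi 0), δ ∈ Ioo (0 : ℝ) (min δ₀ 1) :=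
      Ioo_mem_nhdsGT (lt_min hδ₀ one_pos)
    obtain ⟨δ, hδ, hδt, hδA⟩ :=
      (hI.and (htail.and (Metric.tendsto_nhds.1 hmidA ρ hρ0))).exists
    have hδ1 : δ ≤ δ⁻¹ := by
      have h1 : δ ≤ 1 := hδ.2.le.trans (min_le_right _ _)
      exact h1.trans ((one_le_inv₀ hδ.1).2 h1)
    have hm := tendsto_sum_convPow H one_pos hF hg hspan hδ.1 hδ1
    filter_upwards [hs, hδt, Metric.tendsto_nhds.1 hm ρ hρ0, eventually_gt_atTop 0]
      with x hx1 hx2 hx3 hx0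
    have hℓ := H.pos hx0
    have hxℓ : 0 < x / ℓ x := div_pos hx0 hℓ
    set f : ℕ → ℝ := fun n => (convPow F n).real (Ioc x (x + h)) with hf
    have hf0 : ∀ n, 0 ≤ f n := fun n => measureReal_nonneg
    set a := ⌈δ * ℓ x⌉₊ with ha
    set b := ⌈δ⁻¹ * ℓ x⌉₊ with hb
    set M := x / ℓ x * ∑ n ∈ Finset.Ico a b, f n with hM
    have hsa : x / ℓ x * ∑ n ∈ Finset.range a, f n ≤ ρ := by
      refine le_trans (mul_le_mul_of_nonneg_left ?_ hxℓ.le) hx1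
      refine Finset.sum_le_sum_of_subset_of_nonneg ?_ fun n _ _ => hf0 n
      refine Finset.range_mono (Nat.ceil_mono ?_)
      exact mul_le_mul_of_nonneg_right (hδ.2.le.trans (min_le_left _ _)) hℓ.le
    have hun : ∀ s t : Finset ℕ, ∑ n ∈ s ∪ t, f n ≤ ∑ n ∈ s, f n + ∑ n ∈ t, f n := fun s t => by
      linarith [Finset.sum_union_inter (s₁ := s) (s₂ := t) (f := f),
        Finset.sum_nonneg fun n (_ : n ∈ s ∩ t) => hf0 n]
    have hpart : ∀ m, ∑ n ∈ Finset.range m, f n ≤ (M + 2 * ρ) / (x / ℓ x) := by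
      intro m
      rw [le_div_iff₀ hxℓ, mul_comm]
      have hsub : Finset.range m ⊆
          (Finset.range a ∪ Finset.Ico a b) ∪ (Finset.range m).filter fun n => b ≤ n := by
        intro n hn
        simp only [Finset.mem_union, Finset.mem_range, Finset.mem_Ico, Finset.mem_filter] at hn ⊢
        omega
      have h1 : ∑ n ∈ Finset.range m, f n ≤ (∑ n ∈ Finset.range a, f n + ∑ n ∈ Finset.Ico a b, f n) +
          ∑ n ∈ (Finset.range m).filter (fun n => b ≤ n), f n := by
        refine (Finset.sum_le_sum_of_subset_of_nonneg hsub fun n _ _ => hf0 n).trans ?_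
        linarith [hun (Finset.range a ∪ Finset.Ico a b) ((Finset.range m).filter fun n => b ≤ n),
          hun (Finset.range a) (Finset.Ico a b)]
      have h2 := mul_le_mul_of_nonneg_left h1 hxℓ.le
      rw [mul_add, mul_add] at h2
      have h3 := hx2 ((Finset.range m).filter fun n => b ≤ n) fun n hn => (Finset.mem_filter.1 hn).2
      linarith
    have hsum : Summable f := summable_of_sum_range_le hf0 hpart
    have hU : (renewal F (Ioc x (x + h))).toReal = ∑' n, f n := renewal_toReal F measurableSet_Ioc
    have hup : x / ℓ x * ∑' n, f n ≤ M + 2 * ρ := by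
      have := Real.tsum_le_of_sum_range_le hf0 hpart
      rwa [le_div_iff₀ hxℓ, mul_comm] at this
    have hlo : M ≤ x / ℓ x * ∑' n, f n :=
      mul_le_mul_of_nonneg_left (hsum.sum_le_tsum _ fun n _ => hf0 n) hxℓ.le
    rw [Real.dist_eq, abs_lt] at hδA hx3 ⊢
    rw [hU]
    constructor <;> linarith [hδA.1, hδA.2, hx3.1, hx3.2]
  have h1 := hF.mul hR
  rw [one_mul] at h1
  refine h1.congr' ?_
  filter_upwards [eventually_gt_atTop 0] with x hx
  have := (H.pos hx).ne'
  field_simp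

end SRT

/-- Theorem 1.3 of the paper: an integral criterion on the
Lévy measure `ν` of an infinitely divisible `F` for the SRT, `α ∈ (0,1/2]`. -/
theorem srt_inf_div
    (F ν : Measure ℝ) [IsProbabilityMeasure F] (α h : ℝ)
    (hID : IsInfDivLevy F ν) (hν1 : ν ((Set.Ioo (-1:ℝ) 1)ᶜ) ≠ 0)
    (Fν : Measure ℝ) (hFν : Fν = (ν ((Set.Ioo (-1:ℝ) 1)ᶜ))⁻¹ • ν.restrict ((Set.Ioo (-1:ℝ) 1)ᶜ))
    (lν : ℝ → ℝ) (hlν : ∀ x > (0:ℝ), lν x = ((ν (Set.Ioi x))⁻¹).toReal)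
    (hα : α ∈ Set.Ioc (0:ℝ) (1/2)) (hreg : RegVary lν α)
    (hTRν : ∃ p : ℝ, Tendsto (fun x => (ν (Set.Iic (-x))).toReal / (ν (Set.Ioi x)).toReal)
      atTop (nhds p))
    (hspan : SpanOK F h)
    (L : ℝ → ℝ) (hLreg : RegVaryAny L) (hL1 : ∀ x, 1 ≤ L x)
    (T : ℝ) (hT : 0 ≤ T) (η : ℝ) (hη : η ∈ Set.Ioc (0:ℝ) 1)
    (ha1 : Tendsto (fun x => L x / lν x) atTop (nhds 0))
    (ha2 : Tendsto (fun ε : ℝ =>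
        Filter.limsup (fun x : ℝ => ENNReal.ofReal ((x / lν x) *
          ∑ n ∈ Finset.range ⌈L x⌉₊,
            sSup ((fun t => ((convPow Fν n) (Set.Ioc t (t + h))).toReal) ''
              Set.Icc (x - ε * x) (x + ε * x)))) atTop)
      (nhdsWithin 0 (Set.Ioi 0)) (nhds 0))
    (hb : α < 1/2 →
      (fun x => Iof Fν h η x T) =o[atTop]
        fun x => lν x ^ 2 * linv lν (L x) / L x ^ 2)
    (hc1 : α = 1/2 →
      Tendsto (fun x => (∫ s in (1:ℝ)..x, (lν s / s) ^ 2) /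
          ∫ s in (1:ℝ)..(linv lν (L x)), (lν s / s) ^ 2) atTop (nhds 1) →
      (fun x => Iof Fν h η x T) =O[atTop]
        fun x => lν x ^ 2 / ∫ s in (1:ℝ)..x, (lν s / s) ^ 2)
    (hc2 : α = 1/2 →
      ¬ Tendsto (fun x => (∫ s in (1:ℝ)..x, (lν s / s) ^ 2) /
          ∫ s in (1:ℝ)..(linv lν (L x)), (lν s / s) ^ 2) atTop (nhds 1) →
      (fun x => Iof Fν h η x T) =o[atTop]
        fun x => lν x ^ 2 / ∫ s in (1:ℝ)..x, (lν s / s) ^ 2) :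
    RightTail F lν ∧ TailRatio F ∧
      ∀ g : ℝ → ℝ, StableLimit F lν g → SRTholds F h α g := by
  set A : Set ℝ := (Ioo (-1 : ℝ) 1)ᶜ with hA
  have hfin := isFiniteMeasure_restrict_compl_Ioo hID.2.1
  have hq_top : ν A ≠ ⊤ := by
    have := measure_ne_top (ν.restrict A) univ
    rwa [Measure.restrict_apply_univ] at this
  set q := (ν A).toReal with hq
  have hq0 : 0 < q := ENNReal.toReal_pos hν1 hq_top
  have hprob : IsProbabilityMeasure Fν := ⟨by
    rw [hFν, Measure.smul_apply, Measure.restrict_apply_univ, smul_eq_mul,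
      ENNReal.inv_mul_cancel hν1 hq_top]⟩
  have hres : ν.restrict A = ENNReal.ofReal q • Fν := by
    rw [hFν, hq, ENNReal.ofReal_toReal hq_top, smul_smul, ENNReal.mul_inv_cancel hν1 hq_top,
      one_smul]
  have hIoi : ∀ x > (0 : ℝ), ν (Ioi x) ≠ 0 ∧ ν (Ioi x) ≠ ⊤ := fun x hx => by
    have h1 := hreg.1 x hx
    rw [hlν x hx, ENNReal.toReal_pos_iff] at h1
    exact ⟨fun h0 => by simp [h0] at h1, fun h0 => by simp [h0] at h1⟩
  have H : RVMono lν α := by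
    refine ⟨hα.1, fun {x y} hx hxy => ?_, hreg⟩
    rw [hlν x hx, hlν y (hx.trans_le hxy)]
    exact ENNReal.toReal_mono (ENNReal.inv_ne_top.2 (hIoi y (hx.trans_le hxy)).1)
      (ENNReal.inv_le_inv.2 (measure_mono (Ioi_subset_Ioi hxy)))
  have hα1 : α < 1 := by linarith [hα.2]
  have hreal : ∀ E ⊆ A, MeasurableSet E → Fν.real E = q⁻¹ * (ν E).toReal := fun E hE hm => by
    rw [hFν, measureReal_ennreal_smul_apply, ENNReal.toReal_inv, measureReal_restrict_apply hm,
      inter_eq_left.2 hE]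
    rfl
  have hμr : Tendsto (fun x => rtail Fν x * lν x) atTop (nhds q⁻¹) := by
    refine tendsto_const_nhds.congr' ?_
    filter_upwards [eventually_ge_atTop 1] with x hx
    have hx0 : 0 < x := by linarith
    have h0 := ENNReal.toReal_pos (hIoi x hx0).1 (hIoi x hx0).2
    rw [rtail_eq_real, hreal _ (fun y hy hm => ?_) measurableSet_Ioi, hlν x hx0, ENNReal.toReal_inv,
      mul_assoc, mul_inv_cancel₀ h0.ne', mul_one]
    exact absurd hm.2 (not_lt.2 (hx.trans (le_of_lt hy)))
  obtain ⟨p, hp⟩ := hTRν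
  have hμl : Tendsto (fun x => Fν.real (Iic (-x)) * lν x) atTop (nhds (q⁻¹ * p)) := by
    refine (hp.const_mul q⁻¹).congr' ?_
    filter_upwards [eventually_ge_atTop 1] with x hx
    have hx0 : 0 < x := by linarith
    rw [hreal _ (fun y hy hm => ?_) measurableSet_Iic, hlν x hx0, ENNReal.toReal_inv, mul_assoc,
      div_eq_mul_inv]
    have hy : y ≤ -x := hy
    linarith [hm.1]
  obtain ⟨G, hGp, ⟨B, hG⟩, hF⟩ := hID.exists_eq_conv
  rw [← hA, hres] at hF
  have hRT : RightTail F lν := by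
    have := H.tendsto_rtail_infDiv hα1 hq0.le (hG 1 (by simp)) hF hμr
    rwa [mul_inv_cancel₀ hq0.ne'] at this
  have hsmall : SmallSums Fν lν h := by
    rcases hα.2.lt_or_eq with hlt | heq
    · exact H.smallSums_of_lt_half hlt (inv_pos.2 hq0) hμr hspan.1 hT hη.1 hη.2 hLreg hL1 ha1 ha2
        (hb hlt)
    · exact H.smallSums_of_eq_half heq (inv_pos.2 hq0) hμr hspan.1 hT hη.1 hη.2 hL1 ha1 ha2
        (hc1 heq) (hc2 heq)
  refine ⟨hRT, ⟨p, ?_⟩, fun g hg => ?_⟩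
  · have h1 := H.tendsto_ltail_infDiv hα1 hq0.le (hG (-1) (by simp)) hF hμl
    rw [mul_inv_cancel_left₀ hq0.ne'] at h1
    have h2 := h1.div hRT one_ne_zero
    rw [div_one] at h2
    refine h2.congr' ?_
    filter_upwards [eventually_gt_atTop 0] with x hx
    rw [Pi.div_apply, mul_div_mul_right _ _ (H.pos hx).ne']
    rfl
  · exact srtHolds_of_small H hα1 hRT hg hspan fun ρ hρ =>
      H.sum_convPow_infDiv_le hα1 hq0 hG hF hsmall hρ
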